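/- There exist absolute constants c, C > 0 with the following property. Let p be a prime and n ≥ 2 an integer with log p < c·n/(log n)², and let G be any group with SL_n(p) ≤ G ≤ GL_n(p). Choose x, y, z independently and uniformly at random from G and set S = {x^{±1}, y^{±1}, z^{±1}}. Then with probability at least 1 − e^{−c·n}, the subgroup ⟨S⟩ generated by S contains SL_n(p) and every element of ⟨S⟩ is a product of at most n^{C·log p} elements of S. -/

import Mathlib

set_option linter.all false

namespace RandGen

open Module Finset

section Transitivity

variable {F V : Type*} [Field F] [AddCommGroup V] [Module F V]

/-- Two proper subspaces do not cover the whole space. -/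
theorem exists_notMem_of_ne_top {A B : Submodule F V} (hA : A ≠ ⊤) (hB : B ≠ ⊤) :
    ∃ f, f ∉ A ∧ f ∉ B := by
  obtain ⟨a, -, ha⟩ := SetLike.exists_of_lt (lt_top_iff_ne_top.2 hA)
  obtain ⟨b, -, hb⟩ := SetLike.exists_of_lt (lt_top_iff_ne_top.2 hB)
  by_cases hab : a ∈ B
  · by_cases hba : b ∈ A
    · exact ⟨a + b, fun h => ha ((A.add_mem_iff_left hba).1 h),
        fun h => hb ((B.add_mem_iff_right hab).1 h)⟩
    · exact ⟨b, hba, hb⟩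
  · exact ⟨a, ha, hab⟩

/-- A transvection fixing `U` pointwise and moving `w` to `e`. -/
theorem exists_transvection_of_notMem {U : Submodule F V} {w e : V} (hw : w ∉ U)
    (he : e ∉ U ⊔ Submodule.span F {w}) :
    ∃ t ∈ LinearEquiv.transvections F V, (∀ u ∈ U, t u = u) ∧ t w = e := by
  have h : w ∉ U ⊔ Submodule.span F {e - w} := by
    intro h
    obtain ⟨u, hu, z, hz, huz⟩ := Submodule.mem_sup.1 h
    obtain ⟨c, rfl⟩ := Submodule.mem_span_singleton.1 hz
    by_cases hc : c = 0
    · apply hw; rw [← huz, hc]; simpa using hu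
    · apply he
      have : e = c⁻¹ • (-u) + (c⁻¹ * (1 + c)) • w := by
        have h2 : c • e = -u + (1 + c) • w := by
          rw [add_smul, one_smul]; nth_rewrite 1 [← huz]; rw [smul_sub]; abel
        calc e = c⁻¹ • (c • e) := by rw [smul_smul, inv_mul_cancel₀ hc, one_smul]
          _ = _ := by rw [h2, smul_add, smul_smul]
      rw [this]
      exact Submodule.add_mem_sup (U.smul_mem _ (U.neg_mem hu))
        (Submodule.smul_mem _ _ (Submodule.mem_span_singleton_self w))
  obtain ⟨f, hf, hker⟩ := Submodule.exists_le_ker_of_notMem h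
  have hfe : f (e - w) = 0 :=
    hker (Submodule.mem_sup_right (Submodule.mem_span_singleton_self _))
  have h0 : ((f w)⁻¹ • f) (e - w) = 0 := by simp [hfe]
  refine ⟨LinearEquiv.transvection h0, LinearEquiv.mem_transvections _, fun u hu => ?_, ?_⟩
  · have : f u = 0 := hker (Submodule.mem_sup_left hu)
    rw [LinearEquiv.transvection.apply]; simp [this]
  · rw [LinearEquiv.transvection.apply]; simp [inv_mul_cancel₀ hf]

variable [FiniteDimensional F V]

theorem exists_two_transvections {U : Submodule F V} {w e : V} (hw : w ∉ U) (he : e ∉ U)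
    (hU : finrank F U + 1 < finrank F V) :
    ∃ t ∈ LinearEquiv.transvections F V, ∃ s ∈ LinearEquiv.transvections F V,
      (∀ u ∈ U, t (s u) = u) ∧ t (s w) = e := by
  have key : ∀ x : V, U ⊔ Submodule.span F {x} ≠ ⊤ := by
    intro x h
    have h1 := Submodule.finrank_add_le_finrank_add_finrank U (Submodule.span F {x})
    have h2 : finrank F (Submodule.span F {x}) ≤ 1 := by
      simpa using finrank_span_le_card (R := F) ({x} : Set V)
    rw [h, finrank_top] at h1
    omega
  obtain ⟨f, hf1, hf2⟩ := exists_notMem_of_ne_top (key w) (key e)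
  obtain ⟨s, hs, hsU, hsw⟩ := exists_transvection_of_notMem hw hf1
  have hfe : e ∉ U ⊔ Submodule.span F {f} := by
    intro h
    obtain ⟨u, hu, z, hz, huz⟩ := Submodule.mem_sup.1 h
    obtain ⟨c, rfl⟩ := Submodule.mem_span_singleton.1 hz
    by_cases hc : c = 0
    · apply he; rw [← huz, hc]; simpa using hu
    · apply hf2
      have : f = c⁻¹ • (-u) + c⁻¹ • e := by
        rw [← smul_add, ← huz]; simp [smul_smul, inv_mul_cancel₀ hc]
      rw [this]
      exact Submodule.add_mem_sup (U.smul_mem _ (U.neg_mem hu))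
        (Submodule.smul_mem _ _ (Submodule.mem_span_singleton_self e))
  obtain ⟨t, ht, htU, htf⟩ := exists_transvection_of_notMem
    (fun h => hf1 (Submodule.mem_sup_left h)) hfe
  exact ⟨t, ht, s, hs, fun u hu => by rw [hsU u hu, htU u hu], by rw [hsw, htf]⟩

/-- Products of transvections act transitively on linearly independent tuples of length less than
the dimension. -/
theorem exists_transvections_map_eq {k : ℕ} {a b : Fin k → V} (ha : LinearIndependent F a)
    (hb : LinearIndependent F b) (hk : k < finrank F V) :
    ∃ L : List (V ≃ₗ[F] V), (∀ t ∈ L, t ∈ LinearEquiv.transvections F V) ∧ L.length ≤ 2 * k ∧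
      ∀ i, L.prod (a i) = b i := by
  induction k with
  | zero => exact ⟨[], by simp, by simp, fun i => i.elim0⟩
  | succ k ih =>
    obtain ⟨ha1, ha2⟩ := linearIndependent_finSucc'.1 ha
    obtain ⟨hb1, hb2⟩ := linearIndependent_finSucc'.1 hb
    obtain ⟨L, hL, hlen, hLab⟩ := ih ha1 hb1 (by omega)
    have hw : L.prod (a (Fin.last k)) ∉ Submodule.span F (Set.range (Fin.init b)) := by
      have : Set.range (Fin.init b) = L.prod '' Set.range (Fin.init a) := by
        rw [← Set.range_comp]; congr 1; funext i; exact (hLab i).symm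
      rw [this]
      intro h
      rw [show (⇑L.prod : V → V) = ⇑(L.prod : V →ₗ[F] V) from rfl, Submodule.span_image] at h
      obtain ⟨y, hy, hy'⟩ := h
      exact ha2 (by rwa [← L.prod.injective hy'])
    obtain ⟨t, ht, s, hs, hU, hlast⟩ := exists_two_transvections hw hb2 (by
      rw [finrank_span_eq_card hb1, Fintype.card_fin]; exact hk)
    refine ⟨t :: s :: L, ?_, ?_, ?_⟩
    · intro r hr
      rcases List.mem_cons.1 hr with rfl | hr
      · exact ht
      rcases List.mem_cons.1 hr with rfl | hr
      · exact hs
      · exact hL r hr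
    · simp; omega
    · intro i
      simp only [List.prod_cons, LinearEquiv.mul_apply]
      refine Fin.lastCases hlast (fun i => ?_) i
      have := hLab i
      simp only [Fin.init] at this
      rw [this]
      exact hU _ (Submodule.subset_span ⟨i, rfl⟩)

theorem det_prod_transvections {L : List (V ≃ₗ[F] V)}
    (hL : ∀ t ∈ L, t ∈ LinearEquiv.transvections F V) : LinearEquiv.det L.prod = 1 := by
  rw [map_list_prod]
  apply List.prod_eq_one
  intro x hx
  obtain ⟨t, ht, rfl⟩ := List.mem_map.1 hx
  obtain ⟨f, v, hfv, rfl⟩ := hL t ht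
  exact LinearEquiv.transvection.det_eq_one hfv

theorem inv_prod_transvections {L : List (V ≃ₗ[F] V)}
    (hL : ∀ t ∈ L, t ∈ LinearEquiv.transvections F V) :
    ∃ L' : List (V ≃ₗ[F] V), (∀ t ∈ L', t ∈ LinearEquiv.transvections F V) ∧
      L'.length = L.length ∧ L'.prod = L.prod⁻¹ := by
  refine ⟨(L.map (·⁻¹)).reverse, ?_, by simp, (List.prod_inv_reverse L).symm⟩
  intro t ht
  obtain ⟨s, hs, rfl⟩ := List.mem_map.1 (List.mem_reverse.1 ht)
  exact LinearEquiv.inv_mem_transvections_iff.2 (hL s hs)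

/-- Every linear automorphism of determinant one is a product of few transvections. -/
theorem exists_transvections_of_det_eq_one (hn : 1 ≤ finrank F V) {g : V ≃ₗ[F] V}
    (hg : LinearEquiv.det g = 1) :
    ∃ L : List (V ≃ₗ[F] V), (∀ t ∈ L, t ∈ LinearEquiv.transvections F V) ∧
      L.length ≤ 2 * finrank F V ∧ L.prod = g := by
  obtain ⟨m, hm⟩ : ∃ m, finrank F V = m + 1 := ⟨finrank F V - 1, by omega⟩
  let e : Basis (Fin (m + 1)) F V := finBasisOfFinrankEq F V hm
  have hind : LinearIndependent F (fun i : Fin m => e i.castSucc) :=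
    e.linearIndependent.comp _ (Fin.castSucc_injective m)
  have hind' : LinearIndependent F (fun i : Fin m => g (e i.castSucc)) :=
    hind.map' (g : V →ₗ[F] V) (LinearEquiv.ker g)
  obtain ⟨L, hL, hlen, hLg⟩ := exists_transvections_map_eq hind' hind (by omega)
  set h := L.prod * g with hh
  have hfix : ∀ i : Fin m, h (e i.castSucc) = e i.castSucc := fun i => hLg i
  have hdet : LinearEquiv.det h = 1 := by
    rw [hh, map_mul, det_prod_transvections hL, hg, one_mul]
  set φ := e.coord (Fin.last m)
  set v := h (e (Fin.last m)) - e (Fin.last m)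
  have heq : (h : V →ₗ[F] V) = LinearMap.transvection φ v := by
    refine e.ext fun i => ?_
    refine Fin.lastCases ?_ (fun i => ?_) i
    · simp [LinearMap.transvection.apply, φ, v]
    · have : (Finsupp.single i.castSucc (1 : F)) (Fin.last m) = 0 := by
        rw [Finsupp.single_apply, if_neg (Fin.castSucc_lt_last i).ne]
      simp [LinearMap.transvection.apply, φ, hfix, this]
  have hφv : φ v = 0 := by
    have h1 : (1 : F) = 1 + φ v := by
      rw [← LinearMap.transvection.det φ v, ← heq, ← LinearEquiv.coe_det, hdet]; rfl
    simpa using h1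
  have hht : h = LinearEquiv.transvection hφv := by
    apply LinearEquiv.ext
    intro x
    exact DFunLike.congr_fun heq x
  obtain ⟨L', hL', hlen', hp⟩ := inv_prod_transvections hL
  refine ⟨L' ++ [h], ?_, ?_, ?_⟩
  · intro t ht
    rcases List.mem_append.1 ht with ht | ht
    · exact hL' t ht
    · rw [List.mem_singleton.1 ht, hht]; exact LinearEquiv.mem_transvections _
  · simp; omega
  · rw [List.prod_append, hp]; simp [hh]

/-- Transitivity on pairs (vector, covector) with zero pairing, up to scaling the covector. -/
theorem exists_det_one_map_pair {v v' : V} {φ φ' : Dual F V} (hv : v ≠ 0) (hv' : v' ≠ 0)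
    (hφ : φ ≠ 0) (hφ' : φ' ≠ 0) (h : φ v = 0) (h' : φ' v' = 0) :
    ∃ g : V ≃ₗ[F] V, LinearEquiv.det g = 1 ∧ g v = v' ∧ ∃ c : Fˣ, ∀ x, φ' (g x) = c * φ x := by
  have key : ∀ (v : V) (φ : Dual F V), v ≠ 0 → φ ≠ 0 → φ v = 0 → ∃ m : ℕ,
      finrank F V = m + 2 ∧ ∃ a : Fin (m + 1) → V, LinearIndependent F a ∧ a 0 = v ∧
      Submodule.span F (Set.range a) = LinearMap.ker φ := by
    intro v φ hv hφ h
    have h1 : finrank F (LinearMap.ker φ) + 1 = finrank F V := by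
      have := Module.Dual.finrank_ker_add_one_of_ne_zero hφ
      omega
    have h2 : 0 < finrank F (LinearMap.ker φ) := by
      rw [Module.finrank_pos_iff_exists_ne_zero]
      exact ⟨⟨v, h⟩, fun h0 => hv (congrArg Subtype.val h0)⟩
    obtain ⟨m, hm⟩ : ∃ m, finrank F (LinearMap.ker φ) = m + 1 :=
      ⟨finrank F (LinearMap.ker φ) - 1, by omega⟩
    have ext : ∀ j, j ≤ m → ∃ b : Fin (j + 1) → LinearMap.ker φ,
        LinearIndependent F b ∧ b 0 = ⟨v, h⟩ := by
      intro j
      induction j with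
      | zero =>
        intro _
        refine ⟨fun _ => ⟨v, h⟩, ?_, rfl⟩
        rw [show (0 + 1) = 1 from rfl, linearIndependent_unique_iff]
        exact fun h0 => hv (congrArg Subtype.val h0)
      | succ j ih =>
        intro hj
        obtain ⟨b, hb, hb0⟩ := ih (by omega)
        obtain ⟨x, hx⟩ := exists_linearIndependent_snoc_of_lt_finrank hb (by omega)
        refine ⟨_, hx, ?_⟩
        rw [← hb0]
        exact Fin.snoc_castSucc (α := fun _ => LinearMap.ker φ) x b 0
    obtain ⟨b, hb, hb0⟩ := ext m le_rfl
    refine ⟨m, by omega, fun i => b i, ?_, by simp [hb0], ?_⟩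
    · exact hb.map' (LinearMap.ker φ).subtype (Submodule.ker_subtype _)
    · have h3 := hb.span_eq_top_of_card_eq_finrank (by simp [hm])
      have : Set.range (fun i => (b i : V)) = (LinearMap.ker φ).subtype '' Set.range b := by
        rw [← Set.range_comp]; rfl
      rw [this, Submodule.span_image, h3, Submodule.map_top, Submodule.range_subtype]
  obtain ⟨m, hm, a, ha, ha0, hspan⟩ := key v φ hv hφ h
  obtain ⟨m', hm', a', ha', ha0', hspan'⟩ := key v' φ' hv' hφ' h'
  obtain rfl : m = m' := by omega
  obtain ⟨L, hL, -, hLa⟩ := exists_transvections_map_eq ha ha' (by omega)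
  refine ⟨L.prod, det_prod_transvections hL, by rw [← ha0, hLa, ha0'], ?_⟩
  have hker : LinearMap.ker φ ≤ LinearMap.ker (φ' ∘ₗ (L.prod : V →ₗ[F] V)) := by
    rw [← hspan, Submodule.span_le]
    rintro _ ⟨i, rfl⟩
    have : a' i ∈ LinearMap.ker φ' := hspan' ▸ Submodule.subset_span ⟨i, rfl⟩
    simpa [hLa] using this
  obtain ⟨x, hx⟩ : ∃ x, φ x ≠ 0 := by
    by_contra! h0; exact hφ (LinearMap.ext h0)
  have hall : ∀ y, φ' (L.prod y) = φ' (L.prod x) / φ x * φ y := by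
    intro y
    have : y - (φ y / φ x) • x ∈ LinearMap.ker φ := by simp [hx]
    have := hker this
    simp only [LinearMap.mem_ker, LinearMap.comp_apply, map_sub, map_smul, smul_eq_mul,
      LinearEquiv.coe_coe] at this
    rw [sub_eq_zero.1 this]; ring
  have hne : φ' (L.prod x) / φ x ≠ 0 := by
    intro h0
    apply hφ'
    ext y
    have := hall (L.prod.symm y)
    rw [LinearEquiv.apply_symm_apply, h0, zero_mul] at this
    simpa using this
  exact ⟨Units.mk0 _ hne, hall⟩

end Transitivity

section Counting

variable {F V : Type*} [Field F] [Fintype F] [AddCommGroup V] [Module F V] [Fintype V]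

noncomputable instance linearEquivFintype : Fintype (V ≃ₗ[F] V) :=
  have : Finite (V ≃ₗ[F] V) := Finite.of_injective (fun g => (g : V → V)) DFunLike.coe_injective
  Fintype.ofFinite _

noncomputable instance dualFintype : Fintype (Dual F V) :=
  have : Finite (Dual F V) := Finite.of_injective (fun g => (g : V → F)) DFunLike.coe_injective
  Fintype.ofFinite _

/-- A group of linear automorphisms containing every automorphism of determinant one. -/
def ContainsSL (G : Subgroup (V ≃ₗ[F] V)) : Prop := ∀ g, LinearEquiv.det g = 1 → g ∈ G

open scoped Classical in
/-- The number of linearly independent tuples. -/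
noncomputable def numIndep (F V ι : Type*) [Field F] [AddCommGroup V] [Module F V] [Fintype V]
    [Fintype ι] : ℕ := #{s : ι → V | LinearIndependent F s}

variable {ι : Type*} [Fintype ι]

theorem exists_det_one_map_eq {a b : ι → V} (ha : LinearIndependent F a)
    (hb : LinearIndependent F b) (hk : Fintype.card ι < finrank F V) :
    ∃ g : V ≃ₗ[F] V, LinearEquiv.det g = 1 ∧ ∀ i, g (a i) = b i := by
  let e := (Fintype.equivFin ι).symm
  obtain ⟨L, hL, -, h⟩ := exists_transvections_map_eq (ha.comp e e.injective)
    (hb.comp e e.injective) hk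
  refine ⟨L.prod, det_prod_transvections hL, fun i => ?_⟩
  simpa using h (e.symm i)

open scoped Classical in
theorem card_map_eq_mul_numIndep {G : Subgroup (V ≃ₗ[F] V)} (hG : ContainsSL G) {a b : ι → V}
    (ha : LinearIndependent F a) (hb : LinearIndependent F b)
    (hk : Fintype.card ι < finrank F V) :
    #{x : G | ∀ i, (x : V ≃ₗ[F] V) (a i) = b i} * numIndep F V ι = Fintype.card G := by
  have hfib : ∀ c ∈ ({s : ι → V | LinearIndependent F s} : Finset (ι → V)),
      #{x : G | (fun i => (x : V ≃ₗ[F] V) (a i)) = c} =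
        #{x : G | ∀ i, (x : V ≃ₗ[F] V) (a i) = b i} := by
    intro c hc
    obtain ⟨g, hg, hgc⟩ := exists_det_one_map_eq hb (mem_filter.1 hc).2 hk
    symm
    refine card_bij (fun x _ => (⟨g, hG g hg⟩ : G) * x) ?_ ?_ ?_
    · intro x hx
      simp only [mem_filter, mem_univ, true_and] at hx ⊢
      funext i
      simp [hx, hgc]
    · intro x _ y _ h
      exact mul_left_cancel h
    · intro y hy
      refine ⟨(⟨g, hG g hg⟩ : G)⁻¹ * y, ?_, by group⟩
      simp only [mem_filter, mem_univ, true_and] at hy ⊢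
      intro i
      have := congrFun hy i
      simp only [Subgroup.coe_mul, LinearEquiv.mul_apply, this, ← hgc]
      exact LinearEquiv.symm_apply_apply g (b i)
  have h1 := card_eq_sum_card_fiberwise (s := (univ : Finset G))
    (t := ({s : ι → V | LinearIndependent F s} : Finset (ι → V)))
    (f := fun (x : G) i => (x : V ≃ₗ[F] V) (a i)) (by
      intro x _
      simp only [coe_filter, mem_univ, true_and, Set.mem_ofPred_eq]
      exact ha.map' ((x : V ≃ₗ[F] V) : V →ₗ[F] V) (LinearEquiv.ker _))
  rw [card_univ, sum_congr rfl hfib, sum_const, smul_eq_mul] at h1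
  rw [h1, mul_comm]; rfl

open scoped Classical in
theorem card_map_mem_mul_numIndep {G : Subgroup (V ≃ₗ[F] V)} (hG : ContainsSL G) {a : ι → V}
    (ha : LinearIndependent F a) (S : Finset (ι → V)) (hk : Fintype.card ι < finrank F V) :
    #{x : G | (fun i => (x : V ≃ₗ[F] V) (a i)) ∈ S} * numIndep F V ι =
      #{s ∈ S | LinearIndependent F s} * Fintype.card G := by
  have h1 := card_eq_sum_card_fiberwise
    (s := ({x : G | (fun i => (x : V ≃ₗ[F] V) (a i)) ∈ S} : Finset G))
    (t := {s ∈ S | LinearIndependent F s})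
    (f := fun (x : G) i => (x : V ≃ₗ[F] V) (a i)) (by
      intro x hx
      simp only [coe_filter, mem_univ, true_and, Set.mem_ofPred_eq] at hx ⊢
      exact ⟨hx, ha.map' ((x : V ≃ₗ[F] V) : V →ₗ[F] V) (LinearEquiv.ker _)⟩)
  rw [h1, sum_mul]
  rw [sum_congr rfl (g := fun _ => Fintype.card G), sum_const, smul_eq_mul]
  intro b hb
  rw [← card_map_eq_mul_numIndep hG ha (mem_filter.1 hb).2 hk]
  congr 2
  ext x
  simp only [mem_filter, mem_univ, true_and, funext_iff]
  constructor
  · exact fun h => h.2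
  · intro h
    refine ⟨?_, h⟩
    rw [show (fun i => (x : V ≃ₗ[F] V) (a i)) = b from funext h]
    exact (mem_filter.1 hb).1

theorem numIndep_le : numIndep F V ι ≤ Fintype.card V ^ Fintype.card ι := by
  classical
  unfold numIndep
  refine (card_le_univ _).trans ?_
  simp

open scoped Classical in
theorem card_le_card_map_eq_mul {G : Subgroup (V ≃ₗ[F] V)} (hG : ContainsSL G) {a b : ι → V}
    (ha : LinearIndependent F a) (hb : LinearIndependent F b)
    (hk : Fintype.card ι < finrank F V) :
    Fintype.card G ≤
      #{x : G | ∀ i, (x : V ≃ₗ[F] V) (a i) = b i} * Fintype.card V ^ Fintype.card ι := by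
  rw [← card_map_eq_mul_numIndep hG ha hb hk]
  exact Nat.mul_le_mul_left _ numIndep_le

theorem numIndep_eq_prod {k : ℕ} (hk : k ≤ finrank F V) :
    numIndep F V (Fin k) =
      ∏ i : Fin k, (Fintype.card F ^ finrank F V - Fintype.card F ^ (i : ℕ)) := by
  classical
  rw [← card_linearIndependent hk, Nat.card_eq_fintype_card, Fintype.card_subtype, numIndep]
  congr!

theorem numIndep_pos (hk : Fintype.card ι ≤ finrank F V) : 0 < numIndep F V ι := by
  classical
  unfold numIndep
  rw [card_pos]
  let b := finBasis F V
  refine ⟨fun i => b (Fin.castLE hk (Fintype.equivFin ι i)), ?_⟩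
  simp only [mem_filter, mem_univ, true_and]
  exact b.linearIndependent.comp (fun i => Fin.castLE hk (Fintype.equivFin ι i))
    ((Fin.castLE_injective hk).comp (Fintype.equivFin ι).injective)

open scoped Classical in
/-- The proportion of elements of `G` mapping an independent tuple into a subspace. -/
theorem card_map_mem_submodule_mul_le {G : Subgroup (V ≃ₗ[F] V)} (hG : ContainsSL G) {k : ℕ}
    {a : Fin k → V} (ha : LinearIndependent F a) (Y : Submodule F V) (hk : k < finrank F V) :
    #{x : G | ∀ i, (x : V ≃ₗ[F] V) (a i) ∈ Y} *
        Fintype.card F ^ (k * (finrank F V - finrank F Y)) ≤ Fintype.card G := by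
  set q := Fintype.card F with hq
  have hq1 : 1 ≤ q := Fintype.card_pos
  have hYn : finrank F Y ≤ finrank F V := Submodule.finrank_le Y
  have h1 := card_map_mem_mul_numIndep hG ha ({s | ∀ i, s i ∈ Y} : Finset (Fin k → V))
    (by simpa using hk)
  have h2 : #{s ∈ ({s | ∀ i, s i ∈ Y} : Finset (Fin k → V)) | LinearIndependent F s} ≤
      numIndep F Y (Fin k) := by
    refine card_le_card_of_injOn (fun s i => if h : s i ∈ Y then ⟨s i, h⟩ else 0) ?_ ?_
    · intro s hs
      simp only [coe_filter, mem_filter, mem_univ, true_and, Set.mem_ofPred_eq] at hs ⊢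
      refine LinearIndependent.of_comp Y.subtype ?_
      convert hs.2 using 1
      funext i
      simp [hs.1 i]
    · intro s hs t ht hst
      simp only [coe_filter, mem_filter, mem_univ, true_and, Set.mem_ofPred_eq] at hs ht
      funext i
      have := congrFun hst i
      simpa [hs.1 i, ht.1 i] using this
  have h3 : numIndep F Y (Fin k) * q ^ (k * (finrank F V - finrank F Y)) ≤
      numIndep F V (Fin k) := by
    by_cases hkY : k ≤ finrank F Y
    · rw [numIndep_eq_prod hkY, numIndep_eq_prod hk.le, mul_comm k, pow_mul,
        ← Fin.prod_const k (q ^ (finrank F V - finrank F Y)), ← prod_mul_distrib]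
      refine prod_le_prod' fun i _ => ?_
      rw [Nat.sub_mul, ← pow_add, Nat.add_sub_cancel' hYn]
      exact Nat.sub_le_sub_left (Nat.le_mul_of_pos_right _ (by positivity)) _
    · have : numIndep F Y (Fin k) = 0 := by
        unfold numIndep
        rw [card_eq_zero, filter_eq_empty_iff]
        intro s _ hs
        have := hs.fintype_card_le_finrank
        simp at this
        omega
      rw [this]; simp
  have hpos : 0 < numIndep F V (Fin k) := numIndep_pos (by simpa using hk.le)
  simp only [mem_filter, mem_univ, true_and] at h1
  refine Nat.le_of_mul_le_mul_right ?_ hpos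
  calc _ = #{x : G | ∀ i, (x : V ≃ₗ[F] V) (a i) ∈ Y} * numIndep F V (Fin k) *
        q ^ (k * (finrank F V - finrank F Y)) := by ring
    _ ≤ numIndep F Y (Fin k) * Fintype.card G * q ^ (k * (finrank F V - finrank F Y)) := by
        rw [h1]; gcongr
    _ = Fintype.card G * (numIndep F Y (Fin k) * q ^ (k * (finrank F V - finrank F Y))) := by
        ring
    _ ≤ _ := by gcongr

open scoped Classical in
/-- Nonzero pairs (vector, covector) with zero pairing. -/
noncomputable def flagPairs (F V : Type*) [Field F] [Fintype F] [AddCommGroup V] [Module F V]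
    [Fintype V] : Finset (V × Dual F V) := {p | p.1 ≠ 0 ∧ p.2 ≠ 0 ∧ p.2 p.1 = 0}

open scoped Classical in
/-- The stabilizer of a flag pair is small. -/
theorem card_stab_mul_card_flagPairs_le {G : Subgroup (V ≃ₗ[F] V)} (hG : ContainsSL G)
    {v : V} {φ : Dual F V} (hv : (v, φ) ∈ flagPairs F V) :
    #{x : G | (x : V ≃ₗ[F] V) v = v ∧ ∀ u, φ ((x : V ≃ₗ[F] V) u) = φ u} * #(flagPairs F V) ≤
      Fintype.card G * Fintype.card F := by
  simp only [flagPairs, mem_filter, mem_univ, true_and] at hv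
  have key : ∀ p : V × Dual F V, p ∈ flagPairs F V → ∃ g : G, (g : V ≃ₗ[F] V) v = p.1 ∧
      ∃ c : Fˣ, ∀ x, p.2 ((g : V ≃ₗ[F] V) x) = c * φ x := by
    intro p hp
    simp only [flagPairs, mem_filter, mem_univ, true_and] at hp
    obtain ⟨g, hg, h1, h2⟩ := exists_det_one_map_pair hv.1 hp.1 hv.2.1 hp.2.1 hv.2.2 hp.2.2
    exact ⟨⟨g, hG g hg⟩, h1, h2⟩
  choose! g hgv c hgc using key
  rw [← card_product, ← card_univ, ← card_univ (α := F), ← card_product]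
  refine card_le_card_of_injOn (fun z => (g z.2 * z.1, (c z.2 : F))) (fun _ _ => by simp) ?_
  rintro ⟨x, p⟩ hx ⟨y, r⟩ hy hxy
  simp only [coe_product, Set.mem_prod, coe_filter, mem_univ, true_and, Set.mem_ofPred_eq,
    mem_coe] at hx hy
  simp only [Prod.mk.injEq] at hxy
  have e1 : p.1 = r.1 := by
    have h := congrArg (fun t : G => (t : V ≃ₗ[F] V) v) hxy.1
    simp only [Subgroup.coe_mul, LinearEquiv.mul_apply, hx.1.1, hy.1.1] at h
    rw [← hgv p hx.2, ← hgv r hy.2, h]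
  have e2 : p.2 = r.2 := by
    ext u
    have h := congrArg (fun t : G => (t : V ≃ₗ[F] V)
      (((g p * x : G) : V ≃ₗ[F] V).symm u)) hxy.1
    simp only [LinearEquiv.apply_symm_apply] at h
    set w := ((g p * x : G) : V ≃ₗ[F] V).symm u with hw
    have hu : u = (g p : V ≃ₗ[F] V) ((x : V ≃ₗ[F] V) w) := by
      rw [← LinearEquiv.mul_apply, ← Subgroup.coe_mul, hw, LinearEquiv.apply_symm_apply]
    have hu' : u = (g r : V ≃ₗ[F] V) ((y : V ≃ₗ[F] V) w) := by
      rw [← LinearEquiv.mul_apply, ← Subgroup.coe_mul, ← h]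
    conv_lhs => rw [hu]
    conv_rhs => rw [hu']
    rw [hgc p hx.2, hgc r hy.2, hx.1.2, hy.1.2, hxy.2]
  obtain rfl : p = r := Prod.ext e1 e2
  simpa using hxy.1

end Counting

section Words

variable {α : Type*}

/-- Evaluation of a signed word; the sign `true` stands for the generator itself. -/
def evalWord {Γ : Type*} [Group Γ] (g : α → Γ) : List (α × Bool) → Γ
  | [] => 1
  | (b, true) :: l => g b * evalWord g l
  | (b, false) :: l => (g b)⁻¹ * evalWord g l

/-- The source of the edge joining a word to its tail, oriented along the generator. -/
def wordSource : List (α × Bool) → List (α × Bool)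
  | (_, true) :: l => l
  | l => l

/-- The target of the edge joining a word to its tail, oriented along the generator. -/
def wordTarget : List (α × Bool) → List (α × Bool)
  | (_, false) :: l => l
  | l => l

/-- A suffix-closed set of reduced words. -/
structure IsWordTree (T : Finset (List (α × Bool))) : Prop where
  nil_mem : [] ∈ T
  tail_mem : ∀ c l, c :: l ∈ T → l ∈ T
  reduced : ∀ b s s' l, (b, s) :: (b, s') :: l ∈ T → s = s'

variable {F V : Type*} [Field F] [Fintype F] [AddCommGroup V] [Module F V] [Fintype V]

theorem numIndep_eq_fin {ι : Type*} [Fintype ι] :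
    numIndep F V ι = numIndep F V (Fin (Fintype.card ι)) := by
  classical
  unfold numIndep
  let e := Fintype.equivFin ι
  refine card_bij (fun s _ => s ∘ e.symm) ?_ ?_ ?_
  · intro s hs
    simp only [mem_filter, mem_univ, true_and] at hs ⊢
    exact hs.comp _ e.symm.injective
  · intro s _ t _ h
    funext i
    simpa using congrFun h (e i)
  · intro s hs
    simp only [mem_filter, mem_univ, true_and] at hs
    exact ⟨s ∘ e, by simpa using hs.comp _ e.injective, by funext i; simp⟩

theorem numIndep_lower {ι : Type*} [Fintype ι] (hk : Fintype.card ι ≤ finrank F V) :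
    (Fintype.card V : ℝ) ^ Fintype.card ι *
      (1 - (Fintype.card F : ℝ) ^ Fintype.card ι / Fintype.card V) ≤ numIndep F V ι := by
  rw [numIndep_eq_fin]
  generalize Fintype.card ι = k at hk
  rw [numIndep_eq_prod hk]
  have hq : (2 : ℝ) ≤ Fintype.card F := by exact_mod_cast Fintype.one_lt_card
  set q : ℕ := Fintype.card F
  have hV : Fintype.card V = q ^ finrank F V := card_eq_pow_finrank
  rw [hV]
  set N := finrank F V
  have hq0 : (0 : ℝ) < (q : ℝ) ^ N := by positivity
  rw [← Finset.prod_range (fun i => (q ^ N - q ^ i : ℕ))]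
  push_cast
  clear_value q N
  clear hV
  induction k with
  | zero =>
    simp only [pow_zero, one_div, prod_range_zero, Nat.cast_one, one_mul, tsub_le_iff_right,
      le_add_iff_nonneg_right]
    positivity
  | succ k ih =>
    have hkN : k ≤ N := by omega
    have hle : q ^ k ≤ q ^ N := Nat.pow_le_pow_right (by
      have : (0 : ℝ) < q := by linarith
      exact_mod_cast this) hkN
    rw [prod_range_succ]
    push_cast [Nat.cast_sub hle]
    have ih' := ih hkN
    push_cast at ih'
    have h1 : (q : ℝ) ^ k / q ^ N ≤ 1 := by
      rw [div_le_one hq0]; exact_mod_cast hle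
    have h0 : 0 ≤ (q : ℝ) ^ k / q ^ N := by positivity
    set t := (q : ℝ) ^ k / q ^ N with ht
    have e1 : (q : ℝ) ^ (k + 1) / q ^ N = q * t := by rw [ht]; ring
    have e2 : (q : ℝ) ^ N - q ^ k = q ^ N * (1 - t) := by rw [ht]; field_simp
    rw [e1, e2]
    calc ((q : ℝ) ^ N) ^ (k + 1) * (1 - q * t)
        ≤ ((q : ℝ) ^ N) ^ (k + 1) * ((1 - t) * (1 - t)) := by
          gcongr; nlinarith
      _ = ((q : ℝ) ^ N) ^ k * (1 - t) * (q ^ N * (1 - t)) := by ring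
      _ ≤ _ := by
          apply mul_le_mul_of_nonneg_right ih'
          have : 0 ≤ 1 - t := by linarith
          positivity

variable [Fintype α]

open scoped Classical in
/-- With high probability, the images of a random vector under the words of a small tree are
linearly independent. -/
theorem card_not_linearIndependent_tree_le {G : Subgroup (V ≃ₗ[F] V)} (hG : ContainsSL G)
    {T : Finset (List (α × Bool))} (hT : IsWordTree T) (hcard : #T ≤ finrank F V) :
    (#{z : (α → G) × V | ¬ LinearIndependent F
        (fun l : T => evalWord (fun b => (z.1 b : V ≃ₗ[F] V)) l z.2)} : ℝ) ≤
      (Fintype.card G : ℝ) ^ Fintype.card α * (Fintype.card F : ℝ) ^ #T := by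
  set E : α → Finset (List (α × Bool)) := fun b => {l ∈ T | l.head?.map Prod.fst = some b} with hE
  have hEform : ∀ b, ∀ l ∈ E b, ∃ s l', l = (b, s) :: l' := by
    intro b l hl
    rcases l with _ | ⟨⟨b', s⟩, l'⟩
    · simp [hE] at hl
    · simp only [hE, mem_filter, List.head?_cons, Option.map_some, Option.some.injEq] at hl
      exact ⟨s, l', by rw [hl.2]⟩
  have hEmem : ∀ b s l, (b, s) :: l ∈ T → (b, s) :: l ∈ E b := by
    intro b s l hl; simp [hE, hl]
  have hET : ∀ b, E b ⊆ T := fun b => filter_subset _ _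
  have hEcard : ∑ b, #(E b) + 1 = #T := by
    have h1 : T = insert [] (univ.biUnion E) := by
      ext l
      simp only [mem_insert, mem_biUnion, mem_univ, true_and]
      constructor
      · intro hl
        rcases l with _ | ⟨⟨b, s⟩, l⟩
        · exact Or.inl rfl
        · exact Or.inr ⟨b, hEmem b s l hl⟩
      · rintro (rfl | ⟨b, hb⟩)
        · exact hT.nil_mem
        · exact hET b hb
    have h2 : [] ∉ univ.biUnion E := by
      simp only [mem_biUnion, mem_univ, true_and, not_exists]
      intro b hb
      obtain ⟨s, l, h⟩ := hEform b _ hb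
      simp at h
    conv_rhs => rw [h1]
    rw [card_insert_of_notMem h2, card_biUnion]
    intro b _ c _ hbc
    rw [Function.onFun, disjoint_left]
    intro l hl hl'
    obtain ⟨s, m, rfl⟩ := hEform b l hl
    obtain ⟨s', m', h⟩ := hEform c _ hl'
    simp at h
    exact hbc h.1.1
  have hsrc : ∀ b, ∀ l ∈ E b, wordSource l ∈ T := by
    intro b l hl
    obtain ⟨s, m, rfl⟩ := hEform b l hl
    cases s
    · exact hET b hl
    · exact hT.tail_mem _ _ (hET b hl)
  have htgt : ∀ b, ∀ l ∈ E b, wordTarget l ∈ T := by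
    intro b l hl
    obtain ⟨s, m, rfl⟩ := hEform b l hl
    cases s
    · exact hT.tail_mem _ _ (hET b hl)
    · exact hET b hl
  have hsrcinj : ∀ b, ∀ l ∈ E b, ∀ l' ∈ E b, wordSource l = wordSource l' → l = l' := by
    intro b l hl l' hl' h
    obtain ⟨s, m, rfl⟩ := hEform b l hl
    obtain ⟨s', m', rfl⟩ := hEform b l' hl'
    cases s <;> cases s' <;> simp only [wordSource] at h
    · exact h
    · subst h; exact absurd (hT.reduced _ _ _ _ (hET b hl')) (by simp)
    · subst h; exact absurd (hT.reduced _ _ _ _ (hET b hl)) (by simp)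
    · rw [h]
  have htgtinj : ∀ b, ∀ l ∈ E b, ∀ l' ∈ E b, wordTarget l = wordTarget l' → l = l' := by
    intro b l hl l' hl' h
    obtain ⟨s, m, rfl⟩ := hEform b l hl
    obtain ⟨s', m', rfl⟩ := hEform b l' hl'
    cases s <;> cases s' <;> simp only [wordTarget] at h
    · rw [h]
    · subst h; exact absurd (hT.reduced _ _ _ _ (hET b hl)) (by simp)
    · subst h; exact absurd (hT.reduced _ _ _ _ (hET b hl')) (by simp)
    · exact h
  -- compatible generators for a tuple
  let src : ∀ b, E b → T := fun b l => ⟨wordSource l, hsrc b l l.2⟩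
  let tgt : ∀ b, E b → T := fun b l => ⟨wordTarget l, htgt b l l.2⟩
  let C : (T → V) → α → Finset G := fun τ b =>
    {x : G | ∀ e : E b, (x : V ≃ₗ[F] V) (τ (src b e)) = τ (tgt b e)}
  have hCcard : ∀ τ : T → V, LinearIndependent F τ → ∀ b,
      (Fintype.card G : ℝ) ≤ #(C τ b) * (Fintype.card V : ℝ) ^ #(E b) := by
    intro τ hτ b
    have h1 : LinearIndependent F (fun e : E b => τ (src b e)) :=
      hτ.comp (src b) fun e e' h => Subtype.ext
        (hsrcinj b _ e.2 _ e'.2 (congrArg Subtype.val h))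
    have h2 : LinearIndependent F (fun e : E b => τ (tgt b e)) :=
      hτ.comp (tgt b) fun e e' h => Subtype.ext
        (htgtinj b _ e.2 _ e'.2 (congrArg Subtype.val h))
    have h3 := card_le_card_map_eq_mul hG h1 h2 (by
      rw [Fintype.card_coe]
      have : #(E b) ≤ ∑ b, #(E b) := single_le_sum (f := fun b => #(E b))
        (fun _ _ => Nat.zero_le _) (mem_univ b)
      omega)
    rw [Fintype.card_coe] at h3
    exact_mod_cast h3
  have hev : ∀ (τ : T → V) (g : α → G), (∀ b, g b ∈ C τ b) → ∀ (l : List (α × Bool)) (hl : l ∈ T),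
      evalWord (fun b => (g b : V ≃ₗ[F] V)) l (τ ⟨[], hT.nil_mem⟩) = τ ⟨l, hl⟩ := by
    intro τ g hg l
    induction l with
    | nil => intro hl; simp [evalWord]
    | cons c l ih =>
      intro hl
      obtain ⟨b, s⟩ := c
      have ih' := ih (hT.tail_mem _ _ hl)
      have hc := (mem_filter.1 (hg b)).2 ⟨_, hEmem b s l hl⟩
      cases s
      · simp only [evalWord, LinearEquiv.mul_apply, ih']
        simp only [src, tgt, wordSource, wordTarget] at hc
        rw [← hc]
        exact LinearEquiv.symm_apply_apply _ _
      · simp only [evalWord, LinearEquiv.mul_apply, ih']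
        simp only [src, tgt, wordSource, wordTarget] at hc
        exact hc
  -- counting
  let good : Finset ((α → G) × V) := {z | LinearIndependent F
    (fun l : T => evalWord (fun b => (z.1 b : V ≃ₗ[F] V)) l z.2)}
  let LI : Finset (T → V) := {τ | LinearIndependent F τ}
  have hinj : #(LI.sigma fun τ => Fintype.piFinset (C τ)) ≤ #good := by
    refine card_le_card_of_injOn (fun z => (z.2, z.1 ⟨[], hT.nil_mem⟩)) ?_ ?_
    · rintro ⟨τ, g⟩ hz
      simp only [mem_coe, mem_sigma, Fintype.mem_piFinset] at hz
      simp only [mem_coe, good, mem_filter, mem_univ, true_and]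
      have : (fun l : T => evalWord (fun b => (g b : V ≃ₗ[F] V)) l (τ ⟨[], hT.nil_mem⟩)) = τ := by
        funext l; exact hev τ g hz.2 l l.2
      rw [this]
      exact (mem_filter.1 hz.1).2
    · rintro ⟨τ, g⟩ hz ⟨τ', g'⟩ hz' h
      simp only [mem_coe, mem_sigma, Fintype.mem_piFinset] at hz hz'
      simp only [Prod.mk.injEq] at h
      obtain ⟨rfl, h0⟩ := h
      have : τ = τ' := by
        funext l
        rw [← hev τ g hz.2 l l.2, ← hev τ' g hz'.2 l l.2, h0]
      subst this; rfl
  have hVpos : (0 : ℝ) < Fintype.card V := by exact_mod_cast Fintype.card_pos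
  have hsum : (#LI : ℝ) * (Fintype.card G : ℝ) ^ Fintype.card α ≤
      #good * (Fintype.card V : ℝ) ^ (#T - 1) := by
    have h1 : (#LI : ℝ) * (Fintype.card G : ℝ) ^ Fintype.card α ≤
        (∑ τ ∈ LI, ∏ b, (#(C τ b) : ℝ)) * (Fintype.card V : ℝ) ^ (#T - 1) := by
      rw [sum_mul, ← nsmul_eq_mul]
      refine card_nsmul_le_sum _ _ _ fun τ hτ => ?_
      have : #T - 1 = ∑ b, #(E b) := by omega
      rw [this, ← prod_pow_eq_pow_sum, ← prod_mul_distrib, ← card_univ (α := α),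
        ← prod_const]
      exact prod_le_prod (fun _ _ => Nat.cast_nonneg _)
        fun b _ => hCcard τ (mem_filter.1 hτ).2 b
    refine h1.trans ?_
    gcongr
    rw [card_sigma] at hinj
    simp only [Fintype.card_piFinset] at hinj
    exact_mod_cast hinj
  have hLI : (Fintype.card V : ℝ) ^ #T * (1 - (Fintype.card F : ℝ) ^ #T / Fintype.card V) ≤
      #LI := by
    have := numIndep_lower (F := F) (V := V) (ι := T) (by simpa using hcard)
    rw [Fintype.card_coe] at this
    convert this using 2
    simp only [LI, numIndep]
    congr!
  have hT1 : 1 ≤ #T := card_pos.2 ⟨_, hT.nil_mem⟩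
  have hgood : (Fintype.card G : ℝ) ^ Fintype.card α *
      (Fintype.card V - (Fintype.card F : ℝ) ^ #T) ≤ #good := by
    have hp : (0 : ℝ) < (Fintype.card V : ℝ) ^ (#T - 1) := by positivity
    refine le_of_mul_le_mul_right ?_ hp
    refine le_trans ?_ hsum
    calc (Fintype.card G : ℝ) ^ Fintype.card α *
      (Fintype.card V - (Fintype.card F : ℝ) ^ #T) * (Fintype.card V : ℝ) ^ (#T - 1)
        = ((Fintype.card V : ℝ) ^ #T * (1 - (Fintype.card F : ℝ) ^ #T / Fintype.card V)) *
          (Fintype.card G : ℝ) ^ Fintype.card α := by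
          obtain ⟨t, ht⟩ : ∃ t, #T = t + 1 := ⟨#T - 1, by omega⟩
          rw [ht, Nat.add_sub_cancel]; field_simp; ring
      _ ≤ _ := by gcongr
  have htot := card_filter_add_card_filter_not (s := (univ : Finset ((α → G) × V)))
    (fun z => LinearIndependent F
      (fun l : T => evalWord (fun b => (z.1 b : V ≃ₗ[F] V)) l z.2))
  have htot' : (#good : ℝ) + #{z : (α → G) × V | ¬ LinearIndependent F
        (fun l : T => evalWord (fun b => (z.1 b : V ≃ₗ[F] V)) l z.2)} =
      (Fintype.card G : ℝ) ^ Fintype.card α * Fintype.card V := by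
    rw [card_univ, Fintype.card_prod, Fintype.card_fun] at htot
    exact_mod_cast htot
  linarith

end Words

section Correlation

variable {Γ : Type*} [Group Γ] [Fintype Γ]

/-- The autocorrelation of a function on a finite group. -/
def corr (f : Γ → ℝ) (g : Γ) : ℝ := ∑ z, f z * f (g * z)

/-- Functions constant on conjugacy classes. -/
def IsClassFun (f : Γ → ℝ) : Prop := ∀ h z, f (h * z * h⁻¹) = f z

theorem sum_mul_translate (f : Γ → ℝ) (a b : Γ) :
    ∑ z, f (a * z) * f (b * z) = corr f (b * a⁻¹) := by
  unfold corr
  rw [← Equiv.sum_comp (Equiv.mulLeft a) (fun z => f z * f (b * a⁻¹ * z))]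
  simp [mul_assoc]

theorem corr_conj {f : Γ → ℝ} (hf : IsClassFun f) (h g : Γ) :
    corr f (h * g * h⁻¹) = corr f g := by
  unfold corr
  rw [← Equiv.sum_comp (MulAut.conj h).toEquiv]
  refine sum_congr rfl fun z _ => ?_
  simp only [MulEquiv.toEquiv_eq_coe, EquivLike.coe_coe, MulAut.conj_apply]
  rw [show h * g * h⁻¹ * (h * z * h⁻¹) = h * (g * z) * h⁻¹ by group, hf, hf]

theorem corr_one (f : Γ → ℝ) : corr f 1 = ∑ z, f z ^ 2 := by
  simp [corr, sq]

theorem corr_one_nonneg (f : Γ → ℝ) : 0 ≤ corr f 1 := by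
  rw [corr_one]; exact sum_nonneg fun _ _ => sq_nonneg _

theorem abs_corr_le (f : Γ → ℝ) (g : Γ) : |corr f g| ≤ corr f 1 := by
  refine abs_le_of_sq_le_sq ?_ (corr_one_nonneg f)
  have h := sum_mul_sq_le_sq_mul_sq univ f (fun z => f (g * z))
  have h2 : ∑ z, f (g * z) ^ 2 = corr f 1 := by
    rw [corr_one]; exact Equiv.sum_comp (Equiv.mulLeft g) (fun z => f z ^ 2)
  rw [h2, ← corr_one] at h
  rw [sq (corr f 1)]; exact h

/-- The commutator inequality for autocorrelations of class functions. -/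
theorem corr_sq_le {f : Γ → ℝ} (hf : IsClassFun f) {H : Type*} [Group H] [Fintype H]
    (u : H →* Γ) (g : Γ) :
    corr f g ^ 2 * Fintype.card H ≤ corr f 1 * ∑ k, corr f (g * u k * g⁻¹ * (u k)⁻¹) := by
  have hH : (0 : ℝ) < Fintype.card H := by exact_mod_cast Fintype.card_pos
  have h1 : Fintype.card H * corr f g = ∑ z, f z * ∑ h, f (u h * g * (u h)⁻¹ * z) := by
    simp_rw [mul_sum]
    rw [sum_comm]
    have : ∀ h, ∑ z, f z * f (u h * g * (u h)⁻¹ * z) = corr f g := fun h => corr_conj hf _ _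
    simp [this]
  have h2 := sum_mul_sq_le_sq_mul_sq univ f (fun z => ∑ h, f (u h * g * (u h)⁻¹ * z))
  rw [← h1, ← corr_one] at h2
  have h3 : ∑ z, (∑ h, f (u h * g * (u h)⁻¹ * z)) ^ 2 =
      Fintype.card H * ∑ k, corr f (g * u k * g⁻¹ * (u k)⁻¹) := by
    simp_rw [sq, sum_mul_sum]
    rw [sum_comm]
    have : ∀ h, ∑ z, ∑ h', f (u h * g * (u h)⁻¹ * z) * f (u h' * g * (u h')⁻¹ * z) =
        ∑ k, corr f (g * u k * g⁻¹ * (u k)⁻¹) := by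
      intro h
      rw [sum_comm]
      simp_rw [sum_mul_translate]
      rw [← Equiv.sum_comp ((Equiv.inv H).trans (Equiv.mulLeft h))]
      refine sum_congr rfl fun k _ => ?_
      rw [← corr_conj hf (u k * (u h)⁻¹)]
      congr 1
      simp only [Equiv.trans_apply, Equiv.inv_apply, Equiv.coe_mulLeft, map_mul, map_inv]
      group
    simp_rw [sum_comm (s := univ (α := Γ))] at this ⊢
    simp_rw [this]
    simp
  rw [h3] at h2
  refine le_of_mul_le_mul_right ?_ hH
  calc corr f g ^ 2 * Fintype.card H * Fintype.card H = (Fintype.card H * corr f g) ^ 2 := by ring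
    _ ≤ _ := h2
    _ = _ := by ring

end Correlation

section DualAction

variable {F V : Type*} [Field F] [AddCommGroup V] [Module F V] [FiniteDimensional F V]

theorem exists_linearEquiv_dual (h : Dual F V ≃ₗ[F] Dual F V) :
    ∃ g : V ≃ₗ[F] V, ∀ (φ : Dual F V) v, φ (g v) = h φ v := by
  refine ⟨(evalEquiv F V).trans (h.dualMap.trans (evalEquiv F V).symm), fun φ v => ?_⟩
  simp

end DualAction

section Unipotent

variable {F V : Type*} [Field F] [Fintype F] [AddCommGroup V] [Module F V] [Fintype V]

/-- The transvection group attached to a covector. -/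
def unip (e : Dual F V) (b : LinearMap.ker e) : V ≃ₗ[F] V := LinearEquiv.transvection b.2

theorem unip_apply (e : Dual F V) (b : LinearMap.ker e) (x : V) :
    unip e b x = x + e x • (b : V) := LinearEquiv.transvection.apply _ _

theorem unip_add (e : Dual F V) (b c : LinearMap.ker e) :
    unip e (b + c) = unip e b * unip e c := by
  ext x
  have : e (c : V) = 0 := c.2
  simp only [unip_apply, LinearEquiv.mul_apply, map_add, map_smul, this, Submodule.coe_add,
    smul_eq_mul, zero_smul, smul_zero, add_zero, smul_add]
  abel

theorem unip_zero (e : Dual F V) : unip e 0 = 1 := by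
  ext x; simp [unip_apply]

theorem unip_conj {e : Dual F V} {g : V ≃ₗ[F] V} (hg : ∀ x, e (g x) = e x) (b : LinearMap.ker e) :
    g * unip e b * g⁻¹ = unip e ⟨g b, by rw [LinearMap.mem_ker, hg]; exact b.2⟩ := by
  rw [mul_inv_eq_iff_eq_mul]
  ext x
  simp [unip_apply, hg]

theorem sum_addChar_linear_eq_zero {W : Type*} [AddCommGroup W] [Module F W] [Fintype W]
    {ψ : AddChar F ℂ} (hψ : ψ ≠ 1) {L : W →ₗ[F] F} (hL : L ≠ 0) : ∑ w, ψ (L w) = 0 := by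
  have h : ψ.compAddMonoidHom (L : W →+ F) ≠ 1 := by
    intro h
    apply hψ
    ext c
    obtain ⟨w, hw⟩ : ∃ w, L w ≠ 0 := by
      by_contra! h0; exact hL (LinearMap.ext h0)
    have := DFunLike.congr_fun h ((c / L w) • w)
    simpa [hw] using this
  simpa using AddChar.sum_eq_zero_of_ne_one h

variable {X : Type*} [AddCommGroup X] [Module ℂ X]

/-- The isotypic averaging operator of a character of the transvection group. -/
noncomputable def isoProj (ψ : AddChar F ℂ) (e : Dual F V)
    (R : (V ≃ₗ[F] V) →* Module.End ℂ X) (a : Dual F (LinearMap.ker e)) : Module.End ℂ X :=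
  let := Fintype.ofFinite (LinearMap.ker e)
  ∑ b, ψ (-(a b)) • R (unip e b)

variable {ψ : AddChar F ℂ} {e : Dual F V} {R S : (V ≃ₗ[F] V) →* Module.End ℂ X}

theorem isoProj_apply [Fintype (LinearMap.ker e)] (a : Dual F (LinearMap.ker e)) (x : X) :
    isoProj ψ e R a x = ∑ b, ψ (-(a b)) • R (unip e b) x := by
  unfold isoProj
  rw [LinearMap.sum_apply]
  simp only [LinearMap.smul_apply]
  congr!

theorem apply_isoProj (a : Dual F (LinearMap.ker e)) (c : LinearMap.ker e) (x : X) :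
    R (unip e c) (isoProj ψ e R a x) = ψ (a c) • isoProj ψ e R a x := by
  let := Fintype.ofFinite (LinearMap.ker e)
  rw [isoProj_apply, map_sum, smul_sum]
  rw [← Equiv.sum_comp (Equiv.addLeft c) (fun b => ψ (a c) • ψ (-(a b)) • R (unip e b) x)]
  refine sum_congr rfl fun b _ => ?_
  simp only [Equiv.coe_addLeft, map_add, map_smul, unip_add, map_mul, Module.End.mul_apply,
    smul_smul]
  rw [← AddChar.map_add_eq_mul]
  congr 2; ring

theorem isoProj_apply_unip (a : Dual F (LinearMap.ker e)) (c : LinearMap.ker e) (x : X) :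
    isoProj ψ e R a (R (unip e c) x) = ψ (a c) • isoProj ψ e R a x := by
  let := Fintype.ofFinite (LinearMap.ker e)
  rw [← apply_isoProj, isoProj_apply, isoProj_apply, map_sum]
  refine sum_congr rfl fun b _ => ?_
  rw [map_smul, ← Module.End.mul_apply, ← Module.End.mul_apply, ← map_mul, ← map_mul, ← unip_add,
    ← unip_add, add_comm]

theorem isoProj_comm (hc : ∀ g h x, R g (S h x) = S h (R g x)) (a : Dual F (LinearMap.ker e))
    (g : V ≃ₗ[F] V) (x : X) : isoProj ψ e R a (S g x) = S g (isoProj ψ e R a x) := by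
  let := Fintype.ofFinite (LinearMap.ker e)
  rw [isoProj_apply, isoProj_apply, map_sum]
  exact sum_congr rfl fun b _ => by rw [hc, map_smul]

theorem isoProj_of_eigen (hψ : ψ ≠ 1) {a c : Dual F (LinearMap.ker e)} {x : X}
    (hx : ∀ b, R (unip e b) x = ψ (a b) • x) (hac : a ≠ c) : isoProj ψ e R c x = 0 := by
  let := Fintype.ofFinite (LinearMap.ker e)
  rw [isoProj_apply]
  simp_rw [hx, smul_smul, ← AddChar.map_add_eq_mul]
  rw [← sum_smul]
  have := sum_addChar_linear_eq_zero hψ (sub_ne_zero.2 hac)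
  rw [show ∑ b, ψ (-(c b) + a b) = ∑ b, ψ ((a - c) b) by
    refine sum_congr rfl fun b _ => ?_
    rw [LinearMap.sub_apply]; congr 1; ring, this, zero_smul]

theorem isoProj_of_eigen_self {a : Dual F (LinearMap.ker e)} {x : X}
    (hx : ∀ b, R (unip e b) x = ψ (a b) • x) :
    isoProj ψ e R a x = (Nat.card (LinearMap.ker e) : ℂ) • x := by
  let := Fintype.ofFinite (LinearMap.ker e)
  rw [isoProj_apply]
  simp_rw [hx, smul_smul, ← AddChar.map_add_eq_mul]
  rw [Nat.card_eq_fintype_card, Nat.cast_smul_eq_nsmul]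
  simp only [neg_add_cancel, AddChar.map_zero_eq_one, one_smul, sum_const, card_univ]

theorem eq_zero_of_isoProj (hψ : ψ ≠ 1) {x : X} (h : ∀ a, isoProj ψ e R a x = 0) : x = 0 := by
  let := Fintype.ofFinite (LinearMap.ker e)
  have h1 : ∑ a, isoProj ψ e R a x = 0 := sum_eq_zero fun a _ => h a
  simp_rw [isoProj_apply] at h1
  rw [sum_comm] at h1
  simp_rw [← sum_smul] at h1
  rw [sum_eq_single 0] at h1
  · simp only [map_zero, neg_zero, AddChar.map_zero_eq_one, sum_const, card_univ, unip_zero,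
      map_one, Module.End.one_apply, smul_eq_zero] at h1
    rcases h1 with h1 | h1
    · simp at h1
    · exact h1
  · intro b _ hb
    have hL : Dual.eval F (LinearMap.ker e) (-b) ≠ 0 := by
      intro h0
      exact hb (neg_eq_zero.1 (forall_dual_apply_eq_zero_iff F (-b) |>.1
        fun f => DFunLike.congr_fun h0 f))
    have := sum_addChar_linear_eq_zero hψ hL
    simp only [Dual.eval_apply, map_neg (_ : Dual F (LinearMap.ker e))] at this
    rw [this, zero_smul]
  · simp

/-- Elements fixing the covector permute the isotypic operators. -/
theorem apply_isoProj_conj {a a' : Dual F (LinearMap.ker e)} {g : V ≃ₗ[F] V}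
    (hg : ∀ x, e (g x) = e x)
    (ha : ∀ (b : LinearMap.ker e) (c : LinearMap.ker e), (c : V) = g b → a' c = a b) (x : X) :
    R g (isoProj ψ e R a x) = isoProj ψ e R a' (R g x) := by
  let := Fintype.ofFinite (LinearMap.ker e)
  rw [isoProj_apply, isoProj_apply, map_sum]
  have hb : ∀ b : LinearMap.ker e, g b ∈ LinearMap.ker e := fun b => by
    rw [LinearMap.mem_ker, hg]; exact b.2
  refine sum_bij (fun b _ => ⟨g b, hb b⟩) (fun _ _ => mem_univ _) ?_ ?_ ?_
  · intro b _ c _ h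
    exact Subtype.ext (g.injective (congrArg Subtype.val h))
  · intro c _
    refine ⟨⟨g.symm c, ?_⟩, mem_univ _, Subtype.ext (by simp)⟩
    rw [LinearMap.mem_ker, ← hg]; simp
  · intro b _
    rw [ha b _ rfl, map_smul, ← unip_conj hg, map_mul, map_mul, Module.End.mul_apply,
      Module.End.mul_apply, ← Module.End.mul_apply (R g⁻¹), ← map_mul]
    simp

theorem exists_fixing_covector (hn : 3 ≤ finrank F V) (he : e ≠ 0)
    {a a' : Dual F (LinearMap.ker e)} (ha : a ≠ 0) (ha' : a' ≠ 0) :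
    ∃ g : V ≃ₗ[F] V, (∀ x, e (g x) = e x) ∧
      ∀ (b : LinearMap.ker e) (c : LinearMap.ker e), (c : V) = g b → a' c = a b := by
  obtain ⟨A, hA⟩ := LinearMap.exists_extend a
  obtain ⟨A', hA'⟩ := LinearMap.exists_extend a'
  have ind : ∀ (a : Dual F (LinearMap.ker e)) (A : Dual F V), a ≠ 0 →
      A ∘ₗ (LinearMap.ker e).subtype = a → LinearIndependent F ![e, A] := by
    intro a A ha hA
    rw [LinearIndependent.pair_iff' he]
    rintro c rfl
    apply ha
    rw [← hA]
    ext b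
    have : e (b : V) = 0 := b.2
    simp [this]
  have hd : Fintype.card (Fin 2) < finrank F (Dual F V) := by
    rw [Subspace.dual_finrank_eq]; simp; omega
  obtain ⟨h, -, hh⟩ := exists_det_one_map_eq (ind a' A' ha' hA') (ind a A ha hA) hd
  obtain ⟨g, hg⟩ := exists_linearEquiv_dual h
  have h0 := hh 0
  have h1 := hh 1
  simp only [Matrix.cons_val_zero, Matrix.cons_val_one] at h0 h1
  refine ⟨g, fun x => by rw [hg, h0], fun b c hc => ?_⟩
  have e1 : a' c = A' c := by rw [← hA']; rfl
  have e2 : a b = A b := by rw [← hA]; rfl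
  rw [e1, e2, hc, hg, h1]

theorem exists_unip_conj (hn : 3 ≤ finrank F V) (he : e ≠ 0) {t : V ≃ₗ[F] V}
    (ht : t ∈ LinearEquiv.transvections F V) : ∃ (g : V ≃ₗ[F] V) (b : LinearMap.ker e),
      t = g⁻¹ * unip e b * g := by
  obtain ⟨φ, v, hφv, rfl⟩ := ht
  by_cases hφ : φ = 0
  · subst hφ
    refine ⟨1, 0, ?_⟩
    ext x
    rw [LinearEquiv.transvection.apply]; simp [unip_zero]
  · have hd : Fintype.card (Fin 1) < finrank F (Dual F V) := by
      rw [Subspace.dual_finrank_eq]; simp; omega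
    obtain ⟨h, -, hh⟩ := exists_det_one_map_eq (a := fun _ : Fin 1 => e) (b := fun _ => φ)
      (linearIndependent_unique_iff.2 he) (linearIndependent_unique_iff.2 hφ) hd
    obtain ⟨g, hg⟩ := exists_linearEquiv_dual h
    have hge : ∀ x, e (g x) = φ x := fun x => by rw [hg, hh 0]
    refine ⟨g, ⟨g v, by rw [LinearMap.mem_ker, hge, hφv]⟩, ?_⟩
    rw [mul_assoc, eq_inv_mul_iff_mul_eq]
    ext x
    simp only [LinearEquiv.mul_apply, unip_apply, hge]
    rw [LinearEquiv.transvection.apply]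
    simp

variable [FiniteDimensional ℂ X]

/-- A two-sided invariant space without invariant vectors has large dimension. -/
theorem sq_le_finrank_of_invariant (hn : 3 ≤ finrank F V)
    (hc : ∀ g h x, R g (S h x) = S h (R g x)) (E : Submodule ℂ X) (hE : E ≠ ⊥)
    (hRE : ∀ g, ∀ x ∈ E, R g x ∈ E) (hSE : ∀ g, ∀ x ∈ E, S g x ∈ E)
    (hR0 : ∀ x ∈ E, (∀ s, LinearEquiv.det s = 1 → R s x = x) → x = 0)
    (hS0 : ∀ x ∈ E, (∀ s, LinearEquiv.det s = 1 → S s x = x) → x = 0) :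
    (Fintype.card F ^ (finrank F V - 1) - 1) ^ 2 ≤ finrank ℂ E := by
  classical
  obtain ⟨ψ, hψ1⟩ := (AddChar.exists_apply_ne_zero (α := F) (a := 1)).2 one_ne_zero
  have hψ : ψ ≠ 1 := by rintro rfl; simp at hψ1
  haveI : Nontrivial V := Module.nontrivial_of_finrank_pos (R := F) (by omega)
  obtain ⟨e, he⟩ : ∃ e : Dual F V, e ≠ 0 := exists_ne 0
  let : Fintype (LinearMap.ker e) := Fintype.ofFinite _
  have hc' : ∀ g h x, S g (R h x) = R h (S g x) := fun g h x => (hc h g x).symm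
  have hPR : ∀ a, ∀ x ∈ E, isoProj ψ e R a x ∈ E := fun a x hx => by
    rw [isoProj_apply]
    exact E.sum_mem fun b _ => E.smul_mem _ (hRE _ _ hx)
  have hPS : ∀ a, ∀ x ∈ E, isoProj ψ e S a x ∈ E := fun a x hx => by
    rw [isoProj_apply]
    exact E.sum_mem fun b _ => E.smul_mem _ (hSE _ _ hx)
  have hPRS : ∀ a c x, isoProj ψ e R a (isoProj ψ e S c x) =
      isoProj ψ e S c (isoProj ψ e R a x) := by
    intro a c x
    rw [isoProj_apply (R := R), isoProj_apply (R := R), map_sum]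
    exact sum_congr rfl fun b _ => by rw [map_smul, isoProj_comm hc']
  have main : ∀ a c, a ≠ 0 → c ≠ 0 → ∃ x ∈ E, isoProj ψ e R a (isoProj ψ e S c x) ≠ 0 := by
    intro a₀ c₀ ha₀ hc₀
    by_contra! hz
    have hz' : ∀ a c, a ≠ 0 → c ≠ 0 → ∀ x ∈ E, isoProj ψ e R a (isoProj ψ e S c x) = 0 := by
      intro a c ha hc1 x hx
      obtain ⟨g, hg, hga⟩ := exists_fixing_covector hn he ha ha₀
      obtain ⟨h, hh, hhc⟩ := exists_fixing_covector hn he hc1 hc₀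
      have h1 : R g (S h (isoProj ψ e R a (isoProj ψ e S c x))) = 0 := by
        rw [← isoProj_comm hc, apply_isoProj_conj hg hga, apply_isoProj_conj hh hhc,
          ← isoProj_comm hc']
        exact hz _ (hRE g _ (hSE h _ hx))
      have h2 := congrArg (fun y => S h⁻¹ (R g⁻¹ y)) h1
      simp only [map_zero] at h2
      rwa [← Module.End.mul_apply (R g⁻¹), ← map_mul, inv_mul_cancel, map_one,
        Module.End.one_apply, ← Module.End.mul_apply (S h⁻¹), ← map_mul, inv_mul_cancel, map_one,
        Module.End.one_apply] at h2
    have hU : ∀ b d, ∀ x ∈ E,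
        R (unip e b) (S (unip e d) x - x) - (S (unip e d) x - x) = 0 := by
      intro b d x hx
      apply eq_zero_of_isoProj (e := e) (R := R) hψ
      intro a
      rw [map_sub, isoProj_apply_unip]
      by_cases ha : a = 0
      · simp [ha]
      have : isoProj ψ e R a (S (unip e d) x - x) = 0 := by
        apply eq_zero_of_isoProj (e := e) (R := S) hψ
        intro c
        rw [← hPRS, map_sub, isoProj_apply_unip]
        by_cases hc1 : c = 0
        · simp [hc1]
        · rw [map_sub, map_smul, hz' a c ha hc1 x hx]; simp
      rw [this]; simp
    have hT : ∀ s, LinearEquiv.det s = 1 → ∀ d, ∀ x ∈ E,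
        R s (S (unip e d) x - x) = S (unip e d) x - x := by
      intro s hs d
      have htrans : ∀ t ∈ LinearEquiv.transvections F V, ∀ x ∈ E,
          R t (S (unip e d) x - x) = S (unip e d) x - x := by
        intro t ht x hx
        obtain ⟨g, b, rfl⟩ := exists_unip_conj hn he ht
        have h1 := sub_eq_zero.1 (hU b d (R g x) (hRE g x hx))
        rw [← hc, ← map_sub] at h1
        rw [map_mul, map_mul, Module.End.mul_apply, Module.End.mul_apply, h1,
          ← Module.End.mul_apply, ← map_mul]
        simp
      obtain ⟨L, hL, -, rfl⟩ := exists_transvections_of_det_eq_one (by omega) hs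
      clear hs
      intro x hx
      induction L with
      | nil => simp
      | cons t L ih =>
        rw [List.prod_cons, map_mul, Module.End.mul_apply,
          ih (fun s hs => hL s (List.mem_cons_of_mem _ hs)),
          htrans t (hL t List.mem_cons_self) x hx]
    have hS1 : ∀ d, ∀ x ∈ E, S (unip e d) x = x := fun d x hx =>
      sub_eq_zero.1 (hR0 _ (E.sub_mem (hSE _ _ hx) hx) fun s hs => hT s hs d x hx)
    have hS2 : ∀ x ∈ E, x = 0 := by
      intro x hx
      apply hS0 x hx
      intro s hs
      obtain ⟨L, hL, -, rfl⟩ := exists_transvections_of_det_eq_one (by omega) hs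
      clear hs
      induction L with
      | nil => simp
      | cons t L ih =>
        rw [List.prod_cons, map_mul, Module.End.mul_apply,
          ih (fun s hs => hL s (List.mem_cons_of_mem _ hs))]
        obtain ⟨g, b, rfl⟩ := exists_unip_conj hn he (hL t List.mem_cons_self)
        rw [map_mul, map_mul, Module.End.mul_apply, Module.End.mul_apply, hS1 b _ (hSE g x hx),
          ← Module.End.mul_apply, ← map_mul]
        simp
    exact hE ((Submodule.eq_bot_iff E).2 hS2)
  choose! x hxE hx using main
  let I := {a : Dual F (LinearMap.ker e) // a ≠ 0} × {a : Dual F (LinearMap.ker e) // a ≠ 0}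
  let y : I → E := fun i => ⟨isoProj ψ e R i.1 (isoProj ψ e S i.2 (x i.1 i.2)),
    hPR _ _ (hPS _ _ (hxE _ _ i.1.2 i.2.2))⟩
  have hyR : ∀ (i : I) b, R (unip e b) (y i : X) = ψ ((i.1 : Dual F (LinearMap.ker e)) b) •
      (y i : X) := fun i b => apply_isoProj _ _ _
  have hyS : ∀ (i : I) b, S (unip e b) (y i : X) = ψ ((i.2 : Dual F (LinearMap.ker e)) b) •
      (y i : X) := fun i b => by simp only [y]; rw [hPRS]; exact apply_isoProj _ _ _
  have hy : LinearIndependent ℂ y := by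
    rw [Fintype.linearIndependent_iff]
    intro c hsum j
    have h1 : ∑ i, c i • (y i : X) = 0 := by
      have := congrArg Subtype.val hsum
      simpa using this
    have h2 := congrArg (fun z => isoProj ψ e R j.1 (isoProj ψ e S j.2 z)) h1
    simp only [map_sum, map_smul, map_zero] at h2
    rw [sum_eq_single j] at h2
    · rw [isoProj_of_eigen_self (hyS j), map_smul, isoProj_of_eigen_self (hyR j)] at h2
      have hK : (Nat.card (LinearMap.ker e) : ℂ) ≠ 0 := by
        exact_mod_cast Nat.card_pos.ne'
      have hyj : (y j : X) ≠ 0 := hx _ _ j.1.2 j.2.2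
      simpa only [smul_eq_zero, hK, hyj, or_false, false_or] using h2
    · intro i _ hij
      by_cases h1 : i.1 = j.1
      · have h2 : (i.2 : Dual F (LinearMap.ker e)) ≠ j.2 := fun h =>
          hij (Prod.ext h1 (Subtype.ext h))
        rw [isoProj_of_eigen hψ (hyS i) h2]; simp
      · have h2 : (i.1 : Dual F (LinearMap.ker e)) ≠ j.1 := fun h => h1 (Subtype.ext h)
        rw [hPRS, isoProj_of_eigen hψ (hyR i) h2]; simp
    · simp
  have hcard := hy.fintype_card_le_finrank
  have hd : Fintype.card {a : Dual F (LinearMap.ker e) // a ≠ 0} =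
      Fintype.card F ^ (finrank F V - 1) - 1 := by
    rw [Fintype.card_subtype_compl, Fintype.card_subtype_eq, card_eq_pow_finrank (K := F),
      Subspace.dual_finrank_eq]
    have := Module.Dual.finrank_ker_add_one_of_ne_zero he
    congr 2; omega
  rw [Fintype.card_prod, hd] at hcard
  rw [sq]; exact hcard

end Unipotent

section Operator

variable {X : Type*} [NormedAddCommGroup X] [InnerProductSpace ℂ X] [FiniteDimensional ℂ X]

theorem exists_max_eigenvalue [Nontrivial X] {L L' : X →ₗ[ℂ] X}
    (h : ∀ x y, inner ℂ (L x) y = inner ℂ x (L' y)) :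
    ∃ lam : ℝ, (∀ x, ‖L x‖ ^ 2 ≤ lam * ‖x‖ ^ 2) ∧
      End.eigenspace (L' ∘ₗ L) (lam : ℂ) ≠ ⊥ := by
  have h' : ∀ x y, inner ℂ (L' x) y = inner ℂ x (L y) := fun x y => by
    rw [← inner_conj_symm, ← h, inner_conj_symm]
  have hT : (L' ∘ₗ L).IsSymmetric := fun x y => by
    simp only [LinearMap.comp_apply]; rw [h', h]
  haveI : Nonempty (Fin (finrank ℂ X)) := Fin.pos_iff_nonempty.1 finrank_pos
  obtain ⟨j, hj⟩ := Finite.exists_max (hT.eigenvalues rfl)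
  refine ⟨hT.eigenvalues rfl j, fun x => ?_, hT.hasEigenvalue_eigenvalues rfl j⟩
  have h1 : ∀ i, inner ℂ ((L' ∘ₗ L) x) (hT.eigenvectorBasis rfl i) =
      (hT.eigenvalues rfl i : ℂ) * inner ℂ x (hT.eigenvectorBasis rfl i) := fun i => by
    rw [hT, hT.apply_eigenvectorBasis]; exact inner_smul_right _ _ _
  have h2 := (hT.eigenvectorBasis rfl).sum_inner_mul_inner ((L' ∘ₗ L) x) x
  have h3 : inner ℂ ((L' ∘ₗ L) x) x = ((‖L x‖ ^ 2 : ℝ) : ℂ) := by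
    simp only [LinearMap.comp_apply]; rw [h', inner_self_eq_norm_sq_to_K]; simp
  rw [h3] at h2
  have h4 : ‖L x‖ ^ 2 = ∑ i, hT.eigenvalues rfl i * ‖inner ℂ (hT.eigenvectorBasis rfl i) x‖ ^ 2 := by
    have : ((‖L x‖ ^ 2 : ℝ) : ℂ) =
      ((∑ i, hT.eigenvalues rfl i * ‖inner ℂ (hT.eigenvectorBasis rfl i) x‖ ^ 2 : ℝ) : ℂ) := by
      rw [← h2]
      rw [Complex.ofReal_sum]
      refine sum_congr rfl fun i _ => ?_
      rw [h1, mul_assoc, ← inner_conj_symm, ← Complex.normSq_eq_conj_mul_self,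
        Complex.normSq_eq_norm_sq, Complex.ofReal_mul]
    exact_mod_cast this
  rw [h4, ← (hT.eigenvectorBasis rfl).sum_sq_norm_inner_right x, mul_sum]
  exact sum_le_sum fun i _ => mul_le_mul_of_nonneg_right (hj i) (sq_nonneg _)

theorem eigenvalue_mul_finrank_le {L L' : X →ₗ[ℂ] X}
    (h : ∀ x y, inner ℂ (L x) y = inner ℂ x (L' y)) (lam : ℝ) {ι : Type*} [Fintype ι]
    (δ : OrthonormalBasis ι ℂ X) :
    lam * finrank ℂ (End.eigenspace (L' ∘ₗ L) (lam : ℂ)) ≤ ∑ i, ‖L' (δ i)‖ ^ 2 := by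
  have h' : ∀ x y, inner ℂ (L' x) y = inner ℂ x (L y) := fun x y => by
    rw [← inner_conj_symm, ← h, inner_conj_symm]
  set E := End.eigenspace (L' ∘ₗ L) (lam : ℂ) with hE
  let b := stdOrthonormalBasis ℂ E
  have hb : Orthonormal ℂ (fun j => (b j : X)) := b.orthonormal.comp_linearIsometry E.subtypeₗᵢ
  have h1 : ∀ j, ∑ i, ‖inner ℂ (b j : X) (L' (δ i))‖ ^ 2 = lam := by
    intro j
    have e1 : ∀ i, ‖inner ℂ (b j : X) (L' (δ i))‖ = ‖inner ℂ (δ i) (L (b j))‖ := fun i => by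
      rw [← h, norm_inner_symm]
    simp_rw [e1]
    rw [δ.sum_sq_norm_inner_right]
    have e2 : (L' ∘ₗ L) (b j) = (lam : ℂ) • (b j : X) := End.mem_eigenspace_iff.1 (b j).2
    have e3 : inner ℂ (b j : X) ((L' ∘ₗ L) (b j)) = ((‖L (b j)‖ ^ 2 : ℝ) : ℂ) := by
      simp only [LinearMap.comp_apply]; rw [← h, inner_self_eq_norm_sq_to_K]; simp
    rw [e2, inner_smul_right, inner_self_eq_norm_sq_to_K, hb.1 j] at e3
    simp only [RCLike.ofReal_one, one_pow, mul_one, Complex.coe_algebraMap, Complex.ofReal_one] at e3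
    exact_mod_cast e3.symm
  calc lam * finrank ℂ E = ∑ j, ∑ i, ‖inner ℂ (b j : X) (L' (δ i))‖ ^ 2 := by
        simp [h1, mul_comm]
    _ = ∑ i, ∑ j, ‖inner ℂ (b j : X) (L' (δ i))‖ ^ 2 := sum_comm
    _ ≤ _ := sum_le_sum fun i _ => hb.sum_inner_products_le _

end Operator

section Convolution

variable {Γ : Type*} [Group Γ] [Fintype Γ]

/-- Right convolution by a real function. -/
noncomputable def convOp (f : Γ → ℝ) : EuclideanSpace ℂ Γ →ₗ[ℂ] EuclideanSpace ℂ Γ where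
  toFun φ := WithLp.toLp 2 fun x => ∑ y, φ y * (f (y⁻¹ * x) : ℂ)
  map_add' φ ψ := by ext x; simp [add_mul, sum_add_distrib]
  map_smul' c φ := by ext x; simp [mul_assoc, mul_sum]

theorem convOp_apply (f : Γ → ℝ) (φ : EuclideanSpace ℂ Γ) (x : Γ) :
    convOp f φ x = ∑ y, φ y * (f (y⁻¹ * x) : ℂ) := rfl

/-- Left translation. -/
noncomputable def leftTrans : Γ →* Module.End ℂ (EuclideanSpace ℂ Γ) where
  toFun g :=
    { toFun := fun φ => WithLp.toLp 2 fun x => φ (g⁻¹ * x)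
      map_add' := fun φ ψ => by ext x; simp
      map_smul' := fun c φ => by ext x; simp }
  map_one' := by ext φ x; simp
  map_mul' g h := by ext φ x; simp [mul_assoc]

/-- Right translation. -/
noncomputable def rightTrans : Γ →* Module.End ℂ (EuclideanSpace ℂ Γ) where
  toFun g :=
    { toFun := fun φ => WithLp.toLp 2 fun x => φ (x * g)
      map_add' := fun φ ψ => by ext x; simp
      map_smul' := fun c φ => by ext x; simp }
  map_one' := by ext φ x; simp
  map_mul' g h := by ext φ x; simp [mul_assoc]

theorem leftTrans_apply (g : Γ) (φ : EuclideanSpace ℂ Γ) (x : Γ) :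
    leftTrans g φ x = φ (g⁻¹ * x) := rfl

theorem rightTrans_apply (g : Γ) (φ : EuclideanSpace ℂ Γ) (x : Γ) :
    rightTrans g φ x = φ (x * g) := rfl

theorem convOp_adjoint (f : Γ → ℝ) (φ ψ : EuclideanSpace ℂ Γ) :
    inner ℂ (convOp f φ) ψ = inner ℂ φ (convOp (fun z => f z⁻¹) ψ) := by
  simp only [PiLp.inner_apply, convOp_apply, RCLike.inner_apply, map_sum, map_mul, mul_sum, sum_mul]
  rw [sum_comm]
  refine sum_congr rfl fun y _ => sum_congr rfl fun x _ => ?_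
  simp [mul_inv_rev]
  ring

theorem convOp_leftTrans (f : Γ → ℝ) (g : Γ) (φ : EuclideanSpace ℂ Γ) :
    convOp f (leftTrans g φ) = leftTrans g (convOp f φ) := by
  ext x
  simp only [convOp_apply, leftTrans_apply]
  rw [← Equiv.sum_comp (Equiv.mulLeft g)]
  simp [mul_assoc]

theorem convOp_rightTrans {f : Γ → ℝ} (hf : IsClassFun f) (g : Γ) (φ : EuclideanSpace ℂ Γ) :
    convOp f (rightTrans g φ) = rightTrans g (convOp f φ) := by
  ext x
  simp only [convOp_apply, rightTrans_apply]
  rw [← Equiv.sum_comp (Equiv.mulRight g) (fun y => φ y * (f (y⁻¹ * (x * g)) : ℂ))]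
  refine sum_congr rfl fun y _ => ?_
  simp only [Equiv.coe_mulRight, mul_inv_rev]
  rw [← hf g (g⁻¹ * y⁻¹ * (x * g))]
  simp [mul_assoc]

theorem IsClassFun.inv {f : Γ → ℝ} (hf : IsClassFun f) : IsClassFun (fun z => f z⁻¹) := by
  intro h z
  simp only
  rw [← hf h z⁻¹]; simp [mul_assoc]

variable {N : Subgroup Γ} [Fintype N]

theorem convOp_eq_zero_of_right {f : Γ → ℝ} 
    (h0 : ∀ z, ∑ s : N, f (s * z) = 0) {φ : EuclideanSpace ℂ Γ}
    (hφ : ∀ s ∈ N, rightTrans s φ = φ) : convOp f φ = 0 := by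
  ext x
  have h1 : ∀ s : N, convOp f φ x = ∑ y, φ y * (f ((s : Γ) * (y⁻¹ * x)) : ℂ) := by
    intro s
    rw [convOp_apply, ← Equiv.sum_comp (Equiv.mulRight (s : Γ)⁻¹)]
    refine sum_congr rfl fun y _ => ?_
    have : φ (y * (s : Γ)⁻¹) = φ y := by
      conv_rhs => rw [← hφ _ (N.inv_mem s.2)]
      rfl
    simp [mul_inv_rev, this, mul_assoc]
  have h2 : ∑ s : N, convOp f φ x = 0 := by
    rw [sum_congr rfl fun s _ => h1 s, sum_comm]
    refine sum_eq_zero fun y _ => ?_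
    rw [← mul_sum, ← Complex.ofReal_sum, h0]; simp
  simpa using h2

theorem convOp_eq_zero_of_left {f : Γ → ℝ} (hf : IsClassFun f)
    (h0 : ∀ z, ∑ s : N, f (s * z) = 0) {φ : EuclideanSpace ℂ Γ}
    (hφ : ∀ s ∈ N, leftTrans s φ = φ) : convOp f φ = 0 := by
  ext x
  have h1 : ∀ s : N, convOp f φ x = ∑ y, φ y * (f ((s : Γ) * (x * y⁻¹)) : ℂ) := by
    intro s
    rw [convOp_apply, ← Equiv.sum_comp (Equiv.mulLeft (s : Γ)⁻¹)]
    refine sum_congr rfl fun y _ => ?_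
    have : φ ((s : Γ)⁻¹ * y) = φ y := by
      conv_rhs => rw [← hφ _ s.2]
      rfl
    simp only [Equiv.coe_mulLeft, mul_inv_rev, inv_inv, this]
    rw [← hf y (y⁻¹ * s * x)]
    simp [mul_assoc]
  have h2 : ∑ s : N, convOp f φ x = 0 := by
    rw [sum_congr rfl fun s _ => h1 s, sum_comm]
    refine sum_eq_zero fun y _ => ?_
    rw [← mul_sum, ← Complex.ofReal_sum, h0]; simp
  simpa using h2

theorem corr_sq_le_of_convOp {f : Γ → ℝ} (hf : IsClassFun f) {B : ℝ}
    (hB : ∀ φ, ‖convOp f φ‖ ^ 2 ≤ B * ‖φ‖ ^ 2) (w : Γ) :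
    corr f w ^ 2 * Fintype.card Γ ≤ corr f 1 * (B * Nat.card {h : Γ // h * w = w * h}) := by
  classical
  have hpos : (0 : ℝ) < Fintype.card Γ := by exact_mod_cast Fintype.card_pos
  let φ : EuclideanSpace ℂ Γ := WithLp.toLp 2 fun y => ∑ h : Γ, if y = h * w⁻¹ * h⁻¹ then 1 else 0
  let ψ : Γ → ℝ := fun z => ∑ h, f (h * w * h⁻¹ * z)
  have hψ : ∀ z, convOp f φ z = (ψ z : ℂ) := by
    intro z
    rw [convOp_apply]
    simp only [φ, ψ, sum_mul, ite_mul, one_mul, zero_mul]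
    rw [sum_comm]
    simp [mul_assoc]
  have hφ : ‖φ‖ ^ 2 = Fintype.card Γ * Nat.card {h : Γ // h * w = w * h} := by
    have e1 : ∀ y, ‖φ y‖ ^ 2 = ∑ h : Γ, ∑ k : Γ,
        if y = h * w⁻¹ * h⁻¹ then (if y = k * w⁻¹ * k⁻¹ then (1 : ℝ) else 0) else 0 := by
      intro y
      have : φ y = ((∑ h : Γ, if y = h * w⁻¹ * h⁻¹ then (1 : ℝ) else 0 : ℝ) : ℂ) := by
        simp [φ]
      rw [this, Complex.norm_real, Real.norm_eq_abs, sq_abs, sq, sum_mul_sum]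
      refine sum_congr rfl fun h _ => sum_congr rfl fun k _ => ?_
      split_ifs <;> simp
    rw [EuclideanSpace.norm_sq_eq]
    simp_rw [e1]
    rw [sum_comm]
    have e2 : ∀ h : Γ, ∑ y, ∑ k : Γ,
        (if y = h * w⁻¹ * h⁻¹ then (if y = k * w⁻¹ * k⁻¹ then (1 : ℝ) else 0) else 0) =
        Nat.card {h : Γ // h * w = w * h} := by
      intro h
      rw [sum_comm]
      simp only [sum_ite_eq', mem_univ, if_true, sum_ite_eq]
      rw [← Equiv.sum_comp (Equiv.mulLeft h), Nat.card_eq_fintype_card, Fintype.card_subtype,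
        sum_boole]
      congr 2
      ext k
      simp only [mem_filter, mem_univ, true_and, Equiv.coe_mulLeft, mul_inv_rev]
      constructor
      · intro e
        have e' : w⁻¹ = k * w⁻¹ * k⁻¹ := by
          have := congrArg (fun t => h⁻¹ * t * h) e
          simpa [mul_assoc] using this
        have := congrArg (fun t => w * t * (k * w)) e'
        simpa [mul_assoc] using this
      · intro e
        have e' : k * w⁻¹ * k⁻¹ = w⁻¹ := by
          rw [mul_inv_eq_iff_eq_mul, eq_inv_mul_iff_mul_eq, ← mul_assoc, ← e, mul_assoc]; simp
        calc h * w⁻¹ * h⁻¹ = h * (k * w⁻¹ * k⁻¹) * h⁻¹ := by rw [e']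
          _ = _ := by simp [mul_assoc]
    rw [sum_congr rfl fun h _ => e2 h]; simp
  have h1 : Fintype.card Γ * corr f w = ∑ z, f z * ψ z := by
    simp only [ψ, mul_sum]
    rw [sum_comm]
    have : ∀ h, ∑ z, f z * f (h * w * h⁻¹ * z) = corr f w := fun h => corr_conj hf _ _
    simp [this]
  have h2 := sum_mul_sq_le_sq_mul_sq univ f ψ
  rw [← h1, ← corr_one] at h2
  have h3 : ∑ z, ψ z ^ 2 = ‖convOp f φ‖ ^ 2 := by
    rw [EuclideanSpace.norm_sq_eq]
    refine sum_congr rfl fun z _ => ?_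
    rw [hψ, Complex.norm_real, Real.norm_eq_abs, sq_abs]
  rw [h3] at h2
  have h4 := mul_le_mul_of_nonneg_left (hB φ) (corr_one_nonneg f)
  rw [hφ] at h4
  have h5 := h2.trans h4
  nlinarith

end Convolution

section Main

variable {F V : Type*} [Field F] [Fintype F] [AddCommGroup V] [Module F V] [Fintype V]

/-- The special linear group as a subgroup. -/
noncomputable def slSub (F V : Type*) [Field F] [AddCommGroup V] [Module F V] : Subgroup (V ≃ₗ[F] V) :=
  (LinearEquiv.det : (V ≃ₗ[F] V) →* Fˣ).ker

theorem mem_slSub {s : V ≃ₗ[F] V} : s ∈ slSub F V ↔ LinearEquiv.det s = 1 := MonoidHom.mem_ker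

/-- Autocorrelations of class functions with vanishing coset sums are controlled by
centralizers. -/
theorem corr_sq_mul_le_centralizer (hn : 3 ≤ finrank F V) {f : (V ≃ₗ[F] V) → ℝ}
    (hf : IsClassFun f) [Fintype (slSub F V)] (h0 : ∀ z, ∑ s : slSub F V, f (s * z) = 0)
    (w : V ≃ₗ[F] V) :
    corr f w ^ 2 * (((Fintype.card F ^ (finrank F V - 1) - 1 : ℕ) : ℝ)) ^ 2 ≤
      corr f 1 ^ 2 * Nat.card {h : V ≃ₗ[F] V // h * w = w * h} := by
  classical
  set D : ℝ := ((Fintype.card F ^ (finrank F V - 1) - 1 : ℕ) : ℝ)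
  have hpos : (0 : ℝ) < Fintype.card (V ≃ₗ[F] V) := by exact_mod_cast Fintype.card_pos
  obtain ⟨lam, hlam, hE⟩ := exists_max_eigenvalue (convOp_adjoint f)
  set T := convOp (fun z => f z⁻¹) ∘ₗ convOp f
  have hD : lam * D ^ 2 ≤ Fintype.card (V ≃ₗ[F] V) * corr f 1 := by
    rcases le_or_gt lam 0 with hl | hl
    · exact (mul_nonpos_of_nonpos_of_nonneg hl (sq_nonneg _)).trans
        (mul_nonneg hpos.le (corr_one_nonneg f))
    have hmem : ∀ x, x ∈ End.eigenspace T (lam : ℂ) ↔ T x = (lam : ℂ) • x :=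
      fun x => End.mem_eigenspace_iff
    have hker : ∀ x ∈ End.eigenspace T (lam : ℂ), convOp f x = 0 → x = 0 := by
      intro x hx h
      have h1 := (hmem x).1 hx
      simp only [T, LinearMap.comp_apply, h, map_zero] at h1
      rcases smul_eq_zero.1 h1.symm with h2 | h2
      · exact absurd h2 (by exact_mod_cast hl.ne')
      · exact h2
    have hdim := sq_le_finrank_of_invariant (F := F) (V := V) (R := leftTrans) (S := rightTrans)
      hn (fun g h x => by ext z; simp only [leftTrans_apply, rightTrans_apply, mul_assoc])
      (End.eigenspace T (lam : ℂ)) hE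
      (fun g x hx => by
        rw [hmem] at hx ⊢
        simp only [T, LinearMap.comp_apply] at hx ⊢
        rw [convOp_leftTrans, convOp_leftTrans, hx, map_smul])
      (fun g x hx => by
        rw [hmem] at hx ⊢
        simp only [T, LinearMap.comp_apply] at hx ⊢
        rw [convOp_rightTrans hf, convOp_rightTrans hf.inv, hx, map_smul])
      (fun x hx h => hker x hx (convOp_eq_zero_of_left hf h0 fun s hs => h s (mem_slSub.1 hs)))
      (fun x hx h => hker x hx (convOp_eq_zero_of_right h0 fun s hs => h s (mem_slSub.1 hs)))
    have h1 := eigenvalue_mul_finrank_le (convOp_adjoint f) lam (EuclideanSpace.basisFun (V ≃ₗ[F] V) ℂ)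
    have h2 : ∀ x : V ≃ₗ[F] V, ‖convOp (fun z => f z⁻¹) (EuclideanSpace.basisFun (V ≃ₗ[F] V) ℂ x)‖ ^ 2 = corr f 1 := by
      intro x
      rw [EuclideanSpace.norm_sq_eq, corr_one]
      have : ∀ z, convOp (fun z => f z⁻¹) (EuclideanSpace.basisFun (V ≃ₗ[F] V) ℂ x) z =
          ((f (z⁻¹ * x) : ℝ) : ℂ) := by
        intro z
        rw [convOp_apply, sum_eq_single x]
        · simp [mul_inv_rev]
        · intro y _ hy; simp [hy]
        · simp
      simp_rw [this, Complex.norm_real, Real.norm_eq_abs, sq_abs]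
      exact Equiv.sum_comp ((Equiv.inv (V ≃ₗ[F] V)).trans (Equiv.mulRight x)) (fun z => f z ^ 2)
    rw [sum_congr rfl fun x _ => h2 x] at h1
    simp only [sum_const, card_univ, nsmul_eq_mul] at h1
    refine le_trans ?_ h1
    refine mul_le_mul_of_nonneg_left ?_ hl.le
    simp only [D]
    exact_mod_cast hdim
  have h5 := corr_sq_le_of_convOp hf hlam w
  have h6 := mul_le_mul_of_nonneg_right h5 (sq_nonneg D)
  have hc : (0 : ℝ) ≤ Nat.card {h : V ≃ₗ[F] V // h * w = w * h} := Nat.cast_nonneg _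
  have h7 := mul_le_mul_of_nonneg_left hD (mul_nonneg (corr_one_nonneg f) hc)
  have h8 : corr f w ^ 2 * D ^ 2 * Fintype.card (V ≃ₗ[F] V) ≤
      corr f 1 ^ 2 * Nat.card {h : V ≃ₗ[F] V // h * w = w * h} * Fintype.card (V ≃ₗ[F] V) := by
    calc _ = _ := by ring
      _ ≤ _ := h6
      _ = _ := by ring
      _ ≤ _ := h7
      _ = _ := by ring
  exact le_of_mul_le_mul_right h8 hpos

end Main

section Step

variable {Γ : Type*} [Group Γ] [Fintype Γ]

theorem corr_sq_le_of_bad {f : Γ → ℝ} (hf : IsClassFun f) {K : Type*} [AddGroup K] [Fintype K]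
    (u : Multiplicative K →* Γ) (g : Γ) (B : Finset K) {r : ℝ} (hr : 0 ≤ r)
    (h : ∀ k ∉ B, |corr f (g * u (Multiplicative.ofAdd k) * g⁻¹ *
      (u (Multiplicative.ofAdd k))⁻¹)| ≤ r * corr f 1) :
    corr f g ^ 2 ≤ (#B / Fintype.card K + r) * corr f 1 ^ 2 := by
  classical
  have hK : (0 : ℝ) < Fintype.card K := by exact_mod_cast Fintype.card_pos
  have h1 := corr_sq_le hf u g
  have h0 := corr_one_nonneg f
  have h2 : ∑ k : Multiplicative K, corr f (g * u k * g⁻¹ * (u k)⁻¹) ≤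
      #B * corr f 1 + Fintype.card K * (r * corr f 1) := by
    rw [← Equiv.sum_comp Multiplicative.ofAdd]
    calc _ ≤ ∑ k : K, ((if k ∈ B then corr f 1 else 0) + r * corr f 1) := by
          refine sum_le_sum fun k _ => ?_
          split_ifs with hk
          · exact (le_abs_self _).trans ((abs_corr_le f _).trans (by nlinarith))
          · exact (le_abs_self _).trans ((h k hk).trans (by simp))
      _ = _ := by rw [sum_add_distrib]; simp
  have h3 : corr f g ^ 2 * Fintype.card K ≤
      corr f 1 * (#B * corr f 1 + Fintype.card K * (r * corr f 1)) := by
    refine le_trans ?_ (mul_le_mul_of_nonneg_left h2 h0)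
    simpa using h1
  rw [← div_le_div_iff_of_pos_right hK] at h3
  rw [mul_div_cancel_right₀ _ hK.ne'] at h3
  refine h3.trans (le_of_eq ?_)
  field_simp

end Step

section Conj

variable {F V : Type*} [Field F] [AddCommGroup V] [Module F V] [FiniteDimensional F V]

/-- `g - 1` squares to zero and has rank `b`. -/
def IsUnip (b : ℕ) (g : V ≃ₗ[F] V) : Prop :=
  ∃ N : V →ₗ[F] V, (∀ v, N (N v) = 0) ∧ finrank F (LinearMap.range N) = b ∧ ∀ v, g v = v + N v

theorem exists_sq_zero_normal_form {N : V →ₗ[F] V} (hN : ∀ v, N (N v) = 0) {b : ℕ}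
    (hb : finrank F (LinearMap.range N) = b) :
    ∃ Φ : ((Fin b → F) × (Fin b → F) × (Fin (finrank F V - 2 * b) → F)) ≃ₗ[F] V,
      ∀ x y z, N (Φ (x, y, z)) = Φ (y, 0, 0) := by
  obtain ⟨U, hU⟩ := Submodule.exists_isCompl (LinearMap.ker N)
  have hle : LinearMap.range N ≤ LinearMap.ker N := by
    rintro _ ⟨v, rfl⟩; exact hN v
  obtain ⟨W, hW⟩ := Submodule.exists_isCompl ((LinearMap.range N).comap (LinearMap.ker N).subtype)
  have h1 := LinearMap.finrank_range_add_finrank_ker N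
  have h2 := Submodule.finrank_add_eq_of_isCompl hU
  have h3 := Submodule.finrank_add_eq_of_isCompl hW
  have h4 : finrank F ((LinearMap.range N).comap (LinearMap.ker N).subtype) = b := by
    rw [(Submodule.comapSubtypeEquivOfLe hle).finrank_eq, hb]
  let i : (Fin b → F) ≃ₗ[F] U := LinearEquiv.ofFinrankEq _ _ (by simp; omega)
  let j : (Fin (finrank F V - 2 * b) → F) ≃ₗ[F] W := LinearEquiv.ofFinrankEq _ _ (by simp; omega)
  let ι : (Fin b → F) →ₗ[F] V := U.subtype ∘ₗ i.toLinearMap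
  let κ : (Fin (finrank F V - 2 * b) → F) →ₗ[F] V :=
    (LinearMap.ker N).subtype ∘ₗ W.subtype ∘ₗ j.toLinearMap
  have hκN : ∀ z, N (κ z) = 0 := fun z => (j z : LinearMap.ker N).2
  have hιinj : ∀ y, N (ι y) = 0 → y = 0 := by
    intro y hy
    have : ι y ∈ LinearMap.ker N ⊓ U := ⟨hy, (i y).2⟩
    rw [hU.inf_eq_bot, Submodule.mem_bot] at this
    have h5 : i y = 0 := Subtype.ext this
    simpa using h5
  let Ψ : ((Fin b → F) × (Fin b → F) × (Fin (finrank F V - 2 * b) → F)) →ₗ[F] V :=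
    LinearMap.coprod (N ∘ₗ ι) (LinearMap.coprod ι κ)
  have hΨ : ∀ x y z, Ψ (x, y, z) = N (ι x) + (ι y + κ z) := fun x y z => rfl
  have hinj : Function.Injective Ψ := by
    rw [← LinearMap.ker_eq_bot, LinearMap.ker_eq_bot']
    rintro ⟨x, y, z⟩ h
    rw [hΨ] at h
    have hy : y = 0 := by
      apply hιinj
      have := congrArg N h
      simpa [hN, hκN] using this
    subst hy
    rw [map_zero, zero_add] at h
    have hz : (j z : LinearMap.ker N) ∈
        (LinearMap.range N).comap (LinearMap.ker N).subtype ⊓ W := by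
      refine ⟨?_, (j z).2⟩
      refine ⟨-(ι x), ?_⟩
      rw [map_neg]
      exact neg_eq_of_add_eq_zero_right h
    rw [hW.inf_eq_bot, Submodule.mem_bot] at hz
    have hz' : z = 0 := by
      have : j z = 0 := Subtype.ext hz
      simpa using this
    subst hz'
    rw [map_zero, add_zero] at h
    rw [hιinj x h]; rfl
  have hfin : finrank F ((Fin b → F) × (Fin b → F) × (Fin (finrank F V - 2 * b) → F)) =
      finrank F V := by simp; omega
  refine ⟨LinearEquiv.ofInjectiveOfFinrankEq Ψ hinj hfin, fun x y z => ?_⟩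
  change N (Ψ (x, y, z)) = Ψ (y, 0, 0)
  rw [hΨ, hΨ]
  simp [hN, hκN]

theorem IsUnip.conj {b : ℕ} {g g' : V ≃ₗ[F] V} (hg : IsUnip b g) (hg' : IsUnip b g') :
    ∃ h : V ≃ₗ[F] V, g' = h * g * h⁻¹ := by
  obtain ⟨N, hN, hb, hgN⟩ := hg
  obtain ⟨N', hN', hb', hgN'⟩ := hg'
  obtain ⟨Φ, hΦ⟩ := exists_sq_zero_normal_form hN hb
  obtain ⟨Φ', hΦ'⟩ := exists_sq_zero_normal_form hN' hb'
  refine ⟨Φ.symm.trans Φ', ?_⟩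
  rw [eq_mul_inv_iff_mul_eq]
  ext v
  obtain ⟨⟨x, y, z⟩, rfl⟩ := Φ.surjective v
  simp only [LinearEquiv.mul_apply, LinearEquiv.trans_apply, LinearEquiv.symm_apply_apply, hgN,
    hgN', hΦ, hΦ', map_add]

end Conj

section Greedy

variable {F V : Type*} [Field F] [Fintype F] [AddCommGroup V] [Module F V] [Fintype V]

theorem card_preimage_le (B : V →ₗ[F] V) (D : Set V) :
    Nat.card (B ⁻¹' D) ≤ Nat.card (LinearMap.ker B) * Nat.card D := by
  classical
  have h : ∀ d : D, ∃ t : V, ∀ x : V, B x = d → x - t ∈ LinearMap.ker B := by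
    intro d
    by_cases hd : ∃ t, B t = d
    · obtain ⟨t, ht⟩ := hd
      exact ⟨t, fun x hx => by rw [LinearMap.mem_ker, map_sub, hx, ht, sub_self]⟩
    · exact ⟨0, fun x hx => absurd ⟨x, hx⟩ hd⟩
  choose t ht using h
  rw [← Nat.card_prod]
  refine Nat.card_le_card_of_injective
    (fun x : B ⁻¹' D => (⟨x.1 - t ⟨B x.1, x.2⟩, ht ⟨B x.1, x.2⟩ x.1 rfl⟩, ⟨B x.1, x.2⟩)) ?_
  intro x y hxy
  simp only [Prod.mk.injEq, Subtype.mk.injEq] at hxy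
  have h2 : (⟨B x.1, x.2⟩ : D) = ⟨B y.1, y.2⟩ := Subtype.ext hxy.2
  rw [h2] at hxy
  exact Subtype.ext (sub_left_injective hxy.1)

theorem exists_indep_pairs (A : V →ₗ[F] V) {a : ℕ}
    (hA : ∀ c : F, Nat.card (LinearMap.ker (A - c • LinearMap.id)) ≤ Fintype.card F ^ a)
    (U : Submodule F V) (k : ℕ) (hU : Fintype.card F ^ (a + 2 * k) < Nat.card U) :
    ∃ x : Fin k → V, (∀ i, x i ∈ U) ∧ ∀ c d : Fin k → F,
      ∑ i, c i • x i + ∑ i, d i • A (x i) = 0 → c = 0 ∧ d = 0 := by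
  classical
  set q := Fintype.card F with hq
  have hq2 : 2 ≤ q := Fintype.one_lt_card
  induction k with
  | zero => exact ⟨Fin.elim0, fun i => i.elim0, fun c d _ => ⟨Subsingleton.elim _ _, Subsingleton.elim _ _⟩⟩
  | succ k ih =>
    obtain ⟨x, hxU, hx⟩ := ih (lt_of_le_of_lt (Nat.pow_le_pow_right (by omega) (by omega)) hU)
    let D : Set V := Set.range fun cd : (Fin k → F) × (Fin k → F) =>
      ∑ i, cd.1 i • x i + ∑ i, cd.2 i • A (x i)
    have hD : Nat.card D ≤ q ^ (2 * k) := by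
      refine (Finite.card_range_le _).trans (le_of_eq ?_)
      simp [Nat.card_prod, ← hq, ← pow_add, two_mul]
    obtain ⟨y, hyU, hyD, hyA⟩ : ∃ y ∈ U, y ∉ D ∧ ∀ c : F, (A - c • (LinearMap.id : V →ₗ[F] V)) y ∉ D := by
      by_contra! hcon
      have hsub : (U : Set V) ⊆ D ∪ ⋃ c : F, (A - c • (LinearMap.id : V →ₗ[F] V)) ⁻¹' D := by
        intro y hy
        by_cases hyD : y ∈ D
        · exact Or.inl hyD
        · obtain ⟨c, hc⟩ := hcon y hy hyD
          exact Or.inr (Set.mem_iUnion.2 ⟨c, hc⟩)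
      have h1 : Nat.card U ≤ q ^ (2 * k) + q * (q ^ a * q ^ (2 * k)) := by
        have h2 : (U : Set V).ncard ≤ D.ncard + ∑ c : F, ((A - c • (LinearMap.id : V →ₗ[F] V)) ⁻¹' D).ncard := by
          refine (Set.ncard_le_ncard hsub (Set.toFinite _)).trans ?_
          refine (Set.ncard_union_le _ _).trans ?_
          gcongr
          have := Set.ncard_iUnion_le_of_fintype (fun c : F => (A - c • (LinearMap.id : V →ₗ[F] V)) ⁻¹' D)
          exact this
        refine h2.trans ?_
        refine add_le_add hD ?_
        rw [hq, ← card_univ, ← smul_eq_mul, ← sum_const]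
        refine sum_le_sum fun c _ => ?_
        exact (card_preimage_le _ _).trans (Nat.mul_le_mul (hA c) hD)
      have h3 : q ^ (2 * k) + q * (q ^ a * q ^ (2 * k)) ≤ q ^ (a + 2 * (k + 1)) := by
        have : 1 ≤ q ^ a := Nat.one_le_pow _ _ (by omega)
        rw [show a + 2 * (k + 1) = a + 2 * k + 2 by ring, pow_add, pow_add]
        have h4 : q ^ (2 * k) ≤ q ^ a * q ^ (2 * k) := Nat.le_mul_of_pos_left _ (by omega)
        have h5 : 1 + q ≤ q ^ 2 := by nlinarith
        calc _ ≤ q ^ a * q ^ (2 * k) * (1 + q) := by nlinarith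
          _ ≤ _ := Nat.mul_le_mul_left _ h5
      omega
    refine ⟨Fin.cons y x, fun i => ?_, fun c d h => ?_⟩
    · refine Fin.cases ?_ ?_ i
      · simpa using hyU
      · simpa using hxU
    · rw [Fin.sum_univ_succ, Fin.sum_univ_succ] at h
      simp only [Fin.cons_zero, Fin.cons_succ] at h
      have key : ∀ s : F, s • (c 0 • y + d 0 • A y) ∈ D := by
        intro s
        refine ⟨(fun i => -s * c i.succ, fun i => -s * d i.succ), ?_⟩
        simp only [mul_smul, ← smul_sum]
        rw [← smul_add, neg_smul, ← smul_neg]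
        congr 1
        rw [neg_eq_iff_add_eq_zero, ← h]; abel
      have hd : d 0 = 0 := by
        by_contra hd
        apply hyA (-(c 0 / d 0))
        have := key (d 0)⁻¹
        rw [smul_add, smul_smul, smul_smul, inv_mul_cancel₀ hd, one_smul] at this
        convert this using 1
        simp only [LinearMap.sub_apply, LinearMap.smul_apply, LinearMap.id_apply, neg_smul,
          sub_neg_eq_add]
        rw [add_comm, div_eq_inv_mul]
        rfl
      have hc : c 0 = 0 := by
        by_contra hc
        apply hyD
        have := key (c 0)⁻¹
        rw [hd, zero_smul, add_zero, smul_smul, inv_mul_cancel₀ hc, one_smul] at this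
        exact this
      rw [hc, hd, zero_smul, zero_smul, zero_add, zero_add] at h
      obtain ⟨h1, h2⟩ := hx (fun i => c i.succ) (fun i => d i.succ) h
      constructor
      · funext i; exact Fin.cases hc (fun i => congrFun h1 i) i
      · funext i; exact Fin.cases hd (fun i => congrFun h2 i) i

end Greedy

section Elementary

variable {F V : Type*} [Field F] [AddCommGroup V] [Module F V]
variable {K : Type*} [Field K] [Algebra F K] {M : Type*} [AddCommGroup M] [Module F M]
  [Module K M] [IsScalarTower F K M]

/-- The elementary automorphism `1 + ι γ π`. -/
def elemEquiv (ι : M →ₗ[F] V) (π : V →ₗ[F] M) (h : ∀ s, π (ι s) = 0) (γ : K) : V ≃ₗ[F] V where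
  toFun v := v + ι (γ • π v)
  map_add' v w := by simp only [map_add, smul_add]; abel
  map_smul' c v := by
    simp only [map_smul, RingHom.id_apply, smul_add]
    rw [smul_comm γ c, map_smul]
  invFun v := v + ι ((-γ) • π v)
  left_inv v := by simp [h]
  right_inv v := by simp [h]

/-- The elementary automorphisms form a homomorphic image of the additive group. -/
def elemHom (ι : M →ₗ[F] V) (π : V →ₗ[F] M) (h : ∀ s, π (ι s) = 0) :
    Multiplicative K →* (V ≃ₗ[F] V) where
  toFun γ := elemEquiv ι π h γ.toAdd
  map_one' := by ext v; simp [elemEquiv]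
  map_mul' γ δ := by
    ext v
    simp only [elemEquiv, toAdd_mul, LinearEquiv.mul_apply, LinearEquiv.coe_mk, LinearMap.coe_mk,
      AddHom.coe_mk, map_add, h, add_zero, add_smul, smul_zero, map_zero]
    abel

theorem elemHom_apply (ι : M →ₗ[F] V) (π : V →ₗ[F] M) (h : ∀ s, π (ι s) = 0) (γ : K) (v : V) :
    elemHom ι π h (Multiplicative.ofAdd γ) v = v + ι (γ • π v) := rfl

theorem elemHom_inv_apply (ι : M →ₗ[F] V) (π : V →ₗ[F] M) (h : ∀ s, π (ι s) = 0) (γ : K) (v : V) :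
    (elemHom ι π h (Multiplicative.ofAdd γ))⁻¹ v = v - ι (γ • π v) := by
  rw [← map_inv, ← ofAdd_neg, elemHom_apply]; simp [sub_eq_add_neg]

end Elementary

section Generic

variable {F V : Type*} [Field F] [Fintype F] [AddCommGroup V] [Module F V] [Fintype V]

theorem exists_generic_pair (g : V ≃ₗ[F] V) {a : ℕ}
    (hg : ∀ c : F, Nat.card (LinearMap.ker ((g : V →ₗ[F] V) - c • LinearMap.id)) ≤
      Fintype.card F ^ a) (hn : 6 * a < finrank F V)
    {K : Type*} [AddCommGroup K] [Module F K] (J : (Fin a → F) ≃ₗ[F] K) :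
    ∃ (ι : K →ₗ[F] V) (π : V →ₗ[F] K), (∀ s, π (ι s) = 0) ∧ (∀ s, π (g (ι s)) = 0) ∧
      (∀ s, π (g⁻¹ (ι s)) = 0) ∧ (∀ s s', g (ι s) = ι s' → s = 0 ∧ s' = 0) ∧
      ∀ s s', ∃ v, π (g⁻¹ v) = s ∧ π v = s' := by
  classical
  set q := Fintype.card F with hq
  have hq2 : 2 ≤ q := Fintype.one_lt_card
  have hcard : ∀ (W : Submodule F V), Nat.card W = q ^ finrank F W := fun W => by
    rw [Module.natCard_eq_pow_finrank (K := F), Nat.card_eq_fintype_card]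
  have hcard' : ∀ (W : Submodule F (Dual F V)), Nat.card W = q ^ finrank F W := fun W => by
    rw [Module.natCard_eq_pow_finrank (K := F), Nat.card_eq_fintype_card]
  obtain ⟨x, -, hx⟩ := exists_indep_pairs (g : V →ₗ[F] V) hg ⊤ a (by
    rw [hcard, finrank_top]; exact Nat.pow_lt_pow_right (by omega) (by omega))
  -- covectors
  let T : Dual F V →ₗ[F] (Fin a → F) × (Fin a → F) × (Fin a → F) :=
    { toFun := fun φ => (fun i => φ (x i), fun i => φ (g (x i)), fun i => φ (g⁻¹ (x i)))
      map_add' := fun φ ψ => rfl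
      map_smul' := fun c φ => rfl }
  have hT : finrank F V ≤ 3 * a + finrank F (LinearMap.ker T) := by
    have h1 := LinearMap.finrank_range_add_finrank_ker T
    have h2 := Submodule.finrank_le (LinearMap.range T)
    rw [Subspace.dual_finrank_eq] at h1
    simp only [finrank_prod, finrank_fin_fun] at h2
    omega
  let B : V →ₗ[F] V := ((g⁻¹ : V ≃ₗ[F] V) : V →ₗ[F] V)
  have hker : ∀ c : F, finrank F (LinearMap.ker (B - c • LinearMap.id)) ≤ a := by
    intro c
    by_cases hc : c = 0
    · have : LinearMap.ker (B - c • LinearMap.id) = ⊥ := by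
        rw [hc, zero_smul, sub_zero]; exact LinearEquiv.ker _
      rw [this]; simp
    · have hle : LinearMap.ker (B - c • LinearMap.id) ≤
          LinearMap.ker ((g : V →ₗ[F] V) - c⁻¹ • LinearMap.id) := by
        intro v hv
        rw [LinearMap.mem_ker, LinearMap.sub_apply, sub_eq_zero] at hv ⊢
        have hv' : g⁻¹ v = c • v := hv
        have h2 := congrArg g hv'
        rw [map_smul] at h2
        have h3 : g (g⁻¹ v) = v := g.apply_symm_apply v
        rw [h3] at h2
        change g v = c⁻¹ • v
        conv_rhs => rw [h2]
        rw [smul_smul, inv_mul_cancel₀ hc, one_smul]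
      refine (Submodule.finrank_mono hle).trans ?_
      have := hg c⁻¹
      rw [hcard] at this
      exact (Nat.pow_le_pow_iff_right (by omega)).1 this
  have hBd : ∀ c : F, Nat.card (LinearMap.ker (B.dualMap - c • LinearMap.id)) ≤ q ^ a := by
    intro c
    have e : B.dualMap - c • LinearMap.id = (B - c • LinearMap.id).dualMap := by
      ext φ v; simp [LinearMap.dualMap_apply]
    rw [e, hcard']
    refine Nat.pow_le_pow_right (by omega) ((le_of_eq ?_).trans (hker c))
    have h1 := LinearMap.finrank_range_add_finrank_ker (B - c • LinearMap.id)
    have h2 := LinearMap.finrank_range_add_finrank_ker (B - c • LinearMap.id).dualMap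
    rw [LinearMap.finrank_range_dualMap_eq_finrank_range, Subspace.dual_finrank_eq] at h2
    omega
  obtain ⟨φ, hφU, hφ⟩ := exists_indep_pairs B.dualMap hBd (LinearMap.ker T) a (by
    rw [hcard']; exact Nat.pow_lt_pow_right (by omega) (by omega))
  let ι : K →ₗ[F] V := (Fintype.linearCombination F x) ∘ₗ J.symm.toLinearMap
  let π : V →ₗ[F] K := J.toLinearMap ∘ₗ LinearMap.pi φ
  have hι : ∀ s, ι s = ∑ i, J.symm s i • x i := fun s => rfl
  have hφ0 : ∀ i j, φ i (x j) = 0 ∧ φ i (g (x j)) = 0 ∧ φ i (g⁻¹ (x j)) = 0 := by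
    intro i j
    have h := hφU i
    rw [LinearMap.mem_ker] at h
    simp only [T, LinearMap.coe_mk, AddHom.coe_mk, Prod.mk_eq_zero] at h
    exact ⟨congrFun h.1 j, congrFun h.2.1 j, congrFun h.2.2 j⟩
  have hπ0 : ∀ v, (∀ i, φ i v = 0) → π v = 0 := by
    intro v hv
    have : LinearMap.pi φ v = 0 := funext hv
    simp only [π, LinearMap.comp_apply, this, map_zero]
  refine ⟨ι, π, fun s => hπ0 _ fun i => ?_, fun s => hπ0 _ fun i => ?_, fun s => hπ0 _ fun i => ?_,
    fun s s' h => ?_, ?_⟩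
  · rw [hι]; simp [hφ0]
  · rw [hι]; simp [hφ0]
  · rw [hι, map_sum, map_sum]
    exact sum_eq_zero fun j _ => by rw [map_smul, map_smul, (hφ0 i j).2.2, smul_zero]
  · have h1 := hx (-(J.symm s')) (J.symm s) (by
      rw [hι, hι, map_sum] at h
      simp only [map_smul] at h
      simp only [Pi.neg_apply, neg_smul, sum_neg_distrib]
      rw [neg_add_eq_zero, ← h]; rfl)
    exact ⟨by simpa using h1.2, by simpa using h1.1⟩
  · let Θ : V →ₗ[F] (Fin a → F) × (Fin a → F) :=
      LinearMap.prod (LinearMap.pi φ ∘ₗ B) (LinearMap.pi φ)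
    have hΘ : LinearMap.range Θ = ⊤ := by
      by_contra hne
      obtain ⟨ξ, hξ0, hξ⟩ := Submodule.exists_le_ker_of_lt_top _ (lt_top_iff_ne_top.2 hne)
      let d : Fin a → F := fun i => ξ (Pi.single i 1, 0)
      let c : Fin a → F := fun i => ξ (0, Pi.single i 1)
      have hξe : ∀ u v, ξ (u, v) = ∑ i, u i * d i + ∑ i, v i * c i := by
        intro u v
        have e1 : (u, v) = LinearMap.inl F (Fin a → F) (Fin a → F) u +
          LinearMap.inr F (Fin a → F) (Fin a → F) v := by simp
        rw [e1, map_add]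
        congr 1
        · rw [← LinearMap.comp_apply, LinearMap.pi_apply_eq_sum_univ]
          simp [d]
          exact sum_congr rfl fun i _ => by congr 3; funext j; simp [Pi.single_apply, eq_comm]
        · rw [← LinearMap.comp_apply, LinearMap.pi_apply_eq_sum_univ]
          simp [c]
          exact sum_congr rfl fun i _ => by congr 3; funext j; simp [Pi.single_apply, eq_comm]
      have h1 := hφ c d (by
        ext v
        have h2 : ξ (Θ v) = 0 := hξ ⟨v, rfl⟩
        have h3 : Θ v = (fun i => φ i (B v), fun i => φ i v) := rfl
        rw [h3, hξe] at h2
        simp only [LinearMap.add_apply, LinearMap.sum_apply, LinearMap.smul_apply, smul_eq_mul,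
          LinearMap.zero_apply, LinearMap.dualMap_apply]
        rw [← h2, add_comm]
        simp only [mul_comm])
      apply hξ0
      ext1
      · ext i
        have := congrFun h1.2 i
        simpa [d] using this
      · ext i
        have := congrFun h1.1 i
        simpa [c] using this
    intro s s'
    obtain ⟨v, hv⟩ := LinearMap.range_eq_top.1 hΘ (J.symm s, J.symm s')
    refine ⟨v, ?_, ?_⟩
    · have h1 : LinearMap.pi φ (B v) = J.symm s := congrArg Prod.fst hv
      change J (LinearMap.pi φ (B v)) = s
      rw [h1]; simp
    · have h1 : LinearMap.pi φ v = J.symm s' := congrArg Prod.snd hv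
      change J (LinearMap.pi φ v) = s'
      rw [h1]; simp

/-- For generic `g`, the autocorrelation is controlled by square-zero unipotents. -/
theorem corr_sq_le_of_generic {f : (V ≃ₗ[F] V) → ℝ} (hf : IsClassFun f) {g : V ≃ₗ[F] V} {a : ℕ}
    (hg : ∀ c : F, Nat.card (LinearMap.ker ((g : V →ₗ[F] V) - c • LinearMap.id)) ≤
      Fintype.card F ^ a) (hn : 6 * a < finrank F V)
    {K : Type*} [Field K] [Algebra F K] [Fintype K] (hK : finrank F K = a)
    {r : ℝ} (hr : 0 ≤ r) (hu : ∀ t : V ≃ₗ[F] V, IsUnip (2 * a) t → |corr f t| ≤ r * corr f 1) :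
    corr f g ^ 2 ≤ (1 / (Fintype.card F : ℝ) ^ a + r) * corr f 1 ^ 2 := by
  classical
  let J : (Fin a → F) ≃ₗ[F] K := LinearEquiv.ofFinrankEq _ _ (by simp [hK])
  obtain ⟨ι, π, h1, h2, h3, h4, h5⟩ := exists_generic_pair g hg hn J
  have hcK : (Fintype.card K : ℝ) = (Fintype.card F : ℝ) ^ a := by
    rw [Module.card_eq_pow_finrank (K := F), hK]; push_cast; rfl
  have key := corr_sq_le_of_bad hf (elemHom (K := K) ι π h1) g {0} hr (fun γ hγ => by
    have hγ0 : γ ≠ 0 := by simpa using hγ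
    apply hu
    let A : K →ₗ[F] V := (g : V →ₗ[F] V) ∘ₗ ι
    let mγ : K →ₗ[F] K := LinearMap.mulLeft F γ
    let N : V →ₗ[F] V := (A ∘ₗ mγ ∘ₗ π ∘ₗ ((g⁻¹ : V ≃ₗ[F] V) : V →ₗ[F] V)) - (ι ∘ₗ mγ ∘ₗ π)
    have hNa : ∀ v, N v = g (ι (γ * π (g⁻¹ v))) - ι (γ * π v) := fun v => rfl
    have hgg : ∀ v, g⁻¹ (g v) = v := fun v => g.symm_apply_apply v
    have hgg' : ∀ v, g (g⁻¹ v) = v := fun v => g.apply_symm_apply v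
    refine ⟨N, fun v => ?_, ?_, fun v => ?_⟩
    · rw [hNa (N v), hNa v]
      simp only [map_sub, hgg, h1, h2, h3, sub_self, mul_zero, map_zero]
    · let Θ : K × K →ₗ[F] V := LinearMap.coprod A (-ι)
      have hΘ : Function.Injective Θ := by
        rw [← LinearMap.ker_eq_bot, LinearMap.ker_eq_bot']
        rintro ⟨s, s'⟩ h
        have h' : g (ι s) + -(ι s') = 0 := h
        obtain ⟨e1, e2⟩ := h4 s s' (by rwa [← sub_eq_add_neg, sub_eq_zero] at h')
        rw [e1, e2]; rfl
      have hr : LinearMap.range N = LinearMap.range Θ := by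
        apply le_antisymm
        · rintro _ ⟨v, rfl⟩
          refine ⟨(γ * π (g⁻¹ v), γ * π v), ?_⟩
          rw [hNa, sub_eq_add_neg]; rfl
        · rintro _ ⟨⟨s, s'⟩, rfl⟩
          obtain ⟨v, hv1, hv2⟩ := h5 (γ⁻¹ * s) (γ⁻¹ * s')
          refine ⟨v, ?_⟩
          rw [hNa, hv1, hv2, ← mul_assoc, ← mul_assoc, mul_inv_cancel₀ hγ0, one_mul, one_mul,
            sub_eq_add_neg]
          rfl
      haveI : FiniteDimensional F K := FiniteDimensional.of_injective J.symm.toLinearMap J.symm.injective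
      rw [hr, LinearMap.finrank_range_of_inj hΘ, finrank_prod, hK]; ring
    · simp only [LinearEquiv.mul_apply, elemHom_apply, elemHom_inv_apply, hNa, smul_eq_mul, map_sub,
        map_add, hgg', h3, mul_zero, map_zero, sub_zero]
      abel)
  rw [hcK] at key
  simpa using key

end Generic

section Transport

variable {F V W : Type*} [Field F] [AddCommGroup V] [Module F V] [AddCommGroup W] [Module F W]

/-- Conjugation by a linear equivalence. -/
def conjMul (e : W ≃ₗ[F] V) : (W ≃ₗ[F] W) ≃* (V ≃ₗ[F] V) where
  toFun h := (e.symm.trans h).trans e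
  invFun h := (e.trans h).trans e.symm
  left_inv h := by ext; simp
  right_inv h := by ext; simp
  map_mul' g h := by ext; simp

theorem conjMul_apply (e : W ≃ₗ[F] V) (h : W ≃ₗ[F] W) (v : V) :
    conjMul e h v = e (h (e.symm v)) := rfl

theorem IsUnip.conjMul {b : ℕ} {h : W ≃ₗ[F] W} (hh : IsUnip b h) (e : W ≃ₗ[F] V) :
    IsUnip b (conjMul e h) := by
  obtain ⟨N, hN, hb, hhN⟩ := hh
  refine ⟨e.toLinearMap ∘ₗ N ∘ₗ e.symm.toLinearMap, fun v => by simp [hN], ?_, fun v => by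
    simp [conjMul_apply, hhN]⟩
  rw [LinearMap.range_comp, LinearMap.range_comp_of_range_eq_top _ (LinearEquiv.range _)]
  rw [LinearEquiv.finrank_map_eq, hb]

theorem IsClassFun.comp {Γ Δ : Type*} [Group Γ] [Group Δ] {f : Γ → ℝ} (hf : IsClassFun f)
    (c : Δ ≃* Γ) : IsClassFun (f ∘ c) := fun h z => by
  simp only [Function.comp_apply, map_mul, map_inv, hf _ _]

theorem corr_comp {Γ Δ : Type*} [Group Γ] [Group Δ] [Fintype Γ] [Fintype Δ] (f : Γ → ℝ)
    (c : Δ ≃* Γ) (g : Δ) : corr (f ∘ c) g = corr f (c g) := by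
  unfold corr
  rw [← Equiv.sum_comp c.toEquiv]
  simp

end Transport

section Block

variable {F K C : Type*} [Field F] [Field K] [Algebra F K] [AddCommGroup C] [Module F C]

/-- The upper unipotent element of the block group. -/
def blockUp (F K C : Type*) [Field F] [Field K] [Algebra F K] [AddCommGroup C] [Module F C] :
    Multiplicative K →* ((K × K × C) ≃ₗ[F] (K × K × C)) :=
  elemHom (LinearMap.inl F K (K × C)) (LinearMap.fst F K C ∘ₗ LinearMap.snd F K (K × C))
    (fun s => by simp)

/-- The lower unipotent element of the block group. -/
def blockLow (F K C : Type*) [Field F] [Field K] [Algebra F K] [AddCommGroup C] [Module F C] :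
    Multiplicative K →* ((K × K × C) ≃ₗ[F] (K × K × C)) :=
  elemHom (LinearMap.inr F K (K × C) ∘ₗ LinearMap.inl F K C) (LinearMap.fst F K (K × C))
    (fun s => by simp)

/-- The commutator of opposite unipotents. -/
def blockComm (F : Type*) {K : Type*} (C : Type*) [Field F] [Field K] [Algebra F K]
    [AddCommGroup C] [Module F C] (β : K) : (K × K × C) ≃ₗ[F] (K × K × C) :=
  blockUp F K C (Multiplicative.ofAdd 1) * blockLow F K C (Multiplicative.ofAdd β) *
    (blockUp F K C (Multiplicative.ofAdd 1))⁻¹ * (blockLow F K C (Multiplicative.ofAdd β))⁻¹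

theorem blockUp_apply (x y : K) (z : C) (β : K) :
    blockUp F K C (Multiplicative.ofAdd β) (x, y, z) = (x + β * y, y, z) := by
  exact (elemHom_apply _ _ _ _ _).trans (by simp)

theorem blockLow_apply (x y : K) (z : C) (β : K) :
    blockLow F K C (Multiplicative.ofAdd β) (x, y, z) = (x, y + β * x, z) := by
  exact (elemHom_apply _ _ _ _ _).trans (by simp)

theorem blockUp_inv_apply (x y : K) (z : C) (β : K) :
    (blockUp F K C (Multiplicative.ofAdd β))⁻¹ (x, y, z) = (x - β * y, y, z) := by
  exact (elemHom_inv_apply _ _ _ _ _).trans (by simp)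

theorem blockLow_inv_apply (x y : K) (z : C) (β : K) :
    (blockLow F K C (Multiplicative.ofAdd β))⁻¹ (x, y, z) = (x, y - β * x, z) := by
  exact (elemHom_inv_apply _ _ _ _ _).trans (by simp)

theorem blockComm_apply (β x y : K) (z : C) :
    blockComm F C β (x, y, z) = ((1 + β + β ^ 2) * x - β * y, β ^ 2 * x + (1 - β) * y, z) := by
  simp only [blockComm, LinearEquiv.mul_apply, blockUp_apply, blockLow_apply, blockUp_inv_apply,
    blockLow_inv_apply, Prod.mk.injEq]
  exact ⟨by ring, by ring, trivial⟩

theorem blockComm_inv_apply (β x y : K) (z : C) :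
    (blockComm F C β)⁻¹ (x, y, z) =
      ((1 - β) * x + β * y, -β ^ 2 * x + (1 + β + β ^ 2) * y, z) := by
  have : blockComm F C β ((1 - β) * x + β * y, -β ^ 2 * x + (1 + β + β ^ 2) * y, z) = (x, y, z) := by
    rw [blockComm_apply, Prod.mk.injEq, Prod.mk.injEq]
    exact ⟨by ring, by ring, rfl⟩
  rw [← this]
  exact (blockComm F C β).symm_apply_apply _

theorem isUnip_blockUp [FiniteDimensional F K] :
    IsUnip (finrank F K) (blockUp F K C (Multiplicative.ofAdd 1)) := by
  refine ⟨LinearMap.inl F K (K × C) ∘ₗ LinearMap.fst F K C ∘ₗ LinearMap.snd F K (K × C),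
    fun v => by simp, ?_, fun ⟨x, y, z⟩ => by rw [blockUp_apply]; simp⟩
  rw [LinearMap.range_comp_of_range_eq_top, LinearMap.finrank_range_of_inj LinearMap.inl_injective]
  rw [LinearMap.range_eq_top]
  intro y
  exact ⟨(0, y, 0), rfl⟩

variable [Fintype F] [Fintype K] [Fintype C]

theorem corr_blockUp_sq_le {f : ((K × K × C) ≃ₗ[F] (K × K × C)) → ℝ} (hf : IsClassFun f)
    (B : Finset K) {r : ℝ} (hr : 0 ≤ r)
    (hu : ∀ β ∉ B, |corr f (blockComm F C β)| ≤ r * corr f 1) :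
    corr f (blockUp F K C (Multiplicative.ofAdd 1)) ^ 2 ≤
      (#B / (Fintype.card F : ℝ) ^ finrank F K + r) * corr f 1 ^ 2 := by
  have := corr_sq_le_of_bad hf (blockLow F K C) (blockUp F K C (Multiplicative.ofAdd 1)) B hr hu
  rwa [Module.card_eq_pow_finrank (K := F), Nat.cast_pow] at this

theorem corr_blockComm_sq_le {C' : Type*} [AddCommGroup C'] [Module F C'] [Fintype C']
    {f : ((K × K × (K × K × C')) ≃ₗ[F] (K × K × (K × K × C'))) → ℝ} (hf : IsClassFun f)
    {β : K} (hβ : β ≠ 0) {r : ℝ} (hr : 0 ≤ r)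
    (hu : ∀ t, IsUnip (2 * finrank F K) t → |corr f t| ≤ r * corr f 1) :
    corr f (blockComm F (K × K × C') β) ^ 2 ≤
      (1 / (Fintype.card F : ℝ) ^ finrank F K + r) * corr f 1 ^ 2 := by
  classical
  let ι : K × K →ₗ[F] (K × K × (K × K × C')) :=
    { toFun := fun s => (s.1, s.2, 0)
      map_add' := fun s t => by simp
      map_smul' := fun c s => by simp }
  let π : (K × K × (K × K × C')) →ₗ[F] K × K :=
    { toFun := fun v => (v.2.2.1, v.2.2.2.1)
      map_add' := fun s t => rfl
      map_smul' := fun c s => rfl }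
  have h0 : ∀ s, π (ι s) = 0 := fun s => rfl
  have key := corr_sq_le_of_bad hf (elemHom (K := K) ι π h0) (blockComm F (K × K × C') β) {0} hr
    (fun γ hγ => by
      have hγ0 : γ ≠ 0 := by simpa using hγ
      apply hu
      let D : K × K →ₗ[F] K × K :=
        { toFun := fun s => (γ * ((β + β ^ 2) * s.1 - β * s.2), γ * (β ^ 2 * s.1 - β * s.2))
          map_add' := fun s t => by ext <;> simp <;> ring
          map_smul' := fun c s => by ext <;> simp [Algebra.smul_def] <;> ring }
      have hD : LinearMap.ker D = ⊥ := by
        rw [LinearMap.ker_eq_bot']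
        rintro ⟨x, y⟩ h
        have e1 : γ * ((β + β ^ 2) * x - β * y) = 0 := congrArg Prod.fst h
        have e2 : γ * (β ^ 2 * x - β * y) = 0 := congrArg Prod.snd h
        have e3 : γ * β * x = 0 := by linear_combination e1 - e2
        have hx : x = 0 := by simpa [hγ0, hβ] using e3
        subst hx
        have hy : y = 0 := by simpa [hγ0, hβ] using e2
        rw [hy]; rfl
      have hDs : LinearMap.range D = ⊤ := LinearMap.ker_eq_bot_iff_range_eq_top.1 hD
      have hπ : LinearMap.range π = ⊤ := by
        rw [LinearMap.range_eq_top]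
        rintro ⟨x, y⟩
        exact ⟨(0, 0, x, y, 0), rfl⟩
      have hι : Function.Injective ι := by
        rintro ⟨x, y⟩ ⟨x', y'⟩ h
        simp only [ι, LinearMap.coe_mk, AddHom.coe_mk, Prod.mk.injEq] at h
        rw [h.1, h.2.1]
      refine ⟨ι ∘ₗ D ∘ₗ π, fun v => ?_, ?_, ?_⟩
      · simp [h0]
      · rw [LinearMap.range_comp_of_range_eq_top]
        · rw [LinearMap.finrank_range_of_inj hι, finrank_prod]; ring
        · rw [LinearMap.range_comp_of_range_eq_top _ hπ, hDs]
      · rintro ⟨x, y, z⟩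
        rw [LinearEquiv.mul_apply, LinearEquiv.mul_apply, LinearEquiv.mul_apply, elemHom_inv_apply]
        have e1 : (x, y, z) - ι (γ • π (x, y, z)) = (x - γ * z.1, y - γ * z.2.1, z) := by
          simp [ι, π]
        rw [e1, blockComm_inv_apply, elemHom_apply]
        have e2 : ∀ a b : K, (a, b, z) + ι (γ • π (a, b, z)) = (a + γ * z.1, b + γ * z.2.1, z) := by
          intro a b; simp [ι, π]
        rw [e2, blockComm_apply]
        simp only [LinearMap.comp_apply, ι, D, π, LinearMap.coe_mk, AddHom.coe_mk, Prod.mk_add_mk,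
          add_zero, Prod.mk.injEq]
        exact ⟨by ring, by ring, trivial⟩)
  rw [Module.card_eq_pow_finrank (K := F) (V := K), Nat.cast_pow] at key
  simpa using key

theorem card_centralizer_blockComm_le (e : ℕ) {β : K} (hβ : β ≠ 0)
    (hgen : Algebra.adjoin F {β ^ 2} = ⊤) :
    Nat.card {h : (K × K × (Fin e → F)) ≃ₗ[F] (K × K × (Fin e → F)) //
        h * blockComm F (Fin e → F) β = blockComm F (Fin e → F) β * h} ≤
      Fintype.card F ^ (2 * finrank F K + e + e * e) := by
  classical
  have hwapp := blockComm_apply (F := F) (C := Fin e → F) β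
  have hwinv := blockComm_inv_apply (F := F) (C := Fin e → F) β
  generalize blockComm F (Fin e → F) β = w at *
  have hfix : ∀ (x y : K) (z : Fin e → F), w (x, y, z) = (x, y, z) → x = 0 ∧ y = 0 := by
    intro x y z h
    rw [hwapp, Prod.mk.injEq, Prod.mk.injEq] at h
    have e1 : β * x = 0 := by linear_combination h.1 - h.2.1
    have hx : x = 0 := by simpa [hβ] using e1
    subst hx
    have e2 : β * y = 0 := by linear_combination -h.1
    exact ⟨rfl, by simpa [hβ] using e2⟩
  let Z := {h : (K × K × (Fin e → F)) ≃ₗ[F] (K × K × (Fin e → F)) // h * w = w * h}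
  let ev : Z → (K × K × (Fin e → F)) × (Fin e → (Fin e → F)) :=
    fun h => (h.1 (1, 0, 0), fun i => (h.1 (0, 0, Pi.single i 1)).2.2)
  have hinj : Function.Injective ev := by
    intro h h' heq
    have e0 : h.1 (1, 0, 0) = h'.1 (1, 0, 0) := congrArg Prod.fst heq
    have comm : ∀ (h : Z) v, h.1 (w v) = w (h.1 v) := fun h v =>
      congrArg (fun g : (K × K × (Fin e → F)) ≃ₗ[F] (K × K × (Fin e → F)) => g v) h.2
    have comm' : ∀ (h : Z) v, h.1 (w⁻¹ v) = w⁻¹ (h.1 v) := by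
      intro h v
      have h1 := comm h (w⁻¹ v)
      have h2 : w (w⁻¹ v) = v := w.apply_symm_apply v
      rw [h2] at h1
      rw [h1]
      exact (w.symm_apply_apply _).symm
    let M : Submodule F (K × K × (Fin e → F)) := LinearMap.eqLocus h.1.toLinearMap h'.1.toLinearMap
    have hM : ∀ v, v ∈ M ↔ h.1 v = h'.1 v := fun v => Iff.rfl
    have hMw : ∀ v ∈ M, w v ∈ M := fun v hv => by
      rw [hM] at hv ⊢; rw [comm, comm, hv]
    have hMw' : ∀ v ∈ M, w⁻¹ v ∈ M := fun v hv => by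
      rw [hM] at hv ⊢; rw [comm', comm', hv]
    have hz : ∀ z, ((0, 0, z) : K × K × (Fin e → F)) ∈ M := by
      have hz1 : ∀ i, ((0, 0, Pi.single i 1) : K × K × (Fin e → F)) ∈ M := by
        intro i
        rw [hM]
        have hf : ∀ h : Z, (h.1 (0, 0, Pi.single i 1)).1 = 0 ∧ (h.1 (0, 0, Pi.single i 1)).2.1 = 0 := by
          intro h
          apply hfix _ _ (h.1 (0, 0, Pi.single i 1)).2.2
          change w (h.1 (0, 0, Pi.single i 1)) = h.1 (0, 0, Pi.single i 1)
          rw [← comm, hwapp]; simp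
        have h3 : (h.1 (0, 0, Pi.single i 1)).2.2 = (h'.1 (0, 0, Pi.single i 1)).2.2 :=
          congrFun (congrArg Prod.snd heq) i
        exact Prod.ext ((hf h).1.trans (hf h').1.symm)
          (Prod.ext ((hf h).2.trans (hf h').2.symm) h3)
      intro z
      have : ((0, 0, z) : K × K × (Fin e → F)) = ∑ i, z i • (0, 0, Pi.single i 1) := by
        refine Prod.ext ?_ (Prod.ext ?_ ?_)
        · simp [Prod.fst_sum]
        · simp [Prod.fst_sum, Prod.snd_sum]
        · simp only [Prod.snd_sum, Prod.smul_snd]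
          ext j; simp [Finset.sum_apply, Pi.single_apply]
      rw [this]
      exact M.sum_mem fun i _ => M.smul_mem _ (hz1 i)
    have hsc : ∀ s : K, ∀ x y, ((x, y, 0) : K × K × (Fin e → F)) ∈ M →
        ((s * x, s * y, 0) : K × K × (Fin e → F)) ∈ M := by
      intro s
      have hs : s ∈ Algebra.adjoin F {β ^ 2} := by rw [hgen]; trivial
      refine Algebra.adjoin_induction ?_ ?_ ?_ ?_ hs
      · rintro _ rfl x y hxy
        have h1 := M.sub_mem (M.add_mem (hMw _ hxy) (hMw' _ hxy)) (M.add_mem hxy hxy)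
        rw [hwapp, hwinv] at h1
        convert h1 using 1
        simp only [Prod.mk_add_mk, Prod.mk_sub_mk, Prod.mk.injEq]
        exact ⟨by ring, by ring, by simp⟩
      · intro r x y hxy
        have := M.smul_mem r hxy
        simpa [Algebra.smul_def] using this
      · intro s t _ _ hs ht x y hxy
        have := M.add_mem (hs x y hxy) (ht x y hxy)
        simpa [add_mul] using this
      · intro s t _ _ hs ht x y hxy
        have := hs _ _ (ht x y hxy)
        simpa [mul_assoc] using this
    have hx : ∀ x, ((x, 0, 0) : K × K × (Fin e → F)) ∈ M := fun x => by
      have := hsc x 1 0 ((hM _).2 e0)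
      simpa using this
    have hy : ∀ y, ((0, y, 0) : K × K × (Fin e → F)) ∈ M := fun y => by
      have h1 := hMw _ (hx 1)
      rw [hwapp] at h1
      have h2 := M.sub_mem h1 (hx ((1 + β + β ^ 2) * 1 - β * 0))
      have h3 := hsc (y * (β ^ 2)⁻¹) 0 (β ^ 2) (by simpa using h2)
      simpa [hβ] using h3
    apply Subtype.ext
    ext1 ⟨x, y, z⟩
    have h4 := M.add_mem (M.add_mem (hx x) (hy y)) (hz z)
    rw [hM] at h4
    simpa using h4
  have := Nat.card_le_card_of_injective ev hinj
  refine this.trans (le_of_eq ?_)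
  rw [Nat.card_eq_fintype_card, Fintype.card_prod, Fintype.card_prod, Fintype.card_prod,
    Module.card_eq_pow_finrank (K := F) (V := K)]
  simp only [Fintype.card_pi, prod_const, card_univ, Fintype.card_fin]
  ring

end Block

theorem exists_extension (F : Type*) [Field F] [Fintype F] {b : ℕ} (hb : b ≠ 0) :
    ∃ (K : Type) (_ : Field K) (_ : Algebra F K) (_ : Fintype K), finrank F K = b := by
  obtain ⟨p, hp⟩ := CharP.exists F
  have : Fact p.Prime := ⟨(CharP.char_is_prime_or_zero F p).resolve_right (by
    rintro rfl
    have := CharP.charP_to_charZero F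
    exact not_finite F)⟩
  have : NeZero b := ⟨hb⟩
  exact ⟨FiniteField.Extension F p b, inferInstance, inferInstance, Fintype.ofFinite _,
    FiniteField.finrank_extension F p b⟩

section Adjoin

variable {F K : Type*} [Field F] [Fintype F] [Field K] [Algebra F K] [Fintype K]

theorem exists_pow_eq_of_adjoin_ne_top {θ : K} (h : Algebra.adjoin F {θ} ≠ ⊤) :
    ∃ d, 1 ≤ d ∧ d ≤ finrank F K / 2 ∧ θ ^ Fintype.card F ^ d = θ := by
  classical
  have hθint : IsIntegral F θ := Algebra.IsIntegral.isIntegral θ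
  let L := IntermediateField.adjoin F {θ}
  have hL : L ≠ ⊤ := by
    intro hL
    apply h
    have := IntermediateField.adjoin_simple_toSubalgebra_of_isAlgebraic hθint.isAlgebraic
    rw [← this]
    change L.toSubalgebra = ⊤
    rw [hL]; rfl
  have hpos : 0 < finrank F L := finrank_pos
  have hmul : finrank F L * finrank L K = finrank F K := finrank_mul_finrank F L K
  have h2 : finrank L K ≠ 1 := fun h1 => hL (IntermediateField.finrank_eq_one_iff_eq_top.1 h1)
  have h3 : 0 < finrank L K := finrank_pos
  refine ⟨finrank F L, hpos, ?_, ?_⟩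
  · rw [Nat.le_div_iff_mul_le two_pos, ← hmul]
    exact Nat.mul_le_mul_left _ (by omega)
  · have h4 := FiniteField.pow_card (⟨θ, IntermediateField.mem_adjoin_simple_self F θ⟩ : L)
    rw [Module.card_eq_pow_finrank (K := F)] at h4
    exact congrArg Subtype.val h4

open Classical in
theorem card_bad_le (hK : 2 ≤ finrank F K) :
    #{β : K | β = 0 ∨ Algebra.adjoin F {β ^ 2} ≠ ⊤} ≤ 4 * Fintype.card F ^ (finrank F K / 2) := by
  have hq : 2 ≤ Fintype.card F := Fintype.one_lt_card
  set q := Fintype.card F with hqd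
  set b := finrank F K / 2 with hb
  have hb1 : 1 ≤ b := by omega
  let P : ℕ → Polynomial K := fun d => Polynomial.X ^ (2 * q ^ d) - Polynomial.X ^ 2
  have hdeg : ∀ d, 1 ≤ d → (P d).natDegree = 2 * q ^ d := by
    intro d hd
    have : 2 < 2 * q ^ d := by
      have : q ^ 1 ≤ q ^ d := Nat.pow_le_pow_right (by omega) hd
      rw [pow_one] at this
      omega
    simp only [P]
    rw [Polynomial.natDegree_sub_eq_left_of_natDegree_lt] <;> simp [this]
  have hsub : ({β : K | β = 0 ∨ Algebra.adjoin F {β ^ 2} ≠ ⊤} : Finset K) ⊆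
      (Icc 1 b).biUnion fun d => (P d).roots.toFinset := by
    intro β hβ
    simp only [mem_filter, mem_univ, true_and] at hβ
    have hP : ∀ d, 1 ≤ d → P d ≠ 0 := by
      intro d hd h0
      have := hdeg d hd
      rw [h0] at this
      have : 0 < q ^ d := by positivity
      simp at *; omega
    simp only [mem_biUnion, mem_Icc, Multiset.mem_toFinset]
    rcases hβ with rfl | hβ
    · refine ⟨1, ⟨le_rfl, hb1⟩, ?_⟩
      rw [Polynomial.mem_roots (hP 1 le_rfl)]
      simp [P, Polynomial.IsRoot]; omega
    · obtain ⟨d, hd1, hd2, hd⟩ := exists_pow_eq_of_adjoin_ne_top hβ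
      refine ⟨d, ⟨hd1, hd2⟩, ?_⟩
      rw [Polynomial.mem_roots (hP d hd1)]
      simp [P, Polynomial.IsRoot, pow_mul, hd, q]
  refine (card_le_card hsub).trans (card_biUnion_le.trans ?_)
  have h1 : ∀ d ∈ Icc 1 b, #(P d).roots.toFinset ≤ 2 * q ^ d := fun d hd =>
    (Multiset.toFinset_card_le _).trans ((Polynomial.card_roots' _).trans
      (hdeg d (mem_Icc.1 hd).1).le)
  refine (sum_le_sum h1).trans ?_
  clear_value b
  clear hb hsub h1
  induction b, hb1 using Nat.le_induction with
  | base => simp; omega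
  | succ m hm ih =>
    rw [sum_Icc_succ_top (by omega), pow_succ]
    nlinarith [Nat.pos_of_ne_zero (pow_ne_zero m (by omega : q ≠ 0))]

end Adjoin

section Chain

variable {F V W : Type*} [Field F] [Fintype F] [AddCommGroup V] [Module F V] [Fintype V]
  [AddCommGroup W] [Module F W] [Fintype W]

theorem corr_unip_eq {f : (V ≃ₗ[F] V) → ℝ} (hf : IsClassFun f) (e : W ≃ₗ[F] V) {b : ℕ}
    {t : V ≃ₗ[F] V} (ht : IsUnip b t) {t₀ : W ≃ₗ[F] W} (ht₀ : IsUnip b t₀) :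
    corr f t = corr (f ∘ conjMul e) t₀ := by
  rw [corr_comp]
  obtain ⟨h, hh⟩ := (ht₀.conjMul e).conj ht
  rw [hh, corr_conj hf]

theorem corr_comp_one (f : (V ≃ₗ[F] V) → ℝ) (e : W ≃ₗ[F] V) :
    corr (f ∘ conjMul e) 1 = corr f 1 := by
  rw [corr_comp, map_one]

theorem card_centralizer_conjMul (e : W ≃ₗ[F] V) (w : W ≃ₗ[F] W) :
    Nat.card {h : V ≃ₗ[F] V // h * conjMul e w = conjMul e w * h} =
      Nat.card {h : W ≃ₗ[F] W // h * w = w * h} := by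
  refine Nat.card_congr (Equiv.subtypeEquiv (conjMul e).toEquiv.symm fun h => ?_)
  obtain ⟨k, rfl⟩ := (conjMul e).surjective h
  simp only [← map_mul, (conjMul e).injective.eq_iff]
  simp

theorem abs_le_of_sq_le {x y c r : ℝ} (h : x ^ 2 ≤ c * y ^ 2) (hc : c ≤ r ^ 2) (hr : 0 ≤ r)
    (hy : 0 ≤ y) : |x| ≤ r * y := by
  apply abs_le_of_sq_le_sq _ (by positivity)
  rw [mul_pow]
  exact h.trans (mul_le_mul_of_nonneg_right hc (by positivity))

theorem corr_generic_le {f : (V ≃ₗ[F] V) → ℝ} (hf : IsClassFun f) {a : ℕ} (ha : 13 ≤ a)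
    (h1 : 8 * a ≤ finrank F V) (h2 : finrank F V ≤ 8 * a + 7)
    (hD : ∀ w, corr f w ^ 2 * (((Fintype.card F ^ (finrank F V - 1) - 1 : ℕ) : ℝ)) ^ 2 ≤
      corr f 1 ^ 2 * Nat.card {h : V ≃ₗ[F] V // h * w = w * h})
    {g : V ≃ₗ[F] V}
    (hg : ∀ c : F, Nat.card (LinearMap.ker ((g : V →ₗ[F] V) - c • LinearMap.id)) ≤
      Fintype.card F ^ a) {τ : ℝ} (hτ0 : 0 ≤ τ) (hτ : τ ^ 8 * (Fintype.card F : ℝ) ^ a = 1) :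
    |corr f g| ≤ 2 * τ * corr f 1 := by
  classical
  have hq : 2 ≤ Fintype.card F := Fintype.one_lt_card
  have hone := corr_one_nonneg f
  set q := Fintype.card F with hqd
  have hqR : (2 : ℝ) ≤ q := by exact_mod_cast hq
  have hqa : (0 : ℝ) < (q : ℝ) ^ a := by positivity
  have hτa : τ ^ 8 = 1 / (q : ℝ) ^ a := by field_simp; exact hτ
  have hτ1 : τ ≤ 1 := by
    by_contra h
    push Not at h
    have h3 : 1 < τ ^ 8 := one_lt_pow₀ h (by norm_num)
    have h4 : (1 : ℝ) ≤ (q : ℝ) ^ a := one_le_pow₀ (by linarith)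
    nlinarith
  obtain ⟨e, he⟩ : ∃ e, finrank F V = 8 * a + e := ⟨finrank F V - 8 * a, by omega⟩
  have he7 : e ≤ 7 := by omega
  have hpow : ∀ k, (1 : ℝ) / (q : ℝ) ^ (k * a) = τ ^ (8 * k) := by
    intro k
    rw [pow_mul τ, hτa, mul_comm k a, pow_mul, one_div_pow]
  have hmono : ∀ i j, i ≤ j → τ ^ j ≤ τ ^ i := fun i j hij => pow_le_pow_of_le_one hτ0 hτ1 hij
  -- unipotents of rank `4 * a`
  have s1 : ∀ t : V ≃ₗ[F] V, IsUnip (4 * a) t → |corr f t| ≤ 3 * τ ^ 8 * corr f 1 := by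
    intro t ht
    obtain ⟨K, _, _, _, hK⟩ := exists_extension F (b := 4 * a) (by omega)
    let E : (K × K × (Fin e → F)) ≃ₗ[F] V := LinearEquiv.ofFinrankEq _ _ (by
      simp only [finrank_prod, hK, finrank_fin_fun, he]; ring)
    have hcf : IsClassFun (f ∘ conjMul E) := hf.comp _
    let B : Finset K := {β : K | β = 0 ∨ Algebra.adjoin F {β ^ 2} ≠ ⊤}
    have hr : (0 : ℝ) ≤ 2 * τ ^ 16 := by positivity
    have hcomm : ∀ β ∉ B, |corr (f ∘ conjMul E) (blockComm F (Fin e → F) β)| ≤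
        2 * τ ^ 16 * corr (f ∘ conjMul E) 1 := by
      intro β hβ
      simp only [B, mem_filter, mem_univ, true_and, not_or, not_not] at hβ
      have hcard := card_centralizer_blockComm_le e hβ.1 hβ.2
      have hD' := hD (conjMul E (blockComm F (Fin e → F) β))
      rw [card_centralizer_conjMul, ← corr_comp] at hD'
      rw [corr_comp_one]
      refine abs_le_of_sq_le (c := 4 * τ ^ 32) ?_ (by ring_nf; rfl) hr hone
      have hDbig : (q : ℝ) ^ (finrank F V - 1) / 2 ≤ ((q ^ (finrank F V - 1) - 1 : ℕ) : ℝ) := by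
        have h5 : 1 ≤ q ^ (finrank F V - 1) := Nat.one_le_pow _ _ (by omega)
        rw [Nat.cast_sub h5]; push_cast
        have : (2 : ℝ) ≤ (q : ℝ) ^ (finrank F V - 1) :=
          hqR.trans (le_self_pow₀ (by linarith) (by omega))
        linarith
      have hcard' : (Nat.card {h : (K × K × (Fin e → F)) ≃ₗ[F] (K × K × (Fin e → F)) //
        h * blockComm F (Fin e → F) β = blockComm F (Fin e → F) β * h} : ℝ) ≤
          (q : ℝ) ^ (finrank F V + 49) := by
        have : (Fintype.card F ^ (2 * finrank F K + e + e * e)) ≤ q ^ (finrank F V + 49) :=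
          Nat.pow_le_pow_right (by omega) (by rw [hK, he]; nlinarith)
        exact_mod_cast hcard.trans this
      have h6 := hD'.trans (mul_le_mul_of_nonneg_left hcard' (by positivity))
      have h7 : corr (f ∘ conjMul E) (blockComm F (Fin e → F) β) ^ 2 *
          ((q : ℝ) ^ (finrank F V - 1) / 2) ^ 2 ≤ corr f 1 ^ 2 * (q : ℝ) ^ (finrank F V + 49) :=
        le_trans (mul_le_mul_of_nonneg_left (pow_le_pow_left₀ (by positivity) hDbig 2)
          (by positivity)) h6
      have h8 : τ ^ 32 * (q : ℝ) ^ (4 * a) = 1 := by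
        have := hpow 4
        rw [show 8 * 4 = 32 from rfl] at this
        rw [← this]; field_simp
      have h9 : (q : ℝ) ^ (finrank F V + 49) ≤
          τ ^ 32 * ((q : ℝ) ^ (finrank F V - 1)) ^ 2 := by
        have : (q : ℝ) ^ (finrank F V + 49) * (q : ℝ) ^ (4 * a) ≤
            ((q : ℝ) ^ (finrank F V - 1)) ^ 2 := by
          rw [← pow_mul, ← pow_add]
          exact pow_le_pow_right₀ (by linarith) (by omega)
        calc _ = τ ^ 32 * ((q : ℝ) ^ (finrank F V + 49) * (q : ℝ) ^ (4 * a)) := by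
              linear_combination -(q : ℝ) ^ (finrank F V + 49) * h8
          _ ≤ _ := mul_le_mul_of_nonneg_left this (by positivity)
      have h10 : (0 : ℝ) < ((q : ℝ) ^ (finrank F V - 1)) ^ 2 := by positivity
      have h11 := mul_le_mul_of_nonneg_left h9 (by positivity : 0 ≤ corr f 1 ^ 2)
      refine le_of_mul_le_mul_right ?_ h10
      nlinarith
    have key := corr_blockUp_sq_le hcf B hr hcomm
    rw [corr_comp_one, ← corr_unip_eq hf E ht (by rw [← hK]; exact isUnip_blockUp)] at key
    refine abs_le_of_sq_le key ?_ (by positivity) hone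
    have hB : (#B : ℝ) ≤ 4 * (q : ℝ) ^ (2 * a) := by
      have := card_bad_le (F := F) (K := K) (by omega)
      rw [hK, show 4 * a / 2 = 2 * a by omega] at this
      exact_mod_cast this
    have hB2 : (#B : ℝ) / (q : ℝ) ^ (4 * a) ≤ 4 * τ ^ 16 := by
      rw [← show 8 * 2 = 16 from rfl, ← hpow 2, div_le_iff₀ (by positivity)]
      refine hB.trans (le_of_eq ?_)
      rw [show 4 * a = 2 * a + 2 * a by ring, pow_add]
      field_simp
    rw [hK]
    nlinarith [pow_nonneg hτ0 16]
  have s2 : ∀ t : V ≃ₗ[F] V, IsUnip (2 * a) t → |corr f t| ≤ 2 * τ ^ 2 * corr f 1 := by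
    intro t ht
    obtain ⟨K, _, _, _, hK⟩ := exists_extension F (b := 2 * a) (by omega)
    let E : (K × K × (K × K × (Fin e → F))) ≃ₗ[F] V := LinearEquiv.ofFinrankEq _ _ (by
      simp only [finrank_prod, hK, finrank_fin_fun, he]; ring)
    have hcf : IsClassFun (f ∘ conjMul E) := hf.comp _
    have hcomm : ∀ β ∉ ({0} : Finset K),
        |corr (f ∘ conjMul E) (blockComm F (K × K × (Fin e → F)) β)| ≤
        2 * τ ^ 4 * corr (f ∘ conjMul E) 1 := by
      intro β hβ
      have hβ0 : β ≠ 0 := by simpa using hβ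
      have := corr_blockComm_sq_le hcf hβ0 (r := 3 * τ ^ 8) (by positivity) (fun u hu => by
        rw [corr_comp, corr_comp_one]
        apply s1
        rw [show 4 * a = 2 * finrank F K by rw [hK]; ring]
        exact hu.conjMul E)
      refine abs_le_of_sq_le this ?_ (by positivity) (corr_one_nonneg _)
      rw [hK, hpow 2, show 8 * 2 = 16 from rfl, show (2 * τ ^ 4) ^ 2 = 4 * τ ^ 8 by ring]
      linarith [hmono 8 16 (by norm_num)]
    have key := corr_blockUp_sq_le hcf {0} (r := 2 * τ ^ 4) (by positivity) hcomm
    rw [corr_comp_one, ← corr_unip_eq hf E ht (by rw [← hK]; exact isUnip_blockUp)] at key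
    refine abs_le_of_sq_le key ?_ (by positivity) hone
    rw [hK, card_singleton, Nat.cast_one, hpow 2, show 8 * 2 = 16 from rfl,
      show (2 * τ ^ 2) ^ 2 = 4 * τ ^ 4 by ring]
    linarith [hmono 4 16 (by norm_num), pow_nonneg hτ0 4]
  obtain ⟨K, _, _, _, hK⟩ := exists_extension F (b := a) (by omega)
  have key := corr_sq_le_of_generic hf hg (by omega) hK (r := 2 * τ ^ 2) (by positivity) s2
  refine abs_le_of_sq_le key ?_ (by positivity) hone
  rw [← hqd, ← hτa]
  nlinarith [hmono 2 8 (by norm_num), pow_nonneg hτ0 2]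

end Chain

section Unit

variable (F : Type*) [Field F] {R : Type*} [CommRing R] [Algebra F R]

/-- Multiplication by a unit as a linear automorphism. -/
def mulUnit (u : Rˣ) : R ≃ₗ[F] R where
  toFun x := u * x
  invFun x := (u⁻¹ : Rˣ) * x
  map_add' x y := mul_add _ _ _
  map_smul' c x := by simp
  left_inv x := by simp
  right_inv x := by simp

variable {F}

theorem mulUnit_apply (u : Rˣ) (x : R) : mulUnit F u x = u * x := rfl

theorem mulUnit_mul (u v : Rˣ) : mulUnit F (u * v) = mulUnit F u * mulUnit F v := by
  ext x; simp [mulUnit_apply, mul_assoc]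

theorem mulUnit_pow_apply (u : Rˣ) (k : ℕ) (x : R) : (mulUnit F u ^ k) x = (u : R) ^ k * x := by
  induction k generalizing x with
  | zero => simp
  | succ k ih => rw [pow_succ, LinearEquiv.mul_apply, ih, mulUnit_apply, pow_succ, mul_assoc]

theorem map_aeval_mul {K : Type*} [CommRing K] [Algebra F K] (ψ : R →ₗ[F] K) {ω : R} {θ : K}
    (h : ∀ r, ψ (ω * r) = θ * ψ r) (p : Polynomial F) (r : R) :
    ψ (Polynomial.aeval ω p * r) = Polynomial.aeval θ p * ψ r := by
  induction p using Polynomial.induction_on' generalizing r with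
  | add p q hp hq => simp [add_mul, hp, hq]
  | monomial k c =>
    simp only [Polynomial.aeval_monomial, mul_assoc, ← Algebra.smul_def, smul_mul_assoc, map_smul]
    congr 1
    induction k generalizing r with
    | zero => simp
    | succ k ih => rw [pow_succ, mul_assoc, ih, h, pow_succ, mul_assoc]

end Unit

section Centralizer

variable {F R₁ R₂ : Type*} [Field F] [Fintype F] [CommRing R₁] [Algebra F R₁] [Fintype R₁]
  [CommRing R₂] [Algebra F R₂] [Fintype R₂]

theorem card_centralizer_mulUnit_le (u : (R₁ × R₂)ˣ) {M : ℕ} (h₁ : (u : R₁ × R₂).1 ^ M = 1)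
    (h₂ : ∀ x : R₂, (u : R₁ × R₂).2 ^ M * x = x → x = 0)
    (hgen : Algebra.adjoin F {(u : R₁ × R₂).2} = ⊤) :
    Nat.card {h : (R₁ × R₂) ≃ₗ[F] (R₁ × R₂) // h * mulUnit F u = mulUnit F u * h} ≤
      Fintype.card F ^ (finrank F (R₁ × R₂) + finrank F R₁ ^ 2) := by
  classical
  let w : (R₁ × R₂) ≃ₗ[F] (R₁ × R₂) := mulUnit F u
  let Z := {h : (R₁ × R₂) ≃ₗ[F] (R₁ × R₂) // h * w = w * h}
  let ev : Z → (R₁ × R₂) × (R₁ →ₗ[F] R₁) := fun h => (h.1 (0, 1),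
    LinearMap.fst F R₁ R₂ ∘ₗ h.1.toLinearMap ∘ₗ LinearMap.inl F R₁ R₂)
  have comm : ∀ (h : Z) v, h.1 (w v) = w (h.1 v) := fun h v =>
    congrArg (fun g : (R₁ × R₂) ≃ₗ[F] (R₁ × R₂) => g v) h.2
  have commM : ∀ (h : Z) v, h.1 ((w ^ M) v) = (w ^ M) (h.1 v) := fun h v =>
    congrArg (fun g : (R₁ × R₂) ≃ₗ[F] (R₁ × R₂) => g v)
      ((show Commute h.1 w from h.2).pow_right M).eq
  have hinj : Function.Injective ev := by
    intro h h' heq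
    let L : Submodule F (R₁ × R₂) := LinearMap.eqLocus h.1.toLinearMap h'.1.toLinearMap
    have hL : ∀ v, v ∈ L ↔ h.1 v = h'.1 v := fun v => Iff.rfl
    have hLw : ∀ v ∈ L, w v ∈ L := fun v hv => by rw [hL] at hv ⊢; rw [comm, comm, hv]
    have hsc : ∀ s : R₂, ∀ x, ((0, x) : R₁ × R₂) ∈ L → ((0, s * x) : R₁ × R₂) ∈ L := by
      intro s
      have hs : s ∈ Algebra.adjoin F {(u : R₁ × R₂).2} := by rw [hgen]; trivial
      refine Algebra.adjoin_induction ?_ ?_ ?_ ?_ hs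
      · rintro _ rfl x hx
        have := hLw _ hx
        have e : w (0, x) = (0, (u : R₁ × R₂).2 * x) := by
          change (u : R₁ × R₂) * (0, x) = _
          ext <;> simp
        rwa [e] at this
      · intro r x hx
        have := L.smul_mem r hx
        simpa [Algebra.smul_def] using this
      · intro s t _ _ hs ht x hx
        have := L.add_mem (hs x hx) (ht x hx)
        simpa [add_mul] using this
      · intro s t _ _ hs ht x hx
        simpa [mul_assoc] using hs _ (ht x hx)
    have hb : ∀ b, ((0, b) : R₁ × R₂) ∈ L := fun b => by
      have := hsc b 1 ((hL _).2 (congrArg Prod.fst heq))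
      simpa using this
    have hzero : ∀ (h : Z) a, (h.1 (a, 0)).2 = 0 := by
      intro h a
      apply h₂
      have e1 : (w ^ M) (a, 0) = (a, 0) := by
        rw [mulUnit_pow_apply]
        ext
        · simp [h₁]
        · simp
      have e2 := commM h (a, 0)
      rw [e1, mulUnit_pow_apply] at e2
      have := congrArg Prod.snd e2
      simpa using this.symm
    have ha : ∀ a, ((a, 0) : R₁ × R₂) ∈ L := fun a => by
      rw [hL]
      refine Prod.ext ?_ ((hzero h a).trans (hzero h' a).symm)
      have := congrArg (fun g : (R₁ × R₂) × (R₁ →ₗ[F] R₁) => g.2 a) heq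
      simpa [ev] using this
    apply Subtype.ext
    ext1 ⟨a, b⟩
    have := L.add_mem (ha a) (hb b)
    rw [hL] at this
    simpa using this
  have : Finite (R₁ →ₗ[F] R₁) := Module.finite_of_finite F
  refine (Nat.card_le_card_of_injective ev hinj).trans (le_of_eq ?_)
  rw [Nat.card_prod, Module.natCard_eq_pow_finrank (K := F), Module.natCard_eq_pow_finrank (K := F)
    (V := R₁ →ₗ[F] R₁), finrank_linearMap, Nat.card_eq_fintype_card, pow_add, sq]

end Centralizer

section Field

variable {F K : Type*} [Field F] [Fintype F] [Field K] [Algebra F K] [Fintype K]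

theorem adjoin_pi_eq_top (S : Finset K) (hS : ∀ θ ∈ S, Algebra.adjoin F {θ} = ⊤)
    (hinj : Set.InjOn (minpoly F) (S : Set K)) :
    Algebra.adjoin F {(fun θ : S => (θ : K))} = ⊤ := by
  classical
  rw [eq_top_iff]
  intro k _
  have hk : k = ∑ θ : S, Pi.single θ (k θ) := by
    ext θ; simp [Finset.sum_apply]
  rw [hk]
  refine Subalgebra.sum_mem _ fun θ _ => ?_
  let P : Polynomial F := ∏ θ' ∈ (univ : Finset S).erase θ, minpoly F (θ' : K)
  have hP0 : Polynomial.aeval (θ : K) P ≠ 0 := by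
    rw [map_prod, prod_ne_zero_iff]
    intro θ' hθ' h0
    have hne := (mem_erase.1 hθ').1
    apply hne
    apply Subtype.ext
    have hi : IsIntegral F (θ' : K) := Algebra.IsIntegral.isIntegral _
    exact hinj θ'.2 θ.2 (minpoly.eq_of_irreducible_of_monic (minpoly.irreducible hi) h0
      (minpoly.monic hi))
  have hex : ∃ Q : Polynomial F, Polynomial.aeval (θ : K) Q =
      k θ * (Polynomial.aeval (θ : K) P)⁻¹ := by
    have : k θ * (Polynomial.aeval (θ : K) P)⁻¹ ∈ Algebra.adjoin F {(θ : K)} := by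
      rw [hS θ θ.2]; trivial
    rw [Algebra.adjoin_singleton_eq_range_aeval] at this
    exact this
  obtain ⟨Q, hQ⟩ := hex
  rw [Algebra.adjoin_singleton_eq_range_aeval]
  refine ⟨Q * P, ?_⟩
  have happ : ∀ (R : Polynomial F) (θ' : S),
      (Polynomial.aeval (fun θ : S => (θ : K)) R) θ' = Polynomial.aeval (θ' : K) R := by
    intro R θ'
    exact (Polynomial.aeval_algHom_apply (Pi.evalAlgHom F (fun _ : S => K) θ') _ R).symm
  change Polynomial.aeval (fun θ : S => (θ : K)) (Q * P) = _
  ext θ'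
  rw [happ, map_mul]
  by_cases hθ : θ' = θ
  · subst hθ
    rw [hQ, Pi.single_eq_same, mul_assoc, inv_mul_cancel₀ hP0, mul_one]
  · rw [Pi.single_eq_of_ne hθ, map_prod, prod_eq_zero (mem_erase.2 ⟨hθ, mem_univ _⟩)
      (minpoly.aeval F (θ' : K)), mul_zero]

/-- There are many generators with pairwise distinct minimal polynomials. -/
theorem exists_generators (hd : 6 ≤ finrank F K) :
    ∃ S : Finset K, (∀ θ ∈ S, Algebra.adjoin F {θ} = ⊤) ∧ Set.InjOn (minpoly F) (S : Set K) ∧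
      Fintype.card F ^ finrank F K ≤ 2 * finrank F K * #S := by
  classical
  set d := finrank F K with hdd
  set q := Fintype.card F with hqd
  have hq : 2 ≤ q := Fintype.one_lt_card
  let Gen : Finset K := {θ : K | Algebra.adjoin F {θ} = ⊤}
  have hGen : q ^ d ≤ 2 * #Gen := by
    have h1 := card_bad_le (F := F) (K := K) (by omega)
    have h2 : Genᶜ ⊆ ({β : K | β = 0 ∨ Algebra.adjoin F {β ^ 2} ≠ ⊤} : Finset K) := by
      intro θ hθ
      simp only [Gen, mem_compl, mem_filter, mem_univ, true_and] at hθ ⊢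
      right
      intro htop
      apply hθ
      have hmem : θ ^ 2 ∈ Algebra.adjoin F {θ} :=
        pow_mem (Algebra.self_mem_adjoin_singleton F θ) 2
      have hle : Algebra.adjoin F {θ ^ 2} ≤ Algebra.adjoin F {θ} :=
        Algebra.adjoin_le (Set.singleton_subset_iff.2 hmem)
      exact top_le_iff.1 (htop ▸ hle)
    have h3 := (card_le_card h2).trans h1
    rw [card_compl, Module.card_eq_pow_finrank (K := F)] at h3
    have h4 : 8 * q ^ (d / 2) ≤ q ^ d := by
      calc 8 * q ^ (d / 2) ≤ q ^ 3 * q ^ (d / 2) :=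
            Nat.mul_le_mul_right _ (by calc 8 = 2 ^ 3 := rfl
                                      _ ≤ q ^ 3 := Nat.pow_le_pow_left hq 3)
        _ = q ^ (3 + d / 2) := (pow_add _ _ _).symm
        _ ≤ _ := Nat.pow_le_pow_right (by omega) (by omega)
    rw [← hqd, ← hdd] at h3
    omega
  have hfib : #Gen ≤ d * #(Gen.image (minpoly F)) := by
    apply card_le_mul_card_image
    intro f hf
    obtain ⟨θ, hθ, rfl⟩ := mem_image.1 hf
    have hi : IsIntegral F θ := Algebra.IsIntegral.isIntegral _
    have hne : minpoly F θ ≠ 0 := minpoly.ne_zero hi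
    have : ({a ∈ Gen | minpoly F a = minpoly F θ}) ⊆ ((minpoly F θ).aroots K).toFinset := by
      intro a ha
      rw [Multiset.mem_toFinset, Polynomial.mem_aroots]
      exact ⟨hne, by rw [← (mem_filter.1 ha).2]; exact minpoly.aeval F a⟩
    refine (card_le_card this).trans ((Multiset.toFinset_card_le _).trans
      ((Polynomial.card_roots' _).trans ?_))
    rw [Polynomial.natDegree_map]
    exact minpoly.natDegree_le θ
  have hsec : ∀ f : (Gen.image (minpoly F)), ∃ θ ∈ Gen, minpoly F θ = f := fun f =>
    mem_image.1 f.2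
  choose s hs hs' using hsec
  have hsinj : Function.Injective s := fun f g h => Subtype.ext (by rw [← hs' f, ← hs' g, h])
  refine ⟨univ.image s, ?_, ?_, ?_⟩
  · intro θ hθ
    obtain ⟨f, -, rfl⟩ := mem_image.1 hθ
    exact (mem_filter.1 (hs f)).2
  · intro a ha b hb hab
    obtain ⟨f, -, rfl⟩ := mem_image.1 (mem_coe.1 ha)
    obtain ⟨g, -, rfl⟩ := mem_image.1 (mem_coe.1 hb)
    rw [hs', hs'] at hab
    rw [Subtype.ext hab]
  · rw [card_image_of_injective _ hsinj, card_univ, Fintype.card_coe]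
    nlinarith

end Field

section Rich

variable {F V W : Type*} [Field F] [AddCommGroup V] [Module F V] [AddCommGroup W] [Module F W]

/-- The `m`-th power of `w` is a transvection whose data is fixed by `w`. -/
def IsRich (m : ℕ) (w : V ≃ₗ[F] V) : Prop :=
  ∃ (v : V) (φ : Dual F V), v ≠ 0 ∧ φ ≠ 0 ∧ φ v = 0 ∧ (∀ x, (w ^ m) x = x + φ x • v) ∧ w v = v ∧
    ∀ x, φ (w x) = φ x

theorem IsRich.conjMul {m : ℕ} {w : W ≃ₗ[F] W} (h : IsRich m w) (e : W ≃ₗ[F] V) :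
    IsRich m (conjMul e w) := by
  obtain ⟨v, φ, h1, h2, h3, h4, h5, h6⟩ := h
  refine ⟨e v, φ ∘ₗ e.symm.toLinearMap, by simpa using h1, fun h0 => h2 ?_, by simpa using h3,
    fun x => ?_, by rw [conjMul_apply]; simp [h5], fun x => by
      simp [conjMul_apply, h6]⟩
  · ext x
    have := congrArg (fun g : Dual F V => g (e x)) h0
    simpa using this
  · rw [← map_pow, conjMul_apply, h4]; simp

theorem IsRich.conj {m : ℕ} {w : V ≃ₗ[F] V} (h : IsRich m w) (g : V ≃ₗ[F] V) :
    IsRich m (g * w * g⁻¹) := h.conjMul g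

theorem isRich_conj_iff {m : ℕ} {w : V ≃ₗ[F] V} (g : V ≃ₗ[F] V) :
    IsRich m (g * w * g⁻¹) ↔ IsRich m w :=
  ⟨fun h => by simpa [mul_assoc] using h.conj g⁻¹, fun h => h.conj g⟩

end Rich

section Dual

variable (F : Type*) [Field F]

/-- Dual numbers as a product. -/
def dualNumberEquiv : DualNumber F ≃ₗ[F] F × F where
  toFun x := (x.fst, x.snd)
  invFun x := TrivSqZeroExt.inl x.1 + TrivSqZeroExt.inr x.2
  map_add' x y := rfl
  map_smul' c x := rfl
  left_inv x := by ext <;> simp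
  right_inv x := by simp

instance [Fintype F] : Fintype (DualNumber F) := Fintype.ofEquiv _ (dualNumberEquiv F).symm.toEquiv

theorem dualNumberEquiv_apply (x : DualNumber F) : dualNumberEquiv F x = (x.fst, x.snd) := rfl

theorem finrank_dualNumber : finrank F (DualNumber F) = 2 := by
  rw [(dualNumberEquiv F).finrank_eq, finrank_prod, finrank_self]

theorem one_add_eps_pow (k : ℕ) :
    (1 + DualNumber.eps : DualNumber F) ^ k = 1 + (k : F) • DualNumber.eps := by
  induction k with
  | zero => simp
  | succ k ih =>
    rw [pow_succ, ih]
    ext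
    · simp
    · simp [add_comm]

end Dual

section Model

variable {F K : Type*} [Field F] [Fintype F] [Field K] [Algebra F K] [Fintype K]

/-- The model algebra. -/
abbrev ModelAlg (F : Type*) {K : Type*} [Field F] [Field K] (e : ℕ) (S : Finset K) : Type _ :=
  (F × DualNumber F × (Fin e → F)) × (S → K)

/-- The distinguished element of the model algebra. -/
def modelElt (e : ℕ) (S : Finset K) (c : F) : ModelAlg F e S :=
  ((c, 1 + DualNumber.eps, 1), fun θ => θ)

theorem ne_zero_of_adjoin (hd : 2 ≤ finrank F K) {θ : K} (h : Algebra.adjoin F {θ} = ⊤) (c : F) :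
    θ ≠ algebraMap F K c := by
  rintro rfl
  have h1 : Algebra.adjoin F {algebraMap F K c} = ⊥ := by
    rw [eq_bot_iff]
    exact Algebra.adjoin_le (Set.singleton_subset_iff.2 (Subalgebra.algebraMap_mem _ c))
  rw [h1, Subalgebra.bot_eq_top_iff_finrank_eq_one] at h
  omega

theorem isUnit_modelElt (hd : 2 ≤ finrank F K) (e : ℕ) (S : Finset K)
    (hS : ∀ θ ∈ S, Algebra.adjoin F {θ} = ⊤) {c : F} (hc : c ≠ 0) : IsUnit (modelElt e S c) := by
  rw [Prod.isUnit_iff, Prod.isUnit_iff, Prod.isUnit_iff]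
  refine ⟨⟨isUnit_iff_ne_zero.2 hc, ?_, isUnit_one⟩, Pi.isUnit_iff.2 fun θ => isUnit_iff_ne_zero.2 ?_⟩
  · rw [TrivSqZeroExt.isUnit_iff_isUnit_fst]
    simp [modelElt]
  · have := ne_zero_of_adjoin hd (hS θ θ.2) 0
    simpa [modelElt] using this

theorem card_sub_one_cast {d : ℕ} (hd : d ≠ 0) : ((Fintype.card F ^ d - 1 : ℕ) : F) = -1 := by
  rw [Nat.cast_sub (Nat.one_le_pow _ _ Fintype.card_pos)]
  simp [hd]

theorem isRich_modelElt (hd : 2 ≤ finrank F K) (e : ℕ) (S : Finset K)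
    (hS : ∀ θ ∈ S, Algebra.adjoin F {θ} = ⊤) {c : F} (hc : c ≠ 0) :
    IsRich (Fintype.card F ^ finrank F K - 1) (mulUnit F (isUnit_modelElt hd e S hS hc).unit) := by
  set u := (isUnit_modelElt hd e S hS hc).unit
  have hu : (u : ModelAlg F e S) = modelElt e S c := rfl
  refine ⟨((0, -DualNumber.eps, 0), 0), LinearMap.fst F F F ∘ₗ
    (dualNumberEquiv F).toLinearMap ∘ₗ LinearMap.fst F _ _ ∘ₗ LinearMap.snd F _ _ ∘ₗ
      LinearMap.fst F _ _, ?_, ?_, ?_, ?_, ?_, ?_⟩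
  · intro h
    have := congrArg (fun x : ModelAlg F e S => TrivSqZeroExt.snd x.1.2.1) h
    simp at this
  · intro h
    have := congrArg (fun g : Dual F (ModelAlg F e S) => g ((0, 1, 0), 0)) h
    simp [dualNumberEquiv_apply] at this
  · simp [dualNumberEquiv_apply]
  · intro x
    rw [mulUnit_pow_apply, hu]
    have hcK : c ^ (Fintype.card F ^ finrank F K - 1) = 1 := by
      apply (algebraMap F K).injective
      rw [map_pow, map_one, ← Module.card_eq_pow_finrank (K := F)]
      exact FiniteField.pow_card_sub_one_eq_one _ (by simpa using hc)
    have hθ : ∀ θ : S, (θ : K) ^ (Fintype.card F ^ finrank F K - 1) = 1 := by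
      intro θ
      rw [← Module.card_eq_pow_finrank (K := F)]
      exact FiniteField.pow_card_sub_one_eq_one _ (by
        have := ne_zero_of_adjoin hd (hS θ θ.2) 0
        simpa using this)
    obtain ⟨⟨x0, x1, x2⟩, k⟩ := x
    simp only [modelElt, Prod.pow_mk, one_add_eps_pow, card_sub_one_cast (show finrank F K ≠ 0 by omega),
      Prod.mk_mul_mk, hcK, one_pow, one_mul]
    refine Prod.ext (Prod.ext ?_ (Prod.ext ?_ ?_)) ?_
    · simp
    · ext
      · simp [dualNumberEquiv_apply]
      · simp [dualNumberEquiv_apply]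
    · simp
    · ext θ
      simp [hθ]
  · rw [mulUnit_apply, hu, modelElt]
    refine Prod.ext (Prod.ext ?_ (Prod.ext ?_ ?_)) ?_
    · simp
    · simp [add_mul]
    · simp
    · simp
  · intro x
    rw [mulUnit_apply, hu, modelElt]
    simp [dualNumberEquiv_apply]

theorem aeval_fst {A B : Type*} [CommRing A] [CommRing B] [Algebra F A] [Algebra F B] (x : A × B)
    (p : Polynomial F) : (Polynomial.aeval x p).1 = Polynomial.aeval x.1 p :=
  (Polynomial.aeval_algHom_apply (AlgHom.fst F A B) x p).symm

theorem aeval_snd {A B : Type*} [CommRing A] [CommRing B] [Algebra F A] [Algebra F B] (x : A × B)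
    (p : Polynomial F) : (Polynomial.aeval x p).2 = Polynomial.aeval x.2 p :=
  (Polynomial.aeval_algHom_apply (AlgHom.snd F A B) x p).symm

theorem aeval_pi {ι A : Type*} [CommRing A] [Algebra F A] (x : ι → A)
    (p : Polynomial F) (i : ι) : (Polynomial.aeval x p) i = Polynomial.aeval (x i) p :=
  (Polynomial.aeval_algHom_apply (Pi.evalAlgHom F (fun _ : ι => A) i) x p).symm

open Polynomial in
/-- The spectrum of the distinguished element recovers the set `S`. -/
theorem mem_iff_exists_functional (hd : 2 ≤ finrank F K) (e : ℕ) (Θ S : Finset K) (hSΘ : S ⊆ Θ)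
    (hΘ : ∀ θ ∈ Θ, Algebra.adjoin F {θ} = ⊤) (hinj : Set.InjOn (minpoly F) (Θ : Set K)) {c : F}
    {θ : K} (hθ : θ ∈ Θ) :
    θ ∈ S ↔ ∃ ψ : ModelAlg F e S →ₗ[F] K, ψ ≠ 0 ∧ ∀ r, ψ (modelElt e S c * r) = θ * ψ r := by
  constructor
  · intro h
    refine ⟨LinearMap.proj (⟨θ, h⟩ : S) ∘ₗ LinearMap.snd F _ _, fun h0 => ?_, fun r => ?_⟩
    · have := congrArg (fun g : ModelAlg F e S →ₗ[F] K => g (0, 1)) h0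
      simp at this
    · simp [modelElt]
  · rintro ⟨ψ, hψ, hψθ⟩
    by_contra hn
    apply hψ
    let P : F[X] := (∏ θ' ∈ S, minpoly F θ') * ((X - C 1) ^ 2 * (X - C c))
    have hP0 : aeval (modelElt e S c) P = 0 := by
      refine Prod.ext (Prod.ext ?_ (Prod.ext ?_ ?_)) ?_
      · rw [aeval_fst, aeval_fst]
        simp [P, modelElt]
      · rw [aeval_fst, aeval_snd, aeval_fst]
        simp only [P, modelElt, map_mul, map_pow, map_sub, aeval_X, aeval_C]
        simp [sq]
      · rw [aeval_fst, aeval_snd, aeval_snd]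
        simp [P, modelElt]
      · rw [aeval_snd]
        ext θ'
        rw [aeval_pi]
        simp only [P, modelElt, map_mul, map_prod]
        rw [prod_eq_zero θ'.2 (minpoly.aeval F (θ' : K))]
        simp
    have hPθ : aeval θ P ≠ 0 := by
      simp only [P, map_mul, map_prod, map_pow, map_sub, aeval_X, aeval_C]
      refine mul_ne_zero (prod_ne_zero_iff.2 fun θ' hθ' h0 => ?_) (mul_ne_zero (pow_ne_zero _ ?_) ?_)
      · have hi : IsIntegral F (θ' : K) := Algebra.IsIntegral.isIntegral _
        have := hinj (hSΘ hθ') hθ (minpoly.eq_of_irreducible_of_monic (minpoly.irreducible hi) h0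
          (minpoly.monic hi))
        exact hn (this ▸ hθ')
      · exact sub_ne_zero.2 (ne_zero_of_adjoin hd (hΘ θ hθ) 1)
      · exact sub_ne_zero.2 (ne_zero_of_adjoin hd (hΘ θ hθ) c)
    refine LinearMap.ext fun r => ?_
    have := map_aeval_mul ψ hψθ P r
    rw [hP0, zero_mul, map_zero] at this
    simpa [hPθ] using this.symm

theorem finrank_modelAlg (e : ℕ) (S : Finset K) :
    finrank F (ModelAlg F e S) = 3 + e + finrank F K * #S := by
  rw [finrank_prod, finrank_prod, finrank_prod, finrank_dualNumber, finrank_self, finrank_fin_fun,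
    finrank_pi_fintype]
  simp
  ring

theorem exists_det_eq (hd : 2 ≤ finrank F K) (e : ℕ) (S : Finset K)
    (hS : ∀ θ ∈ S, Algebra.adjoin F {θ} = ⊤) (δ : Fˣ) :
    ∃ (c : F) (hc : c ≠ 0), LinearEquiv.det (mulUnit F (isUnit_modelElt hd e S hS hc).unit) = δ := by
  set δ₀ := LinearEquiv.det (mulUnit F (isUnit_modelElt hd e S hS (one_ne_zero)).unit) with hδ₀
  set c : Fˣ := δ * δ₀⁻¹ with hc
  refine ⟨c, c.ne_zero, ?_⟩
  have hD : IsUnit (((c, 1, 1), 1) : ModelAlg F e S) := by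
    rw [Prod.isUnit_iff, Prod.isUnit_iff]
    exact ⟨⟨c.isUnit, isUnit_one⟩, isUnit_one⟩
  have h1 : (isUnit_modelElt hd e S hS c.ne_zero).unit =
      hD.unit * (isUnit_modelElt hd e S hS (one_ne_zero)).unit := by
    ext1
    simp [modelElt]
  rw [h1, mulUnit_mul, map_mul, ← hδ₀]
  have h2 : LinearEquiv.det (mulUnit F hD.unit) = c := by
    ext1
    rw [LinearEquiv.coe_det]
    have : (mulUnit F hD.unit : ModelAlg F e S →ₗ[F] ModelAlg F e S) =
        LinearMap.prodMap (LinearMap.prodMap ((c : F) • LinearMap.id) LinearMap.id) LinearMap.id := by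
      apply LinearMap.ext
      rintro ⟨⟨x, y, z⟩, k⟩
      change (((c, 1, 1), 1) : ModelAlg F e S) * ((x, y, z), k) = _
      simp
    rw [this, LinearMap.det_prodMap, LinearMap.det_prodMap]
    simp
  rw [h2, hc]; simp

theorem card_centralizer_modelElt_le (hd : 2 ≤ finrank F K) (e : ℕ) (S : Finset K)
    (hS : ∀ θ ∈ S, Algebra.adjoin F {θ} = ⊤) (hinj : Set.InjOn (minpoly F) (S : Set K)) {c : F}
    (hc : c ≠ 0) :
    Nat.card {h : ModelAlg F e S ≃ₗ[F] ModelAlg F e S //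
        h * mulUnit F (isUnit_modelElt hd e S hS hc).unit =
          mulUnit F (isUnit_modelElt hd e S hS hc).unit * h} ≤
      Fintype.card F ^ (3 + e + finrank F K * #S + (3 + e) ^ 2) := by
  classical
  have h := card_centralizer_mulUnit_le (F := F) (isUnit_modelElt hd e S hS hc).unit
    (M := (Fintype.card F - 1) * Fintype.card F) ?_ ?_ ?_
  · rw [finrank_modelAlg, finrank_prod, finrank_prod, finrank_dualNumber, finrank_self,
      finrank_fin_fun] at h
    convert h using 3
    ring
  · change ((c, 1 + DualNumber.eps, 1) : F × DualNumber F × (Fin e → F)) ^ _ = 1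
    rw [Prod.pow_mk, Prod.pow_mk, one_add_eps_pow, pow_mul,
      FiniteField.pow_card_sub_one_eq_one _ hc]
    simp
  · intro x hx
    ext θ
    have h1 := congrFun hx θ
    change (θ : K) ^ _ * x θ = x θ at h1
    by_contra h0
    have h2 : (θ : K) ^ ((Fintype.card F - 1) * Fintype.card F) = 1 := by
      apply mul_right_cancel₀ h0
      rw [h1, one_mul]
    have h3 : (θ : K) ^ (Fintype.card F - 1) = 1 := by
      rw [pow_mul] at h2
      have := (FiniteField.frobeniusAlgHom F K).injective (a₁ := (θ : K) ^ (Fintype.card F - 1))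
        (a₂ := 1) (by simpa using h2)
      exact this
    have h4 : (θ : K) ^ Fintype.card F = θ := by
      have : Fintype.card F = Fintype.card F - 1 + 1 := by
        have := Fintype.card_pos (α := F); omega
      rw [this, pow_succ, h3, one_mul]
    have hmem : (θ : K) ∈ (algebraMap F K).range := by
      classical
      by_contra hno
      have hsub : insert (θ : K) (univ.image (algebraMap F K)) ⊆
          (Polynomial.X ^ Fintype.card F - Polynomial.X : Polynomial K).roots.toFinset := by
        have hne := FiniteField.X_pow_card_sub_X_ne_zero K (Fintype.one_lt_card (α := F))
        intro a ha
        rw [Multiset.mem_toFinset, Polynomial.mem_roots hne]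
        rcases mem_insert.1 ha with rfl | ha
        · simp [Polynomial.IsRoot, h4]
        · obtain ⟨a, -, rfl⟩ := mem_image.1 ha
          simp [Polynomial.IsRoot, ← map_pow, FiniteField.pow_card]
      have hcard := (card_le_card hsub).trans ((Multiset.toFinset_card_le _).trans
        (Polynomial.card_roots' _))
      rw [FiniteField.X_pow_card_sub_X_natDegree_eq K (Fintype.one_lt_card (α := F)),
        card_insert_of_notMem (by simpa using hno),
        card_image_of_injective _ (algebraMap F K).injective, card_univ] at hcard
      omega
    obtain ⟨a, ha⟩ := hmem
    exact ne_zero_of_adjoin hd (hS θ θ.2) a ha.symm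
  · exact adjoin_pi_eq_top S hS hinj

end Model

section

variable {F V : Type*} [Field F] [Fintype F] [AddCommGroup V] [Module F V] [Fintype V]

open scoped Classical in
theorem choose_mul_card_le {K : Type*} [Field K] [Algebra F K] [Fintype K]
    (hd : 2 ≤ finrank F K) (Θ : Finset K) (hΘ : ∀ θ ∈ Θ, Algebra.adjoin F {θ} = ⊤)
    (hinj : Set.InjOn (minpoly F) (Θ : Set K)) {e t : ℕ}
    (hn : finrank F V = 3 + e + finrank F K * t) (δ : Fˣ) :
    (#Θ).choose t * Fintype.card (V ≃ₗ[F] V) ≤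
      Fintype.card F ^ (finrank F V + (3 + e) ^ 2) *
        #{w : V ≃ₗ[F] V | IsRich (Fintype.card F ^ finrank F K - 1) w ∧ LinearEquiv.det w = δ} := by
  have hex : ∀ S : Finset K, S ∈ powersetCard t Θ → ∃ w : V ≃ₗ[F] V,
      IsRich (Fintype.card F ^ finrank F K - 1) w ∧ LinearEquiv.det w = δ ∧
      Nat.card {h : V ≃ₗ[F] V // h * w = w * h} ≤
        Fintype.card F ^ (finrank F V + (3 + e) ^ 2) ∧
      ∀ θ ∈ Θ, θ ∈ S ↔ ∃ ψ : V →ₗ[F] K, ψ ≠ 0 ∧ ∀ r, ψ (w r) = θ * ψ r := by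
    intro S hS
    obtain ⟨hSΘ, hSt⟩ := mem_powersetCard.1 hS
    have hS' : ∀ θ ∈ S, Algebra.adjoin F {θ} = ⊤ := fun θ hθ => hΘ θ (hSΘ hθ)
    obtain ⟨c, hc, hdet⟩ := exists_det_eq hd e S hS' δ
    let E : ModelAlg F e S ≃ₗ[F] V := LinearEquiv.ofFinrankEq _ _ (by
      rw [finrank_modelAlg, hn, hSt])
    refine ⟨conjMul E (mulUnit F (isUnit_modelElt hd e S hS' hc).unit),
      (isRich_modelElt hd e S hS' hc).conjMul E, ?_, ?_, ?_⟩
    · rw [← hdet]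
      exact LinearEquiv.det_conj _ E
    · rw [card_centralizer_conjMul, hn]
      have := card_centralizer_modelElt_le hd e S hS' (hinj.mono (by exact_mod_cast hSΘ)) hc
      rwa [hSt] at this
    · intro θ hθ
      rw [mem_iff_exists_functional hd e Θ S hSΘ hΘ hinj (c := c) hθ]
      constructor
      · rintro ⟨ψ, h0, hψ⟩
        refine ⟨ψ ∘ₗ E.symm.toLinearMap, fun h => h0 ?_, fun r => ?_⟩
        · refine LinearMap.ext fun x => ?_
          have := congrArg (fun g : V →ₗ[F] K => g (E x)) h
          simpa using this
        · simp only [LinearMap.comp_apply, LinearEquiv.coe_coe, conjMul_apply,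
            LinearEquiv.symm_apply_apply]
          exact hψ _
      · rintro ⟨ψ, h0, hψ⟩
        refine ⟨ψ ∘ₗ E.toLinearMap, fun h => h0 ?_, fun r => ?_⟩
        · refine LinearMap.ext fun x => ?_
          have := congrArg (fun g : ModelAlg F e S →ₗ[F] K => g (E.symm x)) h
          simpa using this
        · have := hψ (E r)
          simp only [conjMul_apply, LinearEquiv.symm_apply_apply] at this
          exact this
  choose! w hrich hdet hcent hspec using hex
  let D : Finset (Finset K × (V ≃ₗ[F] V)) := powersetCard t Θ ×ˢ univ
  let Φ : Finset K × (V ≃ₗ[F] V) → (V ≃ₗ[F] V) := fun x => x.2 * w x.1 * x.2⁻¹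
  have hmaps : D.image Φ ⊆
      ({w : V ≃ₗ[F] V | IsRich (Fintype.card F ^ finrank F K - 1) w ∧ LinearEquiv.det w = δ} :
        Finset (V ≃ₗ[F] V)) := by
    intro y hy
    obtain ⟨⟨S, h⟩, hx, rfl⟩ := mem_image.1 hy
    have hS := (mem_product.1 hx).1
    simp only [mem_filter, mem_univ, true_and, Φ]
    refine ⟨(hrich S hS).conj h, ?_⟩
    rw [map_mul, map_mul, map_inv, hdet S hS]
    simp
  have key : #D ≤ Fintype.card F ^ (finrank F V + (3 + e) ^ 2) * #(D.image Φ) := by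
    apply card_le_mul_card_image
    intro y hy
    obtain ⟨⟨S, h⟩, hx, rfl⟩ := mem_image.1 hy
    have hS := (mem_product.1 hx).1
    refine le_trans ?_ (hcent S hS)
    rw [Nat.card_eq_fintype_card, Fintype.card_subtype]
    refine card_le_card_of_injOn (fun x => h⁻¹ * x.2) ?_ ?_
    · rintro ⟨S', h'⟩ hx'
      obtain ⟨hx', heq⟩ := mem_filter.1 (mem_coe.1 hx')
      have hS' := (mem_product.1 hx').1
      have heq' : h' * w S' * h'⁻¹ = h * w S * h⁻¹ := heq
      have hSS : S' = S := by
        have hw' : w S' = (h'⁻¹ * h) * w S * (h'⁻¹ * h)⁻¹ := by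
          rw [mul_inv_rev, inv_inv]
          calc w S' = h'⁻¹ * (h' * w S' * h'⁻¹) * h' := by group
            _ = _ := by rw [heq']; group
        have hsub : ∀ {A B : V ≃ₗ[F] V} {k : V ≃ₗ[F] V} {θ : K}, A = k * B * k⁻¹ →
            (∃ ψ : V →ₗ[F] K, ψ ≠ 0 ∧ ∀ r, ψ (A r) = θ * ψ r) →
            ∃ ψ : V →ₗ[F] K, ψ ≠ 0 ∧ ∀ r, ψ (B r) = θ * ψ r := by
          rintro A B k θ rfl ⟨ψ, h0, hψ⟩
          refine ⟨ψ ∘ₗ k.toLinearMap, fun h => h0 ?_, fun r => ?_⟩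
          · refine LinearMap.ext fun x => ?_
            have := congrArg (fun g : V →ₗ[F] K => g (k.symm x)) h
            simpa using this
          · have := hψ (k r)
            have e1 : (k⁻¹ : V ≃ₗ[F] V) (k r) = r := k.symm_apply_apply r
            rw [LinearEquiv.mul_apply, LinearEquiv.mul_apply, e1] at this
            exact this
        have hw'' : w S = (h'⁻¹ * h)⁻¹ * w S' * ((h'⁻¹ * h)⁻¹)⁻¹ := by rw [hw']; group
        ext θ
        constructor
        · intro hθ
          have hθΘ := (mem_powersetCard.1 hS').1 hθ
          exact (hspec S hS θ hθΘ).2 (hsub hw' ((hspec S' hS' θ hθΘ).1 hθ))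
        · intro hθ
          have hθΘ := (mem_powersetCard.1 hS).1 hθ
          exact (hspec S' hS' θ hθΘ).2 (hsub hw'' ((hspec S hS θ hθΘ).1 hθ))
      subst hSS
      simp only [coe_filter, mem_univ, true_and]
      change h⁻¹ * h' * w S' = w S' * (h⁻¹ * h')
      calc h⁻¹ * h' * w S' = h⁻¹ * (h' * w S' * h'⁻¹) * h' := by group
        _ = _ := by rw [heq']; group
    · rintro ⟨S₁, h₁⟩ hx₁ ⟨S₂, h₂⟩ hx₂ h12
      have h12' : h₁ = h₂ := mul_left_cancel h12
      subst h12'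
      obtain ⟨hx₁, e₁⟩ := mem_filter.1 (mem_coe.1 hx₁)
      obtain ⟨hx₂, e₂⟩ := mem_filter.1 (mem_coe.1 hx₂)
      have hww : w S₁ = w S₂ := by
        have : h₁ * w S₁ * h₁⁻¹ = h₁ * w S₂ * h₁⁻¹ := e₁.trans e₂.symm
        simpa using this
      have hS₁ := (mem_product.1 hx₁).1
      have hS₂ := (mem_product.1 hx₂).1
      refine Prod.ext ?_ rfl
      ext θ
      constructor
      · intro hθ
        have hθΘ := (mem_powersetCard.1 hS₁).1 hθ
        exact (hspec S₂ hS₂ θ hθΘ).2 (hww ▸ (hspec S₁ hS₁ θ hθΘ).1 hθ)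
      · intro hθ
        have hθΘ := (mem_powersetCard.1 hS₂).1 hθ
        exact (hspec S₁ hS₁ θ hθΘ).2 (hww ▸ (hspec S₂ hS₂ θ hθΘ).1 hθ)
  have hD : #D = (#Θ).choose t * Fintype.card (V ≃ₗ[F] V) := by
    simp only [D, card_product, card_powersetCard, card_univ]
  rw [← hD]
  exact key.trans (Nat.mul_le_mul_left _ (card_le_card hmaps))

open scoped Classical in
/-- Rich elements are not too rare in any coset of the special linear group. -/
theorem card_rich_lower {d e t : ℕ} (hd : 6 ≤ d) (hn : finrank F V = 3 + e + d * t)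
    (hbig : 4 * finrank F V ≤ 2 ^ d) (δ : Fˣ) :
    (Fintype.card (V ≃ₗ[F] V) : ℝ) ≤
      (Fintype.card F : ℝ) ^ (3 + e + (3 + e) ^ 2) * (4 * finrank F V : ℝ) ^ t *
        #{w : V ≃ₗ[F] V | IsRich (Fintype.card F ^ d - 1) w ∧ LinearEquiv.det w = δ} := by
  obtain ⟨K, _, _, _, hK⟩ := exists_extension F (b := d) (by omega)
  obtain ⟨Θ, hΘ, hinj, hcard⟩ := exists_generators (F := F) (K := K) (by omega)
  have key := choose_mul_card_le (V := V) (by omega) Θ hΘ hinj (by rw [hK]; exact hn) δ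
  rw [hK] at hcard key
  set A := #{w : V ≃ₗ[F] V | IsRich (Fintype.card F ^ d - 1) w ∧ LinearEquiv.det w = δ}
  set q := Fintype.card F
  set n := finrank F V
  have hq : 2 ≤ q := Fintype.one_lt_card
  have h2q : 2 ^ d ≤ q ^ d := Nat.pow_le_pow_left hq d
  have hdt : d * t ≤ n := by omega
  -- the binomial coefficient is large
  have hΘt : 2 * t ≤ #Θ := by
    have : 2 * d * (2 * t) ≤ 2 * d * #Θ := by
      calc 2 * d * (2 * t) = 4 * (d * t) := by ring
        _ ≤ 4 * n := by omega
        _ ≤ _ := hbig.trans (h2q.trans hcard)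
    exact Nat.le_of_mul_le_mul_left this (by omega)
  have hch : q ^ (d * t) ≤ (4 * n) ^ t * (#Θ).choose t := by
    have h1 : (#Θ + 1 - t) ^ t ≤ t.factorial * (#Θ).choose t := by
      have := Nat.pow_le_choose (α := ℚ) t #Θ
      rw [div_le_iff₀ (by positivity)] at this
      rw [mul_comm]
      exact_mod_cast this
    have h2 : t.factorial ≤ t ^ t := Nat.factorial_le_pow t
    have h3 : q ^ d ≤ 4 * d * (#Θ + 1 - t) := by
      refine hcard.trans ?_
      have : #Θ ≤ 2 * (#Θ + 1 - t) := by omega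
      calc 2 * d * #Θ ≤ 2 * d * (2 * (#Θ + 1 - t)) := Nat.mul_le_mul_left _ this
        _ = _ := by ring
    calc q ^ (d * t) = (q ^ d) ^ t := pow_mul _ _ _
      _ ≤ (4 * d * (#Θ + 1 - t)) ^ t := Nat.pow_le_pow_left h3 t
      _ = (4 * d) ^ t * (#Θ + 1 - t) ^ t := mul_pow _ _ _
      _ ≤ (4 * d) ^ t * (t ^ t * (#Θ).choose t) :=
          Nat.mul_le_mul_left _ (h1.trans (Nat.mul_le_mul_right _ h2))
      _ = (4 * (d * t)) ^ t * (#Θ).choose t := by rw [← mul_assoc, ← mul_pow, mul_assoc 4]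
      _ ≤ _ := Nat.mul_le_mul_right _ (Nat.pow_le_pow_left (by omega) t)
  have hfin : q ^ (d * t) * Fintype.card (V ≃ₗ[F] V) ≤
      q ^ (d * t) * (q ^ (3 + e + (3 + e) ^ 2) * (4 * n) ^ t * A) := by
    calc q ^ (d * t) * Fintype.card (V ≃ₗ[F] V) ≤
        (4 * n) ^ t * (#Θ).choose t * Fintype.card (V ≃ₗ[F] V) := Nat.mul_le_mul_right _ hch
      _ = (4 * n) ^ t * ((#Θ).choose t * Fintype.card (V ≃ₗ[F] V)) := by ring
      _ ≤ (4 * n) ^ t * (q ^ (n + (3 + e) ^ 2) * A) := Nat.mul_le_mul_left _ key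
      _ = _ := by
        rw [hn, show 3 + e + d * t + (3 + e) ^ 2 = d * t + (3 + e + (3 + e) ^ 2) by ring,
          pow_add q (d * t)]
        ring
  have := Nat.le_of_mul_le_mul_left hfin (by positivity)
  exact_mod_cast this

end

section

variable {F V : Type*} [Field F] [Fintype F] [AddCommGroup V] [Module F V] [Fintype V]

/-- The positive word with prescribed letters. -/
def posWord {L : ℕ} (i : Fin L → Bool) : List (Bool × Bool) := List.ofFn fun k => (i k, true)

theorem posWord_injective {L : ℕ} : Function.Injective (posWord (L := L)) := by
  intro i j h
  have := List.ofFn_injective h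
  funext k
  exact congrArg Prod.fst (congrFun this k)

theorem exists_wordTree_pair {L : ℕ} (i j : Fin L → Bool) :
    ∃ T : Finset (List (Bool × Bool)), IsWordTree T ∧ posWord i ∈ T ∧ posWord j ∈ T ∧
      #T ≤ 2 * L + 2 := by
  classical
  have hpos : ∀ k : Fin L → Bool, ∀ c ∈ posWord k, c.2 = true := by
    intro k c hc
    obtain ⟨x, rfl⟩ := List.mem_ofFn.1 hc
    rfl
  refine ⟨(posWord i).tails.toFinset ∪ (posWord j).tails.toFinset, ⟨by simp, ?_, ?_⟩, by simp,
    by simp, ?_⟩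
  · intro c l h
    simp only [mem_union, List.mem_toFinset, List.mem_tails] at h ⊢
    exact h.imp (fun h => (List.suffix_cons c l).trans h) fun h => (List.suffix_cons c l).trans h
  · intro b s s' l h
    simp only [mem_union, List.mem_toFinset, List.mem_tails] at h
    have h1 : s = true ∧ s' = true := by
      rcases h with h | h
      · exact ⟨hpos i (b, s) (h.subset (by simp)), hpos i (b, s') (h.subset (by simp))⟩
      · exact ⟨hpos j (b, s) (h.subset (by simp)), hpos j (b, s') (h.subset (by simp))⟩
    rw [h1.1, h1.2]
  · refine (card_union_le _ _).trans ?_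
    have h := fun k : Fin L → Bool => List.toFinset_card_le (posWord k).tails
    have h2 : ∀ k : Fin L → Bool, (posWord k).tails.length = L + 1 := by
      intro k; simp [posWord]
    have h3 := h i
    have h4 := h j
    rw [h2] at h3 h4
    omega

theorem ne_smul_of_linearIndependent {ι : Type*} {v : ι → V} (h : LinearIndependent F v) {i j : ι}
    (hij : i ≠ j) (c : F) : v j ≠ c • v i := by
  intro hv
  refine h.notMem_span_image (s := {i}) (x := j) (by simpa using hij.symm) ?_
  rw [Set.image_singleton, hv]
  exact Submodule.smul_mem _ _ (Submodule.mem_span_singleton_self _)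

/-- All eigenspaces have at most `q ^ a` elements. -/
def SmallEigenspaces (a : ℕ) (g : V ≃ₗ[F] V) : Prop :=
  ∀ c : F, Nat.card (LinearMap.ker ((g : V →ₗ[F] V) - c • (LinearMap.id : V →ₗ[F] V))) ≤
    Fintype.card F ^ a

open scoped Classical in
theorem card_le_card_not_linearIndependent {ι : Type*} (h : ι → V ≃ₗ[F] V) {i j : ι} (hij : i ≠ j)
    {a : ℕ} (ha : ¬ SmallEigenspaces a (h j * (h i)⁻¹)) :
    Fintype.card F ^ a ≤ #{v : V | ¬ LinearIndependent F (fun l => h l v)} := by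
  obtain ⟨c, hc⟩ := not_forall.1 ha
  refine (le_of_lt (not_le.1 hc)).trans ?_
  rw [Nat.card_eq_fintype_card, Fintype.card_subtype]
  refine card_le_card_of_injOn (fun v => (h i)⁻¹ v) ?_ (fun _ _ _ _ h => (LinearEquiv.injective _) h)
  intro v hv
  simp only [coe_filter, mem_univ, true_and, Set.mem_ofPred_eq, LinearMap.mem_ker,
    LinearMap.sub_apply, LinearMap.smul_apply, LinearMap.id_apply, sub_eq_zero] at hv ⊢
  intro hli
  have e1 : h i ((h i)⁻¹ v) = v := LinearEquiv.apply_symm_apply _ v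
  have e2 : h j ((h i)⁻¹ v) = c • v := hv
  have h := ne_smul_of_linearIndependent hli hij c
  simp only [e1, e2] at h
  exact h rfl

open scoped Classical in
/-- Quotients of two different words rarely have a large eigenspace. -/
theorem card_large_eigenspace_le {G : Subgroup (V ≃ₗ[F] V)} (hG : ContainsSL G)
    {T : Finset (List (Bool × Bool))} (hT : IsWordTree T) (hcard : #T ≤ finrank F V)
    {l₁ l₂ : List (Bool × Bool)} (h₁ : l₁ ∈ T) (h₂ : l₂ ∈ T) (hne : l₁ ≠ l₂) (a : ℕ) :
    (#{g : Bool → G | ¬ SmallEigenspaces a (evalWord (fun b => (g b : V ≃ₗ[F] V)) l₂ *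
        (evalWord (fun b => (g b : V ≃ₗ[F] V)) l₁)⁻¹)} : ℝ) * (Fintype.card F : ℝ) ^ a ≤
      (Fintype.card G : ℝ) ^ 2 * (Fintype.card F : ℝ) ^ #T := by
  have key := card_not_linearIndependent_tree_le hG hT hcard
  rw [Fintype.card_bool] at key
  set B : Finset (Bool → G) := {g : Bool → G | ¬ SmallEigenspaces a
    (evalWord (fun b => (g b : V ≃ₗ[F] V)) l₂ * (evalWord (fun b => (g b : V ≃ₗ[F] V)) l₁)⁻¹)}
    with hB
  have hfib : ∀ g ∈ B, Fintype.card F ^ a ≤ #{v : V | ¬ LinearIndependent F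
        (fun l : T => evalWord (fun b => (g b : V ≃ₗ[F] V)) l v)} := by
    intro g hg
    rw [hB, mem_filter] at hg
    have hne' : (⟨l₁, h₁⟩ : T) ≠ ⟨l₂, h₂⟩ := fun h => hne (congrArg Subtype.val h)
    exact card_le_card_not_linearIndependent
      (fun l : T => evalWord (fun b => (g b : V ≃ₗ[F] V)) l) hne' hg.2
  have hsum : #B * Fintype.card F ^ a ≤ #{z : (Bool → G) × V | ¬ LinearIndependent F
        (fun l : T => evalWord (fun b => (z.1 b : V ≃ₗ[F] V)) l z.2)} := by
    have h1 : #B * Fintype.card F ^ a ≤ ∑ g ∈ B, #{v : V | ¬ LinearIndependent F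
        (fun l : T => evalWord (fun b => (g b : V ≃ₗ[F] V)) l v)} := by
      rw [← smul_eq_mul]
      exact card_nsmul_le_sum _ _ _ hfib
    refine h1.trans ?_
    rw [← card_sigma]
    refine card_le_card_of_injOn (fun x => (x.1, x.2)) ?_ ?_
    · rintro ⟨g, v⟩ h
      simpa using (mem_sigma.1 (mem_coe.1 h)).2
    · rintro ⟨g, v⟩ _ ⟨g', v'⟩ _ h
      simp only [Prod.mk.injEq] at h
      obtain ⟨rfl, rfl⟩ := h
      rfl
  have hsum' : (#B : ℝ) * (Fintype.card F : ℝ) ^ a ≤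
      (#{z : (Bool → G) × V | ¬ LinearIndependent F
        (fun l : T => evalWord (fun b => (z.1 b : V ≃ₗ[F] V)) l z.2)} : ℝ) := by
    exact_mod_cast hsum
  refine hsum'.trans (le_of_eq_of_le ?_ key)
  congr!

end

section

variable {F V : Type*} [Field F] [Fintype F] [AddCommGroup V] [Module F V] [Fintype V]

open scoped Classical in
/-- The proportion of elements with property `P` in a determinant coset. -/
noncomputable def detDensity (P : (V ≃ₗ[F] V) → Prop) (δ : Fˣ) : ℝ :=
  (#{w : V ≃ₗ[F] V | P w ∧ LinearEquiv.det w = δ} : ℝ) / Nat.card (slSub F V)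

open scoped Classical in
/-- The balanced indicator function of a property on a group containing `SL`. -/
noncomputable def balanced (G : Subgroup (V ≃ₗ[F] V)) (P : (V ≃ₗ[F] V) → Prop)
    (w : V ≃ₗ[F] V) : ℝ :=
  if w ∈ G then (if P w then 1 else 0) - detDensity P (LinearEquiv.det w) else 0

theorem mem_iff_of_det_eq {G : Subgroup (V ≃ₗ[F] V)} (hG : ContainsSL G) {g h : V ≃ₗ[F] V}
    (hd : LinearEquiv.det g = LinearEquiv.det h) : g ∈ G ↔ h ∈ G := by
  have h1 : g * h⁻¹ ∈ G := hG _ (by rw [map_mul, map_inv, hd, mul_inv_cancel])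
  constructor
  · intro hg
    have := G.mul_mem (G.inv_mem h1) hg
    simpa using this
  · intro hh
    have := G.mul_mem h1 hh
    simpa using this

theorem isClassFun_balanced {G : Subgroup (V ≃ₗ[F] V)} (hG : ContainsSL G)
    {P : (V ≃ₗ[F] V) → Prop} (hP : ∀ g w, P (g * w * g⁻¹) ↔ P w) :
    IsClassFun (balanced G P) := by
  classical
  intro h z
  have hd : LinearEquiv.det (h * z * h⁻¹) = LinearEquiv.det z := by
    rw [map_mul, map_mul, map_inv, mul_comm, inv_mul_cancel_left]
  simp only [balanced, mem_iff_of_det_eq hG hd, hd, hP]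

open scoped Classical in
theorem card_slSub_translate (P : (V ≃ₗ[F] V) → Prop) (z : V ≃ₗ[F] V) [Fintype (slSub F V)] :
    #{s : slSub F V | P (s * z)} =
      #{w : V ≃ₗ[F] V | P w ∧ LinearEquiv.det w = LinearEquiv.det z} := by
  refine card_bij (fun s _ => (s : V ≃ₗ[F] V) * z) ?_ ?_ ?_
  · intro s hs
    have := mem_slSub.1 s.2
    simp only [mem_filter, mem_univ, true_and] at hs ⊢
    exact ⟨hs, by rw [map_mul, this, one_mul]⟩
  · intro s _ t _ h
    exact Subtype.ext (mul_right_cancel h)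
  · intro w hw
    simp only [mem_filter, mem_univ, true_and] at hw
    refine ⟨⟨w * z⁻¹, mem_slSub.2 (by rw [map_mul, map_inv, hw.2, mul_inv_cancel])⟩, ?_, ?_⟩
    · simpa using hw.1
    · simp

theorem sum_balanced {G : Subgroup (V ≃ₗ[F] V)} (hG : ContainsSL G) (P : (V ≃ₗ[F] V) → Prop)
    [Fintype (slSub F V)] (z : V ≃ₗ[F] V) : ∑ s : slSub F V, balanced G P (s * z) = 0 := by
  classical
  have hd : ∀ s : slSub F V, LinearEquiv.det ((s : V ≃ₗ[F] V) * z) = LinearEquiv.det z := by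
    intro s
    rw [map_mul, mem_slSub.1 s.2, one_mul]
  simp only [balanced, mem_iff_of_det_eq hG (hd _), hd]
  by_cases hz : z ∈ G
  · simp only [hz, if_true, sum_sub_distrib, sum_boole, sum_const, card_univ, nsmul_eq_mul,
      detDensity, card_slSub_translate, Nat.card_eq_fintype_card]
    rw [mul_div_cancel₀]
    · simp
    · exact_mod_cast Fintype.card_ne_zero
  · simp [hz]

theorem detDensity_mem (P : (V ≃ₗ[F] V) → Prop) (z : V ≃ₗ[F] V) :
    0 ≤ detDensity P (LinearEquiv.det z) ∧ detDensity P (LinearEquiv.det z) ≤ 1 := by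
  classical
  have : Fintype (slSub F V) := Fintype.ofFinite _
  refine ⟨by unfold detDensity; positivity, ?_⟩
  unfold detDensity
  rw [← card_slSub_translate]
  refine div_le_one_of_le₀ ?_ (by positivity)
  rw [Nat.card_eq_fintype_card]
  exact_mod_cast card_filter_le _ _

theorem corr_balanced_one_le (G : Subgroup (V ≃ₗ[F] V)) (P : (V ≃ₗ[F] V) → Prop) :
    corr (balanced G P) 1 ≤ Nat.card G := by
  classical
  rw [corr_one]
  have : ∀ z, balanced G P z ^ 2 ≤ if z ∈ G then 1 else 0 := by
    intro z
    unfold balanced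
    have := detDensity_mem P z
    split_ifs with h1 h2
    · nlinarith
    · nlinarith
    · simp
  refine (sum_le_sum fun z _ => this z).trans ?_
  rw [sum_boole, Nat.card_eq_fintype_card]
  have : Fintype.card G = #{z : V ≃ₗ[F] V | z ∈ G} := Fintype.card_subtype _
  rw [this]

theorem le_detDensity {P : (V ≃ₗ[F] V) → Prop} {α : ℝ} (h0 : 0 ≤ α) {δ : Fˣ}
    (h : α * Fintype.card (V ≃ₗ[F] V) ≤
      Nat.card {w : V ≃ₗ[F] V // P w ∧ LinearEquiv.det w = δ}) : α ≤ detDensity P δ := by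
  classical
  unfold detDensity
  have hpos : (0 : ℝ) < Nat.card (slSub F V) := by exact_mod_cast Nat.card_pos
  rw [le_div_iff₀ hpos]
  rw [Nat.card_eq_fintype_card, Fintype.card_subtype] at h
  refine le_trans (mul_le_mul_of_nonneg_left ?_ h0) h
  rw [← Nat.card_eq_fintype_card]
  exact_mod_cast Finite.card_subtype_le _

open scoped Classical in
/-- Second moment bound for the number of words hitting a conjugation invariant set. -/
theorem card_no_hit_mul_le {G : Subgroup (V ≃ₗ[F] V)} (hG : ContainsSL G)
    {P : (V ≃ₗ[F] V) → Prop} {α : ℝ} (h0 : 0 ≤ α)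
    (hα : ∀ δ, α * Fintype.card (V ≃ₗ[F] V) ≤
      Nat.card {w : V ≃ₗ[F] V // P w ∧ LinearEquiv.det w = δ})
    {I : Type*} [Fintype I] (u : I → G) :
    (#{z : G | ∀ i, ¬ P (u i * z)} : ℝ) * (Fintype.card I * α) ^ 2 ≤
      ∑ i, ∑ j, corr (balanced G P) (u j * (u i : V ≃ₗ[F] V)⁻¹) := by
  set f := balanced G P
  have h1 : ∑ i, ∑ j, corr f (u j * (u i : V ≃ₗ[F] V)⁻¹) =
      ∑ z, (∑ i, f (u i * z)) ^ 2 := by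
    simp only [← sum_mul_translate]
    rw [sum_congr rfl fun i _ => sum_comm, sum_comm]
    refine sum_congr rfl fun z _ => ?_
    rw [sq, sum_mul_sum]
  rw [h1]
  have h2 : ∑ z ∈ ({z : G | ∀ i, ¬ P (u i * z)} : Finset G).map ⟨Subtype.val, Subtype.val_injective⟩,
      (∑ i, f (u i * z)) ^ 2 ≤ ∑ z, (∑ i, f (u i * z)) ^ 2 :=
    sum_le_sum_of_subset_of_nonneg (subset_univ _) fun _ _ _ => sq_nonneg _
  refine le_trans ?_ h2
  rw [sum_map, ← nsmul_eq_mul]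
  refine card_nsmul_le_sum _ _ _ fun z hz => ?_
  have hz' := (mem_filter.1 hz).2
  have h3 : ∑ i, f (u i * (z : V ≃ₗ[F] V)) ≤ -(Fintype.card I * α) := by
    have : ∀ i, f (u i * (z : V ≃ₗ[F] V)) ≤ -α := by
      intro i
      have hm : (u i : V ≃ₗ[F] V) * z ∈ G := G.mul_mem (u i).2 z.2
      have := le_detDensity h0 (hα (LinearEquiv.det ((u i : V ≃ₗ[F] V) * (z : V ≃ₗ[F] V))))
      simp only [f, balanced, if_pos hm, if_neg (hz' i)]
      linarith
    refine (sum_le_sum fun i _ => this i).trans ?_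
    simp
  have h4 : 0 ≤ Fintype.card I * α := by positivity
  simp only [Function.Embedding.coeFn_mk]
  nlinarith

theorem evalWord_mem {Γ α : Type*} [Group Γ] {G : Subgroup Γ} (g : α → G) (l : List (α × Bool)) :
    evalWord (fun b => (g b : Γ)) l ∈ G := by
  induction l with
  | nil => exact G.one_mem
  | cons c l ih =>
    obtain ⟨b, _ | _⟩ := c
    · exact G.mul_mem (G.inv_mem (g b).2) ih
    · exact G.mul_mem (g b).2 ih

open scoped Classical in
/-- With high probability, some positive word times a random element is rich. -/
theorem card_no_rich_le {G : Subgroup (V ≃ₗ[F] V)} (hG : ContainsSL G)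
    {P : (V ≃ₗ[F] V) → Prop} (hP : ∀ g w, P (g * w * g⁻¹) ↔ P w) {α : ℝ} (h0 : 0 ≤ α)
    (hα : ∀ δ, α * Fintype.card (V ≃ₗ[F] V) ≤
      Nat.card {w : V ≃ₗ[F] V // P w ∧ LinearEquiv.det w = δ})
    {a L : ℕ} (ha : 13 ≤ a) (h1 : 8 * a ≤ finrank F V) (h2 : finrank F V ≤ 8 * a + 7)
    (hL : 2 * L + 2 ≤ a) {τ : ℝ} (hτ0 : 0 ≤ τ) (hτ : τ ^ 8 * (Fintype.card F : ℝ) ^ a = 1) :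
    (#{x : (Bool → G) × G | ∀ i : Fin L → Bool,
        ¬ P (evalWord (fun b => (x.1 b : V ≃ₗ[F] V)) (posWord i) * x.2)} : ℝ) * α ^ 2 ≤
      (Nat.card G : ℝ) ^ 3 * (1 / 2 ^ L + (Fintype.card F : ℝ) ^ (2 * L + 2) /
        (Fintype.card F : ℝ) ^ a + 2 * τ) := by
  have : Fintype (slSub F V) := Fintype.ofFinite _
  set f := balanced G P with hfd
  have hf : IsClassFun f := isClassFun_balanced hG hP
  have hD := corr_sq_mul_le_centralizer (by omega) hf (sum_balanced hG P)
  have hc1 : corr f 1 ≤ Nat.card G := corr_balanced_one_le G P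
  set N : ℝ := (Nat.card G : ℝ) with hN
  have hN0 : 0 ≤ N := by positivity
  set q : ℝ := (Fintype.card F : ℝ) with hq
  have hq2 : 1 ≤ q := by rw [hq]; exact_mod_cast Fintype.card_pos
  let u : (Bool → G) → (Fin L → Bool) → G := fun g i =>
    ⟨evalWord (fun b => (g b : V ≃ₗ[F] V)) (posWord i), evalWord_mem g _⟩
  set M : ℝ := (Fintype.card (Fin L → Bool) : ℝ) with hM
  have hM2 : M = 2 ^ L := by simp [hM]
  have hsplit : (#{x : (Bool → G) × G | ∀ i : Fin L → Bool, ¬ P (u x.1 i * x.2)} : ℝ) =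
      ∑ g : Bool → G, (#{z : G | ∀ i, ¬ P (u g i * z)} : ℝ) := by
    rw [← Nat.cast_sum, ← card_sigma]
    congr 1
    refine card_bij (fun x _ => ⟨x.1, x.2⟩) ?_ ?_ ?_
    · intro x hx; simpa using hx
    · rintro ⟨a, b⟩ _ ⟨c, d⟩ _ h
      simp only [Sigma.mk.injEq, heq_eq_eq] at h
      rw [h.1, h.2]
    · rintro ⟨a, b⟩ h
      exact ⟨(a, b), by simpa using h, rfl⟩
  have hpair : ∀ i j, ∑ g : Bool → G, corr f ((u g j : V ≃ₗ[F] V) * (u g i : V ≃ₗ[F] V)⁻¹) ≤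
      N ^ 3 * ((if i = j then 1 else 0) + q ^ (2 * L + 2) / q ^ a + 2 * τ) := by
    intro i j
    have hcardf : (Fintype.card (Bool → G) : ℝ) = N ^ 2 := by
      simp [hN]
    by_cases hij : i = j
    · subst hij
      have : ∀ g : Bool → G, corr f (u g i * (u g i : V ≃ₗ[F] V)⁻¹) ≤ N := by
        intro g; rw [mul_inv_cancel]; exact hc1
      refine (sum_le_sum fun g _ => this g).trans ?_
      rw [sum_const, card_univ, nsmul_eq_mul, hcardf, if_pos rfl]
      have h5 : 0 ≤ q ^ (2 * L + 2) / q ^ a := by positivity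
      have h6 : 0 ≤ N ^ 3 := by positivity
      nlinarith [mul_nonneg h6 h5, mul_nonneg h6 hτ0]
    · obtain ⟨T, hT, hi, hj, hTc⟩ := exists_wordTree_pair i j
      have hbad := card_large_eigenspace_le hG hT (by omega) hi hj
        (fun h => hij (posWord_injective h)) a
      set B : Finset (Bool → G) := {g : Bool → G | ¬ SmallEigenspaces a
        (evalWord (fun b => (g b : V ≃ₗ[F] V)) (posWord j) *
          (evalWord (fun b => (g b : V ≃ₗ[F] V)) (posWord i))⁻¹)} with hB
      have hpt : ∀ g : Bool → G, corr f ((u g j : V ≃ₗ[F] V) * (u g i : V ≃ₗ[F] V)⁻¹) ≤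
          (if g ∈ B then N else 0) + 2 * τ * N := by
        intro g
        have hτN : 0 ≤ 2 * τ * N := by positivity
        by_cases hg : g ∈ B
        · rw [if_pos hg]
          have := (le_abs_self _).trans (abs_corr_le f ((u g j : V ≃ₗ[F] V) * (u g i : V ≃ₗ[F] V)⁻¹))
          linarith
        · rw [if_neg hg, zero_add]
          have hs : SmallEigenspaces a ((u g j : V ≃ₗ[F] V) * (u g i : V ≃ₗ[F] V)⁻¹) := by
            by_contra hs
            exact hg (by rw [hB, mem_filter]; exact ⟨mem_univ _, hs⟩)
          refine (le_abs_self _).trans ((corr_generic_le hf ha h1 h2 hD hs hτ0 hτ).trans ?_)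
          exact mul_le_mul_of_nonneg_left hc1 (by positivity)
      refine (sum_le_sum fun g _ => hpt g).trans ?_
      rw [sum_add_distrib, sum_const, card_univ, nsmul_eq_mul, hcardf, if_neg hij, ← sum_filter,
        sum_const, nsmul_eq_mul, filter_mem_eq_inter, univ_inter]
      have hqa : 0 < q ^ a := by positivity
      have hB' : (#B : ℝ) ≤ N ^ 2 * (q ^ (2 * L + 2) / q ^ a) := by
        rw [mul_div_assoc', le_div_iff₀ hqa]
        refine hbad.trans ?_
        rw [← Nat.card_eq_fintype_card (α := G)]
        exact mul_le_mul_of_nonneg_left (pow_le_pow_right₀ hq2 hTc) (by positivity)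
      nlinarith [mul_le_mul_of_nonneg_right hB' hN0]
  have hsum : (#{x : (Bool → G) × G | ∀ i : Fin L → Bool, ¬ P (u x.1 i * x.2)} : ℝ) * (M * α) ^ 2 ≤
      ∑ i : Fin L → Bool, ∑ j : Fin L → Bool, N ^ 3 * ((if i = j then 1 else 0) + q ^ (2 * L + 2) / q ^ a + 2 * τ) := by
    rw [hsplit, sum_mul]
    refine (sum_le_sum fun g _ => card_no_hit_mul_le hG h0 hα (u g)).trans ?_
    rw [sum_comm]
    refine sum_le_sum fun i _ => ?_
    rw [sum_comm]
    exact sum_le_sum fun j _ => hpair i j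
  have hrhs : ∑ i : Fin L → Bool, ∑ j : Fin L → Bool,
      N ^ 3 * ((if i = j then 1 else 0) + q ^ (2 * L + 2) / q ^ a + 2 * τ) =
      M ^ 2 * (N ^ 3 * (1 / 2 ^ L + q ^ (2 * L + 2) / q ^ a + 2 * τ)) := by
    simp only [← mul_sum, sum_add_distrib, sum_ite_eq, mem_univ, if_true, sum_const, card_univ,
      nsmul_eq_mul, ← hM]
    rw [hM2]
    field_simp
  rw [hrhs] at hsum
  have hMpos : 0 < M ^ 2 := by rw [hM2]; positivity
  refine le_of_mul_le_mul_left ?_ hMpos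
  calc M ^ 2 * (_ * α ^ 2) = _ * (M * α) ^ 2 := by rw [mul_pow]; ring
    _ ≤ _ := hsum

end

section

variable {F V : Type*} [Field F] [Fintype F] [AddCommGroup V] [Module F V] [Fintype V]

/-- Every subspace of at most half the dimension grows by a factor `11 / 10` when its two images
are added. -/
def Expands (g₁ g₂ : V ≃ₗ[F] V) : Prop :=
  ∀ X : Submodule F V, 2 * finrank F X ≤ finrank F V →
    11 * finrank F X ≤ 10 * finrank F
      (X ⊔ X.map (g₁ : V →ₗ[F] V) ⊔ X.map (g₂ : V →ₗ[F] V) : Submodule F V)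

theorem exists_span_eq (C : Submodule F V) {r : ℕ} (h : finrank F C ≤ r) :
    ∃ c : Fin r → V, Submodule.span F (Set.range c) = C := by
  let b := finBasis F C
  refine ⟨fun i => if hi : (i : ℕ) < finrank F C then b ⟨i, hi⟩ else 0, le_antisymm ?_ ?_⟩
  · rw [Submodule.span_le]
    rintro _ ⟨i, rfl⟩
    dsimp only
    split_ifs
    · exact (b _).2
    · exact C.zero_mem
  · have h1 : C = (Submodule.span F (Set.range b)).map C.subtype := by
      rw [b.span_eq, Submodule.map_top, Submodule.range_subtype]
    conv_lhs => rw [h1]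
    rw [Submodule.map_span, Submodule.span_le]
    rintro _ ⟨_, ⟨i, rfl⟩, rfl⟩
    refine Submodule.subset_span ⟨⟨i, lt_of_lt_of_le i.2 h⟩, ?_⟩
    simp

theorem exists_sup_span_eq {X W : Submodule F V} (hXW : X ≤ W) {r : ℕ}
    (h : finrank F W ≤ finrank F X + r) :
    ∃ c : Fin r → V, X ⊔ Submodule.span F (Set.range c) = W := by
  obtain ⟨X', hX'⟩ := Submodule.exists_isCompl X
  have h1 : X ⊔ X' ⊓ W = W := by
    rw [← sup_inf_assoc_of_le _ hXW, hX'.sup_eq_top, top_inf_eq]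
  have h2 : X ⊓ (X' ⊓ W) = ⊥ := by
    rw [← inf_assoc, hX'.inf_eq_bot, bot_inf_eq]
  have h3 := Submodule.finrank_sup_add_finrank_inf_eq X (X' ⊓ W)
  rw [h1, h2, finrank_bot] at h3
  obtain ⟨c, hc⟩ := exists_span_eq (X' ⊓ W) (r := r) (by omega)
  exact ⟨c, by rw [hc, h1]⟩

theorem pow_le_numIndep {W : Type*} [AddCommGroup W] [Module F W] [Fintype W] {k : ℕ}
    (hk : finrank F W = k) : Fintype.card F ^ (k * (k - 1)) ≤ numIndep F W (Fin k) := by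
  rw [numIndep_eq_prod hk.ge, hk]
  have hq : 2 ≤ Fintype.card F := Fintype.one_lt_card
  have : ∀ i ∈ (univ : Finset (Fin k)), Fintype.card F ^ (k - 1) ≤
      Fintype.card F ^ k - Fintype.card F ^ (i : ℕ) := by
    intro i _
    have h1 : Fintype.card F ^ (i : ℕ) ≤ Fintype.card F ^ (k - 1) :=
      Nat.pow_le_pow_right (by omega) (by omega)
    have h2 : Fintype.card F ^ k = Fintype.card F * Fintype.card F ^ (k - 1) := by
      have := i.2
      rw [← pow_succ']; congr 1; omega
    have h3 : 2 * Fintype.card F ^ (k - 1) ≤ Fintype.card F * Fintype.card F ^ (k - 1) :=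
      Nat.mul_le_mul_right _ hq
    omega
  have h := prod_le_prod' this
  rw [prod_const, card_univ, Fintype.card_fin, ← pow_mul, mul_comm] at h
  exact h

open scoped Classical in
theorem card_not_expands_dim_le {G : Subgroup (V ≃ₗ[F] V)} (hG : ContainsSL G) {k r : ℕ}
    (hk : k < finrank F V) (hkr : k + r ≤ finrank F V) :
    #{g : G × G | ∃ X : Submodule F V, finrank F X = k ∧ finrank F
      (X ⊔ X.map ((g.1 : V ≃ₗ[F] V) : V →ₗ[F] V) ⊔ X.map ((g.2 : V ≃ₗ[F] V) : V →ₗ[F] V) :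
        Submodule F V) ≤ k + r} *
      Fintype.card F ^ (k * (k - 1) + 2 * (k * (finrank F V - (k + r)))) ≤
      Fintype.card F ^ (finrank F V * (k + r)) * Fintype.card G ^ 2 := by
  set q := Fintype.card F with hq
  set n := finrank F V with hn
  have hq1 : 1 ≤ q := Fintype.card_pos
  let Y : (Fin k → V) × (Fin r → V) → Submodule F V := fun b =>
    Submodule.span F (Set.range b.1) ⊔ Submodule.span F (Set.range b.2)
  have hY : ∀ b, finrank F (Y b) ≤ k + r := by
    intro b
    refine (Submodule.finrank_add_le_finrank_add_finrank _ _).trans ?_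
    have h1 := finrank_range_le_card (R := F) b.1
    have h2 := finrank_range_le_card (R := F) b.2
    rw [Fintype.card_fin] at h1 h2
    unfold Set.finrank at h1 h2
    omega
  let R : G × G → (Fin k → V) × (Fin r → V) → Prop := fun g b => LinearIndependent F b.1 ∧
    (∀ i, (g.1 : V ≃ₗ[F] V) (b.1 i) ∈ Y b) ∧ ∀ i, (g.2 : V ≃ₗ[F] V) (b.1 i) ∈ Y b
  set B : Finset (G × G) := {g : G × G | ∃ X : Submodule F V, finrank F X = k ∧ finrank F
      (X ⊔ X.map ((g.1 : V ≃ₗ[F] V) : V →ₗ[F] V) ⊔ X.map ((g.2 : V ≃ₗ[F] V) : V →ₗ[F] V) :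
        Submodule F V) ≤ k + r} with hB
  have hlow : ∀ g ∈ B, q ^ (k * (k - 1)) ≤ #(bipartiteAbove R univ g) := by
    intro g hg
    obtain ⟨X, hX, hW⟩ := (mem_filter.1 hg).2
    set W : Submodule F V := X ⊔ X.map ((g.1 : V ≃ₗ[F] V) : V →ₗ[F] V) ⊔
      X.map ((g.2 : V ≃ₗ[F] V) : V →ₗ[F] V) with hWd
    have hXW : X ≤ W := le_sup_left.trans le_sup_left
    obtain ⟨c, hc⟩ := exists_sup_span_eq hXW (r := r) (by omega)
    refine (pow_le_numIndep hX).trans ?_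
    unfold numIndep
    refine card_le_card_of_injOn (fun s => (fun i => (s i : V), c)) ?_ ?_
    · intro s hs
      have hs' : LinearIndependent F s := by simpa using hs
      have hli : LinearIndependent F (fun i => (s i : V)) :=
        hs'.map' X.subtype (Submodule.ker_subtype X)
      have hsp : Submodule.span F (Set.range (fun i => (s i : V))) = X := by
        refine Submodule.eq_of_le_of_finrank_eq ?_ ?_
        · rw [Submodule.span_le]
          rintro _ ⟨i, rfl⟩
          exact (s i).2
        · rw [finrank_span_eq_card hli, Fintype.card_fin, hX]
      have hYW : Y (fun i => (s i : V), c) = W := by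
        simp only [Y]; rw [hsp, hc]
      simp only [bipartiteAbove, coe_filter, mem_univ, true_and, Set.mem_ofPred_eq, R]
      refine ⟨hli, fun i => ?_, fun i => ?_⟩
      · rw [hYW]
        exact (le_sup_right.trans le_sup_left : X.map ((g.1 : V ≃ₗ[F] V) : V →ₗ[F] V) ≤ W)
          (Submodule.mem_map_of_mem (s i).2)
      · rw [hYW]
        exact (le_sup_right : X.map ((g.2 : V ≃ₗ[F] V) : V →ₗ[F] V) ≤ W)
          (Submodule.mem_map_of_mem (s i).2)
    · intro s _ t _ h
      funext i
      exact Subtype.ext (congrFun (congrArg Prod.fst h) i)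
  have hup : ∀ b, #(bipartiteBelow R B b) * q ^ (2 * (k * (n - (k + r)))) ≤ Fintype.card G ^ 2 := by
    intro b
    by_cases hli : LinearIndependent F b.1
    · have h1 := card_map_mem_submodule_mul_le hG hli (Y b) hk
      have h2 : #(bipartiteBelow R B b) ≤ #{x : G | ∀ i, (x : V ≃ₗ[F] V) (b.1 i) ∈ Y b} ^ 2 := by
        rw [sq, ← card_product]
        refine card_le_card fun g hg => ?_
        have := (mem_filter.1 hg).2
        simp only [mem_product, mem_filter, mem_univ, true_and]
        exact ⟨this.2.1, this.2.2⟩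
      have h3 : q ^ (k * (n - (k + r))) ≤ q ^ (k * (n - finrank F (Y b))) :=
        Nat.pow_le_pow_right hq1 (Nat.mul_le_mul_left _ (by have := hY b; omega))
      calc #(bipartiteBelow R B b) * q ^ (2 * (k * (n - (k + r))))
          ≤ #{x : G | ∀ i, (x : V ≃ₗ[F] V) (b.1 i) ∈ Y b} ^ 2 *
            (q ^ (k * (n - finrank F (Y b)))) ^ 2 := by
            rw [mul_comm 2, pow_mul]
            exact Nat.mul_le_mul h2 (Nat.pow_le_pow_left h3 2)
        _ = (#{x : G | ∀ i, (x : V ≃ₗ[F] V) (b.1 i) ∈ Y b} *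
            q ^ (k * (n - finrank F (Y b)))) ^ 2 := (mul_pow _ _ _).symm
        _ ≤ _ := Nat.pow_le_pow_left h1 2
    · have : #(bipartiteBelow R B b) = 0 := by
        rw [card_eq_zero]
        refine filter_eq_empty_iff.2 fun g _ h => hli h.1
      simp [this]
  have hcount : #B * q ^ (k * (k - 1)) ≤ ∑ b, #(bipartiteBelow R B b) := by
    rw [← smul_eq_mul]
    refine (card_nsmul_le_sum _ _ _ hlow).trans ?_
    rw [sum_card_bipartiteAbove_eq_sum_card_bipartiteBelow]
  have hVc : Fintype.card ((Fin k → V) × (Fin r → V)) = q ^ (n * (k + r)) := by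
    rw [Fintype.card_prod, Fintype.card_fun, Fintype.card_fun, Fintype.card_fin, Fintype.card_fin,
      ← pow_add, Module.card_eq_pow_finrank (K := F) (V := V), ← pow_mul]
  calc #B * q ^ (k * (k - 1) + 2 * (k * (n - (k + r))))
      = #B * q ^ (k * (k - 1)) * q ^ (2 * (k * (n - (k + r)))) := by rw [pow_add, mul_assoc]
    _ ≤ (∑ b, #(bipartiteBelow R B b)) * q ^ (2 * (k * (n - (k + r)))) :=
        Nat.mul_le_mul_right _ hcount
    _ = ∑ b, #(bipartiteBelow R B b) * q ^ (2 * (k * (n - (k + r)))) := sum_mul _ _ _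
    _ ≤ ∑ b : (Fin k → V) × (Fin r → V), Fintype.card G ^ 2 := sum_le_sum fun b _ => hup b
    _ = _ := by rw [sum_const, card_univ, hVc, smul_eq_mul]

open scoped Classical in
/-- A random pair of elements expands. -/
theorem card_not_expands_le {G : Subgroup (V ≃ₗ[F] V)} (hG : ContainsSL G)
    (hn : 20 ≤ finrank F V) :
    #{g : G × G | ¬ Expands (g.1 : V ≃ₗ[F] V) g.2} * Fintype.card F ^ (finrank F V / 4) ≤
      finrank F V * Fintype.card G ^ 2 := by
  set q := Fintype.card F with hq
  set n := finrank F V with hnd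
  have hq1 : 1 ≤ q := Fintype.card_pos
  let B : ℕ → Finset (G × G) := fun k => {g : G × G | ∃ X : Submodule F V, finrank F X = k ∧ finrank F
      (X ⊔ X.map ((g.1 : V ≃ₗ[F] V) : V →ₗ[F] V) ⊔ X.map ((g.2 : V ≃ₗ[F] V) : V →ₗ[F] V) :
        Submodule F V) ≤ k + (k - 1) / 10}
  have hsub : ({g : G × G | ¬ Expands (g.1 : V ≃ₗ[F] V) g.2} : Finset (G × G)) ⊆
      (Finset.Icc 1 (n / 2)).biUnion B := by
    intro g hg
    have hg := (mem_filter.1 hg).2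
    unfold Expands at hg
    push Not at hg
    obtain ⟨X, h1, h2⟩ := hg
    simp only [mem_biUnion, mem_Icc, B, mem_filter, mem_univ, true_and]
    exact ⟨finrank F X, ⟨by omega, by omega⟩, X, rfl, by omega⟩
  have hB : ∀ k ∈ Finset.Icc 1 (n / 2), #(B k) * q ^ (n / 4) ≤ Fintype.card G ^ 2 := by
    intro k hk
    obtain ⟨hk1, hk2⟩ := mem_Icc.1 hk
    set r := (k - 1) / 10
    have h := card_not_expands_dim_le hG (k := k) (r := r) (by omega) (by omega)
    obtain ⟨k', rfl⟩ : ∃ k', k = k' + 1 := ⟨k - 1, by omega⟩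
    obtain ⟨m, hm⟩ : ∃ m, n = (k' + 1) + r + m := ⟨n - (k' + 1 + r), by omega⟩
    have hr : 10 * r ≤ k' := by omega
    have hexp : n * (k' + 1 + r) + n / 4 ≤
        (k' + 1) * (k' + 1 - 1) + 2 * ((k' + 1) * (n - (k' + 1 + r))) := by
      have e1 : n - (k' + 1 + r) = m := by omega
      have h4 : 4 * (n / 4) ≤ n := Nat.mul_div_le n 4
      have h5 : 2 * (k' + 1) ≤ n := by omega
      rw [e1, Nat.add_sub_cancel]
      generalize n / 4 = w at h4
      have hmn : n ≤ m + (k' + 1 + r) := by omega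
      zify at *
      nlinarith [mul_nonneg (show (0:ℤ) ≤ k' by positivity) (show (0 : ℤ) ≤ n - 2 * (k' + 1) by linarith),
        mul_nonneg (show (0:ℤ) ≤ n by positivity) (show (0 : ℤ) ≤ k' - 10 * r by linarith),
        mul_nonneg (show (0:ℤ) ≤ k' + 1 by positivity) (show (0 : ℤ) ≤ k' - 10 * r by linarith),
        mul_nonneg (show (0:ℤ) ≤ k' by positivity) (show (0 : ℤ) ≤ n - 20 by linarith)]
    have h6 : #(B (k' + 1)) * q ^ (n / 4) * q ^ (n * (k' + 1 + r)) ≤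
        Fintype.card G ^ 2 * q ^ (n * (k' + 1 + r)) := by
      calc #(B (k' + 1)) * q ^ (n / 4) * q ^ (n * (k' + 1 + r))
          = #(B (k' + 1)) * q ^ (n * (k' + 1 + r) + n / 4) := by rw [pow_add]; ring
        _ ≤ #(B (k' + 1)) * q ^ ((k' + 1) * (k' + 1 - 1) + 2 * ((k' + 1) * (n - (k' + 1 + r)))) :=
            Nat.mul_le_mul_left _ (Nat.pow_le_pow_right hq1 hexp)
        _ ≤ _ := h
        _ = _ := mul_comm _ _
    exact Nat.le_of_mul_le_mul_right h6 (by positivity)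
  calc _ ≤ (∑ k ∈ Finset.Icc 1 (n / 2), #(B k)) * q ^ (n / 4) :=
        Nat.mul_le_mul_right _ ((card_le_card hsub).trans card_biUnion_le)
    _ = ∑ k ∈ Finset.Icc 1 (n / 2), #(B k) * q ^ (n / 4) := sum_mul _ _ _
    _ ≤ ∑ k ∈ Finset.Icc 1 (n / 2), Fintype.card G ^ 2 := sum_le_sum hB
    _ ≤ _ := by
      rw [sum_const, smul_eq_mul, Nat.card_Icc]
      exact Nat.mul_le_mul_right _ (by omega)

end

section

variable {F V : Type*} [Field F] [AddCommGroup V] [Module F V]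

/-- The contragredient action on the dual space. -/
noncomputable def dualHom : (V ≃ₗ[F] V) →* (Dual F V ≃ₗ[F] Dual F V) where
  toFun g := LinearEquiv.dualMap (g⁻¹)
  map_one' := by ext φ v; rfl
  map_mul' g h := by ext φ v; simp [LinearEquiv.dualMap_apply]

theorem dualHom_apply (g : V ≃ₗ[F] V) (φ : Dual F V) (v : V) : dualHom g φ v = φ (g⁻¹ v) := rfl

theorem dualHom_injective : Function.Injective (dualHom (F := F) (V := V)) := by
  rw [injective_iff_map_eq_one]
  intro g hg
  have h : ∀ (φ : Dual F V) v, φ (g⁻¹ v) = φ v := by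
    intro φ v
    rw [← dualHom_apply, hg]; rfl
  have h2 : ∀ v, g⁻¹ v = v := by
    intro v
    rw [← sub_eq_zero, ← Module.forall_dual_apply_eq_zero_iff F]
    intro φ
    rw [map_sub, h, sub_self]
  have : g⁻¹ = 1 := LinearEquiv.ext h2
  exact inv_eq_one.1 this

theorem exists_dualHom_eq [FiniteDimensional F V] (h : Dual F V ≃ₗ[F] Dual F V)
    (hd : LinearEquiv.det h = 1) : ∃ g : V ≃ₗ[F] V, LinearEquiv.det g = 1 ∧ dualHom g = h := by
  let g : V ≃ₗ[F] V := (evalEquiv F V).trans (h.dualMap.trans (evalEquiv F V).symm)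
  have hg : ∀ (φ : Dual F V) v, φ (g v) = h φ v := by
    intro φ v
    rw [← Dual.eval_apply (R := F), ← evalEquiv_toLinearMap]
    simp only [g, LinearEquiv.coe_coe, LinearEquiv.trans_apply, LinearEquiv.apply_symm_apply]
    rfl
  have h1 : (g : V →ₗ[F] V).dualMap = (h : Dual F V →ₗ[F] Dual F V) := by
    ext φ v
    exact hg φ v
  have h2 : LinearEquiv.det g = 1 := by
    rw [← hd]
    apply Units.ext
    rw [LinearEquiv.coe_det, LinearEquiv.coe_det, ← h1, LinearMap.det_dualMap]
  refine ⟨g⁻¹, by rw [map_inv, h2, inv_one], ?_⟩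
  ext φ v
  rw [dualHom_apply, inv_inv]
  exact hg φ v

variable [Fintype F] [Fintype V]

theorem ContainsSL.map_dualHom {G : Subgroup (V ≃ₗ[F] V)} (hG : ContainsSL G) :
    ContainsSL (G.map dualHom) := by
  intro h hd
  obtain ⟨g, hg, rfl⟩ := exists_dualHom_eq h hd
  exact ⟨g, hG g hg, rfl⟩

/-- The expansion properties used to grow a system of transvections. -/
structure ExpandsAll (h₁ h₂ : V ≃ₗ[F] V) : Prop where
  fwd : Expands h₁ h₂
  inv : Expands h₁⁻¹ h₂⁻¹
  dual : Expands (dualHom h₁) (dualHom h₂)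
  dualInv : Expands (dualHom h₁⁻¹) (dualHom h₂⁻¹)

open scoped Classical in
theorem card_filter_not_le {α β : Type*} [Fintype α] [Fintype β] {f : α → β}
    (hf : Function.Injective f) (P : β → Prop) : #{a | ¬ P (f a)} ≤ #{b | ¬ P b} := by
  refine card_le_card_of_injOn f (fun a ha => by simpa using ha) hf.injOn

open scoped Classical in
theorem card_not_expandsAll_le {G : Subgroup (V ≃ₗ[F] V)} (hG : ContainsSL G)
    (hn : 20 ≤ finrank F V) :
    #{g : Bool → G | ¬ ExpandsAll (g true : V ≃ₗ[F] V) (g true * g false)} *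
      Fintype.card F ^ (finrank F V / 4) ≤ 4 * (finrank F V * Fintype.card G ^ 2) := by
  let G' := G.map dualHom
  have h1 := card_not_expands_le hG hn
  have hdual : finrank F (Dual F V) = finrank F V := Subspace.dual_finrank_eq
  have h2 := card_not_expands_le hG.map_dualHom (by rw [hdual]; exact hn)
  let T : G ≃* G' := G.equivMapOfInjective dualHom dualHom_injective
  have hcard : Fintype.card G' = Fintype.card G := (Fintype.card_congr T.toEquiv).symm
  rw [hdual, hcard] at h2
  let φ : (Bool → G) → G × G := fun g => (g true, g true * g false)
  have hφ : Function.Injective φ := by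
    intro g h e
    have e1 : g true = h true := congrArg Prod.fst e
    have e2 : g true * g false = h true * h false := congrArg Prod.snd e
    rw [e1] at e2
    funext b
    cases b
    · exact mul_left_cancel e2
    · exact e1
  let ι : G × G → G × G := fun g => (g.1⁻¹, g.2⁻¹)
  have hι : Function.Injective ι := fun g h e =>
    Prod.ext (inv_injective (congrArg Prod.fst e)) (inv_injective (congrArg Prod.snd e))
  let θ : G × G → G' × G' := fun g => (T g.1, T g.2)
  have hθ : Function.Injective θ := fun g h e =>
    Prod.ext (T.injective (congrArg Prod.fst e)) (T.injective (congrArg Prod.snd e))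
  let E : G × G → Prop := fun g => Expands (g.1 : V ≃ₗ[F] V) g.2
  let E' : G' × G' → Prop := fun g => Expands (g.1 : Dual F V ≃ₗ[F] Dual F V) g.2
  have c1 := card_filter_not_le hφ E
  have c2 := card_filter_not_le (hι.comp hφ) E
  have c3 := card_filter_not_le (hθ.comp hφ) E'
  have c4 := card_filter_not_le (hθ.comp (hι.comp hφ)) E'
  let B₁ : Finset (Bool → G) := {g | ¬ E (φ g)}
  let B₂ : Finset (Bool → G) := {g | ¬ E ((ι ∘ φ) g)}
  let B₃ : Finset (Bool → G) := {g | ¬ E' ((θ ∘ φ) g)}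
  let B₄ : Finset (Bool → G) := {g | ¬ E' ((θ ∘ (ι ∘ φ)) g)}
  have hsub : ({g : Bool → G | ¬ ExpandsAll (g true : V ≃ₗ[F] V) (g true * g false)} :
      Finset (Bool → G)) ⊆ (B₁ ∪ B₂) ∪ (B₃ ∪ B₄) := by
    intro g hg
    have hg := (mem_filter.1 hg).2
    simp only [mem_union, mem_filter, mem_univ, true_and, B₁, B₂, B₃, B₄]
    by_contra hcon
    simp only [not_or, not_not] at hcon
    exact hg ⟨hcon.1.1, hcon.1.2, hcon.2.1, hcon.2.2⟩
  set Q := Fintype.card F ^ (finrank F V / 4)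
  have := card_le_card hsub
  have u1 := card_union_le (B₁ ∪ B₂) (B₃ ∪ B₄)
  have u2 := card_union_le B₁ B₂
  have u3 := card_union_le B₃ B₄
  have hle : #{g : Bool → G | ¬ ExpandsAll (g true : V ≃ₗ[F] V) (g true * g false)} ≤
      2 * #{g : G × G | ¬ E g} + 2 * #{g : G' × G' | ¬ E' g} := by
    change #B₁ ≤ _ at c1
    change #B₂ ≤ _ at c2
    change #B₃ ≤ _ at c3
    change #B₄ ≤ _ at c4
    omega
  calc _ ≤ (2 * #{g : G × G | ¬ E g} + 2 * #{g : G' × G' | ¬ E' g}) * Q := Nat.mul_le_mul_right _ hle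
    _ = 2 * (#{g : G × G | ¬ E g} * Q) + 2 * (#{g : G' × G' | ¬ E' g} * Q) := by ring
    _ ≤ 2 * (finrank F V * Fintype.card G ^ 2) + 2 * (finrank F V * Fintype.card G ^ 2) :=
        Nat.add_le_add (Nat.mul_le_mul_left _ h1) (Nat.mul_le_mul_left _ h2)
    _ = _ := by ring

end

section

section Ball

variable {Γ : Type*} [Group Γ]

/-- `g` is a product of at most `ℓ` elements of `S`. -/
def InBall (S : Set Γ) (ℓ : ℕ) (g : Γ) : Prop :=
  ∃ l : List Γ, (∀ a ∈ l, a ∈ S) ∧ l.prod = g ∧ l.length ≤ ℓ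

variable {S : Set Γ}

theorem InBall.one (ℓ : ℕ) : InBall S ℓ 1 := ⟨[], by simp, rfl, by simp⟩

theorem InBall.mono {ℓ ℓ' : ℕ} {g : Γ} (h : InBall S ℓ g) (hl : ℓ ≤ ℓ') : InBall S ℓ' g := by
  obtain ⟨l, h1, h2, h3⟩ := h
  exact ⟨l, h1, h2, h3.trans hl⟩

theorem InBall.of_mem {g : Γ} (h : g ∈ S) : InBall S 1 g := ⟨[g], by simpa using h, by simp, by simp⟩

theorem InBall.mul {ℓ ℓ' : ℕ} {g h : Γ} (hg : InBall S ℓ g) (hh : InBall S ℓ' h) :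
    InBall S (ℓ + ℓ') (g * h) := by
  obtain ⟨l, h1, h2, h3⟩ := hg
  obtain ⟨l', h1', h2', h3'⟩ := hh
  refine ⟨l ++ l', ?_, by rw [List.prod_append, h2, h2'], by rw [List.length_append]; omega⟩
  intro a ha
  exact (List.mem_append.1 ha).elim (h1 a) (h1' a)

theorem InBall.inv (hS : ∀ g ∈ S, g⁻¹ ∈ S) {ℓ : ℕ} {g : Γ} (hg : InBall S ℓ g) :
    InBall S ℓ g⁻¹ := by
  obtain ⟨l, h1, rfl, h3⟩ := hg
  refine ⟨(l.map (·⁻¹)).reverse, ?_, by rw [List.prod_inv_reverse], by simpa using h3⟩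
  intro a ha
  simp only [List.mem_reverse, List.mem_map] at ha
  obtain ⟨b, hb, rfl⟩ := ha
  exact hS b (h1 b hb)

theorem InBall.pow {ℓ : ℕ} {g : Γ} (hg : InBall S ℓ g) (k : ℕ) : InBall S (k * ℓ) (g ^ k) := by
  induction k with
  | zero => rw [pow_zero]; exact InBall.one _
  | succ k ih =>
    rw [pow_succ]
    exact (ih.mul hg).mono (by rw [Nat.succ_mul])

theorem InBall.list_prod {ℓ : ℕ} {L : List Γ} (h : ∀ g ∈ L, InBall S ℓ g) :
    InBall S (L.length * ℓ) L.prod := by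
  induction L with
  | nil => exact InBall.one _
  | cons a L ih =>
    rw [List.prod_cons, List.length_cons]
    refine ((h a (by simp)).mul (ih fun g hg => h g (by simp [hg]))).mono ?_
    rw [Nat.succ_mul, add_comm]

end Ball

variable {F V : Type*} [Field F] [AddCommGroup V] [Module F V] {S : Set (V ≃ₗ[F] V)}

/-- All the transvections `x ↦ x + s φ(x) v` are products of at most `ℓ` elements of `S`. -/
def Avail (S : Set (V ≃ₗ[F] V)) (ℓ : ℕ) (v : V) (φ : Dual F V) : Prop :=
  φ v = 0 ∧ ∀ s : F, ∃ g, InBall S ℓ g ∧ ∀ x, g x = x + (s * φ x) • v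

namespace Avail

theorem mono {ℓ ℓ' : ℕ} {v : V} {φ : Dual F V} (h : Avail S ℓ v φ) (hl : ℓ ≤ ℓ') :
    Avail S ℓ' v φ :=
  ⟨h.1, fun s => let ⟨g, hg, hx⟩ := h.2 s; ⟨g, hg.mono hl, hx⟩⟩

theorem smul_left {ℓ : ℕ} {v : V} {φ : Dual F V} (h : Avail S ℓ v φ) (c : F) :
    Avail S ℓ (c • v) φ := by
  refine ⟨by rw [map_smul, h.1, smul_zero], fun s => ?_⟩
  obtain ⟨g, hg, hx⟩ := h.2 (s * c)
  refine ⟨g, hg, fun x => ?_⟩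
  rw [hx, smul_smul]; congr 2; ring

theorem smul_right {ℓ : ℕ} {v : V} {φ : Dual F V} (h : Avail S ℓ v φ) (c : F) :
    Avail S ℓ v (c • φ) := by
  refine ⟨by rw [LinearMap.smul_apply, h.1, smul_zero], fun s => ?_⟩
  obtain ⟨g, hg, hx⟩ := h.2 (s * c)
  refine ⟨g, hg, fun x => ?_⟩
  rw [hx, LinearMap.smul_apply, smul_eq_mul]; congr 2; ring

theorem add_left {ℓ ℓ' : ℕ} {v v' : V} {φ : Dual F V} (h : Avail S ℓ v φ) (h' : Avail S ℓ' v' φ) :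
    Avail S (ℓ + ℓ') (v + v') φ := by
  refine ⟨by rw [map_add, h.1, h'.1, add_zero], fun s => ?_⟩
  obtain ⟨g, hg, hx⟩ := h.2 s
  obtain ⟨g', hg', hx'⟩ := h'.2 s
  refine ⟨g * g', hg.mul hg', fun x => ?_⟩
  rw [LinearEquiv.mul_apply, hx, hx', map_add, map_smul, h'.1]
  simp only [smul_zero, add_zero, smul_add]
  abel

theorem add_right {ℓ ℓ' : ℕ} {v : V} {φ φ' : Dual F V} (h : Avail S ℓ v φ)
    (h' : Avail S ℓ' v φ') : Avail S (ℓ + ℓ') v (φ + φ') := by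
  refine ⟨by rw [LinearMap.add_apply, h.1, h'.1, add_zero], fun s => ?_⟩
  obtain ⟨g, hg, hx⟩ := h.2 s
  obtain ⟨g', hg', hx'⟩ := h'.2 s
  refine ⟨g * g', hg.mul hg', fun x => ?_⟩
  rw [LinearEquiv.mul_apply, hx, hx', map_add, map_smul, h.1, LinearMap.add_apply]
  simp only [smul_zero, add_zero, mul_add, add_smul]
  abel

theorem conj {ℓ m : ℕ} {v : V} {φ : Dual F V} (h : Avail S ℓ v φ) {g : V ≃ₗ[F] V}
    (hg : InBall S m g) (hg' : InBall S m g⁻¹) : Avail S (ℓ + 2 * m) (g v) (dualHom g φ) := by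
  have e : ∀ x, g⁻¹ (g x) = x := g.symm_apply_apply
  have e' : ∀ x, g (g⁻¹ x) = x := g.apply_symm_apply
  refine ⟨by rw [dualHom_apply, e, h.1], fun s => ?_⟩
  obtain ⟨t, ht, hx⟩ := h.2 s
  refine ⟨g * t * g⁻¹, ((hg.mul ht).mul hg').mono (by omega), fun x => ?_⟩
  rw [LinearEquiv.mul_apply, LinearEquiv.mul_apply, hx, map_add, map_smul, e', dualHom_apply]

/-- Commutators of transvections. -/
theorem mix {ℓ ℓ' : ℕ} {v v' : V} {φ φ' : Dual F V}
    (h' : Avail S ℓ' v' φ') (h : Avail S ℓ v φ) (h0 : φ v' = 0) (h1 : φ' v ≠ 0) :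
    Avail S (2 * (ℓ' + ℓ)) v' φ := by
  refine ⟨h0, fun s => ?_⟩
  obtain ⟨X, hX, hXx⟩ := h'.2 (s / φ' v)
  obtain ⟨X', hX', hXx'⟩ := h'.2 (-(s / φ' v))
  obtain ⟨Y, hY, hYx⟩ := h.2 1
  obtain ⟨Y', hY', hYx'⟩ := h.2 (-1)
  refine ⟨X * Y * X' * Y', (((hX.mul hY).mul hX').mul hY').mono (by omega), fun x => ?_⟩
  simp only [LinearEquiv.mul_apply, hXx, hYx, hXx', hYx', map_add, map_smul, h.1, h'.1, h0,
    smul_eq_mul, mul_zero, add_zero, zero_add, smul_add, smul_smul, one_mul]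
  have e : s / φ' v * φ' v = s := div_mul_cancel₀ s h1
  have h2 : s / φ' v * (φ x * φ' v) = s * φ x := by
    rw [mul_comm (φ x), ← mul_assoc, e]
  simp only [mul_add, add_smul, neg_mul, one_mul, neg_smul, mul_neg, h2]
  simp only [zero_mul, mul_zero, zero_smul, smul_zero, neg_zero, add_zero, zero_add]
  abel

end Avail

end

section

variable {F V : Type*} [Field F] [AddCommGroup V] [Module F V]

/-- `Q` contains a four-dimensional space of functionals acting faithfully on `P`. -/
def RankFour (Q : Submodule F (Dual F V)) (P : Submodule F V) : Prop :=
  ∃ L : (Fin 4 → F) →ₗ[F] Dual F V, (∀ γ, L γ ∈ Q) ∧ ∀ γ, (∀ b ∈ P, L γ b = 0) → γ = 0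

theorem RankFour.mono {Q Q' : Submodule F (Dual F V)} {P P' : Submodule F V} (h : RankFour Q P)
    (hQ : Q ≤ Q') (hP : P ≤ P') : RankFour Q' P' :=
  let ⟨L, h1, h2⟩ := h
  ⟨L, fun γ => hQ (h1 γ), fun γ hγ => h2 γ fun b hb => hγ b (hP hb)⟩

theorem RankFour.exists_pairing {Q : Submodule F (Dual F V)} {P : Submodule F V}
    (h : RankFour Q P) {k l : ℕ} (hkl : k + l ≤ 3) (c : Fin k → V) (χ : Fin l → Dual F V) :
    ∃ ψ ∈ Q, ∃ b ∈ P, (∀ i, ψ (c i) = 0) ∧ (∀ j, χ j b = 0) ∧ ψ b ≠ 0 := by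
  obtain ⟨L, hQ, hinj⟩ := h
  by_contra hcon
  push Not at hcon
  let A : (Fin 4 → F) →ₗ[F] (Fin k → F) := LinearMap.pi fun i => (Dual.eval F V (c i)) ∘ₗ L
  let R : Dual F V →ₗ[F] Dual F P := P.subtype.dualMap
  have hA : 4 ≤ finrank F (LinearMap.ker A) + k := by
    have h1 := LinearMap.finrank_range_add_finrank_ker A
    have h2 := Submodule.finrank_le (LinearMap.range A)
    simp only [finrank_fin_fun] at h1 h2
    omega
  have hmem : ∀ γ ∈ LinearMap.ker A, R (L γ) ∈ Submodule.span F (Set.range (fun j => R (χ j))) := by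
    intro γ hγ
    refine mem_span_of_iInf_ker_le_ker ?_
    intro b hb
    simp only [Submodule.mem_iInf, LinearMap.mem_ker] at hb
    have hγ' : ∀ i, L γ (c i) = 0 := fun i => congrFun (LinearMap.mem_ker.1 hγ) i
    exact hcon (L γ) (hQ γ) b b.2 hγ' hb
  let T : LinearMap.ker A →ₗ[F] Submodule.span F (Set.range (fun j => R (χ j))) :=
    ((R ∘ₗ L).domRestrict (LinearMap.ker A)).codRestrict _ fun γ => hmem γ γ.2
  have hT : Function.Injective T := by
    refine (injective_iff_map_eq_zero T).2 ?_
    intro γ hγ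
    have h1 : R (L γ) = 0 := congrArg Subtype.val hγ
    refine Subtype.ext (hinj γ fun b hb => ?_)
    exact congrArg (fun f : Dual F P => f ⟨b, hb⟩) h1
  have : FiniteDimensional F (Submodule.span F (Set.range (fun j => R (χ j)))) :=
    FiniteDimensional.span_of_finite F (Set.finite_range _)
  have h3 := LinearMap.finrank_le_finrank_of_injective hT
  have h4 := finrank_range_le_card (R := F) (fun j => R (χ j))
  rw [Fintype.card_fin] at h4
  unfold Set.finrank at h4
  omega

/-- All the transvections with vector in `P` and functional in `Q` are available. -/
def Full (S : Set (V ≃ₗ[F] V)) (ℓ : ℕ) (P : Submodule F V) (Q : Submodule F (Dual F V)) : Prop :=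
  ∀ a ∈ P, ∀ φ ∈ Q, φ a = 0 → Avail S ℓ a φ

variable {S : Set (V ≃ₗ[F] V)}

theorem Full.mono {ℓ ℓ' : ℕ} {P : Submodule F V} {Q : Submodule F (Dual F V)} (h : Full S ℓ P Q)
    (hl : ℓ ≤ ℓ') : Full S ℓ' P Q := fun a ha φ hφ h0 => (h a ha φ hφ h0).mono hl

theorem Full.cross {ℓ : ℕ} {P P' : Submodule F V} {Q Q' : Submodule F (Dual F V)}
    (h : Full S ℓ P Q) (h' : Full S ℓ P' Q') (hR : RankFour Q P') : Full S (4 * ℓ) P Q' := by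
  intro a ha φ hφ h0
  obtain ⟨ψ, hψ, b, hb, hc, hχ, hne⟩ := hR.exists_pairing (k := 1) (l := 1) (by omega) ![a] ![φ]
  exact ((h a ha ψ hψ (hc 0)).mix (h' b hb φ hφ (hχ 0)) h0 hne).mono (by omega)

theorem Full.sup_left {ℓ : ℕ} {P P' : Submodule F V} {Q Q' : Submodule F (Dual F V)}
    (h : Full S ℓ P Q) (h' : Full S ℓ P' Q') (hR : RankFour Q P') (hR' : RankFour Q' P) :
    Full S (12 * ℓ) (P ⊔ P') Q := by
  intro a ha φ hφ h0
  obtain ⟨p, hp, p', hp', rfl⟩ := Submodule.mem_sup.1 ha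
  obtain ⟨ψ, hψ, b, hb, hc, hχ, hne⟩ := hR'.exists_pairing (k := 2) (l := 1) (by omega)
    ![p, p'] ![φ]
  have h1 := h.cross h' hR p hp ψ hψ (hc 0)
  have h2 := h' p' hp' ψ hψ (hc 1)
  exact ((h1.add_left h2).mix (h b hb φ hφ (hχ 0)) h0 hne).mono (by omega)

theorem Full.sup {ℓ : ℕ} {P P' : Submodule F V} {Q Q' : Submodule F (Dual F V)}
    (h : Full S ℓ P Q) (h' : Full S ℓ P' Q') (hR : RankFour Q P') (hR' : RankFour Q' P) :
    Full S (34 * ℓ) (P ⊔ P') (Q ⊔ Q') := by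
  intro a ha φ hφ h0
  obtain ⟨θ, hθ, θ', hθ', rfl⟩ := Submodule.mem_sup.1 hφ
  obtain ⟨ψ, hψ, b, hb, hc, hχ, hne⟩ := hR'.exists_pairing (k := 1) (l := 2) (by omega)
    ![a] ![θ, θ']
  have h1 : Avail S (12 * ℓ) a ψ := by
    have := h'.sup_left h hR' hR
    rw [sup_comm] at this
    exact this a ha ψ hψ (hc 0)
  have h2 := h b hb θ hθ (hχ 0)
  have h3 := h.cross h' hR b hb θ' hθ' (hχ 1)
  exact (h1.mix (h2.add_right h3) h0 hne).mono (by omega)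

theorem Full.conj {ℓ m : ℕ} {P : Submodule F V} {Q : Submodule F (Dual F V)} (h : Full S ℓ P Q)
    {g : V ≃ₗ[F] V} (hg : InBall S m g) (hg' : InBall S m g⁻¹) :
    Full S (ℓ + 2 * m) (P.map (g : V →ₗ[F] V))
      (Q.map (dualHom g : Dual F V →ₗ[F] Dual F V)) := by
  rintro _ ⟨a, ha, rfl⟩ _ ⟨φ, hφ, rfl⟩ h0
  refine (h a ha φ hφ ?_).conj hg hg'
  have : dualHom g φ (g a) = 0 := h0
  rwa [dualHom_apply, show g⁻¹ (g a) = a from g.symm_apply_apply a] at this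

/-- The enlargement of a pair of subspaces by an element. -/
theorem Full.grow {ℓ : ℕ} {P P₀ : Submodule F V} {Q Q₀ : Submodule F (Dual F V)}
    (h : Full S ℓ P Q) (hP : P₀ ≤ P) (hQ : Q₀ ≤ Q) (hℓ : 4 ≤ ℓ) {g : V ≃ₗ[F] V}
    (hg : InBall S 2 g) (hg' : InBall S 2 g⁻¹)
    (hR : RankFour Q₀ (P₀.map (g : V →ₗ[F] V)))
    (hR' : RankFour (Q₀.map (dualHom g : Dual F V →ₗ[F] Dual F V)) P₀) :
    Full S (68 * ℓ) (P ⊔ P.map (g : V →ₗ[F] V))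
      (Q ⊔ Q.map (dualHom g : Dual F V →ₗ[F] Dual F V)) := by
  have h1 := h.conj hg hg'
  exact ((h.mono (show ℓ ≤ 2 * ℓ by omega)).sup (h1.mono (by omega))
    (hR.mono hQ (Submodule.map_mono hP)) (hR'.mono (Submodule.map_mono hQ) hP)).mono (by omega)

end

section

variable {F V : Type*} [Field F] [AddCommGroup V] [Module F V] [FiniteDimensional F V]

/-- The codimension of every large subspace shrinks by a factor `10 / 11` when its two images
are added. -/
def Contracts (g₁ g₂ : V ≃ₗ[F] V) : Prop :=
  ∀ X : Submodule F V, finrank F V < 2 * finrank F X →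
    11 * (finrank F V - finrank F
      (X ⊔ X.map (g₁ : V →ₗ[F] V) ⊔ X.map (g₂ : V →ₗ[F] V) : Submodule F V)) ≤
      10 * (finrank F V - finrank F X)

theorem contracts_of_dual {g₁ g₂ : V ≃ₗ[F] V} (h : Expands (dualHom g₁⁻¹) (dualHom g₂⁻¹)) :
    Contracts g₁ g₂ := by
  intro X hX
  set Y : Submodule F V := X ⊔ X.map (g₁ : V →ₗ[F] V) ⊔ X.map (g₂ : V →ₗ[F] V) with hY
  have hXY : X ≤ Y := le_sup_left.trans le_sup_left
  have hdual : finrank F (Dual F V) = finrank F V := Subspace.dual_finrank_eq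
  have h1 := Subspace.finrank_add_finrank_dualAnnihilator_eq Y
  have h2 := Subspace.finrank_add_finrank_dualAnnihilator_eq X
  have h3 := Submodule.finrank_mono hXY
  have h4 := h Y.dualAnnihilator (by omega)
  have h5 : Y.dualAnnihilator ⊔
      Y.dualAnnihilator.map (dualHom g₁⁻¹ : Dual F V →ₗ[F] Dual F V) ⊔
      Y.dualAnnihilator.map (dualHom g₂⁻¹ : Dual F V →ₗ[F] Dual F V) ≤ X.dualAnnihilator := by
    refine sup_le (sup_le (Submodule.dualAnnihilator_anti hXY) ?_) ?_
    · rintro _ ⟨φ, hφ, rfl⟩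
      rw [Submodule.mem_dualAnnihilator]
      intro w hw
      exact (Submodule.mem_dualAnnihilator φ).1 hφ _
        ((le_sup_right.trans le_sup_left : X.map (g₁ : V →ₗ[F] V) ≤ Y)
          (Submodule.mem_map_of_mem hw))
    · rintro _ ⟨φ, hφ, rfl⟩
      rw [Submodule.mem_dualAnnihilator]
      intro w hw
      exact (Submodule.mem_dualAnnihilator φ).1 hφ _
        ((le_sup_right : X.map (g₂ : V →ₗ[F] V) ≤ Y) (Submodule.mem_map_of_mem hw))
  have h6 := Submodule.finrank_mono h5
  omega

theorem contracts_dual_of_inv {g₁ g₂ : V ≃ₗ[F] V} (h : Expands g₁⁻¹ g₂⁻¹) :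
    Contracts (dualHom g₁) (dualHom g₂) := by
  intro X hX
  set Y : Submodule F (Dual F V) := X ⊔ X.map (dualHom g₁ : Dual F V →ₗ[F] Dual F V) ⊔
    X.map (dualHom g₂ : Dual F V →ₗ[F] Dual F V) with hY
  have hXY : X ≤ Y := le_sup_left.trans le_sup_left
  have hdual : finrank F (Dual F V) = finrank F V := Subspace.dual_finrank_eq
  have h1 := Subspace.finrank_add_finrank_dualCoannihilator_eq Y
  have h2 := Subspace.finrank_add_finrank_dualCoannihilator_eq X
  have h3 := Submodule.finrank_mono hXY
  have h4 := h Y.dualCoannihilator (by omega)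
  have h5 : Y.dualCoannihilator ⊔
      Y.dualCoannihilator.map ((g₁⁻¹ : V ≃ₗ[F] V) : V →ₗ[F] V) ⊔
      Y.dualCoannihilator.map ((g₂⁻¹ : V ≃ₗ[F] V) : V →ₗ[F] V) ≤ X.dualCoannihilator := by
    refine sup_le (sup_le (Submodule.dualCoannihilator_anti hXY) ?_) ?_
    · rintro _ ⟨w, hw, rfl⟩
      rw [Submodule.mem_dualCoannihilator]
      intro φ hφ
      exact (Submodule.mem_dualCoannihilator w).1 hw _
        ((le_sup_right.trans le_sup_left :
          X.map (dualHom g₁ : Dual F V →ₗ[F] Dual F V) ≤ Y) (Submodule.mem_map_of_mem hφ))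
    · rintro _ ⟨w, hw, rfl⟩
      rw [Submodule.mem_dualCoannihilator]
      intro φ hφ
      exact (Submodule.mem_dualCoannihilator w).1 hw _
        ((le_sup_right : X.map (dualHom g₂ : Dual F V →ₗ[F] Dual F V) ≤ Y)
          (Submodule.mem_map_of_mem hφ))
  have h6 := Submodule.finrank_mono h5
  omega

/-- Adding the image under one element, then under another one. -/
def growStep (g₁ g₂ : V ≃ₗ[F] V) (X : Submodule F V) : Submodule F V :=
  (X ⊔ X.map (g₁ : V →ₗ[F] V)) ⊔ (X ⊔ X.map (g₁ : V →ₗ[F] V)).map (g₂ : V →ₗ[F] V)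

theorem le_growStep (g₁ g₂ : V ≃ₗ[F] V) (X : Submodule F V) :
    X ⊔ X.map (g₁ : V →ₗ[F] V) ⊔ X.map (g₂ : V →ₗ[F] V) ≤ growStep g₁ g₂ X :=
  sup_le_sup le_rfl (Submodule.map_mono le_sup_left)

theorem self_le_growStep (g₁ g₂ : V ≃ₗ[F] V) (X : Submodule F V) : X ≤ growStep g₁ g₂ X :=
  le_sup_left.trans (le_sup_left.trans (le_growStep g₁ g₂ X))

theorem growStep_iterate_eq_top {g₁ g₂ : V ≃ₗ[F] V} (hE : Expands g₁ g₂) (hC : Contracts g₁ g₂)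
    {X : Submodule F V} (hX : X ≠ ⊥) {K : ℕ} (hK : finrank F V * 10 ^ K < 11 ^ K) :
    (growStep g₁ g₂)^[2 * K] X = ⊤ := by
  set n := finrank F V with hn
  set d : ℕ → ℕ := fun k => finrank F ((growStep g₁ g₂)^[k] X : Submodule F V) with hd
  have hle : ∀ k, d k ≤ n := fun k => Submodule.finrank_le _
  have hs : ∀ k, (growStep g₁ g₂)^[k + 1] X = growStep g₁ g₂ ((growStep g₁ g₂)^[k] X) :=
    fun k => Function.iterate_succ_apply' _ _ _
  have hmono : ∀ k, d k ≤ d (k + 1) := by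
    intro k
    have hs' := hs k
    simp only [hd]
    rw [hs']
    exact Submodule.finrank_mono (self_le_growStep _ _ _)
  have hexp : ∀ k, 2 * d k ≤ n → 11 * d k ≤ 10 * d (k + 1) := by
    intro k hk
    refine (hE _ hk).trans (Nat.mul_le_mul_left _ ?_)
    have hs' := hs k
    simp only [hd]
    rw [hs']
    exact Submodule.finrank_mono (le_growStep _ _ _)
  have hcon : ∀ k, n < 2 * d k → 11 * (n - d (k + 1)) ≤ 10 * (n - d k) := by
    intro k hk
    refine le_trans (Nat.mul_le_mul_left _ (Nat.sub_le_sub_left ?_ _)) (hC _ hk)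
    have hs' := hs k
    simp only [hd]
    rw [hs']
    exact Submodule.finrank_mono (le_growStep _ _ _)
  have h0 : 1 ≤ d 0 := by
    simp only [hd, Function.iterate_zero, id]
    exact Nat.one_le_iff_ne_zero.2 fun h => hX (Submodule.finrank_eq_zero.1 h)
  have hph1 : ∀ k, n < 2 * d k ∨ 11 ^ k ≤ 10 ^ k * d k := by
    intro k
    induction k with
    | zero => right; simpa using h0
    | succ k ih =>
      have := hmono k
      rcases ih with h | h
      · left; omega
      · by_cases h2 : 2 * d k ≤ n
        · right
          calc 11 ^ (k + 1) = 11 ^ k * 11 := pow_succ _ _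
            _ ≤ 10 ^ k * d k * 11 := Nat.mul_le_mul_right _ h
            _ = 10 ^ k * (11 * d k) := by ring
            _ ≤ 10 ^ k * (10 * d (k + 1)) := Nat.mul_le_mul_left _ (hexp k h2)
            _ = _ := by ring
        · left; omega
  have hbig : n < 2 * d K := by
    refine (hph1 K).resolve_right fun h => ?_
    have := Nat.mul_le_mul_left (10 ^ K) (hle K)
    rw [mul_comm n] at hK
    omega
  have hph2 : ∀ j, n < 2 * d (K + j) ∧ 11 ^ j * (n - d (K + j)) ≤ 10 ^ j * n := by
    intro j
    induction j with
    | zero => exact ⟨hbig, by simp⟩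
    | succ j ih =>
      have := hmono (K + j)
      refine ⟨by rw [← add_assoc]; omega, ?_⟩
      calc 11 ^ (j + 1) * (n - d (K + (j + 1))) = 11 ^ j * (11 * (n - d (K + j + 1))) := by
            rw [← add_assoc]; ring
        _ ≤ 11 ^ j * (10 * (n - d (K + j))) := Nat.mul_le_mul_left _ (hcon _ ih.1)
        _ = 10 * (11 ^ j * (n - d (K + j))) := by ring
        _ ≤ 10 * (10 ^ j * n) := Nat.mul_le_mul_left _ ih.2
        _ = _ := by ring
  have hfin := (hph2 K).2
  have h1 : n - d (K + K) = 0 := by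
    by_contra h
    have : 11 ^ K * 1 ≤ 11 ^ K * (n - d (K + K)) := Nat.mul_le_mul_left _ (by omega)
    rw [mul_comm n] at hK
    omega
  rw [two_mul]
  refine Submodule.eq_top_of_finrank_eq ?_
  have := hle (K + K)
  change d (K + K) = n
  omega

variable {S : Set (V ≃ₗ[F] V)}

theorem Full.growStep {ℓ : ℕ} {P P₀ : Submodule F V} {Q Q₀ : Submodule F (Dual F V)}
    (h : Full S ℓ P Q) (hP : P₀ ≤ P) (hQ : Q₀ ≤ Q) (hℓ : 4 ≤ ℓ) {h₁ h₂ : V ≃ₗ[F] V}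
    (hb : ∀ g, g = h₁ ∨ g = h₂ → InBall S 2 g ∧ InBall S 2 g⁻¹ ∧
      RankFour Q₀ (P₀.map (g : V →ₗ[F] V)) ∧
      RankFour (Q₀.map (dualHom g : Dual F V →ₗ[F] Dual F V)) P₀) :
    Full S (4624 * ℓ) (growStep h₁ h₂ P) (growStep (dualHom h₁) (dualHom h₂) Q) := by
  obtain ⟨a1, a2, a3, a4⟩ := hb h₁ (Or.inl rfl)
  obtain ⟨b1, b2, b3, b4⟩ := hb h₂ (Or.inr rfl)
  have h1 := h.grow hP hQ hℓ a1 a2 a3 a4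
  have h2 := h1.grow (hP.trans le_sup_left) (hQ.trans le_sup_left) (by omega) b1 b2 b3 b4
  exact h2.mono (by omega)

/-- Growing a system of transvections to all transvections. -/
theorem Full.grow_to_top {ℓ : ℕ} {P₀ : Submodule F V} {Q₀ : Submodule F (Dual F V)}
    (h : Full S ℓ P₀ Q₀) (hℓ : 4 ≤ ℓ) {h₁ h₂ : V ≃ₗ[F] V}
    (hb : ∀ g, g = h₁ ∨ g = h₂ → InBall S 2 g ∧ InBall S 2 g⁻¹ ∧
      RankFour Q₀ (P₀.map (g : V →ₗ[F] V)) ∧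
      RankFour (Q₀.map (dualHom g : Dual F V →ₗ[F] Dual F V)) P₀)
    (hE : Expands h₁ h₂) (hEi : Expands h₁⁻¹ h₂⁻¹) (hEd : Expands (dualHom h₁) (dualHom h₂))
    (hEdi : Expands (dualHom h₁⁻¹) (dualHom h₂⁻¹)) {K : ℕ}
    (hK : finrank F V * 10 ^ K < 11 ^ K) : Full S (4624 ^ (2 * K) * ℓ) ⊤ ⊤ := by
  have hiter : ∀ k, Full S (4624 ^ k * ℓ) ((RandGen.growStep h₁ h₂)^[k] P₀)
      ((RandGen.growStep (dualHom h₁) (dualHom h₂))^[k] Q₀) ∧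
      P₀ ≤ (RandGen.growStep h₁ h₂)^[k] P₀ ∧
      Q₀ ≤ (RandGen.growStep (dualHom h₁) (dualHom h₂))^[k] Q₀ := by
    intro k
    induction k with
    | zero => exact ⟨by simpa using h, le_rfl, le_rfl⟩
    | succ k ih =>
      simp only [Function.iterate_succ_apply']
      have hpos : ℓ ≤ 4624 ^ k * ℓ := Nat.le_mul_of_pos_left _ (by positivity)
      refine ⟨(ih.1.growStep ih.2.1 ih.2.2 (by omega) hb).mono (by rw [pow_succ]; ring_nf; rfl),
        ih.2.1.trans (self_le_growStep _ _ _), ih.2.2.trans (self_le_growStep _ _ _)⟩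
  obtain ⟨L, hL1, hL2⟩ := (hb h₁ (Or.inl rfl)).2.2.2
  obtain ⟨M, hM1, hM2⟩ := (hb h₁ (Or.inl rfl)).2.2.1
  have hP0 : P₀ ≠ ⊥ := by
    rintro rfl
    have := hL2 1 (by simp)
    exact one_ne_zero this
  have hQ0 : Q₀ ≠ ⊥ := by
    rintro rfl
    have h1 : M 1 = 0 := by simpa using hM1 1
    have := hM2 1 (by simp [h1])
    exact one_ne_zero this
  have hdual : finrank F (Dual F V) = finrank F V := Subspace.dual_finrank_eq
  have := (hiter (2 * K)).1
  rwa [growStep_iterate_eq_top hE (contracts_of_dual hEdi) hP0 hK,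
    growStep_iterate_eq_top hEd (contracts_dual_of_inv hEi) hQ0 (by rw [hdual]; exact hK)] at this

end

section

variable {F V : Type*} [Field F] [AddCommGroup V] [Module F V]
variable {S : Set (V ≃ₗ[F] V)}

theorem InBall.zpow {Γ : Type*} [Group Γ] {S : Set Γ} (hS : ∀ g ∈ S, g⁻¹ ∈ S) {x : Γ} (hx : x ∈ S)
    (k : ℤ) : InBall S k.natAbs (x ^ k) := by
  have h := (InBall.of_mem hx).pow k.natAbs
  rw [mul_one] at h
  rcases Int.natAbs_eq k with hk | hk
  · rw [hk, zpow_natCast, Int.natAbs_natCast]; exact h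
  · rw [hk, zpow_neg, zpow_natCast, Int.natAbs_neg, Int.natAbs_natCast]; exact h.inv hS

theorem Avail.of_mem_span {ι : Type*} [Fintype ι] {ℓ : ℕ} {φ : Dual F V} {c : ι → V}
    (h : ∀ i, Avail S ℓ (c i) φ) {a : V} (ha : a ∈ Submodule.span F (Set.range c)) :
    Avail S (Fintype.card ι * ℓ) a φ := by
  classical
  obtain ⟨w, rfl⟩ := (Submodule.mem_span_range_iff_exists_fun F).1 ha
  have : ∀ s : Finset ι, Avail S (#s * ℓ) (∑ i ∈ s, w i • c i) φ := by
    intro s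
    induction s using Finset.induction_on with
    | empty => exact ⟨by simp, fun s => ⟨1, InBall.one _, fun x => by simp⟩⟩
    | insert i s hi ih =>
      rw [sum_insert hi, card_insert_of_notMem hi]
      exact (((h i).smul_left (w i)).add_left ih).mono (by ring_nf; rfl)
  exact this univ

/-- If `φ` is available at `v`, suitable combinations of two translates of `v` are available
together with `φ`. -/
theorem Avail.combine {ℓ m : ℕ} {v : V} {φ : Dual F V} (h : Avail S ℓ v φ)
    {g k : V ≃ₗ[F] V} (hg : InBall S m g) (hg' : InBall S m g⁻¹) (hk : InBall S m k)
    (hk' : InBall S m k⁻¹) (hA : φ (k v) ≠ 0) (hB : φ (k⁻¹ (g v)) ≠ 0)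
    (hC : φ (g⁻¹ v) * φ (k⁻¹ (g v)) * φ (k v) + φ (g v) * φ (g⁻¹ (k v)) * φ (k⁻¹ v) ≠ 0) :
    Avail S (8 * ℓ + 12 * m) (g v - (φ (g v) / φ (k v)) • k v) φ := by
  have h1 := h.conj hg hg'
  have h2 := h.conj hk hk'
  set σ : F := -(φ (g v) / (φ (k v) * φ (k⁻¹ (g v)))) with hσ
  obtain ⟨t, ht, htx⟩ := h2.2 σ
  obtain ⟨t', ht', htx'⟩ := h2.2 (-σ)
  have hkv : k⁻¹ (k v) = v := k.symm_apply_apply v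
  have htt : t * t' = 1 := by
    refine LinearEquiv.ext fun u => ?_
    rw [LinearEquiv.mul_apply, htx, htx', map_add, map_smul, dualHom_apply, dualHom_apply, hkv, h.1,
      LinearEquiv.coe_one, id, smul_zero, add_zero, add_assoc, ← add_smul]
    convert add_zero u using 2
    convert zero_smul F _ using 2
    ring
  have hti : t⁻¹ = t' := inv_eq_of_mul_eq_one_right htt
  have h3 := h1.conj ht (hti ▸ ht')
  have hv : t (g v) = g v - (φ (g v) / φ (k v)) • k v := by
    rw [htx, dualHom_apply, sub_eq_add_neg, ← neg_smul]
    congr 2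
    rw [hσ]; field_simp
  rw [hv] at h3
  refine (h3.mix h ?_ ?_).mono (by omega)
  · rw [map_sub, map_smul, smul_eq_mul, div_mul_cancel₀ _ hA, sub_self]
  · rw [dualHom_apply, hti, dualHom_apply, htx', dualHom_apply, map_add, map_smul, map_add,
      map_smul, smul_eq_mul, hσ]
    intro h0
    apply hC
    field_simp at h0
    linear_combination h0

/-- The functionals spanned by `φ ∘ x, …, φ ∘ x ^ 4`. -/
noncomputable def powDual (x : V ≃ₗ[F] V) (φ : Dual F V) : (Fin 4 → F) →ₗ[F] Dual F V :=
  Fintype.linearCombination F fun r : Fin 4 => dualHom (x ^ (r.1 + 1))⁻¹ φ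

theorem powDual_apply (x : V ≃ₗ[F] V) (φ : Dual F V) (γ : Fin 4 → F) (u : V) :
    powDual x φ γ u = ∑ r : Fin 4, γ r * φ ((x ^ (r.1 + 1)) u) := by
  simp only [powDual, Fintype.linearCombination_apply, LinearMap.sum_apply, LinearMap.smul_apply,
    dualHom_apply, inv_inv, smul_eq_mul]

variable {ι : Type*} [Fintype ι]

/-- The part of the span of a family on which the functionals `powDual x φ` vanish. -/
noncomputable def powCore (x : V ≃ₗ[F] V) (φ : Dual F V) (c : ι → V) : Submodule F V :=
  Submodule.span F (Set.range c) ⊓ (LinearMap.range (powDual x φ)).dualCoannihilator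

theorem full_powCore {ℓ : ℕ} {x : V ≃ₗ[F] V} {φ : Dual F V} {c : ι → V}
    (hS : ∀ g ∈ S, g⁻¹ ∈ S) (hx : x ∈ S) (h : ∀ i, Avail S ℓ (c i) φ)
    (hne : ∀ r : Fin 4, ∃ i, φ ((x ^ (r.1 + 1))⁻¹ (c i)) ≠ 0) (hℓ : 4 ≤ ℓ) :
    Full S (24 * (Fintype.card ι + 1) * ℓ) (powCore x φ c) (LinearMap.range (powDual x φ)) := by
  rintro a ⟨ha, ha'⟩ _ ⟨γ, rfl⟩ h0
  have hz : ∀ r : Fin 4, φ ((x ^ (r.1 + 1)) a) = 0 := by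
    intro r
    have := (Submodule.mem_dualCoannihilator a).1 ha' _ ⟨Pi.single r 1, rfl⟩
    rw [powDual_apply, Finset.sum_eq_single r] at this
    · simpa using this
    · intro b _ hb; simp [Pi.single_eq_of_ne hb]
    · simp
  have hav : ∀ r : Fin 4, Avail S (6 * (Fintype.card ι + 1) * ℓ) a (dualHom (x ^ (r.1 + 1))⁻¹ φ) := by
    intro r
    obtain ⟨i, hi⟩ := hne r
    have hb : InBall S 4 (x ^ (r.1 + 1)) := by
      have := (InBall.of_mem hx).pow (r.1 + 1)
      exact this.mono (by omega)
    have h1 := (h i).conj (hb.inv hS) (by rw [inv_inv]; exact hb)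
    refine ((Avail.of_mem_span h ha).mix h1 ?_ hi).mono ?_
    · rw [dualHom_apply, inv_inv]; exact hz r
    · nlinarith
  have : powDual x φ γ = ∑ r : Fin 4, γ r • dualHom (x ^ (r.1 + 1))⁻¹ φ := by
    simp [powDual, Fintype.linearCombination_apply]
  rw [this, Fin.sum_univ_four]
  exact ((((((hav 0).smul_right _).add_right ((hav 1).smul_right _)).add_right
    ((hav 2).smul_right _))).add_right ((hav 3).smul_right _)).mono (by ring_nf; rfl)

theorem powDual_eq_zero_of_vanish {x : V ≃ₗ[F] V} {φ : Dual F V} {c : ι → V} {h : V ≃ₗ[F] V}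
    (hne : ∀ γ η : Fin 4 → F, γ ≠ 0 → ∃ i, powDual x φ γ (h (c i)) - powDual x φ η (c i) ≠ 0)
    {γ : Fin 4 → F} (hγ : ∀ b ∈ powCore x φ c, powDual x φ γ (h b) = 0) : γ = 0 := by
  by_contra h0
  let P := Submodule.span F (Set.range c)
  let f : Dual F P := ((powDual x φ γ) ∘ₗ (h : V →ₗ[F] V)) ∘ₗ P.subtype
  let e : Fin 4 → Dual F P := fun r => (powDual x φ (Pi.single r 1)) ∘ₗ P.subtype
  have hmem : f ∈ Submodule.span F (Set.range e) := by
    refine mem_span_of_iInf_ker_le_ker fun b hb => ?_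
    rw [Submodule.mem_iInf] at hb
    refine hγ b.1 ⟨b.2, ?_⟩
    rw [SetLike.mem_coe, Submodule.mem_dualCoannihilator]
    rintro _ ⟨η, rfl⟩
    have hη : η = ∑ r, η r • (Pi.single r 1 : Fin 4 → F) := by
      simpa using pi_eq_sum_univ' η
    rw [hη, map_sum, LinearMap.sum_apply]
    refine sum_eq_zero fun r _ => ?_
    rw [map_smul, LinearMap.smul_apply]
    have : powDual x φ (Pi.single r 1) b.1 = 0 := hb r
    rw [this, smul_zero]
  obtain ⟨η, hη⟩ := (Submodule.mem_span_range_iff_exists_fun F).1 hmem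
  obtain ⟨i, hi⟩ := hne γ η h0
  apply hi
  have := LinearMap.congr_fun hη ⟨c i, Submodule.subset_span ⟨i, rfl⟩⟩
  have e1 : powDual x φ γ (h (c i)) = f ⟨c i, Submodule.subset_span ⟨i, rfl⟩⟩ := rfl
  rw [e1, ← this, LinearMap.sum_apply, sub_eq_zero]
  have hη : η = ∑ r, η r • (Pi.single r 1 : Fin 4 → F) := by
    simpa using pi_eq_sum_univ' η
  conv_rhs => rw [hη, map_sum, LinearMap.sum_apply]
  refine sum_congr rfl fun r _ => ?_
  rw [map_smul, LinearMap.smul_apply, LinearMap.smul_apply]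
  rfl

theorem rankFour_map {x : V ≃ₗ[F] V} {φ : Dual F V} {c : ι → V} {h : V ≃ₗ[F] V}
    (hne : ∀ γ η : Fin 4 → F, γ ≠ 0 → ∃ i, powDual x φ γ (h (c i)) - powDual x φ η (c i) ≠ 0) :
    RankFour (LinearMap.range (powDual x φ)) ((powCore x φ c).map (h : V →ₗ[F] V)) :=
  ⟨powDual x φ, fun γ => ⟨γ, rfl⟩, fun γ hγ => powDual_eq_zero_of_vanish hne fun b hb =>
    hγ _ (Submodule.mem_map_of_mem hb)⟩

theorem rankFour_map_dual {x : V ≃ₗ[F] V} {φ : Dual F V} {c : ι → V} {h : V ≃ₗ[F] V}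
    (hne : ∀ γ η : Fin 4 → F, γ ≠ 0 → ∃ i, powDual x φ γ (h⁻¹ (c i)) - powDual x φ η (c i) ≠ 0) :
    RankFour ((LinearMap.range (powDual x φ)).map (dualHom h : Dual F V →ₗ[F] Dual F V))
      (powCore x φ c) :=
  ⟨(dualHom h : Dual F V →ₗ[F] Dual F V) ∘ₗ powDual x φ,
    fun γ => Submodule.mem_map_of_mem ⟨γ, rfl⟩,
    fun γ hγ => powDual_eq_zero_of_vanish hne fun b hb => hγ b hb⟩

end

section

open scoped Classical in
/-- Independent events, expressed through translations of a finite group. -/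
theorem card_forall_mul_le {U ι A : Type*} [AddCommGroup U] [Fintype U] [Fintype ι] [Fintype A]
    (D : (ι → A) → U) (E : ι → A → U) (B : ι → U → Prop)
    (hind : ∀ u s i, B i (u + D s) → B i (u + E i (s i))) {M N : ℕ}
    (hcount : ∀ i u, M * #{s : A | B i (u + E i s)} ≤ N * Fintype.card A) (hA : Nonempty A) :
    M ^ Fintype.card ι * #{u : U | ∀ i, B i u} ≤ N ^ Fintype.card ι * Fintype.card U := by
  have h1 : #{u : U | ∀ i, B i u} * Fintype.card (ι → A) =
      ∑ u : U, #{s : ι → A | ∀ i, B i (u + D s)} := by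
    simp only [card_filter]
    rw [sum_comm]
    have : ∀ s : ι → A, ∑ u : U, (if ∀ i, B i (u + D s) then 1 else 0) =
        ∑ u : U, if ∀ i, B i u then 1 else 0 := fun s =>
      Equiv.sum_comp (Equiv.addRight (D s)) fun u => if ∀ i, B i u then 1 else 0
    rw [sum_congr rfl fun s _ => this s, sum_const, card_univ, smul_eq_mul, mul_comm]
  have h2 : ∀ u : U, M ^ Fintype.card ι * #{s : ι → A | ∀ i, B i (u + D s)} ≤
      N ^ Fintype.card ι * Fintype.card (ι → A) := by
    intro u
    have hsub : ({s : ι → A | ∀ i, B i (u + D s)} : Finset _) ⊆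
        Fintype.piFinset fun i => ({a : A | B i (u + E i a)} : Finset A) := by
      intro s hs
      rw [Fintype.mem_piFinset]
      intro i
      rw [mem_filter] at hs ⊢
      exact ⟨mem_univ _, hind u s i (hs.2 i)⟩
    calc _ ≤ M ^ Fintype.card ι * ∏ i, #{a : A | B i (u + E i a)} := by
          rw [← Fintype.card_piFinset]
          exact Nat.mul_le_mul_left _ (card_le_card hsub)
      _ = ∏ i, M * #{a : A | B i (u + E i a)} := by
          rw [prod_mul_distrib, prod_const, card_univ]
      _ ≤ ∏ i : ι, N * Fintype.card A := prod_le_prod' fun i _ => hcount i u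
      _ = _ := by
          rw [prod_const, card_univ, mul_pow, Fintype.card_fun]
  have h3 : M ^ Fintype.card ι * #{u : U | ∀ i, B i u} * Fintype.card (ι → A) ≤
      N ^ Fintype.card ι * Fintype.card U * Fintype.card (ι → A) := by
    rw [mul_assoc, h1, mul_sum]
    refine (sum_le_sum fun u _ => h2 u).trans (le_of_eq ?_)
    rw [sum_const, card_univ, smul_eq_mul]; ring
  exact Nat.le_of_mul_le_mul_right h3 Fintype.card_pos

variable {F : Type*} [Field F] [Fintype F]

open scoped Classical in
/-- At least one in sixteen choices of four parameters satisfies the four conditions below. -/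
theorem card_bad_parameters_le (A B C c D' E' F' W U : F) (hc : c ≠ 0) :
    16 * #{s : F × F × F × F | ¬ (A + s.1 ≠ 0 ∧ B + s.2.1 ≠ 0 ∧
      (C + s.2.2.1) * (B + s.2.1) * (A + s.1) + D' * E' * F' ≠ 0 ∧
      U + s.2.2.2 * c - D' / (A + s.1) * W ≠ 0)} ≤ 15 * Fintype.card (F × F × F × F) := by
  have hgood : Fintype.card (Fˣ × Fˣ × Fˣ × Fˣ) ≤ #{s : F × F × F × F | (A + s.1 ≠ 0 ∧
      B + s.2.1 ≠ 0 ∧ (C + s.2.2.1) * (B + s.2.1) * (A + s.1) + D' * E' * F' ≠ 0 ∧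
      U + s.2.2.2 * c - D' / (A + s.1) * W ≠ 0)} := by
    rw [← card_univ]
    refine card_le_card_of_injOn (fun t : Fˣ × Fˣ × Fˣ × Fˣ =>
      ((t.1 : F) - A, (t.2.1 : F) - B,
        ((t.2.2.1 : F) - D' * E' * F') / (t.2.1 * t.1) - C,
        ((t.2.2.2 : F) - U + D' / t.1 * W) / c)) ?_ ?_
    · rintro ⟨t1, t2, t3, t4⟩ -
      simp only [coe_filter, mem_univ, true_and, Set.mem_ofPred_eq]
      have e1 : A + ((t1 : F) - A) = t1 := by ring
      have e2 : B + ((t2 : F) - B) = t2 := by ring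
      have n1 := t1.ne_zero
      have n2 := t2.ne_zero
      rw [e1, e2]
      refine ⟨n1, n2, ?_, ?_⟩
      · convert t3.ne_zero using 1; field_simp; ring
      · convert t4.ne_zero using 1; field_simp; ring
    · rintro ⟨t1, t2, t3, t4⟩ - ⟨u1, u2, u3, u4⟩ - h
      simp only [Prod.mk.injEq] at h
      obtain ⟨h1, h2, h3, h4⟩ := h
      have e1 : t1 = u1 := Units.ext (by simpa using h1)
      have e2 : t2 = u2 := Units.ext (by simpa using h2)
      subst e1 e2
      have n1 := t1.ne_zero
      have n2 := t2.ne_zero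
      have e3 : t3 = u3 := Units.ext (by field_simp at h3; linear_combination h3)
      have e4 : t4 = u4 := Units.ext (by
        field_simp at h4
        exact mul_left_cancel₀ n1 (by linear_combination h4))
      rw [e3, e4]
  have htot := card_filter_add_card_filter_not (s := (univ : Finset (F × F × F × F)))
    (fun s => (A + s.1 ≠ 0 ∧
      B + s.2.1 ≠ 0 ∧ (C + s.2.2.1) * (B + s.2.1) * (A + s.1) + D' * E' * F' ≠ 0 ∧
      U + s.2.2.2 * c - D' / (A + s.1) * W ≠ 0))
  have hu : Fintype.card F ≤ 2 * Fintype.card Fˣ := by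
    rw [Fintype.card_units]
    have := Fintype.one_lt_card (α := F)
    omega
  have h16 : Fintype.card (F × F × F × F) ≤ 16 * Fintype.card (Fˣ × Fˣ × Fˣ × Fˣ) := by
    simp only [Fintype.card_prod]
    calc _ ≤ (2 * Fintype.card Fˣ) * ((2 * Fintype.card Fˣ) * ((2 * Fintype.card Fˣ) *
          (2 * Fintype.card Fˣ))) := by gcongr
      _ = _ := by ring
  rw [card_univ] at htot
  omega

variable {V : Type*} [AddCommGroup V] [Module F V]

/-- The condition on a functional that makes one pair of translates useful. -/
def GoodAt (φ : Dual F V) (X : Fin 8 → V) : Prop :=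
  φ (X 0) ≠ 0 ∧ φ (X 1) ≠ 0 ∧ φ (X 2) * φ (X 1) * φ (X 0) + φ (X 4) * φ (X 5) * φ (X 6) ≠ 0 ∧
    φ (X 3) - φ (X 4) / φ (X 0) * φ (X 7) ≠ 0

open scoped Classical in
theorem card_forall_not_goodAt_le {ι : Type*} [Fintype ι] (U : Submodule F (Dual F V)) [Fintype U]
    (X : ι → Fin 8 → V) (D : ι → Fin 4 → U)
    (hD : ∀ i k j l, (D i k : Dual F V) (X j l) = if i = j ∧ k.1 = l.1 then 1 else 0) :
    16 ^ Fintype.card ι * #{φ : U | ∀ i, ¬ GoodAt (φ : Dual F V) (X i)} ≤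
      15 ^ Fintype.card ι * Fintype.card U := by
  let E : ι → F × F × F × F → U := fun i s =>
    s.1 • D i 0 + s.2.1 • D i 1 + s.2.2.1 • D i 2 + s.2.2.2 • D i 3
  have hE : ∀ i s j l, (E i s : Dual F V) (X j l) = if i = j then
      (if l.1 = 0 then s.1 else 0) + (if l.1 = 1 then s.2.1 else 0) +
      (if l.1 = 2 then s.2.2.1 else 0) + (if l.1 = 3 then s.2.2.2 else 0) else 0 := by
    intro i s j l
    simp only [E, Submodule.coe_add, Submodule.coe_smul, LinearMap.add_apply, LinearMap.smul_apply,
      hD, smul_eq_mul]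
    by_cases hij : i = j
    · simp [hij, eq_comm]
    · simp [hij]
  have key := card_forall_mul_le (A := F × F × F × F) (M := 16) (N := 15)
    (fun s => ∑ i, E i (s i)) E (fun i φ => ¬ GoodAt (φ : Dual F V) (X i)) ?_ ?_ inferInstance
  · refine le_of_eq_of_le ?_ key
    congr!
  · intro φ s i
    have : ∀ l, ((φ + ∑ i, E i (s i) : U) : Dual F V) (X i l) =
        ((φ + E i (s i) : U) : Dual F V) (X i l) := by
      intro l
      rw [Submodule.coe_add, Submodule.coe_add, LinearMap.add_apply, LinearMap.add_apply,
        Submodule.coe_sum, LinearMap.sum_apply, Finset.sum_eq_single i]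
      · intro j _ hj; rw [hE, if_neg hj]
      · simp
    simp only [GoodAt, this, imp_self]
  · intro i φ
    have := card_bad_parameters_le ((φ : Dual F V) (X i 0)) ((φ : Dual F V) (X i 1))
      ((φ : Dual F V) (X i 2)) 1 ((φ : Dual F V) (X i 4)) ((φ : Dual F V) (X i 5))
      ((φ : Dual F V) (X i 6)) ((φ : Dual F V) (X i 7)) ((φ : Dual F V) (X i 3)) one_ne_zero
    refine le_of_eq_of_le ?_ this
    congr 2
    ext s
    simp only [mem_filter, mem_univ, true_and, GoodAt, Submodule.coe_add, LinearMap.add_apply, hE]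
    simp

end

section

/-- The word of a power of the first generator. -/
def powWord (k : ℤ) : List (Bool × Bool) := List.replicate k.natAbs (false, decide (0 ≤ k))

theorem powWord_injective : Function.Injective powWord := by
  intro k l h
  obtain ⟨h1, h2⟩ := List.replicate_inj.1 h
  rcases h2 with h2 | h2
  · omega
  · have h3 := congrArg Prod.snd h2
    simp only [decide_eq_decide] at h3
    omega

/-- The words `x ^ k` (left) and `x ^ i * y ^ (± 1) * x ^ k` (right). -/
def nodeWord : ℤ ⊕ (ℕ × Bool × ℤ) → List (Bool × Bool)
  | .inl k => powWord k
  | .inr (i, s, k) => List.replicate i (false, true) ++ (true, s) :: powWord k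

theorem nodeWord_injective : Function.Injective nodeWord := by
  have hx : ∀ k, (true : Bool) ∉ (powWord k).map Prod.fst := by
    intro k; simp [powWord]
  have hcancel : ∀ (i j : ℕ) (c d : Bool) (l m : List (Bool × Bool)),
      List.replicate i (false, true) ++ (true, c) :: l =
        List.replicate j (false, true) ++ (true, d) :: m → i = j ∧ c = d ∧ l = m := by
    intro i
    induction i with
    | zero =>
      intro j c d l m h
      cases j with
      | zero => simpa using h
      | succ j => simp [List.replicate_succ] at h
    | succ i ih =>
      intro j c d l m h
      cases j with
      | zero => simp [List.replicate_succ] at h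
      | succ j =>
        simp only [List.replicate_succ, List.cons_append, List.cons.injEq, true_and] at h
        obtain ⟨h1, h2⟩ := ih j c d l m h
        exact ⟨by rw [h1], h2⟩
  rintro (k | ⟨i, s, k⟩) (l | ⟨j, t, l⟩) h
  · rw [powWord_injective h]
  · exact absurd (by rw [show powWord k = _ from h]; simp [nodeWord]) (hx k)
  · exact absurd (by rw [show powWord l = _ from h.symm]; simp [nodeWord]) (hx l)
  · obtain ⟨rfl, rfl, h3⟩ := hcancel i j s t _ _ h
    rw [powWord_injective h3]

/-- The nodes with bounded exponents. -/
noncomputable def nodes (R : ℕ) : Finset (ℤ ⊕ (ℕ × Bool × ℤ)) :=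
  (Icc (-R : ℤ) R).disjSum (range 5 ×ˢ (univ ×ˢ Icc (-R : ℤ) R))

theorem inl_mem_nodes {R : ℕ} {k : ℤ} : Sum.inl k ∈ nodes R ↔ -R ≤ k ∧ k ≤ R := by
  simp [nodes]

theorem inr_mem_nodes {R i : ℕ} {s : Bool} {k : ℤ} :
    Sum.inr (i, s, k) ∈ nodes R ↔ i < 5 ∧ -R ≤ k ∧ k ≤ R := by
  simp [nodes]

theorem card_nodes (R : ℕ) : #(nodes R) = 11 * (2 * R + 1) := by
  simp only [nodes, card_disjSum, card_product, Int.card_Icc, card_range, card_univ,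
    Fintype.card_bool]
  omega

theorem powWord_tail {k : ℤ} {c : Bool × Bool} {l : List (Bool × Bool)} (h : c :: l = powWord k) :
    ∃ k', l = powWord k' ∧ k'.natAbs ≤ k.natAbs := by
  have h0 : k ≠ 0 := by
    rintro rfl
    simp [powWord] at h
  rcases lt_or_gt_of_ne h0 with hk | hk
  · have hl : l = List.replicate (k.natAbs - 1) (false, false) := by
      rw [powWord, show k.natAbs = (k.natAbs - 1) + 1 by omega, List.replicate_succ,
        List.cons.injEq, decide_eq_false (by omega)] at h
      exact h.2
    by_cases h1 : k = -1
    · exact ⟨0, by rw [hl, h1]; rfl, by omega⟩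
    · refine ⟨k + 1, ?_, by omega⟩
      rw [hl, powWord, decide_eq_false (by omega)]
      congr 1; omega
  · have hl : l = List.replicate (k.natAbs - 1) (false, true) := by
      rw [powWord, show k.natAbs = (k.natAbs - 1) + 1 by omega, List.replicate_succ,
        List.cons.injEq, decide_eq_true (by omega)] at h
      exact h.2
    refine ⟨k - 1, ?_, by omega⟩
    rw [hl, powWord, decide_eq_true (by omega)]
    congr 1; omega

theorem isWordTree_nodes (R : ℕ) : IsWordTree ((nodes R).image nodeWord) := by
  refine ⟨mem_image.2 ⟨.inl 0, inl_mem_nodes.2 (by omega), rfl⟩, ?_, ?_⟩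
  · intro c l h
    obtain ⟨a, ha, h⟩ := mem_image.1 h
    rcases a with k | ⟨i, s, k⟩
    · obtain ⟨k', rfl, hk'⟩ := powWord_tail h.symm
      rw [inl_mem_nodes] at ha
      exact mem_image.2 ⟨.inl k', inl_mem_nodes.2 (by omega), rfl⟩
    · rw [inr_mem_nodes] at ha
      cases i with
      | zero =>
        simp only [nodeWord, List.replicate_zero, List.nil_append, List.cons.injEq] at h
        exact mem_image.2 ⟨.inl k, inl_mem_nodes.2 (by omega), h.2⟩
      | succ i =>
        simp only [nodeWord, List.replicate_succ, List.cons_append, List.cons.injEq] at h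
        exact mem_image.2 ⟨.inr (i, s, k), inr_mem_nodes.2 (by omega), h.2⟩
  · intro b s s' l h
    obtain ⟨a, ha, h⟩ := mem_image.1 h
    have hpow : ∀ (k : ℤ) (c d : Bool × Bool) (m : List (Bool × Bool)),
        powWord k = c :: d :: m → c = d := by
      intro k c d m h
      have h1 : ∀ e ∈ powWord k, e = (false, decide (0 ≤ k)) := fun e he =>
        List.eq_of_mem_replicate he
      rw [h1 c (by rw [h]; simp), h1 d (by rw [h]; simp)]
    rcases a with k | ⟨i, t, k⟩
    · have := hpow k _ _ _ h
      simpa using this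
    · rcases i with _ | _ | i
      · simp only [nodeWord, List.replicate_zero, List.nil_append, List.cons.injEq,
          Prod.mk.injEq] at h
        have : (true : Bool) ∈ (powWord k).map Prod.fst := by rw [h.2, ← h.1.1]; simp
        simp [powWord] at this
      · simp [nodeWord] at h
        have h1 := h.1.1
        rw [h.2.1.1] at h1
        simp at h1
      · simp only [nodeWord, List.replicate_succ, List.cons_append, List.cons.injEq,
          Prod.mk.injEq] at h
        rw [← h.1.2, ← h.2.1.2]

section
variable {Γ : Type*} [Group Γ]

theorem evalWord_powWord (g : Bool → Γ) (k : ℤ) : evalWord g (powWord k) = g false ^ k := by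
  have h1 : ∀ m : ℕ, evalWord g (List.replicate m (false, true)) = g false ^ m := by
    intro m
    induction m with
    | zero => simp [evalWord]
    | succ m ih => rw [List.replicate_succ, evalWord, ih, pow_succ']
  have h2 : ∀ m : ℕ, evalWord g (List.replicate m (false, false)) = (g false ^ m)⁻¹ := by
    intro m
    induction m with
    | zero => simp [evalWord]
    | succ m ih => rw [List.replicate_succ, evalWord, ih, pow_succ, mul_inv_rev]
  rw [powWord]
  by_cases hk : 0 ≤ k
  · rw [decide_eq_true hk, h1, ← zpow_natCast]; congr 1; omega
  · rw [decide_eq_false hk, h2, ← zpow_natCast, ← zpow_neg]; congr 1; omega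

/-- The group element of a node. -/
def nodeElt (x y : Γ) : ℤ ⊕ (ℕ × Bool × ℤ) → Γ
  | .inl k => x ^ k
  | .inr (i, s, k) => x ^ i * (if s then y else y⁻¹) * x ^ k

theorem evalWord_nodeWord (g : Bool → Γ) (a : ℤ ⊕ (ℕ × Bool × ℤ)) :
    evalWord g (nodeWord a) = nodeElt (g false) (g true) a := by
  rcases a with k | ⟨i, s, k⟩
  · exact evalWord_powWord g k
  · have : ∀ (m : ℕ) l, evalWord g (List.replicate m (false, true) ++ l) =
        g false ^ m * evalWord g l := by
      intro m l
      induction m with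
      | zero => simp
      | succ m ih => rw [List.replicate_succ, List.cons_append, evalWord, ih, pow_succ', mul_assoc]
    rw [nodeWord, this, nodeElt, mul_assoc]
    cases s <;> simp [evalWord, evalWord_powWord]
end

variable {F V : Type*} [Field F] [Fintype F] [AddCommGroup V] [Module F V] [Fintype V]

open scoped Classical in
theorem card_not_linearIndependent_nodes_le {G : Subgroup (V ≃ₗ[F] V)} (hG : ContainsSL G) {R : ℕ}
    (hR : 11 * (2 * R + 1) ≤ finrank F V) :
    (#{z : (Bool → G) × V | ¬ LinearIndependent F (fun a : nodes R =>
        nodeElt (z.1 false : V ≃ₗ[F] V) (z.1 true : V ≃ₗ[F] V) a.1 z.2)} : ℝ) ≤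
      (Fintype.card G : ℝ) ^ 2 * (Fintype.card F : ℝ) ^ (11 * (2 * R + 1)) := by
  have hc : #((nodes R).image nodeWord) = 11 * (2 * R + 1) := by
    rw [card_image_of_injective _ nodeWord_injective, card_nodes]
  have key := card_not_linearIndependent_tree_le hG (isWordTree_nodes R) (hc.trans_le hR)
  rw [hc, Fintype.card_bool] at key
  refine le_trans (Nat.cast_le.2 (card_le_card (t := ({z : (Bool → G) × V | ¬ LinearIndependent F
    (fun l : (nodes R).image nodeWord => evalWord (fun b => (z.1 b : V ≃ₗ[F] V)) l z.2)} :
      Finset _)) ?_)) (le_of_eq_of_le ?_ key)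
  · intro z hz
    rw [mem_filter] at hz ⊢
    refine ⟨mem_univ _, fun h => hz.2 ?_⟩
    let f : nodes R → (nodes R).image nodeWord := fun a =>
      ⟨nodeWord a.1, mem_image_of_mem _ a.2⟩
    have hf : Function.Injective f := fun a b hab =>
      Subtype.ext (nodeWord_injective (congrArg Subtype.val hab))
    have h2 := h.comp f hf
    convert h2 using 1
    funext a
    simp only [Function.comp, f, evalWord_nodeWord]
  · congr!

end

section

variable {F V : Type*} [Field F] [Fintype F] [AddCommGroup V] [Module F V]

/-- The eight vectors entering the conditions on the `m`-th pair of translates of `v`. -/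
def testVectors (x : V ≃ₗ[F] V) (v : V) (Θ : V →ₗ[F] V) (K : ℕ) (m : Fin K) : Fin 8 → V :=
  let a : ℤ := 6 * K + 2 + 2 * m.1
  let b : ℤ := 2 * K + 1 + m.1
  ![(x ^ (10 * b)) v, (x ^ (10 * (a - b))) v, (x ^ (10 * (-a))) v, Θ ((x ^ (10 * a)) v),
    (x ^ (10 * a)) v, (x ^ (10 * (b - a))) v, (x ^ (10 * (-b))) v, Θ ((x ^ (10 * b)) v)]

open scoped Classical in
theorem card_forall_not_goodAt_testVectors_le {x : V ≃ₗ[F] V} {v : V} {Θ : V →ₗ[F] V} {K : ℕ}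
    (U : Submodule F (Dual F V)) [Fintype U] (hU : ∀ φ : Dual F V, φ v = 0 → φ ∈ U)
    (D f : ℤ → Dual F V)
    (hD : ∀ k l : ℤ, |k| ≤ 8 * K → |l| ≤ 8 * K → D k ((x ^ (10 * l)) v) = if k = l then 1 else 0)
    (hDΘ : ∀ k l : ℤ, |k| ≤ 8 * K → |l| ≤ 8 * K → D k (Θ ((x ^ (10 * l)) v)) = 0)
    (hf : ∀ k l : ℤ, |k| ≤ 8 * K → |l| ≤ 8 * K → f k ((x ^ (10 * l)) v) = 0)
    (hfΘ : ∀ k l : ℤ, |k| ≤ 8 * K → |l| ≤ 8 * K →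
      f k (Θ ((x ^ (10 * l)) v)) = if k = l then 1 else 0) :
    16 ^ K * #{φ : U | ∀ m : Fin K, ¬ GoodAt (φ : Dual F V) (testVectors x v Θ K m)} ≤
      15 ^ K * Fintype.card U := by
  have hv : ∀ k : ℤ, |k| ≤ 8 * K → k ≠ 0 → D k v = 0 := by
    intro k hk h0
    have := hD k 0 hk (by simp)
    simpa [h0] using this
  have hv' : ∀ k : ℤ, |k| ≤ 8 * K → f k v = 0 := by
    intro k hk
    have := hf k 0 hk (by simp)
    simpa using this
  let E : Fin K → Fin 4 → U := fun m => 
    ![⟨D (2 * K + 1 + m.1), hU _ (hv _ (by rw [abs_le]; omega) (by omega))⟩,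
      ⟨D ((6 * K + 2 + 2 * m.1) - (2 * K + 1 + m.1)),
        hU _ (hv _ (by rw [abs_le]; omega) (by omega))⟩,
      ⟨D (-(6 * K + 2 + 2 * m.1)), hU _ (hv _ (by rw [abs_le]; omega) (by omega))⟩,
      ⟨f (6 * K + 2 + 2 * m.1), hU _ (hv' _ (by rw [abs_le]; omega))⟩]
  have key := card_forall_not_goodAt_le U (testVectors x v Θ K) E ?_
  · rw [Fintype.card_fin] at key
    refine le_of_eq_of_le ?_ key
    congr!
  · intro i k j l
    have hi := i.2
    have hj := j.2
    fin_cases k <;> fin_cases l <;>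
      simp [E, testVectors] <;>
      (first
        | rw [hD _ _ (by rw [abs_le]; omega) (by rw [abs_le]; omega)]
        | rw [hDΘ _ _ (by rw [abs_le]; omega) (by rw [abs_le]; omega)]
        | rw [hf _ _ (by rw [abs_le]; omega) (by rw [abs_le]; omega)]
        | rw [hfΘ _ _ (by rw [abs_le]; omega) (by rw [abs_le]; omega)]
        | skip) <;>
      (try simp only [Fin.ext_iff]) <;> (try split_ifs) <;> first | rfl | omega

end

section

variable {F V : Type*} [Field F] [Fintype F] [AddCommGroup V] [Module F V]

open scoped Classical in
theorem exists_dual_family {ι : Type*} {e : ι → V} (he : LinearIndependent F e) :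
    ∃ D : ι → Dual F V, ∀ i j, D i (e j) = if i = j then 1 else 0 := by
  choose D hD using fun i => LinearMap.exists_extend ((Finsupp.lapply i : (ι →₀ F) →ₗ[F] F) ∘ₗ he.repr)
  refine ⟨D, fun i j => ?_⟩
  have h := LinearMap.congr_fun (hD i) ⟨e j, Submodule.subset_span ⟨j, rfl⟩⟩
  have h2 : he.repr (⟨e j, Submodule.subset_span ⟨j, rfl⟩⟩ : Submodule.span F (Set.range e)) =
      Finsupp.single j 1 := he.repr_eq_single j _ rfl
  refine Eq.trans h ?_
  rw [LinearMap.comp_apply, h2, Finsupp.lapply_apply, Finsupp.single_apply]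
  simp only [eq_comm]

/-- The combination of `x h, …, x ^ 4 h` and `x, …, x ^ 4`. -/
def mixedCombination (x h : V ≃ₗ[F] V) (γ η : Fin 4 → F) : V →ₗ[F] V :=
  ∑ r : Fin 4, (γ r • ((x ^ (r.1 + 1) * h : V ≃ₗ[F] V) : V →ₗ[F] V) -
    η r • ((x ^ (r.1 + 1) : V ≃ₗ[F] V) : V →ₗ[F] V))

section
variable {x y : V ≃ₗ[F] V} {v : V} {K : ℕ}

theorem exists_node_functionals
    (he : LinearIndependent F (fun a : nodes (80 * K + 10) => nodeElt x y a.1 v)) :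
    ∃ D : ℤ ⊕ (ℕ × Bool × ℤ) → Dual F V, ∀ a ∈ nodes (80 * K + 10), ∀ b ∈ nodes (80 * K + 10),
      D a (nodeElt x y b v) = if a = b then 1 else 0 := by
  obtain ⟨D, hD⟩ := exists_dual_family he
  classical
  refine ⟨fun a => if h : a ∈ nodes (80 * K + 10) then D ⟨a, h⟩ else 0, fun a ha b hb => ?_⟩
  simp only [dif_pos ha]
  rw [hD ⟨a, ha⟩ ⟨b, hb⟩]
  simp only [Subtype.mk.injEq]

open scoped Classical in
theorem card_bad_pow_le
    (U : Submodule F (Dual F V)) [Fintype U] (hU : ∀ φ : Dual F V, φ v = 0 → φ ∈ U)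
    (he : LinearIndependent F (fun a : nodes (80 * K + 10) => nodeElt x y a.1 v)) (r : Fin 4) :
    16 ^ K * #{φ : U | ∀ m : Fin K, ¬ GoodAt (φ : Dual F V)
      (testVectors x v (((x ^ (r.1 + 1))⁻¹ : V ≃ₗ[F] V) : V →ₗ[F] V) K m)} ≤
      15 ^ K * Fintype.card U := by
  obtain ⟨D, hD⟩ := exists_node_functionals he
  have hx : ∀ l : ℤ, (((x ^ (r.1 + 1))⁻¹ : V ≃ₗ[F] V) : V →ₗ[F] V) ((x ^ (10 * l)) v) =
      nodeElt x y (.inl (10 * l - (r.1 + 1 : ℤ))) v := by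
    intro l
    rw [LinearEquiv.coe_coe, ← LinearEquiv.mul_apply, nodeElt, ← zpow_natCast, ← zpow_neg,
      ← zpow_add]
    congr 2; push_cast; ring
  have hx' : ∀ l : ℤ, (x ^ (10 * l)) v = nodeElt x y (.inl (10 * l)) v := fun l => rfl
  have hr := r.2
  refine card_forall_not_goodAt_testVectors_le U hU (fun k => D (.inl (10 * k)))
    (fun k => D (.inl (10 * k - (r.1 + 1 : ℤ)))) ?_ ?_ ?_ ?_ <;> intro k l hk hl <;>
    rw [abs_le] at hk hl <;> (try simp only [hx]) <;> (try simp only [hx']) <;>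
    rw [hD _ (inl_mem_nodes.2 (by push_cast; omega)) _ (inl_mem_nodes.2 (by push_cast; omega))]
  · simp
  · rw [if_neg]; simp only [Sum.inl.injEq]; omega
  · rw [if_neg]; simp only [Sum.inl.injEq]; omega
  · congr 1; simp

open scoped Classical in
theorem card_bad_mixed_le
    (U : Submodule F (Dual F V)) [Fintype U] (hU : ∀ φ : Dual F V, φ v = 0 → φ ∈ U)
    (he : LinearIndependent F (fun a : nodes (80 * K + 10) => nodeElt x y a.1 v)) {h : V ≃ₗ[F] V} {j₀ : ℕ} {s : Bool} {k₀ : ℤ} (hj : j₀ ≤ 1) (hk₀ : 0 ≤ k₀)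
    (hk₁ : k₀ ≤ 1)
    (hh : ∀ r : ℕ, x ^ (r + 1) * h = x ^ (r + j₀) * (if s then y else y⁻¹) * x ^ k₀)
    {γ η : Fin 4 → F} (hγ : γ ≠ 0) :
    16 ^ K * #{φ : U | ∀ m : Fin K, ¬ GoodAt (φ : Dual F V)
      (testVectors x v (mixedCombination x h γ η) K m)} ≤ 15 ^ K * Fintype.card U := by
  obtain ⟨D, hD⟩ := exists_node_functionals he
  obtain ⟨r₀, hr₀⟩ := Function.ne_iff.1 hγ
  rw [Pi.zero_apply] at hr₀
  have hx : ∀ l : ℤ, mixedCombination x h γ η ((x ^ (10 * l)) v) =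
      ∑ r : Fin 4, (γ r • nodeElt x y (.inr (r.1 + j₀, s, k₀ + 10 * l)) v -
        η r • nodeElt x y (.inl (r.1 + 1 + 10 * l)) v) := by
    intro l
    simp only [mixedCombination, LinearMap.sum_apply, LinearMap.sub_apply, LinearMap.smul_apply,
      LinearEquiv.coe_coe, ← LinearEquiv.mul_apply, hh]
    refine sum_congr rfl fun r _ => ?_
    rw [nodeElt, nodeElt, zpow_add, mul_assoc, mul_assoc, zpow_add x (r.1 + 1 : ℤ),
      ← zpow_natCast x (r.1 + 1)]
    push_cast
    rfl
  have hx' : ∀ l : ℤ, (x ^ (10 * l)) v = nodeElt x y (.inl (10 * l)) v := fun l => rfl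
  have hr := r₀.2
  refine card_forall_not_goodAt_testVectors_le U hU (fun k => D (.inl (10 * k)))
    (fun k => (γ r₀)⁻¹ • D (.inr (r₀.1 + j₀, s, k₀ + 10 * k))) ?_ ?_ ?_ ?_ <;> intro k l hk hl <;>
    rw [abs_le] at hk hl <;> (try simp only [hx]) <;> (try simp only [hx'])
  · rw [hD _ (inl_mem_nodes.2 (by push_cast; omega)) _ (inl_mem_nodes.2 (by push_cast; omega))]
    simp
  · rw [map_sum]
    refine sum_eq_zero fun r _ => ?_
    have := r.2
    rw [map_sub, map_smul, map_smul,
      hD _ (inl_mem_nodes.2 (by push_cast; omega)) _ (inl_mem_nodes.2 (by push_cast; omega)),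
      hD _ (inl_mem_nodes.2 (by push_cast; omega)) _ (inr_mem_nodes.2 (by push_cast; omega)),
      if_neg (by simp), if_neg (by simp only [Sum.inl.injEq]; omega), smul_zero, smul_zero, sub_zero]
  · rw [LinearMap.smul_apply,
      hD _ (inr_mem_nodes.2 (by push_cast; omega)) _ (inl_mem_nodes.2 (by push_cast; omega)),
      if_neg (by simp), smul_zero]
  · rw [LinearMap.smul_apply, map_sum, Finset.sum_eq_single r₀]
    · rw [map_sub, map_smul, map_smul,
        hD _ (inr_mem_nodes.2 (by push_cast; omega)) _ (inl_mem_nodes.2 (by push_cast; omega)),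
        hD _ (inr_mem_nodes.2 (by push_cast; omega)) _ (inr_mem_nodes.2 (by push_cast; omega)),
        if_neg (show ¬ (Sum.inr _ = Sum.inl _) by simp), smul_zero, sub_zero, smul_smul,
        inv_mul_cancel₀ hr₀, one_smul]
      congr 1; simp
    · intro r _ hne
      have := r.2
      rw [map_sub, map_smul, map_smul,
        hD _ (inr_mem_nodes.2 (by push_cast; omega)) _ (inl_mem_nodes.2 (by push_cast; omega)),
        hD _ (inr_mem_nodes.2 (by push_cast; omega)) _ (inr_mem_nodes.2 (by push_cast; omega)),
        if_neg (show ¬ (Sum.inr _ = Sum.inl _) by simp), if_neg, smul_zero, smul_zero, sub_zero]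
      have : r₀.1 ≠ r.1 := fun h => hne (Fin.ext h.symm)
      simp only [Sum.inr.injEq, Prod.mk.injEq]
      omega
    · simp
end

end

section

variable {F V : Type*} [Field F] [AddCommGroup V] [Module F V]

/-- The four elements with respect to which a system of transvections is grown. -/
def growElts (x y : V ≃ₗ[F] V) : Fin 4 → V ≃ₗ[F] V := ![y, y⁻¹, y * x, (y * x)⁻¹]

/-- A pair (vector, covector) from which all transvections can be reached. -/
def GoodPair (x y : V ≃ₗ[F] V) (K : ℕ) (v : V) (φ : Dual F V) : Prop :=
  (∀ r : Fin 4, ∃ m, GoodAt φ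
    (testVectors x v (((x ^ (r.1 + 1))⁻¹ : V ≃ₗ[F] V) : V →ₗ[F] V) K m)) ∧
  ∀ (i : Fin 4) (γ η : Fin 4 → F), γ ≠ 0 → ∃ m, GoodAt φ
    (testVectors x v (mixedCombination x (growElts x y i) γ η) K m)

open scoped Classical in
theorem card_not_goodPair_le [Fintype F] {x y : V ≃ₗ[F] V} {v : V} {K : ℕ}
    (U : Submodule F (Dual F V)) [Fintype U] (hU : ∀ φ : Dual F V, φ v = 0 → φ ∈ U)
    (he : LinearIndependent F (fun a : nodes (80 * K + 10) => nodeElt x y a.1 v)) :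
    16 ^ K * #{φ : U | ¬ GoodPair x y K v φ} ≤
      15 ^ K * Fintype.card U * (8 * Fintype.card F ^ 8) := by
  let A : Fin 4 → Finset U := fun r => {φ : U | ∀ m : Fin K, ¬ GoodAt (φ : Dual F V)
      (testVectors x v (((x ^ (r.1 + 1))⁻¹ : V ≃ₗ[F] V) : V →ₗ[F] V) K m)}
  let B : Fin 4 × (Fin 4 → F) × (Fin 4 → F) → Finset U := fun t =>
    {φ : U | t.2.1 ≠ 0 ∧ ∀ m : Fin K, ¬ GoodAt (φ : Dual F V)
      (testVectors x v (mixedCombination x (growElts x y t.1) t.2.1 t.2.2) K m)}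
  have hsub : ({φ : U | ¬ GoodPair x y K v φ} : Finset U) ⊆ univ.biUnion A ∪ univ.biUnion B := by
    intro φ hφ
    rw [mem_filter] at hφ
    have h := hφ.2
    rw [GoodPair, not_and_or] at h
    rcases h with h | h
    · push Not at h
      obtain ⟨r, hr⟩ := h
      exact mem_union_left _ (mem_biUnion.2 ⟨r, mem_univ _, mem_filter.2 ⟨mem_univ _, hr⟩⟩)
    · push Not at h
      obtain ⟨i, γ, η, hγ, hr⟩ := h
      exact mem_union_right _ (mem_biUnion.2 ⟨(i, γ, η), mem_univ _,
        mem_filter.2 ⟨mem_univ _, hγ, hr⟩⟩)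
  have hA : ∀ r, 16 ^ K * #(A r) ≤ 15 ^ K * Fintype.card U := fun r => card_bad_pow_le U hU he r
  have hB : ∀ t, 16 ^ K * #(B t) ≤ 15 ^ K * Fintype.card U := by
    rintro ⟨i, γ, η⟩
    by_cases hγ : γ = 0
    · have : B (i, γ, η) = ∅ := by
        refine filter_eq_empty_iff.2 fun φ _ h => h.1 hγ
      rw [this]; simp
    · have hsub : B (i, γ, η) ⊆ ({φ : U | ∀ m : Fin K, ¬ GoodAt (φ : Dual F V)
          (testVectors x v (mixedCombination x (growElts x y i) γ η) K m)} : Finset U) := by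
        intro φ hφ
        exact mem_filter.2 ⟨mem_univ _, (mem_filter.1 hφ).2.2⟩
      refine (Nat.mul_le_mul_left _ (card_le_card hsub)).trans ?_
      fin_cases i
      · exact card_bad_mixed_le U hU he (j₀ := 1) (s := true) (k₀ := 0) (by omega) (by omega)
          (by omega) (fun r => by simp [growElts]) hγ
      · exact card_bad_mixed_le U hU he (j₀ := 1) (s := false) (k₀ := 0) (by omega) (by omega)
          (by omega) (fun r => by simp [growElts]) hγ
      · exact card_bad_mixed_le U hU he (j₀ := 1) (s := true) (k₀ := 1) (by omega) (by omega)
          (by omega) (fun r => by simp [growElts, mul_assoc]) hγ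
      · exact card_bad_mixed_le U hU he (j₀ := 0) (s := false) (k₀ := 0) (by omega) (by omega)
          (by omega) (fun r => by simp [growElts, pow_succ, mul_assoc]) hγ
  have h1 : 16 ^ K * #(univ.biUnion A) ≤ 4 * (15 ^ K * Fintype.card U) := by
    refine (Nat.mul_le_mul_left _ card_biUnion_le).trans ?_
    rw [mul_sum]
    refine (sum_le_sum fun r _ => hA r).trans (le_of_eq ?_)
    simp
  have h2 : 16 ^ K * #(univ.biUnion B) ≤ 4 * Fintype.card F ^ 8 * (15 ^ K * Fintype.card U) := by
    refine (Nat.mul_le_mul_left _ card_biUnion_le).trans ?_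
    rw [mul_sum]
    refine (sum_le_sum fun r _ => hB r).trans (le_of_eq ?_)
    simp only [sum_const, card_univ, Fintype.card_prod, Fintype.card_fun, Fintype.card_fin,
      smul_eq_mul]
    ring
  have h3 := (Nat.mul_le_mul_left (16 ^ K) ((card_le_card hsub).trans (card_union_le _ _)))
  have h4 : 1 ≤ Fintype.card F ^ 8 := Nat.one_le_pow _ _ Fintype.card_pos
  have h5 : 4 * (15 ^ K * Fintype.card U) * 1 ≤
      4 * (15 ^ K * Fintype.card U) * Fintype.card F ^ 8 := Nat.mul_le_mul_left _ h4
  linarith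

/-- A good pair makes all transvections available. -/
theorem GoodPair.full [FiniteDimensional F V] {S : Set (V ≃ₗ[F] V)} (hS : ∀ g ∈ S, g⁻¹ ∈ S)
    {x y : V ≃ₗ[F] V} (hx : x ∈ S) (hy : y ∈ S) {K k ℓ : ℕ} {v : V} {φ : Dual F V}
    (h : GoodPair x y K v φ) (hv : Avail S ℓ v φ) (hE : ExpandsAll y (y * x))
    (hℓ : 80 * K + 4 ≤ ℓ) (hk : finrank F V * 10 ^ k < 11 ^ k) :
    Full S (4624 ^ (2 * k) * (480 * (K + 1) * ℓ)) ⊤ ⊤ := by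
  classical
  let a : Fin K → ℤ := fun m => 10 * (6 * K + 2 + 2 * m.1)
  let b : Fin K → ℤ := fun m => 10 * (2 * K + 1 + m.1)
  let c : Fin K → V := fun m => (x ^ a m) v - (φ ((x ^ a m) v) / φ ((x ^ b m) v)) • (x ^ b m) v
  let ι := {m : Fin K // Avail S (20 * ℓ) (c m) φ}
  have hgood : ∀ (Θ : V →ₗ[F] V) m, GoodAt φ (testVectors x v Θ K m) →
      Avail S (20 * ℓ) (c m) φ ∧ φ (Θ (c m)) ≠ 0 := by
    intro Θ m hm
    have hm2 := m.2
    obtain ⟨h1, h2, h3, h4⟩ := hm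
    have e1 : (x ^ b m)⁻¹ * x ^ a m = x ^ (a m - b m) := by
      rw [← zpow_neg, ← zpow_add]; congr 1; ring
    have e2 : (x ^ a m)⁻¹ * x ^ b m = x ^ (b m - a m) := by
      rw [← zpow_neg, ← zpow_add]; congr 1; ring
    have hball : ∀ j : ℤ, |j| ≤ 80 * K → InBall S (80 * K) (x ^ j) := by
      intro j hj
      rw [abs_le] at hj
      exact (InBall.zpow hS hx j).mono (by omega)
    have ba := hball (a m) (by rw [abs_le]; simp only [a, b]; omega)
    have bb := hball (b m) (by rw [abs_le]; simp only [a, b]; omega)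
    constructor
    · refine (hv.combine ba (ba.inv hS) bb (bb.inv hS) h1 ?_ ?_).mono (by omega)
      · rw [← LinearEquiv.mul_apply, e1]
        convert h2 using 3
        simp only [a, b, testVectors]; rw [← mul_sub]; rfl
      · rw [← LinearEquiv.mul_apply, e1, ← LinearEquiv.mul_apply, e2, ← zpow_neg, ← zpow_neg]
        convert h3 using 4
        all_goals simp only [a, b, testVectors, ← mul_sub, ← mul_neg]; rfl
    · rw [map_sub, map_smul, map_sub, map_smul, smul_eq_mul]
      exact h4
  have hfull : Full S (24 * (Fintype.card ι + 1) * (20 * ℓ)) (powCore x φ fun m : ι => c m.1)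
      (LinearMap.range (powDual x φ)) := by
    refine full_powCore hS hx (fun m => m.2) (fun r => ?_) (by omega)
    obtain ⟨m, hm⟩ := h.1 r
    obtain ⟨h1, h2⟩ := hgood _ m hm
    exact ⟨⟨m, h1⟩, h2⟩
  have hcard : Fintype.card ι ≤ K := by
    simpa using Fintype.card_subtype_le fun m : Fin K => Avail S (20 * ℓ) (c m) φ
  have hrank : ∀ (i : Fin 4) (γ η : Fin 4 → F), γ ≠ 0 → ∃ m : ι,
      powDual x φ γ (growElts x y i (c m.1)) - powDual x φ η (c m.1) ≠ 0 := by
    intro i γ η hγ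
    obtain ⟨m, hm⟩ := h.2 i γ η hγ
    obtain ⟨h1, h2⟩ := hgood _ m hm
    refine ⟨⟨m, h1⟩, ?_⟩
    convert h2 using 1
    simp only [powDual_apply, mixedCombination, LinearMap.sum_apply, LinearMap.sub_apply,
      LinearMap.smul_apply, map_sum, map_sub, map_smul, smul_eq_mul, sum_sub_distrib,
      LinearEquiv.coe_coe, LinearEquiv.mul_apply]
  have hfull' := hfull.mono (ℓ' := 480 * (K + 1) * ℓ) (by
    calc 24 * (Fintype.card ι + 1) * (20 * ℓ) = 480 * (Fintype.card ι + 1) * ℓ := by ring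
      _ ≤ _ := by gcongr)
  have bx : InBall S 1 x := InBall.of_mem hx
  have by' : InBall S 1 y := InBall.of_mem hy
  refine hfull'.grow_to_top (h₁ := y) (h₂ := y * x) ?_ ?_ hE.fwd hE.inv hE.dual hE.dualInv hk
  · nlinarith
  · rintro g (rfl | rfl)
    · exact ⟨by'.mono (by omega), (by'.inv hS).mono (by omega), rankFour_map (hrank 0),
        rankFour_map_dual (hrank 1)⟩
    · exact ⟨by'.mul bx, (by'.mul bx).inv hS, rankFour_map (hrank 2),
        rankFour_map_dual (hrank 3)⟩

end

section

variable {F V : Type*} [Field F] [Fintype F] [AddCommGroup V] [Module F V] [Fintype V]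

open scoped Classical in
theorem pow_le_card_flagPairs (hn : 2 ≤ finrank F V) :
    Fintype.card F ^ (2 * finrank F V - 3) ≤ #(flagPairs F V) := by
  set n := finrank F V with hnn
  have hq : 2 ≤ Fintype.card F := Fintype.one_lt_card
  have hpow : ∀ k, 1 ≤ k → Fintype.card F ^ (k - 1) ≤ Fintype.card F ^ k - 1 := by
    intro k hk
    obtain ⟨j, rfl⟩ := Nat.exists_eq_add_of_le' hk
    have : 1 ≤ Fintype.card F ^ j := Nat.one_le_pow _ _ (by omega)
    have h2 : 2 * Fintype.card F ^ j ≤ Fintype.card F ^ (j + 1) := by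
      rw [pow_succ']; exact Nat.mul_le_mul_right _ hq
    rw [Nat.add_sub_cancel]; omega
  have hφ : ∀ v : V, Fintype.card F ^ (n - 2) ≤ #{φ : Dual F V | φ ≠ 0 ∧ φ v = 0} := by
    intro v
    let f : Dual F V →ₗ[F] F := Dual.eval F V v
    have h1 := LinearMap.finrank_range_add_finrank_ker f
    have h2 : finrank F (LinearMap.range f) ≤ 1 := by
      have := Submodule.finrank_le (LinearMap.range f)
      rwa [Module.finrank_self] at this
    rw [Subspace.dual_finrank_eq] at h1
    have h3 : Fintype.card F ^ (n - 1) ≤ #{φ : Dual F V | φ v = 0} := by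
      have : #{φ : Dual F V | φ v = 0} = Nat.card (LinearMap.ker f) := by
        rw [Nat.card_eq_fintype_card, Fintype.card_subtype]
        rfl
      rw [this, Module.natCard_eq_pow_finrank (K := F), Nat.card_eq_fintype_card]
      exact Nat.pow_le_pow_right (by omega) (by omega)
    have h4 : #{φ : Dual F V | φ v = 0} ≤ #{φ : Dual F V | φ ≠ 0 ∧ φ v = 0} + 1 := by
      rw [← card_singleton (0 : Dual F V)]
      refine (card_le_card fun φ hφ => ?_).trans (card_union_le _ _)
      rw [mem_filter] at hφ
      by_cases h0 : φ = 0
      · exact mem_union_right _ (by simp [h0])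
      · exact mem_union_left _ (mem_filter.2 ⟨mem_univ _, h0, hφ.2⟩)
    have h5 := hpow (n - 1) (by omega)
    rw [show n - 2 = n - 1 - 1 by omega]
    omega
  have hcount : #(flagPairs F V) = ∑ v : V, if v ≠ 0 then #{φ : Dual F V | φ ≠ 0 ∧ φ v = 0} else 0 := by
    rw [flagPairs, card_filter, Fintype.sum_prod_type]
    refine sum_congr rfl fun v _ => ?_
    by_cases hv : v = 0
    · simp [hv]
    · rw [if_pos hv, card_filter]
      refine sum_congr rfl fun φ _ => ?_
      simp [hv]
  rw [hcount]
  calc Fintype.card F ^ (2 * n - 3) = Fintype.card F ^ (n - 1) * Fintype.card F ^ (n - 2) := by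
        rw [← pow_add]; congr 1; omega
    _ ≤ (Fintype.card F ^ n - 1) * Fintype.card F ^ (n - 2) :=
        Nat.mul_le_mul_right _ (hpow n (by omega))
    _ = ∑ v : V, if v ≠ 0 then Fintype.card F ^ (n - 2) else 0 := by
        rw [← sum_filter, sum_const, smul_eq_mul, filter_ne' , card_erase_of_mem (mem_univ _),
          card_univ, Module.card_eq_pow_finrank (K := F) (V := V)]
    _ ≤ _ := sum_le_sum fun v _ => by split_ifs <;> first | exact hφ v | exact le_rfl

open scoped Classical in
theorem sum_card_not_goodPair_le {G : Subgroup (V ≃ₗ[F] V)} (hG : ContainsSL G) {K : ℕ}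
    (hK : 1760 * K + 231 ≤ finrank F V) :
    ((∑ g : Bool → G, #{p ∈ flagPairs F V | ¬ GoodPair (g false : V ≃ₗ[F] V)
        (g true : V ≃ₗ[F] V) K p.1 p.2} : ℕ) : ℝ) ≤
      (Fintype.card G : ℝ) ^ 2 * (Fintype.card F : ℝ) ^ finrank F V *
        ((Fintype.card F : ℝ) ^ (1760 * K + 231) +
          (Fintype.card F : ℝ) ^ finrank F V * (8 * (Fintype.card F : ℝ) ^ 8) * (15 / 16) ^ K) := by
  set q := Fintype.card F with hq
  set n := finrank F V with hn
  have hDual : Fintype.card (Dual F V) = q ^ n := by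
    rw [Module.card_eq_pow_finrank (K := F), Subspace.dual_finrank_eq]
  let li : (Bool → G) → V → Prop := fun g v => LinearIndependent F (fun a : nodes (80 * K + 10) =>
        nodeElt (g false : V ≃ₗ[F] V) (g true : V ≃ₗ[F] V) a.1 v)
  have hbound : ∀ (g : Bool → G) (v : V), li g v →
      (#{φ : Dual F V | φ v = 0 ∧ ¬ GoodPair (g false : V ≃ₗ[F] V) (g true : V ≃ₗ[F] V) K v φ} : ℝ) ≤
      (q : ℝ) ^ n * (8 * (q : ℝ) ^ 8) * (15 / 16) ^ K := by
    intro g v hv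
    let U : Submodule F (Dual F V) := LinearMap.ker (Dual.eval F V v)
    have h1 := card_not_goodPair_le (K := K) U (fun φ h => h) hv
    have h2 : #{φ : Dual F V | φ v = 0 ∧ ¬ GoodPair (g false : V ≃ₗ[F] V) (g true : V ≃ₗ[F] V) K v φ} ≤
        #{φ : U | ¬ GoodPair (g false : V ≃ₗ[F] V) (g true : V ≃ₗ[F] V) K v φ} := by
      refine card_le_card_of_surjOn Subtype.val ?_
      intro φ hφ
      simp only [coe_filter, mem_univ, true_and, Set.mem_ofPred_eq] at hφ
      exact ⟨⟨φ, hφ.1⟩, by simpa using hφ.2, rfl⟩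
    have h3 : Fintype.card U ≤ q ^ n := by
      rw [← hDual]; exact Fintype.card_subtype_le _
    have h4 : ((16 ^ K * #{φ : Dual F V | φ v = 0 ∧
        ¬ GoodPair (g false : V ≃ₗ[F] V) (g true : V ≃ₗ[F] V) K v φ} : ℕ) : ℝ) ≤
        ((15 ^ K * q ^ n * (8 * q ^ 8) : ℕ) : ℝ) := by
      refine Nat.cast_le.2 ((Nat.mul_le_mul_left _ h2).trans (h1.trans ?_))
      gcongr
    push_cast at h4
    rw [div_pow, mul_div_assoc', le_div_iff₀ (by positivity)]
    linarith
  have hsplit : ∀ g : Bool → G, (#{p ∈ flagPairs F V | ¬ GoodPair (g false : V ≃ₗ[F] V)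
      (g true : V ≃ₗ[F] V) K p.1 p.2} : ℝ) ≤
      ∑ v : V, ((if ¬ li g v then (q : ℝ) ^ n else 0) +
        (q : ℝ) ^ n * (8 * (q : ℝ) ^ 8) * (15 / 16) ^ K) := by
    intro g
    have h1 : #{p ∈ flagPairs F V | ¬ GoodPair (g false : V ≃ₗ[F] V)
        (g true : V ≃ₗ[F] V) K p.1 p.2} ≤ ∑ v : V, #{φ : Dual F V | φ v = 0 ∧
        ¬ GoodPair (g false : V ≃ₗ[F] V) (g true : V ≃ₗ[F] V) K v φ} := by
      rw [flagPairs, filter_filter, card_filter, Fintype.sum_prod_type]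
      refine sum_le_sum fun v _ => ?_
      rw [card_filter]
      refine sum_le_sum fun φ _ => ?_
      split_ifs with h1 h2 <;> first | omega | exact absurd ⟨h1.1.2.2, h1.2⟩ h2
    refine (Nat.cast_le.2 h1).trans ?_
    rw [Nat.cast_sum]
    refine sum_le_sum fun v _ => ?_
    by_cases hv : li g v
    · rw [if_neg (not_not.2 hv), zero_add]; exact hbound g v hv
    · rw [if_pos hv]
      refine le_add_of_le_of_nonneg ?_ (by positivity)
      rw [← Nat.cast_pow, ← hDual]
      exact Nat.cast_le.2 (card_le_univ _)
  have hli : ∑ g : Bool → G, ∑ v : V, (if ¬ li g v then (q : ℝ) ^ n else 0) ≤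
      (Fintype.card G : ℝ) ^ 2 * (q : ℝ) ^ (1760 * K + 231) * (q : ℝ) ^ n := by
    have h := card_not_linearIndependent_nodes_le hG (R := 80 * K + 10) (by omega)
    rw [show 11 * (2 * (80 * K + 10) + 1) = 1760 * K + 231 by ring] at h
    rw [← Fintype.sum_prod_type' (f := fun (g : Bool → G) (v : V) =>
      if ¬ li g v then (q : ℝ) ^ n else 0), ← sum_filter, sum_const, nsmul_eq_mul]
    exact mul_le_mul_of_nonneg_right h (by positivity)
  rw [Nat.cast_sum]
  refine (sum_le_sum fun g _ => hsplit g).trans ?_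
  simp only [sum_add_distrib]
  refine (add_le_add_left hli _).trans (le_of_eq ?_)
  have hV : (Fintype.card V : ℝ) = (q : ℝ) ^ n := by
    rw [Module.card_eq_pow_finrank (K := F)]; push_cast; rfl
  simp only [sum_const, card_univ, nsmul_eq_mul, Fintype.card_fun, Fintype.card_bool, hV]
  push_cast
  ring

open scoped Classical in
/-- It is rare that a word fixes a pair (vector, covector) that is not good. -/
theorem card_fix_not_goodPair_le {G : Subgroup (V ≃ₗ[F] V)} (hG : ContainsSL G) {K L : ℕ}
    (hK : 1760 * K + 231 ≤ finrank F V) :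
    (#{t : (Bool → G) × G | ∃ (i : Fin L → Bool) (v : V) (φ : Dual F V), (v, φ) ∈ flagPairs F V ∧
        ¬ GoodPair (t.1 false : V ≃ₗ[F] V) (t.1 true : V ≃ₗ[F] V) K v φ ∧
        (evalWord (fun b => (t.1 b : V ≃ₗ[F] V)) (posWord i) * (t.2 : V ≃ₗ[F] V)) v = v ∧
        ∀ u, φ ((evalWord (fun b => (t.1 b : V ≃ₗ[F] V)) (posWord i) * (t.2 : V ≃ₗ[F] V)) u) =
          φ u} : ℝ) ≤
      (Fintype.card G : ℝ) ^ 3 * 2 ^ L *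
        ((Fintype.card F : ℝ) ^ (1760 * K + 235) / (Fintype.card F : ℝ) ^ finrank F V +
          8 * (Fintype.card F : ℝ) ^ 12 * (15 / 16) ^ K) := by
  set q := Fintype.card F with hq
  set n := finrank F V with hn
  let W : (Bool → G) → (Fin L → Bool) → (V ≃ₗ[F] V) := fun g i =>
    evalWord (fun b => (g b : V ≃ₗ[F] V)) (posWord i)
  let Fix : (V ≃ₗ[F] V) → V → Dual F V → Prop := fun w v φ => w v = v ∧ ∀ u, φ (w u) = φ u
  let Bad : (Bool → G) → Finset (V × Dual F V) := fun g =>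
    {p ∈ flagPairs F V | ¬ GoodPair (g false : V ≃ₗ[F] V) (g true : V ≃ₗ[F] V) K p.1 p.2}
  have hstab : ∀ g i, ∀ p ∈ Bad g, #{z : G | Fix (W g i * (z : V ≃ₗ[F] V)) p.1 p.2} *
      #(flagPairs F V) ≤ Fintype.card G * q := by
    intro g i p hp
    refine le_trans (Nat.mul_le_mul_right _ ?_)
      (card_stab_mul_card_flagPairs_le hG (v := p.1) (φ := p.2) (mem_filter.1 hp).1)
    refine card_le_card_of_injOn (fun z => (⟨W g i, evalWord_mem g _⟩ : G) * z) ?_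
      (fun _ _ _ _ h => mul_left_cancel h)
    intro z hz
    simp only [coe_filter, mem_univ, true_and, Set.mem_ofPred_eq] at hz ⊢
    exact hz
  have hcard : #{t : (Bool → G) × G | ∃ (i : Fin L → Bool) (v : V) (φ : Dual F V),
        (v, φ) ∈ flagPairs F V ∧
        ¬ GoodPair (t.1 false : V ≃ₗ[F] V) (t.1 true : V ≃ₗ[F] V) K v φ ∧
        Fix (W t.1 i * (t.2 : V ≃ₗ[F] V)) v φ} ≤
      ∑ g : Bool → G, ∑ i : Fin L → Bool, ∑ p ∈ Bad g,
        #{z : G | Fix (W g i * (z : V ≃ₗ[F] V)) p.1 p.2} := by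
    rw [card_filter, Fintype.sum_prod_type]
    refine sum_le_sum fun g _ => ?_
    rw [← card_filter]
    have : ({z : G | ∃ (i : Fin L → Bool) (v : V) (φ : Dual F V), (v, φ) ∈ flagPairs F V ∧
        ¬ GoodPair (g false : V ≃ₗ[F] V) (g true : V ≃ₗ[F] V) K v φ ∧
        Fix (W g i * (z : V ≃ₗ[F] V)) v φ} : Finset G) ⊆ univ.biUnion fun i : Fin L → Bool =>
          (Bad g).biUnion fun p => ({z : G | Fix (W g i * (z : V ≃ₗ[F] V)) p.1 p.2} : Finset G) := by
      intro z hz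
      obtain ⟨i, v, φ, h1, h2, h3⟩ := (mem_filter.1 hz).2
      exact mem_biUnion.2 ⟨i, mem_univ _, mem_biUnion.2 ⟨(v, φ), mem_filter.2 ⟨h1, h2⟩,
        mem_filter.2 ⟨mem_univ _, h3⟩⟩⟩
    exact (card_le_card this).trans (card_biUnion_le.trans (sum_le_sum fun i _ => card_biUnion_le))
  have htot : #{t : (Bool → G) × G | ∃ (i : Fin L → Bool) (v : V) (φ : Dual F V),
        (v, φ) ∈ flagPairs F V ∧
        ¬ GoodPair (t.1 false : V ≃ₗ[F] V) (t.1 true : V ≃ₗ[F] V) K v φ ∧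
        Fix (W t.1 i * (t.2 : V ≃ₗ[F] V)) v φ} * #(flagPairs F V) ≤
      2 ^ L * (Fintype.card G * q) * ∑ g : Bool → G, #(Bad g) := by
    refine (Nat.mul_le_mul_right _ hcard).trans ?_
    rw [sum_mul, mul_sum]
    refine sum_le_sum fun g _ => ?_
    rw [sum_mul]
    calc _ ≤ ∑ i : Fin L → Bool, #(Bad g) * (Fintype.card G * q) := by
          refine sum_le_sum fun i _ => ?_
          rw [sum_mul, ← smul_eq_mul #(Bad g), ← sum_const]
          exact sum_le_sum fun p hp => hstab g i p hp
      _ = _ := by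
          rw [sum_const, card_univ, Fintype.card_fun, Fintype.card_bool, Fintype.card_fin,
            smul_eq_mul]
          ring
  have hflag := pow_le_card_flagPairs (F := F) (V := V) (by omega)
  have hsum := sum_card_not_goodPair_le hG hK
  set N := #{t : (Bool → G) × G | ∃ (i : Fin L → Bool) (v : V) (φ : Dual F V),
        (v, φ) ∈ flagPairs F V ∧
        ¬ GoodPair (t.1 false : V ≃ₗ[F] V) (t.1 true : V ≃ₗ[F] V) K v φ ∧
        Fix (W t.1 i * (t.2 : V ≃ₗ[F] V)) v φ} with hN
  have hq0 : (0 : ℝ) < q := by exact_mod_cast Fintype.card_pos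
  have h1 : (N : ℝ) * (q : ℝ) ^ (2 * n - 3) ≤ 2 ^ L * ((Fintype.card G : ℝ) * q) *
      ((Fintype.card G : ℝ) ^ 2 * (q : ℝ) ^ n *
        ((q : ℝ) ^ (1760 * K + 231) + (q : ℝ) ^ n * (8 * (q : ℝ) ^ 8) * (15 / 16) ^ K)) := by
    have h2 : ((N * #(flagPairs F V) : ℕ) : ℝ) ≤
      ((2 ^ L * (Fintype.card G * q) * ∑ g : Bool → G, #(Bad g) : ℕ) : ℝ) := Nat.cast_le.2 htot
    have h3 : ((N * q ^ (2 * n - 3) : ℕ) : ℝ) ≤ ((N * #(flagPairs F V) : ℕ) : ℝ) :=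
      Nat.cast_le.2 (Nat.mul_le_mul_left _ hflag)
    have h4 := h3.trans h2
    rw [Nat.cast_mul, Nat.cast_mul (2 ^ L * (Fintype.card G * q))] at h4
    push_cast at h4
    refine h4.trans (mul_le_mul_of_nonneg_left ?_ (by positivity))
    exact_mod_cast hsum
  have hfin : (N : ℝ) ≤ (Fintype.card G : ℝ) ^ 3 * 2 ^ L * ((q : ℝ) ^ (1760 * K + 235) / (q : ℝ) ^ n +
          8 * (q : ℝ) ^ 12 * (15 / 16) ^ K) := by
    refine le_of_mul_le_mul_right (h1.trans (le_of_eq ?_)) (pow_pos hq0 (2 * n - 3))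
    have e1 : (q : ℝ) ^ (2 * n - 3) * q ^ 3 = q ^ n * q ^ n := by
      rw [← pow_add, ← pow_add]; congr 1; omega
    have e2 : (q : ℝ) ^ (2 * n - 3) = q ^ n * q ^ n / q ^ 3 := by
      rw [eq_div_iff (by positivity), e1]
    rw [e2]
    field_simp
    ring
  exact hfin

end

section

section Words

variable {Γ : Type*} [Group Γ] {S : Set Γ}

theorem inBall_evalWord_posWord {L : ℕ} {g : Bool → Γ} (hg : ∀ b, g b ∈ S) (i : Fin L → Bool) :
    InBall S L (evalWord g (posWord i)) := by
  have h : ∀ l : List Bool, InBall S l.length (evalWord g (l.map fun b => (b, true))) := by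
    intro l
    induction l with
    | nil => exact InBall.one _
    | cons b l ih =>
      rw [List.length_cons, add_comm]
      exact (InBall.of_mem (hg b)).mul ih
  have h2 := h (List.ofFn i)
  rw [List.map_ofFn, List.length_ofFn] at h2
  exact h2

/-- In the subgroup generated by three elements, the value of a homomorphism to an abelian group
is attained by a short product of powers. -/
theorem exists_pow_map_eq {A : Type*} [CommGroup A] [Finite A] (f : Γ →* A) {x y z g : Γ}
    (hS : S = {x, x⁻¹, y, y⁻¹, z, z⁻¹}) (hg : g ∈ Subgroup.closure S) :
    ∃ a b c : ℕ, a ≤ Nat.card A ∧ b ≤ Nat.card A ∧ c ≤ Nat.card A ∧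
      f g = f (x ^ a * y ^ b * z ^ c) := by
  have h1 : ∃ a b c : ℤ, f g = f x ^ a * f y ^ b * f z ^ c := by
    induction hg using Subgroup.closure_induction with
    | mem u hu =>
      subst hS
      rcases hu with rfl | rfl | rfl | rfl | rfl | rfl
      · exact ⟨1, 0, 0, by simp⟩
      · exact ⟨-1, 0, 0, by simp⟩
      · exact ⟨0, 1, 0, by simp⟩
      · exact ⟨0, -1, 0, by simp⟩
      · exact ⟨0, 0, 1, by simp⟩
      · exact ⟨0, 0, -1, by simp⟩
    | one => exact ⟨0, 0, 0, by simp⟩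
    | mul u v _ _ hu hv =>
      obtain ⟨a, b, c, h⟩ := hu
      obtain ⟨a', b', c', h'⟩ := hv
      refine ⟨a + a', b + b', c + c', ?_⟩
      rw [map_mul, h, h', zpow_add, zpow_add, zpow_add]
      simp only [mul_comm, mul_left_comm, mul_assoc]
    | inv u _ hu =>
      obtain ⟨a, b, c, h⟩ := hu
      refine ⟨-a, -b, -c, ?_⟩
      rw [map_inv, h, mul_inv, mul_inv, zpow_neg, zpow_neg, zpow_neg]
  have h2 : ∀ (u : A) (a : ℤ), ∃ k : ℕ, k ≤ Nat.card A ∧ u ^ a = u ^ k := by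
    intro u a
    have h0 : (0 : ℤ) < orderOf u := by exact_mod_cast orderOf_pos u
    refine ⟨(a % orderOf u).toNat, ?_, ?_⟩
    · have := Int.emod_lt_of_pos a h0
      have h3 : orderOf u ≤ Nat.card A := orderOf_le_card
      omega
    · rw [← zpow_natCast, Int.toNat_of_nonneg (Int.emod_nonneg _ h0.ne'), zpow_mod_orderOf]
  obtain ⟨a, b, c, h⟩ := h1
  obtain ⟨a', ha, ha'⟩ := h2 (f x) a
  obtain ⟨b', hb, hb'⟩ := h2 (f y) b
  obtain ⟨c', hc, hc'⟩ := h2 (f z) c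
  exact ⟨a', b', c', ha, hb, hc, by rw [h, ha', hb', hc']; simp⟩

end Words

variable {p : ℕ} [Fact p.Prime] {V : Type*} [AddCommGroup V] [Module (ZMod p) V]

theorem IsRich.avail {S : Set (V ≃ₗ[ZMod p] V)} {m ℓ : ℕ} {w : V ≃ₗ[ZMod p] V}
    (hw : InBall S ℓ w) {v : V} {φ : Dual (ZMod p) V} (h0 : φ v = 0)
    (h : ∀ x, (w ^ m) x = x + φ x • v) : Avail S (p * (m * ℓ)) v φ := by
  refine ⟨h0, fun s => ⟨(w ^ m) ^ s.val, ((hw.pow m).pow _).mono ?_, ?_⟩⟩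
  · exact Nat.mul_le_mul_right _ (ZMod.val_lt s).le
  · have key : ∀ (k : ℕ) x, ((w ^ m) ^ k) x = x + ((k : ZMod p) * φ x) • v := by
      intro k
      induction k with
      | zero => intro x; simp
      | succ k ih =>
        intro x
        rw [pow_succ', LinearEquiv.mul_apply, ih, h, map_add, map_smul, h0, smul_zero, add_zero,
          Nat.cast_succ, add_mul, one_mul, add_smul, add_assoc]
    intro x
    rw [key, ZMod.natCast_zmod_val]

theorem Full.inBall_of_det_eq_one {F V : Type*} [Field F] [AddCommGroup V] [Module F V]
    [FiniteDimensional F V] {S : Set (V ≃ₗ[F] V)} {ℓ : ℕ} (h : Full S ℓ ⊤ ⊤)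
    (hn : 1 ≤ finrank F V) {g : V ≃ₗ[F] V} (hg : LinearEquiv.det g = 1) :
    InBall S (2 * finrank F V * ℓ) g := by
  obtain ⟨L, hL, hlen, rfl⟩ := exists_transvections_of_det_eq_one hn hg
  refine (InBall.list_prod (ℓ := ℓ) fun t ht => ?_).mono (Nat.mul_le_mul_right _ hlen)
  obtain ⟨f, v, hfv, rfl⟩ := hL t ht
  obtain ⟨u, hu, hux⟩ := (h v trivial f trivial hfv).2 1
  convert hu using 1
  ext x
  rw [hux, one_mul, LinearEquiv.transvection.apply]

theorem inBall_of_mem_closure [FiniteDimensional (ZMod p) V] {S : Set (V ≃ₗ[ZMod p] V)} {ℓ : ℕ}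
    {x y z : V ≃ₗ[ZMod p] V} (hS : S = {x, x⁻¹, y, y⁻¹, z, z⁻¹})
    (h : ∀ g : V ≃ₗ[ZMod p] V, LinearEquiv.det g = 1 → InBall S ℓ g)
    {g : V ≃ₗ[ZMod p] V} (hg : g ∈ Subgroup.closure S) : InBall S (ℓ + 3 * p) g := by
  obtain ⟨a, b, c, ha, hb, hc, heq⟩ :=
    exists_pow_map_eq (LinearEquiv.det (R := ZMod p) (M := V)) hS hg
  have hcard : Nat.card (ZMod p)ˣ ≤ p := by
    rw [Nat.card_eq_fintype_card, ZMod.card_units]; omega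
  have h1 : InBall S ℓ (g * (x ^ a * y ^ b * z ^ c)⁻¹) := by
    refine h _ ?_
    rw [map_mul, map_inv, heq, mul_inv_cancel]
  have hx : x ∈ S := by simp [hS]
  have hy : y ∈ S := by simp [hS]
  have hz : z ∈ S := by simp [hS]
  have h2 := h1.mul ((((InBall.of_mem hx).pow a).mul ((InBall.of_mem hy).pow b)).mul
    ((InBall.of_mem hz).pow c))
  rw [inv_mul_cancel_right] at h2
  exact h2.mono (by omega)

/-- The deterministic part: away from the three exceptional events, the generated group contains
the special linear group and has small diameter. -/
theorem inBall_of_generic [Fintype V] {S : Set (V ≃ₗ[ZMod p] V)} {x y z : V ≃ₗ[ZMod p] V}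
    (hS : S = {x, x⁻¹, y, y⁻¹, z, z⁻¹}) {L K k m ℓ : ℕ} (g : Bool → V ≃ₗ[ZMod p] V)
    (hgx : g false = x) (hgy : g true = y) (i : Fin L → Bool)
    (hrich : IsRich m (evalWord g (posWord i) * z))
    (hgood : ∀ (v : V) (φ : Dual (ZMod p) V), (v, φ) ∈ flagPairs (ZMod p) V →
      (evalWord g (posWord i) * z) v = v → (∀ u, φ ((evalWord g (posWord i) * z) u) = φ u) →
      GoodPair x y K v φ)
    (hE : ExpandsAll y (y * x)) (hn : 1 ≤ finrank (ZMod p) V)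
    (hk : finrank (ZMod p) V * 10 ^ k < 11 ^ k) (hℓ : p * (m * (L + 1)) ≤ ℓ)
    (hℓ' : 80 * K + 4 ≤ ℓ) (u : V ≃ₗ[ZMod p] V) (hu : LinearEquiv.det u = 1) :
    InBall S (2 * finrank (ZMod p) V * (4624 ^ (2 * k) * (480 * (K + 1) * ℓ))) u := by
  have hx : x ∈ S := by simp [hS]
  have hy : y ∈ S := by simp [hS]
  have hz : z ∈ S := by simp [hS]
  have hinv : ∀ u ∈ S, u⁻¹ ∈ S := by
    subst hS
    rintro u (rfl | rfl | rfl | rfl | rfl | rfl) <;> simp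
  have hg : ∀ b, g b ∈ S := by
    rintro (_ | _)
    · rw [hgx]; exact hx
    · rw [hgy]; exact hy
  obtain ⟨v, φ, h1, h2, h3, h4, h5, h6⟩ := hrich
  have hav : Avail S ℓ v φ :=
    (IsRich.avail ((inBall_evalWord_posWord hg i).mul (InBall.of_mem hz)) h3 h4).mono hℓ
  have hgp := hgood v φ (by simp [flagPairs, h1, h2, h3]) h5 h6
  exact (hgp.full hinv hx hy hav hE hℓ' hk).inBall_of_det_eq_one hn hu

end

section Numerics

open Real

theorem natCast_pow_eq_exp {q : ℕ} (hq : 0 < q) (k : ℕ) : (q : ℝ) ^ k = exp (k * log q) := by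
  rw [exp_nat_mul, exp_log (by exact_mod_cast hq)]

theorem log_two_lt_log {q : ℕ} (hq : 2 ≤ q) : (0.69 : ℝ) < log q := by
  have h1 := Real.log_two_gt_d9
  have h2 : log 2 ≤ log q := log_le_log (by norm_num) (by exact_mod_cast hq)
  linarith

theorem large_of_log_lt {n q : ℕ} (hq : 2 ≤ q) (hn : 2 ≤ n)
    (h : log q < 1 / 10 ^ 25 * n / (log n) ^ 2) : 10 ^ 20 ≤ n := by
  by_contra hlt
  have h1 := log_two_lt_log hq
  have h2 := log_two_lt_log hn
  have h3 : (n : ℝ) < 10 ^ 20 := by exact_mod_cast not_le.1 hlt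
  have h4 : (0 : ℝ) < log n ^ 2 := by positivity
  rw [lt_div_iff₀ h4] at h
  nlinarith

theorem one_le_log {n : ℕ} (hn : 10 ^ 20 ≤ n) : 1 ≤ log n := by
  have h1 : log (10 ^ 20 : ℝ) ≤ log n := log_le_log (by norm_num) (by exact_mod_cast hn)
  rw [log_pow] at h1
  have h2 : log 2 ≤ log 10 := log_le_log (by norm_num) (by norm_num)
  have := Real.log_two_gt_d9
  push_cast at h1
  linarith

theorem log_four_mul_le {n : ℕ} (hn : 10 ^ 20 ≤ n) : log (4 * n) ≤ 2 * log n := by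
  have h0 : (10 ^ 20 : ℝ) ≤ n := by exact_mod_cast hn
  have : log (4 * n) ≤ log ((n : ℝ) ^ 2) := log_le_log (by positivity) (by nlinarith)
  rwa [log_pow] at this

theorem log_mul_lt {n q : ℕ} (hn : 10 ^ 20 ≤ n)
    (h : log q < 1 / 10 ^ 25 * n / (log n) ^ 2) : 10 ^ 25 * (log q * log n ^ 2) < n := by
  have h1 := one_le_log hn
  rw [lt_div_iff₀ (by positivity)] at h
  linarith

/-- The parameters of rich elements. -/
theorem exists_rich_parameters {n q : ℕ} (hq : 2 ≤ q) (hn : 10 ^ 20 ≤ n)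
    (h : log q < 1 / 10 ^ 25 * n / (log n) ^ 2) :
    ∃ d e t : ℕ, 6 ≤ d ∧ n = 3 + e + d * t ∧ 4 * n ≤ 2 ^ d ∧ (d : ℝ) ≤ 2 * 10 ^ 8 * log n ∧
      ((q : ℝ) ^ (3 + e + (3 + e) ^ 2) * (4 * n : ℝ) ^ t) ^ 2 ≤ exp (n / 10 ^ 7) := by
  have hl := one_le_log hn
  have hΛ := log_two_lt_log hq
  have h4 := log_four_mul_le hn
  have hm := log_mul_lt hn h
  have hn0 : (0 : ℝ) < n := by have : (10 ^ 20 : ℝ) ≤ n := (by exact_mod_cast hn); linarith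
  set ℓ := log n with hℓ
  set Λ := log q with hΛd
  set d := ⌈10 ^ 8 * ℓ⌉₊ with hd
  have hd1 : 10 ^ 8 * ℓ ≤ d := Nat.le_ceil _
  have hd2 : (d : ℝ) < 10 ^ 8 * ℓ + 1 := Nat.ceil_lt_add_one (by positivity)
  have hd6 : 6 ≤ d := by
    have : (6 : ℝ) ≤ d := by linarith
    exact_mod_cast this
  set e := (n - 3) % d with he
  set t := (n - 3) / d with ht
  have hsum : n = 3 + e + d * t := by
    have := Nat.mod_add_div (n - 3) d
    rw [← he, ← ht] at this
    omega
  have hed : e < d := Nat.mod_lt _ (by omega)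
  refine ⟨d, e, t, hd6, hsum, ?_, by linarith, ?_⟩
  · have h2 : (4 * n : ℝ) ≤ 2 ^ d := by
      rw [← log_le_log_iff (by positivity) (by positivity), log_pow]
      have := Real.log_two_gt_d9
      nlinarith
    exact_mod_cast h2
  · have hs : ((3 + e : ℕ) : ℝ) ≤ 1.01 * 10 ^ 8 * ℓ := by
      have : ((3 + e : ℕ) : ℝ) ≤ d + 2 := by exact_mod_cast (by omega : 3 + e ≤ d + 2)
      linarith
    have hs2 : ((3 + e + (3 + e) ^ 2 : ℕ) : ℝ) ≤ 2.1 * 10 ^ 16 * ℓ ^ 2 := by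
      have h1 : ((3 + e + (3 + e) ^ 2 : ℕ) : ℝ) ≤ 2 * ((3 + e : ℕ) : ℝ) ^ 2 := by
        exact_mod_cast (by nlinarith : 3 + e + (3 + e) ^ 2 ≤ 2 * (3 + e) ^ 2)
      have h2 : ((3 + e : ℕ) : ℝ) ^ 2 ≤ (1.01 * 10 ^ 8 * ℓ) ^ 2 := by gcongr
      nlinarith
    have ht2 : (t : ℝ) * ℓ ≤ n / 10 ^ 8 := by
      have h1 : (d : ℝ) * t ≤ n := by exact_mod_cast (by omega : d * t ≤ n)
      have h2 : 10 ^ 8 * ℓ * t ≤ d * t := by gcongr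
      rw [le_div_iff₀ (by norm_num)]
      linarith
    have e1 : (4 * n : ℝ) ^ t = exp (t * log (4 * n)) := by
      rw [exp_nat_mul, exp_log (by positivity)]
    rw [natCast_pow_eq_exp (by omega), e1, ← exp_add, ← exp_nat_mul, exp_le_exp]
    have h5 : ((3 + e + (3 + e) ^ 2 : ℕ) : ℝ) * Λ ≤ 2.1 * 10 ^ 16 * ℓ ^ 2 * Λ := by gcongr
    have h6 : (t : ℝ) * log (4 * n) ≤ t * (2 * ℓ) := by gcongr
    push_cast at h5 ⊢
    nlinarith

theorem error_no_rich_le {n q : ℕ} (hq : 2 ≤ q) (hn : 10 ^ 20 ≤ n) :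
    (1 / 2 ^ (n / 10 ^ 6) + (q : ℝ) ^ (2 * (n / 10 ^ 6) + 2) / (q : ℝ) ^ (n / 8) +
      2 * exp (-((n / 8 : ℕ) * log q / 8))) ≤ 4 * exp (-(n / (2 * 10 ^ 6))) := by
  have hΛ := log_two_lt_log hq
  have hn0 : (10 ^ 20 : ℝ) ≤ n := by exact_mod_cast hn
  set L := n / 10 ^ 6 with hL
  set a := n / 8 with ha
  have hL1 : (n : ℝ) ≤ 10 ^ 6 * L + 10 ^ 6 := by exact_mod_cast (by omega : n ≤ 10 ^ 6 * L + 10 ^ 6)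
  have hL2 : (10 ^ 6 * L : ℝ) ≤ n := by exact_mod_cast (by omega : 10 ^ 6 * L ≤ n)
  have ha1 : (n : ℝ) ≤ 8 * a + 8 := by exact_mod_cast (by omega : n ≤ 8 * a + 8)
  have h1 : (1 / 2 ^ L : ℝ) ≤ exp (-(n / (2 * 10 ^ 6))) := by
    rw [one_div, show (2 : ℝ) = ((2 : ℕ) : ℝ) by norm_num, natCast_pow_eq_exp (by norm_num),
      ← exp_neg, exp_le_exp]
    have := log_two_lt_log le_rfl
    push_cast at this ⊢
    have h3 : (L : ℝ) * 0.69 ≤ L * log 2 := by gcongr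
    rw [neg_le_neg_iff, div_le_iff₀ (by norm_num)]
    linarith
  have h2 : (q : ℝ) ^ (2 * L + 2) / (q : ℝ) ^ a ≤ exp (-(n / (2 * 10 ^ 6))) := by
    rw [natCast_pow_eq_exp (by omega), natCast_pow_eq_exp (by omega), ← exp_sub, exp_le_exp,
      ← sub_mul]
    push_cast
    have h3 : (2 * L + 2 - a : ℝ) ≤ -(n / 100) := by linarith
    have h4 : (2 * L + 2 - a : ℝ) * log q ≤ -(n / 100) * log q := by gcongr
    have h5 : (n / 100 : ℝ) * 0.69 ≤ n / 100 * log q := by gcongr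
    linarith
  have h3 : exp (-(a * log q / 8)) ≤ exp (-(n / (2 * 10 ^ 6))) := by
    rw [exp_le_exp]
    have h5 : (a : ℝ) * 0.69 ≤ a * log q := by gcongr
    linarith
  linarith

theorem error_fix_le {n q : ℕ} (hq : 2 ≤ q) (hn : 10 ^ 20 ≤ n)
    (h : log q < 1 / 10 ^ 25 * n / (log n) ^ 2) :
    2 ^ (n / 10 ^ 6) * ((q : ℝ) ^ (1760 * (n / 4000) + 235) / (q : ℝ) ^ n +
      8 * (q : ℝ) ^ 12 * (15 / 16) ^ (n / 4000)) ≤ 2 * exp (-(n / 10 ^ 6)) := by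
  have hΛ := log_two_lt_log hq
  have hl := one_le_log hn
  have hm := log_mul_lt hn h
  have hn0 : (10 ^ 20 : ℝ) ≤ n := by exact_mod_cast hn
  set L := n / 10 ^ 6 with hL
  set K := n / 4000 with hK
  have hL2 : (10 ^ 6 * L : ℝ) ≤ n := by exact_mod_cast (by omega : 10 ^ 6 * L ≤ n)
  have hK1 : (n : ℝ) ≤ 4000 * K + 4000 := by exact_mod_cast (by omega : n ≤ 4000 * K + 4000)
  have hK2 : (4000 * K : ℝ) ≤ n := by exact_mod_cast (by omega : 4000 * K ≤ n)
  have hΛn : log q * 10 ^ 25 ≤ n := by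
    have : log q * 1 ≤ log q * log n ^ 2 := by gcongr; exact one_le_pow₀ hl
    linarith
  have h1 : (2 : ℝ) ^ L ≤ exp (n / 10 ^ 6) := by
    rw [show (2 : ℝ) = ((2 : ℕ) : ℝ) by norm_num, natCast_pow_eq_exp (by norm_num), exp_le_exp]
    have := Real.log_two_lt_d9
    push_cast
    have h3 : (L : ℝ) * log 2 ≤ L * 1 := by gcongr; linarith
    linarith
  have h2 : (q : ℝ) ^ (1760 * K + 235) / (q : ℝ) ^ n ≤ exp (-(2 * n / 10 ^ 6)) := by
    rw [natCast_pow_eq_exp (by omega), natCast_pow_eq_exp (by omega), ← exp_sub, exp_le_exp,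
      ← sub_mul]
    push_cast
    have h3 : (1760 * K + 235 - n : ℝ) ≤ -(n / 100) := by linarith
    have h4 : (1760 * K + 235 - n : ℝ) * log q ≤ -(n / 100) * log q := by gcongr
    have h5 : (n / 100 : ℝ) * 0.69 ≤ n / 100 * log q := by gcongr
    linarith
  have h3 : 8 * (q : ℝ) ^ 12 * (15 / 16) ^ K ≤ exp (-(2 * n / 10 ^ 6)) := by
    have e1 : (8 : ℝ) ≤ exp 7 := by
      have := add_one_le_exp (7 : ℝ); linarith
    have e2 : ((15 : ℝ) / 16) ^ K ≤ exp (K * (-(1 / 16))) := by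
      rw [exp_nat_mul]
      gcongr
      have := add_one_le_exp (-(1 / 16) : ℝ); linarith
    calc 8 * (q : ℝ) ^ 12 * (15 / 16) ^ K ≤ exp 7 * exp ((12 : ℕ) * log q) * exp (K * (-(1 / 16))) := by
          rw [natCast_pow_eq_exp (by omega)]
          gcongr
      _ ≤ _ := by
          rw [← exp_add, ← exp_add, exp_le_exp]
          push_cast
          linarith
  calc _ ≤ exp (n / 10 ^ 6) * (exp (-(2 * n / 10 ^ 6)) + exp (-(2 * n / 10 ^ 6))) := by gcongr
    _ = _ := by
      rw [← two_mul, mul_left_comm, ← exp_add]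
      congr 2
      ring

theorem error_expand_le {n q : ℕ} (hq : 2 ≤ q) (hn : 10 ^ 20 ≤ n) :
    4 * n / (q : ℝ) ^ (n / 4) ≤ exp (-(n / 10 ^ 6)) := by
  have hΛ := log_two_lt_log hq
  have hn0 : (10 ^ 20 : ℝ) ≤ n := by exact_mod_cast hn
  set b := n / 4 with hb
  have hb1 : (n : ℝ) ≤ 4 * b + 4 := by exact_mod_cast (by omega : n ≤ 4 * b + 4)
  have h1 : (4 * n : ℝ) ≤ exp (n / 100 + 6) := by
    rw [exp_add]
    have e1 := add_one_le_exp (n / 100 : ℝ)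
    have e2 : (400 : ℝ) ≤ exp 6 := by
      have := Real.exp_one_gt_d9
      have h4 : exp 6 = exp 1 ^ 6 := by rw [← exp_nat_mul]; norm_num
      rw [h4]
      calc (400 : ℝ) ≤ 2.718 ^ 6 := by norm_num
        _ ≤ _ := by gcongr; linarith
    nlinarith [exp_pos (n / 100 : ℝ)]
  rw [natCast_pow_eq_exp (by omega), div_le_iff₀ (exp_pos _), ← exp_add]
  refine h1.trans (exp_le_exp.2 ?_)
  have h5 : (b : ℝ) * 0.69 ≤ b * log q := by gcongr
  linarith

theorem total_error_le {n : ℕ} (hn : 10 ^ 20 ≤ n) :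
    exp (n / 10 ^ 7) * (4 * exp (-(n / (2 * 10 ^ 6)))) + 2 * exp (-(n / 10 ^ 6)) +
      exp (-(n / 10 ^ 6)) ≤ exp (-(1 / 10 ^ 25) * n) := by
  have hn0 : (10 ^ 20 : ℝ) ≤ n := by exact_mod_cast hn
  have e1 : (7 : ℝ) ≤ exp 6 := by
    have := add_one_le_exp (6 : ℝ); linarith
  have h1 : exp (n / 10 ^ 7) * (4 * exp (-(n / (2 * 10 ^ 6)))) ≤
      4 * exp (-(1 / 10 ^ 25) * n - 6) := by
    rw [mul_left_comm, ← exp_add]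
    gcongr
    linarith
  have h2 : exp (-(n / 10 ^ 6)) ≤ exp (-(1 / 10 ^ 25) * n - 6) := by
    gcongr
    linarith
  have h3 : exp (-(1 / 10 ^ 25) * n) = exp (-(1 / 10 ^ 25) * n - 6) * exp 6 := by
    rw [← exp_add]; congr 1; ring
  rw [h3]
  nlinarith [exp_pos (-(1 / 10 ^ 25) * n - 6 : ℝ)]

theorem exists_growth_steps {n : ℕ} (hn : 10 ^ 20 ≤ n) :
    ∃ k : ℕ, n * 10 ^ k < 11 ^ k ∧ (k : ℝ) ≤ 12 * log n := by
  have hl := one_le_log hn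
  refine ⟨⌊11 * log n⌋₊ + 1, ?_, ?_⟩
  · set k := ⌊11 * log n⌋₊ + 1
    have hk : 11 * log n < k := by
      have := Nat.lt_floor_add_one (11 * log n)
      push_cast [k]; exact this
    have h1 : (n * 10 ^ k : ℝ) < 11 ^ k := by
      have hn0 : (0 : ℝ) < n := by exact_mod_cast (by omega : 0 < n)
      rw [← log_lt_log_iff (by positivity) (by positivity), log_mul (by positivity) (by positivity),
        log_pow, log_pow]
      have h2 : log (10 / 11) ≤ 10 / 11 - 1 := log_le_sub_one_of_pos (by norm_num)
      rw [log_div (by norm_num) (by norm_num)] at h2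
      nlinarith
    exact_mod_cast h1
  · push_cast
    have := Nat.floor_le (by positivity : 0 ≤ 11 * log n)
    linarith

theorem length_le {n q d k : ℕ} (hq : 2 ≤ q) (hn : 10 ^ 20 ≤ n)
    (hd : (d : ℝ) ≤ 2 * 10 ^ 8 * log n) (hk : (k : ℝ) ≤ 12 * log n) :
    ((2 * n * (4624 ^ (2 * k) * (480 * (n / 4000 + 1) *
      (q * ((q ^ d - 1) * (n / 10 ^ 6 + 1)) + (80 * (n / 4000) + 4)))) + 3 * q : ℕ) : ℝ) ≤
      (n : ℝ) ^ (10 ^ 9 * log q) := by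
  have hl := one_le_log hn
  have hΛ := log_two_lt_log hq
  have hn0 : (0 : ℝ) < n := by exact_mod_cast (by omega : 0 < n)
  have hq0 : (0 : ℝ) < q := by exact_mod_cast (by omega : 0 < q)
  have hE : (n : ℝ) = exp (log n) := (exp_log hn0).symm
  have h1 : q * ((q ^ d - 1) * (n / 10 ^ 6 + 1)) + (80 * (n / 4000) + 4) ≤ q ^ (d + 1) * n := by
    have hqd : 1 ≤ q ^ d := Nat.one_le_pow _ _ (by omega)
    have e1 : q * ((q ^ d - 1) * (n / 10 ^ 6 + 1)) ≤ q * (q ^ d * (n / 10 ^ 6 + 1)) := by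
      gcongr; omega
    have e2 : 80 * (n / 4000) + 4 ≤ q * (q ^ d * (n - (n / 10 ^ 6 + 1))) := by
      have : n - (n / 10 ^ 6 + 1) ≤ q ^ d * (n - (n / 10 ^ 6 + 1)) := Nat.le_mul_of_pos_left _ hqd
      have h2 := Nat.le_mul_of_pos_left (q ^ d * (n - (n / 10 ^ 6 + 1))) (by omega : 0 < q)
      omega
    have e3 : q * (q ^ d * (n / 10 ^ 6 + 1)) + q * (q ^ d * (n - (n / 10 ^ 6 + 1))) =
        q ^ (d + 1) * n := by
      rw [← mul_add, ← mul_add, pow_succ' q d, mul_assoc]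
      congr 3; omega
    omega
  have h2 : 480 * (n / 4000 + 1) ≤ n := by omega
  have h3 : (4624 : ℝ) ^ (2 * k) ≤ exp (18 * k) := by
    have e1 : (4624 : ℝ) ≤ exp 9 := by
      have := Real.exp_one_gt_d9
      have h4 : exp 9 = exp 1 ^ 9 := by rw [← exp_nat_mul]; norm_num
      rw [h4]
      calc (4624 : ℝ) ≤ 2.7 ^ 9 := by norm_num
        _ ≤ _ := by gcongr; linarith
    calc (4624 : ℝ) ^ (2 * k) ≤ exp 9 ^ (2 * k) := by gcongr
      _ = _ := by rw [← exp_nat_mul]; congr 1; push_cast; ring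
  have h4 : 2 * n * (4624 ^ (2 * k) * (480 * (n / 4000 + 1) *
      (q * ((q ^ d - 1) * (n / 10 ^ 6 + 1)) + (80 * (n / 4000) + 4)))) + 3 * q ≤
      n * n * (4624 ^ (2 * k) * (n * (q ^ (d + 1) * n))) := by
    have e1 : 2 * n * (4624 ^ (2 * k) * (480 * (n / 4000 + 1) *
      (q * ((q ^ d - 1) * (n / 10 ^ 6 + 1)) + (80 * (n / 4000) + 4)))) ≤
      2 * n * (4624 ^ (2 * k) * (n * (q ^ (d + 1) * n))) := by gcongr
    have e2 : 3 * q ≤ (n - 2) * (n * (4624 ^ (2 * k) * (n * (q ^ (d + 1) * n)))) := by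
      have e3 : q ≤ n * (4624 ^ (2 * k) * (n * (q ^ (d + 1) * n))) := by
        calc q = 1 * (1 * (1 * (q * 1))) := by ring
          _ ≤ _ := by
            gcongr
            · omega
            · exact Nat.one_le_pow _ _ (by norm_num)
            · omega
            · exact Nat.le_self_pow (by omega) _
            · omega
      exact Nat.mul_le_mul (by omega) e3
    calc _ ≤ 2 * n * (4624 ^ (2 * k) * (n * (q ^ (d + 1) * n))) +
          (n - 2) * (n * (4624 ^ (2 * k) * (n * (q ^ (d + 1) * n)))) := add_le_add e1 e2
      _ = (2 + (n - 2)) * (n * (4624 ^ (2 * k) * (n * (q ^ (d + 1) * n)))) := by ring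
      _ = _ := by rw [Nat.add_sub_cancel' (by omega)]; ring
  refine (Nat.cast_le.2 h4).trans ?_
  push_cast
  calc (n * n * (4624 ^ (2 * k) * (n * (q ^ (d + 1) * n))) : ℝ)
      ≤ n * n * (exp (18 * k) * (n * (q ^ (d + 1) * n))) := by gcongr
    _ = exp (4 * log n + 18 * k + (d + 1) * log q) := by
        rw [natCast_pow_eq_exp (by omega), exp_add, exp_add,
          show 4 * log (n : ℝ) = log n + log n + log n + log n by ring, exp_add, exp_add, exp_add,
          ← hE]
        push_cast
        ring
    _ ≤ exp (log n * (10 ^ 9 * log q)) := by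
        rw [exp_le_exp]
        have e1 : (d + 1 : ℝ) * log q ≤ (3 * 10 ^ 8 * log n) * log q := by gcongr; linarith
        have e2 : log n * 0.69 ≤ log n * log q := by gcongr
        nlinarith
    _ = _ := by rw [rpow_def_of_pos hn0]

end Numerics

section

variable {p : ℕ} [Fact p.Prime] {V : Type*} [AddCommGroup V] [Module (ZMod p) V]

/-- The group generated by `x, y, z` contains the special linear group and has diameter at most
`B` with respect to these generators and their inverses. -/
def QuicklyGenerate {F V : Type*} [Field F] [AddCommGroup V] [Module F V] (B : ℝ)
    (x y z : V ≃ₗ[F] V) : Prop :=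
  ∀ S : Set (V ≃ₗ[F] V), S = {x, x⁻¹, y, y⁻¹, z, z⁻¹} →
    ContainsSL (Subgroup.closure S) ∧ ∀ g ∈ Subgroup.closure S, ∃ ℓ : ℕ, InBall S ℓ g ∧ (ℓ : ℝ) ≤ B

theorem InBall.mem_closure {Γ : Type*} [Group Γ] {S : Set Γ} {ℓ : ℕ} {g : Γ} (h : InBall S ℓ g) :
    g ∈ Subgroup.closure S := by
  obtain ⟨l, hl, rfl, -⟩ := h
  exact Subgroup.list_prod_mem _ fun a ha => Subgroup.subset_closure (hl a ha)

open scoped Classical in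
theorem card_no_rich_parameters_le {F V : Type*} [Field F] [Fintype F] [AddCommGroup V]
    [Module F V] [Fintype V] {G : Subgroup (V ≃ₗ[F] V)} (hG : ContainsSL G) {d e t : ℕ}
    (hd : 6 ≤ d) (hn : finrank F V = 3 + e + d * t) (hbig : 4 * finrank F V ≤ 2 ^ d)
    (hlarge : 10 ^ 20 ≤ finrank F V) :
    (#{x : (Bool → G) × G | ∀ i : Fin (finrank F V / 10 ^ 6) → Bool,
        ¬ IsRich (Fintype.card F ^ d - 1)
          (evalWord (fun b => (x.1 b : V ≃ₗ[F] V)) (posWord i) * (x.2 : V ≃ₗ[F] V))} : ℝ) ≤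
      (Nat.card G : ℝ) ^ 3 * (((Fintype.card F : ℝ) ^ (3 + e + (3 + e) ^ 2) *
        (4 * finrank F V : ℝ) ^ t) ^ 2 * (4 * Real.exp (-(finrank F V / (2 * 10 ^ 6))))) := by
  set n := finrank F V with hnd
  set q := Fintype.card F with hq
  have hq2 : 2 ≤ q := Fintype.one_lt_card
  have hq0 : (0 : ℝ) < q := by exact_mod_cast (by omega : 0 < q)
  have hn0 : (0 : ℝ) < n := by exact_mod_cast (by omega : 0 < n)
  set A : ℝ := (q : ℝ) ^ (3 + e + (3 + e) ^ 2) * (4 * n : ℝ) ^ t with hA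
  have hA0 : 0 < A := by positivity
  have hα : ∀ δ, A⁻¹ * Fintype.card (V ≃ₗ[F] V) ≤
      Nat.card {w : V ≃ₗ[F] V // IsRich (q ^ d - 1) w ∧ LinearEquiv.det w = δ} := by
    intro δ
    rw [inv_mul_le_iff₀ hA0, Nat.card_eq_fintype_card, Fintype.card_subtype]
    exact card_rich_lower hd hn hbig δ
  have hτ : Real.exp (-((n / 8 : ℕ) * Real.log q / 8)) ^ 8 * (q : ℝ) ^ (n / 8) = 1 := by
    rw [natCast_pow_eq_exp (by omega), ← Real.exp_nat_mul, ← Real.exp_add, Real.exp_eq_one_iff]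
    push_cast
    ring
  have key := card_no_rich_le hG (P := IsRich (q ^ d - 1)) (fun g w => isRich_conj_iff g)
    (inv_nonneg.2 hA0.le) hα (a := n / 8) (L := n / 10 ^ 6) (by omega) (by omega) (by omega)
    (by omega) (Real.exp_pos _).le hτ
  rw [inv_pow, ← div_eq_mul_inv, div_le_iff₀ (by positivity)] at key
  refine key.trans ?_
  rw [mul_assoc]
  refine mul_le_mul_of_nonneg_left ?_ (by positivity)
  rw [mul_comm]
  exact mul_le_mul_of_nonneg_left (error_no_rich_le hq2 hlarge) (by positivity)

open scoped Classical in
theorem card_not_expandsAll_prod_le {F V : Type*} [Field F] [Fintype F] [AddCommGroup V]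
    [Module F V] [Fintype V] {G : Subgroup (V ≃ₗ[F] V)} (hG : ContainsSL G)
    (hlarge : 10 ^ 20 ≤ finrank F V) :
    (#{x : (Bool → G) × G | ¬ ExpandsAll (x.1 true : V ≃ₗ[F] V)
        ((x.1 true : V ≃ₗ[F] V) * (x.1 false : V ≃ₗ[F] V))} : ℝ) ≤
      (Nat.card G : ℝ) ^ 3 * Real.exp (-(finrank F V / 10 ^ 6)) := by
  set n := finrank F V with hnd
  have hq2 : 2 ≤ Fintype.card F := Fintype.one_lt_card
  have h1 := card_not_expandsAll_le hG (by omega)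
  have h2 : #{x : (Bool → G) × G | ¬ ExpandsAll (x.1 true : V ≃ₗ[F] V)
        ((x.1 true : V ≃ₗ[F] V) * (x.1 false : V ≃ₗ[F] V))} =
      #{g : Bool → G | ¬ ExpandsAll (g true : V ≃ₗ[F] V)
        ((g true : V ≃ₗ[F] V) * (g false : V ≃ₗ[F] V))} * Fintype.card G := by
    rw [← card_univ (α := G), ← card_product]
    congr 1
    ext x
    simp
  rw [h2, Nat.cast_mul, Nat.card_eq_fintype_card]
  have h3 : (#{g : Bool → G | ¬ ExpandsAll (g true : V ≃ₗ[F] V)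
        ((g true : V ≃ₗ[F] V) * (g false : V ≃ₗ[F] V))} : ℝ) *
        (Fintype.card F : ℝ) ^ (n / 4) ≤ 4 * (n * (Fintype.card G : ℝ) ^ 2) := by
    exact_mod_cast h1
  have hq0 : (0 : ℝ) < Fintype.card F := by exact_mod_cast (by omega : 0 < Fintype.card F)
  rw [← le_div_iff₀ (by positivity)] at h3
  calc _ ≤ 4 * (n * (Fintype.card G : ℝ) ^ 2) / (Fintype.card F : ℝ) ^ (n / 4) *
        Fintype.card G := mul_le_mul_of_nonneg_right h3 (by positivity)
    _ = (Fintype.card G : ℝ) ^ 3 * (4 * n / (Fintype.card F : ℝ) ^ (n / 4)) := by ring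
    _ ≤ _ := mul_le_mul_of_nonneg_left (error_expand_le hq2 hlarge) (by positivity)

open scoped Classical in
/-- A triple fails to generate quickly only if one of three exceptional events occurs. -/
theorem card_not_quicklyGenerate_le_add [Fintype V] {G : Subgroup (V ≃ₗ[ZMod p] V)}
    (hG : ContainsSL G) {L K k m ℓ : ℕ} {B : ℝ} (hK : 1760 * K + 231 ≤ finrank (ZMod p) V)
    (hk : finrank (ZMod p) V * 10 ^ k < 11 ^ k) (hℓ : p * (m * (L + 1)) ≤ ℓ)
    (hℓ' : 80 * K + 4 ≤ ℓ)
    (hB : ((2 * finrank (ZMod p) V * (4624 ^ (2 * k) * (480 * (K + 1) * ℓ)) + 3 * p : ℕ) : ℝ) ≤ B) :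
    (#{t : (Bool → G) × G | ¬ QuicklyGenerate B
      (t.1 false : V ≃ₗ[ZMod p] V) (t.1 true : V ≃ₗ[ZMod p] V) (t.2 : V ≃ₗ[ZMod p] V)} : ℝ) ≤
      #{x : (Bool → G) × G | ∀ i : Fin L → Bool, ¬ IsRich m
        (evalWord (fun b => (x.1 b : V ≃ₗ[ZMod p] V)) (posWord i) * (x.2 : V ≃ₗ[ZMod p] V))} +
      (Fintype.card G : ℝ) ^ 3 * 2 ^ L *
        ((p : ℝ) ^ (1760 * K + 235) / (p : ℝ) ^ finrank (ZMod p) V +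
          8 * (p : ℝ) ^ 12 * (15 / 16) ^ K) +
      #{x : (Bool → G) × G | ¬ ExpandsAll (x.1 true : V ≃ₗ[ZMod p] V)
        ((x.1 true : V ≃ₗ[ZMod p] V) * (x.1 false : V ≃ₗ[ZMod p] V))} := by
  have b2 := card_fix_not_goodPair_le hG (K := K) (L := L) hK
  rw [ZMod.card p] at b2
  refine le_trans ?_ (add_le_add_left (add_le_add_right b2 _) _)
  rw [← Nat.cast_add, ← Nat.cast_add, Nat.cast_le]
  refine le_trans (card_le_card ?_) ((card_union_le _ _).trans
    (Nat.add_le_add_right (card_union_le _ _) _))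
  intro x hx
  by_contra hmem
  simp only [mem_union, not_or, mem_filter, mem_univ, true_and] at hmem
  obtain ⟨⟨h1, h2⟩, h3⟩ := hmem
  push Not at h1 h2 h3
  obtain ⟨i, hi⟩ := h1
  refine (mem_filter.1 hx).2 fun S hS => ?_
  have hball := inBall_of_generic hS (fun b => (x.1 b : V ≃ₗ[ZMod p] V)) rfl rfl i hi
    (fun v φ hv hw hφ => by
      by_contra hgood
      obtain ⟨u, hu⟩ := h2 i v φ hv hgood hw
      exact hu (hφ u)) h3 (by omega) hk hℓ hℓ'
  exact ⟨fun g hg => (hball g hg).mem_closure,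
    fun g hg => ⟨_, inBall_of_mem_closure hS hball hg, hB⟩⟩

open scoped Classical in
theorem card_not_quicklyGenerate_le [Fintype V] {G : Subgroup (V ≃ₗ[ZMod p] V)}
    (hG : ContainsSL G) (hn : 2 ≤ finrank (ZMod p) V)
    (h : Real.log p < 1 / 10 ^ 25 * (finrank (ZMod p) V) / (Real.log (finrank (ZMod p) V)) ^ 2) :
    (#{t : (Bool → G) × G | ¬ QuicklyGenerate ((finrank (ZMod p) V : ℝ) ^ (10 ^ 9 * Real.log p))
      (t.1 false : V ≃ₗ[ZMod p] V) (t.1 true : V ≃ₗ[ZMod p] V) (t.2 : V ≃ₗ[ZMod p] V)} : ℝ) ≤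
      (Nat.card G : ℝ) ^ 3 * Real.exp (-(1 / 10 ^ 25) * finrank (ZMod p) V) := by
  have hp2 : 2 ≤ p := (Fact.out : p.Prime).two_le
  have hlarge := large_of_log_lt hp2 hn h
  obtain ⟨d, e, t, hd, hdet, hbig, hdlog, hA⟩ := exists_rich_parameters hp2 hlarge h
  obtain ⟨k, hk, hklog⟩ := exists_growth_steps hlarge
  have b1 := card_no_rich_parameters_le hG hd hdet hbig hlarge
  have b3 := card_not_expandsAll_prod_le hG hlarge
  have herr := error_fix_le hp2 hlarge h
  have htot := total_error_le hlarge
  rw [ZMod.card p] at b1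
  have hN : (0 : ℝ) ≤ (Nat.card G : ℝ) ^ 3 := by positivity
  refine (card_not_quicklyGenerate_le_add hG (by omega) hk
    (le_add_of_nonneg_right (Nat.zero_le _)) le_add_self (length_le hp2 hlarge hdlog hklog)).trans ?_
  refine le_trans ?_ (mul_le_mul_of_nonneg_left htot hN)
  rw [mul_add ((Nat.card G : ℝ) ^ 3) (_ + _), mul_add ((Nat.card G : ℝ) ^ 3) (Real.exp _ * _)]
  refine add_le_add (add_le_add (b1.trans (mul_le_mul_of_nonneg_left ?_ hN)) ?_) b3
  · exact mul_le_mul_of_nonneg_right hA (by positivity)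
  · rw [mul_assoc, ← Nat.card_eq_fintype_card]
    exact mul_le_mul_of_nonneg_left herr hN

end

section Transfer

open Matrix

/-- Invertible matrices as linear automorphisms. -/
noncomputable def glEquiv (n : ℕ) (F : Type*) [Field F] :
    GL (Fin n) F ≃* ((Fin n → F) ≃ₗ[F] (Fin n → F)) :=
  Matrix.GeneralLinearGroup.toLin.trans (LinearMap.GeneralLinearGroup.generalLinearEquiv F _)

theorem det_glEquiv {n : ℕ} {F : Type*} [Field F] (A : GL (Fin n) F) :
    LinearEquiv.det (glEquiv n F A) = Matrix.GeneralLinearGroup.det A := by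
  ext
  rw [LinearEquiv.coe_det, Matrix.GeneralLinearGroup.val_det_apply]
  exact LinearMap.det_toLin' A.1

theorem exists_toGL_eq {n : ℕ} {F : Type*} [Field F] {u : (Fin n → F) ≃ₗ[F] (Fin n → F)}
    (hu : LinearEquiv.det u = 1) :
    ∃ A : Matrix.SpecialLinearGroup (Fin n) F, glEquiv n F (SpecialLinearGroup.toGL A) = u := by
  have h1 := det_glEquiv ((glEquiv n F).symm u)
  rw [MulEquiv.apply_symm_apply, hu] at h1
  refine ⟨⟨((glEquiv n F).symm u).1, ?_⟩, ?_⟩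
  · rw [← Matrix.GeneralLinearGroup.val_det_apply, ← h1, Units.val_one]
  · rw [← MulEquiv.eq_symm_apply]
    ext
    rfl

theorem det_glEquiv_toGL {n : ℕ} {F : Type*} [Field F] (A : Matrix.SpecialLinearGroup (Fin n) F) :
    LinearEquiv.det (glEquiv n F (SpecialLinearGroup.toGL A)) = 1 := by
  rw [det_glEquiv]
  ext
  rw [Matrix.GeneralLinearGroup.val_det_apply, SpecialLinearGroup.coe_GL_coe_matrix, A.2,
    Units.val_one]

/-- The property of a triple of matrices in the main theorem. -/
theorem QuicklyGenerate.matrix {n : ℕ} {F : Type*} [Field F] {B : ℝ} {x y z : GL (Fin n) F}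
    (h : QuicklyGenerate B (glEquiv n F x) (glEquiv n F y) (glEquiv n F z))
    (S : Set (GL (Fin n) F)) (hS : S = {x, x⁻¹, y, y⁻¹, z, z⁻¹}) :
    (∀ A : Matrix.SpecialLinearGroup (Fin n) F,
      SpecialLinearGroup.toGL A ∈ Subgroup.closure S) ∧
    ∀ g ∈ Subgroup.closure S, ∃ l : List (GL (Fin n) F),
      (∀ a ∈ l, a ∈ S) ∧ l.prod = g ∧ (l.length : ℝ) ≤ B := by
  set e := glEquiv n F with he
  have hcl : Subgroup.closure (e '' S) = (Subgroup.closure S).map e.toMonoidHom :=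
    (MonoidHom.map_closure e.toMonoidHom S).symm
  obtain ⟨h1, h2⟩ := h (e '' S) (by
    rw [hS]; simp only [Set.image_insert_eq, Set.image_singleton, map_inv])
  rw [hcl] at h1 h2
  refine ⟨fun A => ?_, fun g hg => ?_⟩
  · obtain ⟨B, hB, hBA⟩ := h1 _ (det_glEquiv_toGL A)
    rwa [← e.injective hBA]
  · obtain ⟨ℓ, ⟨l, hl, hprod, hlen⟩, hℓ⟩ := h2 (e g) (Subgroup.mem_map_of_mem e.toMonoidHom hg)
    refine ⟨l.map e.symm, ?_, ?_, ?_⟩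
    · intro a ha
      obtain ⟨b, hb, rfl⟩ := List.mem_map.1 ha
      obtain ⟨s, hs, rfl⟩ := hl b hb
      rwa [MulEquiv.symm_apply_apply]
    · rw [← map_list_prod, hprod, MulEquiv.symm_apply_apply]
    · rw [List.length_map]
      exact (Nat.cast_le.2 hlen).trans hℓ

end Transfer

end RandGen

open RandGen Finset in
/-- **Babai's conjecture for `SL_n(p)` with 3 random generators.**
There are absolute constants `c, C > 0` such that for every prime `p` and every
`n ≥ 2` with `log p < c·n/(log n)²`, and every group `G` with
`SL_n(p) ≤ G ≤ GL_n(p)`: for uniformly random `x, y, z ∈ G`, with probability at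
least `1 - e^{-c·n}` the set `S = {x^{±1}, y^{±1}, z^{±1}}` generates a subgroup
containing `SL_n(p)` and every element of `⟨S⟩` is a product of at most
`n^{C·log p}` elements of `S`. -/
theorem stmt0 :
    ∃ c C : ℝ, 0 < c ∧ 0 < C ∧
      ∀ (p : ℕ), Fact p.Prime →
      ∀ n : ℕ, 2 ≤ n →
        Real.log p < c * n / (Real.log n) ^ 2 →
        ∀ G : Subgroup (GL (Fin n) (ZMod p)),
          (∀ A : Matrix.SpecialLinearGroup (Fin n) (ZMod p),
              Matrix.SpecialLinearGroup.toGL A ∈ G) →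
          (1 : ℝ) - Real.exp (-c * n) ≤
            (Nat.card {t : ↥G × ↥G × ↥G //
                ∀ S : Set (GL (Fin n) (ZMod p)),
                  S = {↑t.1, (↑t.1)⁻¹, ↑t.2.1, (↑t.2.1)⁻¹, ↑t.2.2, (↑t.2.2)⁻¹} →
                  (∀ A : Matrix.SpecialLinearGroup (Fin n) (ZMod p),
                      Matrix.SpecialLinearGroup.toGL A ∈ Subgroup.closure S) ∧
                  ∀ g ∈ Subgroup.closure S,
                    ∃ l : List (GL (Fin n) (ZMod p)),
                      (∀ a ∈ l, a ∈ S) ∧ l.prod = g ∧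
                        (l.length : ℝ) ≤ (n : ℝ) ^ (C * Real.log p)} : ℝ) /
              (Nat.card ↥G : ℝ) ^ 3 := by
  classical
  refine ⟨1 / 10 ^ 25, 10 ^ 9, by norm_num, by norm_num, ?_⟩
  intro p hp n hn hlog G hSL
  set e := glEquiv n (ZMod p) with he
  set G' := G.map e.toMonoidHom with hG'
  have hcontains : ContainsSL G' := by
    intro u hu
    obtain ⟨A, rfl⟩ := exists_toGL_eq hu
    exact Subgroup.mem_map_of_mem e.toMonoidHom (hSL A)
  have hfin : Module.finrank (ZMod p) (Fin n → ZMod p) = n := Module.finrank_fin_fun _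
  let f : G ≃* G' := G.equivMapOfInjective e.toMonoidHom e.injective
  have key := card_not_quicklyGenerate_le hcontains (by rw [hfin]; exact hn) (by rw [hfin]; exact hlog)
  rw [hfin] at key
  have hcard : Nat.card G' = Nat.card G := (Nat.card_congr f.toEquiv).symm
  rw [hcard] at key
  set Good : G × G × G → Prop := fun t => ∀ S : Set (GL (Fin n) (ZMod p)),
                  S = {↑t.1, (↑t.1)⁻¹, ↑t.2.1, (↑t.2.1)⁻¹, ↑t.2.2, (↑t.2.2)⁻¹} →
                  (∀ A : Matrix.SpecialLinearGroup (Fin n) (ZMod p),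
                      Matrix.SpecialLinearGroup.toGL A ∈ Subgroup.closure S) ∧
                  ∀ g ∈ Subgroup.closure S,
                    ∃ l : List (GL (Fin n) (ZMod p)),
                      (∀ a ∈ l, a ∈ S) ∧ l.prod = g ∧
                        (l.length : ℝ) ≤ (n : ℝ) ^ ((10 ^ 9 : ℝ) * Real.log p) with hGood
  have hbad : Nat.card {t : G × G × G // ¬ Good t} ≤
      #{t : (Bool → G') × G' | ¬ QuicklyGenerate ((n : ℝ) ^ (10 ^ 9 * Real.log p))
        (t.1 false : (Fin n → ZMod p) ≃ₗ[ZMod p] (Fin n → ZMod p))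
        (t.1 true : (Fin n → ZMod p) ≃ₗ[ZMod p] (Fin n → ZMod p))
        (t.2 : (Fin n → ZMod p) ≃ₗ[ZMod p] (Fin n → ZMod p))} := by
    rw [← Fintype.card_subtype, ← Nat.card_eq_fintype_card]
    refine Nat.card_le_card_of_injective (fun t => ⟨(fun b => f (bif b then t.1.2.1 else t.1.1),
      f t.1.2.2), fun hq => t.2 ?_⟩) ?_
    · exact fun S hS => QuicklyGenerate.matrix hq S hS
    · rintro ⟨⟨x, y, z⟩, h⟩ ⟨⟨x', y', z'⟩, h'⟩ heq
      simp only [Subtype.mk.injEq, Prod.mk.injEq, EmbeddingLike.apply_eq_iff_eq] at heq ⊢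
      have h1 := f.injective (congrFun heq.1 false)
      have h2 := f.injective (congrFun heq.1 true)
      exact ⟨h1, h2, heq.2⟩
  have htotal : Nat.card {t : G × G × G // Good t} + Nat.card {t : G × G × G // ¬ Good t} =
      Nat.card G ^ 3 := by
    rw [← Nat.card_sum, Nat.card_congr (Equiv.sumCompl Good), Nat.card_prod, Nat.card_prod]
    ring
  have hpos : (0 : ℝ) < (Nat.card G : ℝ) ^ 3 := by
    have : 0 < Nat.card G := Nat.card_pos
    positivity
  rw [le_div_iff₀ hpos]
  have h1 : (Nat.card {t : G × G × G // Good t} : ℝ) + Nat.card {t : G × G × G // ¬ Good t} =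
      (Nat.card G : ℝ) ^ 3 := by exact_mod_cast htotal
  have h2 : (Nat.card {t : G × G × G // ¬ Good t} : ℝ) ≤
      (Nat.card G : ℝ) ^ 3 * Real.exp (-(1 / 10 ^ 25) * n) := by
    refine le_trans (Nat.cast_le.2 hbad) (le_of_eq_of_le ?_ key)
    congr!
  linarith
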